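/- Let n ≥ 5. An endomorphism φ of A[B_n] is injective if and only if there exists x ∈ A[B_n] such that conj_x ∘ φ is an endomorphism of type (2a) or of type (2b). -/

import Mathlib

/-- The defining relators of the Artin group of type `Bₙ`, as elements of the free
group on `n` generators (0-indexed: generator `i` corresponds to `r_{i+1}`). -/
def BnRels (n : ℕ) : Set (FreeGroup (Fin n)) :=
  {w | (∃ i j : Fin n, (i : ℕ) + 1 = (j : ℕ) ∧ (j : ℕ) + 1 < n ∧
          w = FreeGroup.of i * FreeGroup.of j * FreeGroup.of i *
              (FreeGroup.of j * FreeGroup.of i * FreeGroup.of j)⁻¹) ∨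
       (∃ i j : Fin n, (i : ℕ) + 2 = n ∧ (j : ℕ) + 1 = n ∧
          w = FreeGroup.of i * FreeGroup.of j * FreeGroup.of i * FreeGroup.of j *
              (FreeGroup.of j * FreeGroup.of i * FreeGroup.of j * FreeGroup.of i)⁻¹) ∨
       (∃ i j : Fin n, (i : ℕ) + 2 ≤ (j : ℕ) ∧
          w = FreeGroup.of i * FreeGroup.of j * (FreeGroup.of j * FreeGroup.of i)⁻¹)}

/-- The Artin group `A[Bₙ]` of type `Bₙ`. -/
abbrev ArtinB (n : ℕ) := PresentedGroup (BnRels n)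

/-- The standard generator `r_i` (1-indexed, `1 ≤ i ≤ n`). -/
def rB (n i : ℕ) : ArtinB n :=
  if h : i - 1 < n then PresentedGroup.of ⟨i - 1, h⟩ else 1

/-- `ρ_B = r_1 r_2 ⋯ r_n`. -/
def ρB (n : ℕ) : ArtinB n := ((List.range n).map fun i => rB n (i + 1)).prod

/-- `Δ_B = ρ_B ^ n`, the generator of the center. -/
def ΔB (n : ℕ) : ArtinB n := ρB n ^ n

/-- `t_i` for `i` read modulo `n`: `t_i = r_i` for `1 ≤ i ≤ n-1`,
and `t_0 = ρ_B r_{n-1} ρ_B⁻¹`. -/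
def tB (n i : ℕ) : ArtinB n :=
  if i % n = 0 then ρB n * rB n (n - 1) * (ρB n)⁻¹ else rB n (i % n)

/-- `Δ_Y = (t_1⋯t_{n-1})(t_1⋯t_{n-2})⋯(t_1t_2)t_1`, the Garside element of the
parabolic subgroup of type `A_{n-1}`. -/
def ΔY (n : ℕ) : ArtinB n :=
  ((List.range (n - 1)).map fun k =>
    ((List.range (n - 1 - k)).map fun i => rB n (i + 1)).prod).prod

/-- `ρ_0 = t_1 t_2 ⋯ t_{n-1}`. -/
def ρ₀B (n : ℕ) : ArtinB n := ((List.range (n - 1)).map fun i => rB n (i + 1)).prod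

/-- `ρ_1 = t_1⁻¹ t_2⁻¹ ⋯ t_{n-1}⁻¹`. -/
def ρ₁B (n : ℕ) : ArtinB n := ((List.range (n - 1)).map fun i => (rB n (i + 1))⁻¹).prod

/-- `ρ_k` for `k ∈ {0,1}`. -/
def ρkB (n k : ℕ) : ArtinB n := if k = 0 then ρ₀B n else ρ₁B n

/-- `v_k = ρ_k t_{n-1} ρ_k⁻¹` for `k ∈ {0,1}`. -/
def vB (n k : ℕ) : ArtinB n := ρkB n k * rB n (n - 1) * (ρkB n k)⁻¹

/-- `δ = r_{n-1} r_{n-2} ⋯ r_2 r_1² r_2 ⋯ r_{n-2} r_{n-1}`. -/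
def δB (n : ℕ) : ArtinB n :=
  ((List.range (n - 2)).map fun i => rB n (n - 1 - i)).prod * rB n 1 ^ 2 *
  ((List.range (n - 2)).map fun i => rB n (i + 2)).prod

/-- The quotient `Ā = A[Bₙ]/Z(A[Bₙ])`. -/
abbrev AbarB (n : ℕ) := ArtinB n ⧸ Subgroup.center (ArtinB n)

/-- The canonical projection `π : A[Bₙ] → Ā`. -/
def πB (n : ℕ) : ArtinB n →* AbarB n := QuotientGroup.mk' (Subgroup.center (ArtinB n))

/-- `t̄_i = π(t_i)`. -/
def tbar (n i : ℕ) : AbarB n := πB n (tB n i)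

/-- `ρ̄_B = π(ρ_B)`. -/
def ρbar (n : ℕ) : AbarB n := πB n (ρB n)

/-- The composition `conj_x ∘ φ` of an endomorphism with an inner automorphism. -/
def conjComp {G : Type*} [Group G] (x : G) (φ : G →* G) : G →* G :=
  (MulAut.conj x).toMonoidHom.comp φ

/-- Type (1): there are commuting `g, h` with `φ(t_i) = g` for all `0 ≤ i ≤ n-1`
and `φ(ρ_B) = h`. -/
def IsType1 (n : ℕ) (φ : ArtinB n →* ArtinB n) : Prop :=
  ∃ g h : ArtinB n, g * h = h * g ∧ (∀ i < n, φ (tB n i) = g) ∧ φ (ρB n) = h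

/-- Type (2a) with parameters `ε ∈ {1,-1}`, `p q : ℤ`. -/
def IsType2a (n : ℕ) (ε p q : ℤ) (φ : ArtinB n →* ArtinB n) : Prop :=
  (ε = 1 ∨ ε = -1) ∧ (∀ i < n, φ (tB n i) = tB n i ^ ε * ΔB n ^ p) ∧
    φ (ρB n) = ρB n * ΔB n ^ q

/-- Type (2b) with parameters `ε ∈ {1,-1}`, `p q : ℤ`. -/
def IsType2b (n : ℕ) (ε p q : ℤ) (φ : ArtinB n →* ArtinB n) : Prop :=
  (ε = 1 ∨ ε = -1) ∧ (∀ i < n, φ (tB n i) = tB n (n - i) ^ ε * ΔB n ^ p) ∧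
    φ (ρB n) = (ρB n)⁻¹ * ΔB n ^ q

/-- Type (3) with parameters `ε ∈ {1,-1}`, `k ∈ {0,1}`, `p q r s : ℤ`. -/
def IsType3 (n : ℕ) (ε : ℤ) (k : ℕ) (p q r s : ℤ) (φ : ArtinB n →* ArtinB n) : Prop :=
  (ε = 1 ∨ ε = -1) ∧ (k = 0 ∨ k = 1) ∧
    (∀ i, 1 ≤ i → i ≤ n - 1 → φ (tB n i) = tB n i ^ ε * ΔY n ^ (2 * p) * ΔB n ^ q) ∧
    φ (tB n 0) = vB n k ^ ε * ΔY n ^ (2 * p) * ΔB n ^ q ∧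
    φ (ρB n) = ρkB n k * ΔY n ^ (2 * r) * ΔB n ^ s

/-! ### Facts about free groups -/

namespace FreeGroup

variable {α : Type*}

/-- The exponent sum of the letter `a`. -/
noncomputable def expSum (a : α) : FreeGroup α →* Multiplicative ℤ :=
  open Classical in FreeGroup.lift fun b => Multiplicative.ofAdd (if b = a then 1 else 0)

theorem expSum_of_self (a : α) : expSum a (of a) = Multiplicative.ofAdd 1 := by
  simp [expSum]

theorem expSum_of_ne {a b : α} (h : b ≠ a) : expSum a (of b) = 1 := by
  simp [expSum, h]

theorem mem_zpowers_of_commute_of (a : α) (h : FreeGroup α) (hc : of a * h = h * of a) :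
    ∃ k : ℤ, h = of a ^ k := by
  classical
  obtain ⟨k, hk⟩ : ∃ k : ℤ, ∀ l : ℤ, (of a ^ k * h).norm ≤ (of a ^ l * h).norm := by
    have := WellFounded.has_min (measure fun k : ℤ => (of a ^ k * h).norm).wf Set.univ ⟨0, trivial⟩
    obtain ⟨k, -, hk⟩ := this
    exact ⟨k, fun l => not_lt.1 (hk l trivial)⟩
  set g := of a ^ k * h with hg
  have hgc : of a * g = g * of a := by
    rw [hg, ← mul_assoc, ← zpow_one_add, add_comm, zpow_add_one, mul_assoc, hc, mul_assoc]
  suffices h1 : g = 1 by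
    refine ⟨-k, ?_⟩
    rw [zpow_neg, eq_inv_iff_mul_eq_one, ← h1, hg]
    have : Commute (of a) h := hc
    exact ((this.zpow_left k).eq).symm
  have hmin : ∀ (b : Bool) (u : List (α × Bool)), g.toWord ≠ (a, b) :: u := by
    intro b u hu
    have hgm : g = mk [(a, b)] * mk u := by
      rw [mul_mk, ← mk_toWord (x := g), hu]; rfl
    have : ∃ e : ℤ, of a ^ e * g = mk u := by
      cases b
      · refine ⟨1, ?_⟩
        rw [hgm, ← mul_assoc]
        have : mk [(a, false)] = (of a)⁻¹ := by rw [of, inv_mk]; rfl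
        rw [this]; simp
      · refine ⟨-1, ?_⟩
        rw [hgm, ← mul_assoc]
        have : mk [(a, true)] = of a := rfl
        rw [this]; simp
    obtain ⟨e, he⟩ := this
    have h2 := hk (e + k)
    rw [zpow_add, mul_assoc, ← hg, he] at h2
    have h3 : (mk u).norm ≤ u.length := norm_mk_le
    have h4 : g.norm = u.length + 1 := by rw [norm, hu]; rfl
    omega
  by_contra hne
  have hw : IsReduced g.toWord := isReduced_toWord
  have hconj : g = mk (((a, true) :: g.toWord) ++ [(a, false)]) := by
    rw [← mul_mk, show ((a, true) :: g.toWord) = [(a, true)] ++ g.toWord from rfl, ← mul_mk, mk_toWord]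
    have : mk [(a, false)] = (of a)⁻¹ := by rw [of, inv_mk]; rfl
    rw [this, eq_mul_inv_iff_mul_eq]; exact hgc.symm
  have hr1 : IsReduced ((a, true) :: g.toWord) := by
    cases hgw : g.toWord with
    | nil => exact IsReduced.singleton
    | cons c u =>
      rw [isReduced_cons_cons]
      refine ⟨fun h => ?_, hgw ▸ hw⟩
      exact absurd hgw (by rcases c with ⟨c, b⟩; simp only at h; subst h; exact hmin b u)
  rcases List.eq_nil_or_concat g.toWord with h0 | ⟨u, c, hu⟩
  · exact hne (toWord_eq_nil_iff.1 h0)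
  · by_cases hca : c = (a, true)
    · have : g = mk ((a, true) :: u) := by
        rw [hconj, hu, hca]
        have := Red.Step.not_rev (L₁ := (a, true) :: u) (L₂ := []) (x := a) (b := false)
        have h6 : mk ((a, true) :: u ++ (a, !false) :: (a, false) :: []) = mk ((a, true) :: u ++ []) :=
          Quot.sound this
        simpa using h6
      have hred : IsReduced ((a, true) :: u) := by
        rw [hu, List.concat_eq_append, ← List.cons_append, IsReduced, List.isChain_append] at hr1
        exact hr1.1
      apply hmin true u
      rw [this, toWord_mk, hred.reduce_eq]
    · have hred : IsReduced (((a, true) :: g.toWord) ++ [(a, false)]) := by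
        rw [IsReduced, List.isChain_append]
        refine ⟨hr1, List.isChain_singleton _, ?_⟩
        intro x hx y hy
        rw [hu] at hx
        simp at hx hy
        have : x = c := by
          have h5 : ((a, true) :: (u ++ [c])).getLast? = some c := by
            rw [← List.cons_append, List.getLast?_concat]
          exact Option.some.inj (hx.symm.trans h5)
        subst this; subst hy
        intro h; rcases x with ⟨x, b⟩
        simp only at h; subst h; cases b
        · rfl
        · exact absurd rfl hca
      have := congrArg toWord hconj
      rw [toWord_mk, hred.reduce_eq] at this
      have := congrArg List.length this
      simp at this
      omega

theorem eq_one_of_commute_of_of {a b : α} (hab : a ≠ b) (h : FreeGroup α)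
    (ha : of a * h = h * of a) (hb : of b * h = h * of b) : h = 1 := by
  obtain ⟨k, rfl⟩ := mem_zpowers_of_commute_of a h ha
  obtain ⟨l, hl⟩ := mem_zpowers_of_commute_of b _ hb
  have := congrArg (expSum a) hl
  rw [map_zpow, map_zpow, expSum_of_self, expSum_of_ne hab.symm, one_zpow, ← ofAdd_zsmul] at this
  have : k = 0 := by simpa using this
  simp [this]

theorem subsingleton_of_central {S : Type*} (y : FreeGroup S) (hy : y ≠ 1)
    (hc : ∀ z, z * y = y * z) : Subsingleton S := by
  by_contra h
  rw [not_subsingleton_iff_nontrivial] at h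
  obtain ⟨a, b, hab⟩ := h
  exact hy (eq_one_of_commute_of_of hab y (hc _) (hc _))

theorem exists_zpow_of_subsingleton {S : Type*} [Subsingleton S] :
    ∃ c : FreeGroup S, ∀ z, ∃ k : ℤ, z = c ^ k := by
  rcases isEmpty_or_nonempty S with h | ⟨⟨a⟩⟩
  · exact ⟨1, fun z => ⟨0, Subsingleton.elim _ _⟩⟩
  · refine ⟨of a, fun z => ?_⟩
    apply mem_zpowers_of_commute_of
    induction z using FreeGroup.induction_on with
    | C1 => simp
    | of x => rw [Subsingleton.elim x a]
    | inv_of x _ => rw [Subsingleton.elim x a]; simp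
    | mul x y hx hy => rw [← mul_assoc, hx, mul_assoc, hy, mul_assoc]

theorem exists_zpow_of_centralizer {y : FreeGroup α} (hy : y ≠ 1) :
    ∃ c : FreeGroup α, ∀ a, Commute y a → ∃ k : ℤ, a = c ^ k := by
  let C := Subgroup.centralizer {y}
  have : IsFreeGroup C := inferInstance
  let e : C ≃* FreeGroup (IsFreeGroup.Generators C) := (IsFreeGroup.toFreeGroup C)
  have hyC : y ∈ C := Subgroup.mem_centralizer_singleton_iff.2 rfl
  have hs : Subsingleton (IsFreeGroup.Generators C) := by
    refine subsingleton_of_central (e ⟨y, hyC⟩) ?_ ?_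
    · intro h
      rw [MulEquiv.map_eq_one_iff] at h
      exact hy (congrArg Subtype.val h)
    · intro z
      obtain ⟨w, rfl⟩ := e.surjective z
      rw [← _root_.map_mul e, ← _root_.map_mul e]
      congr 1
      exact Subtype.ext (Subgroup.mem_centralizer_singleton_iff.1 w.2)
  obtain ⟨c, hc⟩ := exists_zpow_of_subsingleton (S := IsFreeGroup.Generators C)
  refine ⟨(e.symm c : C), fun a ha => ?_⟩
  have haC : a ∈ C := Subgroup.mem_centralizer_singleton_iff.2 ha.eq.symm
  obtain ⟨k, hk⟩ := hc (e ⟨a, haC⟩)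
  refine ⟨k, ?_⟩
  have := congrArg (fun z => ((e.symm z : C) : FreeGroup α)) hk
  simpa using this

/-- Commutation is transitive on nontrivial elements. -/
theorem commute_trans {y a b : FreeGroup α} (hy : y ≠ 1) (ha : Commute y a) (hb : Commute y b) :
    Commute a b := by
  obtain ⟨c, hc⟩ := exists_zpow_of_centralizer hy
  obtain ⟨k, rfl⟩ := hc a ha
  obtain ⟨l, rfl⟩ := hc b hb
  exact (Commute.refl c).zpow_zpow k l

theorem exists_common_root {a b : FreeGroup α} (h : Commute a b) :
    ∃ (c : FreeGroup α) (k l : ℤ), a = c ^ k ∧ b = c ^ l := by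
  by_cases ha : a = 1
  · exact ⟨b, 0, 1, by simp [ha], by simp⟩
  · obtain ⟨c, hc⟩ := exists_zpow_of_centralizer ha
    obtain ⟨k, hk⟩ := hc a (Commute.refl a)
    obtain ⟨l, hl⟩ := hc b h
    exact ⟨c, k, l, hk, hl⟩

theorem eq_of_zpow_eq {a b : FreeGroup α} {k : ℤ} (hk : k ≠ 0) (h : a ^ k = b ^ k) : a = b := by
  exact zpow_left_injective hk h

/-- A homomorphism from a perfect group to a free group is trivial. -/
theorem hom_eq_one_of_perfect {Q : Type*} [Group Q] (hQ : commutator Q = ⊤)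
    (f : Q →* FreeGroup α) (q : Q) : f q = 1 := by
  let e : f.range ≃* FreeGroup (IsFreeGroup.Generators f.range) := IsFreeGroup.toFreeGroup f.range
  let F : Q →* FreeGroup (IsFreeGroup.Generators f.range) := e.toMonoidHom.comp f.rangeRestrict
  have hF : Function.Surjective F := e.surjective.comp f.rangeRestrict_surjective
  have hab : ∀ (g : FreeGroup (IsFreeGroup.Generators f.range) →* Multiplicative ℤ) q, g (F q) = 1 := by
    intro g q
    have : q ∈ commutator Q := hQ ▸ Subgroup.mem_top q
    exact Abelianization.commutator_subset_ker (g.comp F) this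
  have hE : IsEmpty (IsFreeGroup.Generators f.range) := by
    refine ⟨fun s => ?_⟩
    obtain ⟨q, hq⟩ := hF (of s)
    have := hab (expSum s) q
    rw [hq, expSum_of_self] at this
    exact absurd this (by decide)
  have : F q = 1 := Subsingleton.elim _ _
  have h2 : f.rangeRestrict q = 1 := by
    simpa [F] using this
  exact congrArg Subtype.val h2

end FreeGroup

/-! ### Words fixed by endomorphisms permuting a basis up to conjugation -/

namespace FreeGroup

open Classical in
/-- The retraction killing the letters outside `M`. -/
noncomputable def kap {α : Type*} (M : Set α) : FreeGroup α →* FreeGroup α :=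
  FreeGroup.lift fun i => if i ∈ M then of i else 1

variable {α : Type*}

theorem kap_of_mem {M : Set α} {i : α} (h : i ∈ M) : kap M (of i) = of i := by simp [kap, h]

theorem kap_of_notMem {M : Set α} {i : α} (h : i ∉ M) : kap M (of i) = 1 := by simp [kap, h]

theorem kap_kap (M N : Set α) (f : FreeGroup α) : kap M (kap N f) = kap (M ∩ N) f := by
  have : (kap M).comp (kap N) = kap (M ∩ N) := by
    ext i
    by_cases h1 : i ∈ N <;> by_cases h2 : i ∈ M <;> simp [kap, h1, h2]
  exact DFunLike.congr_fun this f

theorem kap_kap_self (M : Set α) (f : FreeGroup α) : kap M (kap M f) = kap M f := by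
  rw [kap_kap, Set.inter_self]

theorem exists_finset_kap (v : FreeGroup α) : ∃ S : Finset α, kap (S : Set α) v = v := by
  classical
  have key : ∀ {S T : Finset α} {u : FreeGroup α}, kap (S : Set α) u = u → S ⊆ T →
      kap (T : Set α) u = u := by
    intro S T u hu hST
    conv_lhs => rw [← hu]
    rw [kap_kap, Set.inter_eq_right.2 (by exact_mod_cast hST), hu]
  induction v using FreeGroup.induction_on with
  | C1 => exact ⟨∅, _root_.map_one _⟩
  | of x => exact ⟨{x}, kap_of_mem (by simp)⟩
  | inv_of x ih => obtain ⟨S, hS⟩ := ih; exact ⟨S, by rw [_root_.map_inv, hS]⟩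
  | mul x y hx hy =>
    obtain ⟨S, hS⟩ := hx
    obtain ⟨T, hT⟩ := hy
    exact ⟨S ∪ T, by rw [_root_.map_mul, key hS Finset.subset_union_left,
      key hT Finset.subset_union_right]⟩

theorem kap_subsingleton {M : Set α} {i : α} (hM : M ⊆ {i}) (v : FreeGroup α) :
    ∃ k : ℤ, kap M v = of i ^ k := by
  induction v using FreeGroup.induction_on with
  | C1 => exact ⟨0, by simp⟩
  | of x =>
    by_cases h : x ∈ M
    · exact ⟨1, by rw [kap_of_mem h, zpow_one, hM h]⟩
    · exact ⟨0, by rw [kap_of_notMem h, zpow_zero]⟩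
  | inv_of x ih => obtain ⟨k, hk⟩ := ih; exact ⟨-k, by rw [_root_.map_inv, hk, zpow_neg]⟩
  | mul x y hx hy =>
    obtain ⟨k, hk⟩ := hx
    obtain ⟨l, hl⟩ := hy
    exact ⟨k + l, by rw [_root_.map_mul, hk, hl, zpow_add]⟩

/-- `l` permutes the letters along `T` up to conjugation. -/
def ConjPerm (l : FreeGroup α →* FreeGroup α) (T : α → α) : Prop :=
  ∀ w, ∃ c, l (of w) = c * of (T w) * c⁻¹

theorem ConjPerm.comp {l m : FreeGroup α →* FreeGroup α} {T U : α → α} (hl : ConjPerm l T)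
    (hm : ConjPerm m U) : ConjPerm (l.comp m) (T ∘ U) := by
  intro w
  obtain ⟨c, hc⟩ := hm w
  obtain ⟨d, hd⟩ := hl (U w)
  exact ⟨l c * d, by simp [hc, hd, mul_assoc]⟩

theorem ConjPerm.kap_eq {l : FreeGroup α →* FreeGroup α} {T : α → α} (hl : ConjPerm l T)
    (S : Set α) (v : FreeGroup α) : kap S (l v) = kap S (l (kap (T ⁻¹' S) v)) := by
  have : (kap S).comp l = ((kap S).comp l).comp (kap (T ⁻¹' S)) := by
    ext w
    obtain ⟨c, hc⟩ := hl w
    by_cases h : T w ∈ S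
    · have h' : w ∈ T ⁻¹' S := h
      simp [kap_of_mem h']
    · have h' : w ∉ T ⁻¹' S := h
      simp [kap_of_notMem h', hc, kap_of_notMem h]
  exact DFunLike.congr_fun this v

theorem ConjPerm.exists_zpow {l : FreeGroup α →* FreeGroup α} {T : α → α} (hl : ConjPerm l T)
    {v : FreeGroup α} (hv : l v = v) {S : Set α} (hS : kap S v = v) {w₀ : α}
    (h : ∀ w ∈ S, T w ∈ S → w = w₀) : ∃ (w : α) (c : FreeGroup α) (k : ℤ), v = c * of w ^ k * c⁻¹ := by
  have h1 := hl.kap_eq S v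
  obtain ⟨k, hk⟩ := kap_subsingleton (M := (T ⁻¹' S) ∩ S) (i := w₀) (fun w hw => h w hw.2 hw.1) v
  rw [← kap_kap, hS] at hk
  rw [hv, hS, hk, _root_.map_zpow, _root_.map_zpow] at h1
  obtain ⟨c, hc⟩ := hl w₀
  rw [hc, _root_.map_mul, _root_.map_mul, _root_.map_inv, conj_zpow] at h1
  by_cases hT : T w₀ ∈ S
  · rw [kap_of_mem hT] at h1
    exact ⟨_, _, _, h1⟩
  · rw [kap_of_notMem hT] at h1
    exact ⟨w₀, 1, 0, by rw [h1]; simp⟩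

theorem exists_forall_iterate_notMem {Ω : Type*} (T : Equiv.Perm Ω)
    (hT : ∀ w, ∀ k : ℕ, k ≠ 0 → (T ^ k) w = w → T w = w) (S D : Finset Ω)
    (hD : ∀ w ∈ D, T w ≠ w) : ∃ K : ℕ, ∀ w ∈ D, (T ^ K) w ∉ S := by
  classical
  have hinj : ∀ w ∈ D, Function.Injective fun k : ℕ => (T ^ k) w := by
    intro w hw
    have key : ∀ a b : ℕ, a < b → (T ^ a) w ≠ (T ^ b) w := by
      intro a b hab h
      refine hD w hw (hT w (b - a) (by omega) ?_)
      have : b = a + (b - a) := by omega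
      rw [this, pow_add, Equiv.Perm.mul_apply] at h
      exact ((T ^ a).injective h).symm
    intro a b h
    rcases lt_trichotomy a b with h1 | h1 | h1
    · exact absurd h (key _ _ h1)
    · exact h1
    · exact absurd h.symm (key _ _ h1)
  have hfin : (⋃ w ∈ D, (fun k : ℕ => (T ^ k) w) ⁻¹' (S : Set Ω)).Finite := by
    refine Set.Finite.biUnion D.finite_toSet fun w hw => ?_
    exact S.finite_toSet.preimage (hinj w hw).injOn
  obtain ⟨K, hK⟩ := hfin.infinite_compl.nonempty
  refine ⟨K, fun w hw h => hK ?_⟩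
  simp only [Set.mem_iUnion]
  exact ⟨w, hw, h⟩

theorem conjPerm_pow {l : FreeGroup α →* FreeGroup α} {T : Equiv.Perm α} (hl : ConjPerm l T)
    {v : FreeGroup α} (hv : l v = v) (k : ℕ) :
    ∃ m : FreeGroup α →* FreeGroup α, ConjPerm m (T ^ k : Equiv.Perm α) ∧ m v = v := by
  induction k with
  | zero => exact ⟨MonoidHom.id _, fun w => ⟨1, by simp⟩, rfl⟩
  | succ k ih =>
    obtain ⟨m, hm, hmv⟩ := ih
    refine ⟨m.comp l, ?_, by simp [hv, hmv]⟩
    have := hm.comp hl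
    intro w
    simpa [pow_succ] using this w

theorem exists_zpow_of_two_conjPerm {l₁ l₂ : FreeGroup α →* FreeGroup α} {T₁ T₂ : Equiv.Perm α}
    (h₁ : ConjPerm l₁ T₁) (h₂ : ConjPerm l₂ T₂) {v : FreeGroup α} (hv₁ : l₁ v = v) (hv₂ : l₂ v = v)
    (hT₁ : ∀ w, ∀ k : ℕ, k ≠ 0 → (T₁ ^ k) w = w → T₁ w = w)
    (hT₂ : ∀ w, ∀ k : ℕ, k ≠ 0 → (T₂ ^ k) w = w → T₂ w = w)
    (hfix : ∀ w w', T₁ w = w → T₂ w = w → T₁ w' = w' → T₂ w' = w' → w = w') [Nonempty α] :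
    ∃ (w : α) (c : FreeGroup α) (k : ℤ), v = c * of w ^ k * c⁻¹ := by
  classical
  obtain ⟨S, hS⟩ := exists_finset_kap v
  obtain ⟨B, hB⟩ := exists_forall_iterate_notMem T₂ hT₂ S (S.filter fun w => T₂ w ≠ w) (by simp)
  obtain ⟨A, hA⟩ := exists_forall_iterate_notMem T₁ hT₁ S
    ((S.image (T₂ ^ B : Equiv.Perm α)).filter fun w => T₁ w ≠ w) (by simp)
  obtain ⟨m₁, hm₁, hm₁v⟩ := conjPerm_pow h₁ hv₁ A
  obtain ⟨m₂, hm₂, hm₂v⟩ := conjPerm_pow h₂ hv₂ B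
  have hfixpow : ∀ (T : Equiv.Perm α) (k : ℕ) w, T w = w → (T ^ k) w = w := by
    intro T k w hw
    induction k with
    | zero => rfl
    | succ k ih => rw [pow_succ, Equiv.Perm.mul_apply, hw, ih]
  have hmem : ∀ w ∈ S, (T₁ ^ A) ((T₂ ^ B) w) ∈ S → T₁ w = w ∧ T₂ w = w := by
    intro w hw hw'
    by_cases h2 : T₂ w = w
    · rw [hfixpow T₂ B w h2] at hw'
      refine ⟨?_, h2⟩
      by_contra h1
      refine hA w ?_ hw'
      simp only [Finset.mem_filter, Finset.mem_image]
      exact ⟨⟨w, hw, hfixpow T₂ B w h2⟩, h1⟩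
    · exfalso
      have h3 := hB w (by simp [hw, h2])
      by_cases h1 : T₁ ((T₂ ^ B) w) = (T₂ ^ B) w
      · rw [hfixpow T₁ A _ h1] at hw'
        exact h3 hw'
      · refine hA _ ?_ hw'
        simp only [Finset.mem_filter, Finset.mem_image]
        exact ⟨⟨w, hw, rfl⟩, h1⟩
  by_cases he : ∃ w, T₁ w = w ∧ T₂ w = w
  · obtain ⟨w₀, hw₀⟩ := he
    refine (hm₁.comp hm₂).exists_zpow (by simp [hm₁v, hm₂v]) hS (w₀ := w₀) ?_
    intro w hw hw'
    obtain ⟨a, b⟩ := hmem w hw hw'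
    exact hfix w w₀ a b hw₀.1 hw₀.2
  · refine (hm₁.comp hm₂).exists_zpow (by simp [hm₁v, hm₂v]) hS (w₀ := Classical.arbitrary α) ?_
    intro w hw hw'
    exact absurd ⟨w, hmem w hw hw'⟩ he

end FreeGroup

/-! ### The kernel of killing one letter -/

namespace FreeGroup

variable {α : Type*}

/-- Left translation on the letters of `FreeGroup (FreeGroup α)`. -/
def transl : FreeGroup α →* MulAut (FreeGroup (FreeGroup α)) where
  toFun g := freeGroupCongr (MulAction.toPerm g)
  map_one' := by
    apply MulEquiv.toMonoidHom_injective
    ext w; simp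
  map_mul' g h := by
    apply MulEquiv.toMonoidHom_injective
    ext w; simp [mul_assoc]

theorem transl_of (g w : FreeGroup α) : transl g (of w) = of (g * w) := by
  simp [transl]

open Classical in
/-- Splitting off the letter `r`. -/
noncomputable def split (r : α) : FreeGroup α →* FreeGroup (FreeGroup α) ⋊[transl] FreeGroup α :=
  FreeGroup.lift fun i => if i = r then SemidirectProduct.inl (of 1) else SemidirectProduct.inr (of i)

theorem split_right (r : α) (f : FreeGroup α) : (split r f).right = kap {r}ᶜ f := by
  have : SemidirectProduct.rightHom.comp (split r) = kap {r}ᶜ := by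
    ext i
    by_cases h : i = r <;> simp [split, kap, h]
  exact DFunLike.congr_fun this f

/-- The letter `w` goes to the conjugate of the letter `r` by `w`. -/
def conjLetter (r : α) : FreeGroup (FreeGroup α) →* FreeGroup α :=
  FreeGroup.lift fun w => w * of r * w⁻¹

theorem conjLetter_of (r : α) (w : FreeGroup α) : conjLetter r (of w) = w * of r * w⁻¹ := by
  simp [conjLetter]

theorem conjLetter_transl (r : α) (g : FreeGroup α) (u : FreeGroup (FreeGroup α)) :
    conjLetter r (transl g u) = g * conjLetter r u * g⁻¹ := by
  have : (conjLetter r).comp (transl g).toMonoidHom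
      = (MulAut.conj g).toMonoidHom.comp (conjLetter r) := by
    ext w; simp [transl_of, conjLetter_of, mul_assoc]
  exact DFunLike.congr_fun this u

theorem conjLetter_split (r : α) (f : FreeGroup α) :
    conjLetter r (split r f).left * (split r f).right = f := by
  induction f using FreeGroup.induction_on with
  | C1 => simp
  | of x => by_cases h : x = r <;> simp [split, h, conjLetter_of]
  | inv_of x _ => by_cases h : x = r <;> simp [split, h, conjLetter_of]
  | mul x y hx hy =>
    rw [_root_.map_mul, SemidirectProduct.mul_left, SemidirectProduct.mul_right, _root_.map_mul,
      conjLetter_transl]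
    conv_rhs => rw [← hx, ← hy]
    group

/-- The subgroup of `FreeGroup (FreeGroup α)` on the letters not involving `r`. -/
def lettersAvoiding (r : α) : Subgroup (FreeGroup (FreeGroup α)) :=
  Subgroup.closure {u | ∃ w, kap {r}ᶜ w = w ∧ u = of w}

theorem split_left_mem (r : α) (f : FreeGroup α) : (split r f).left ∈ lettersAvoiding r := by
  have htr : ∀ (g : FreeGroup α), kap {r}ᶜ g = g → ∀ u ∈ lettersAvoiding r,
      transl g u ∈ lettersAvoiding r := by
    intro g hg u hu
    have : lettersAvoiding r ≤ (lettersAvoiding r).comap (transl g).toMonoidHom := by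
      refine (Subgroup.closure_le _).2 ?_
      rintro _ ⟨w, hw, rfl⟩
      refine Subgroup.subset_closure ⟨g * w, by rw [_root_.map_mul, hg, hw], ?_⟩
      simp [transl_of]
    exact this hu
  have hof : ∀ x : α, (split r (of x)).left ∈ lettersAvoiding r := by
    intro x
    by_cases h : x = r
    · simp only [split, lift_apply_of, h, if_true, SemidirectProduct.left_inl]
      exact Subgroup.subset_closure ⟨1, _root_.map_one _, rfl⟩
    · simp [split, h, one_mem]
  induction f using FreeGroup.induction_on with
  | C1 => simp [one_mem]
  | of x => exact hof x
  | inv_of x _ =>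
    rw [_root_.map_inv, SemidirectProduct.inv_left]
    refine htr _ ?_ _ (inv_mem (hof x))
    rw [split_right, _root_.map_inv, kap_kap_self]
  | mul x y hx hy =>
    rw [_root_.map_mul, SemidirectProduct.mul_left]
    exact mul_mem hx (htr _ (by rw [split_right, kap_kap_self]) _ hy)

theorem exists_conjPerm_split (r : α) (p : FreeGroup α →* FreeGroup α) {g h : FreeGroup α}
    (hg : p (of r) = g * of r * g⁻¹) (hh : ∀ f, kap {r}ᶜ (p f) = h * kap {r}ᶜ f * h⁻¹) :
    ∃ l : FreeGroup (FreeGroup α) →* FreeGroup (FreeGroup α),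
      ConjPerm l (fun w => h * w * (h⁻¹ * kap {r}ᶜ g)) ∧
      ∀ v, kap {r}ᶜ v = 1 → (split r (p v)).left = l (split r v).left := by
  let c : FreeGroup α → FreeGroup (FreeGroup α) := fun w => (split r (p w * g)).left
  let l : FreeGroup (FreeGroup α) →* FreeGroup (FreeGroup α) :=
    FreeGroup.lift fun w => c w * of (h * w * (h⁻¹ * kap {r}ᶜ g)) * (c w)⁻¹
  refine ⟨l, fun w => ⟨c w, by simp [l]⟩, fun v hv => ?_⟩
  have key : ∀ u ∈ lettersAvoiding r, split r (p (conjLetter r u)) = SemidirectProduct.inl (l u) := by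
    intro u hu
    have : lettersAvoiding r ≤
        (((split r).comp (p.comp (conjLetter r))).eqLocus (SemidirectProduct.inl.comp l)) := by
      refine (Subgroup.closure_le _).2 ?_
      rintro _ ⟨w, hw, rfl⟩
      change split r (p (conjLetter r (of w))) = SemidirectProduct.inl (l (of w))
      have h1 : p (conjLetter r (of w)) = (p w * g) * of r * (p w * g)⁻¹ := by
        rw [conjLetter_of, _root_.map_mul, _root_.map_mul, hg, _root_.map_inv]; group
      have h2 : split r (of r) = SemidirectProduct.inl (of 1) := by simp [split]
      have h3 : split r (p w * g) = SemidirectProduct.inl (c w) *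
          SemidirectProduct.inr (h * w * (h⁻¹ * kap {r}ᶜ g)) := by
        ext
        · simp [c]
        · rw [split_right, _root_.map_mul, hh, hw]; simp [mul_assoc]
      rw [h1, _root_.map_mul, _root_.map_mul, _root_.map_inv, h2, h3]
      have h4 : ∀ x : FreeGroup α, SemidirectProduct.inr x * SemidirectProduct.inl (of (1 : FreeGroup α))
          * (SemidirectProduct.inr x)⁻¹ =
          (SemidirectProduct.inl (of x) : FreeGroup (FreeGroup α) ⋊[transl] FreeGroup α) := by
        intro x
        rw [← _root_.map_inv, ← SemidirectProduct.inl_aut, transl_of, mul_one]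
      rw [mul_inv_rev, ← mul_assoc, mul_assoc (SemidirectProduct.inl (c w)),
        mul_assoc (SemidirectProduct.inl (c w)), h4]
      simp [l]
    exact this hu
  have h1 := key _ (split_left_mem r v)
  have h2 := conjLetter_split r v
  rw [split_right, hv, mul_one] at h2
  rw [h2] at h1
  rw [h1]; simp

/-- A word killed by `x_r ↦ 1` and fixed by two endomorphisms acting as inner automorphisms modulo
`x_r`, in a noncommuting way, is conjugate to a power of `x_r`. -/
theorem exists_conj_zpow_of_fixed (r : α) {p₁ p₂ : FreeGroup α →* FreeGroup α}
    {g₁ h₁ g₂ h₂ v : FreeGroup α}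
    (hg₁ : p₁ (of r) = g₁ * of r * g₁⁻¹) (hh₁ : ∀ f, kap {r}ᶜ (p₁ f) = h₁ * kap {r}ᶜ f * h₁⁻¹)
    (hg₂ : p₂ (of r) = g₂ * of r * g₂⁻¹) (hh₂ : ∀ f, kap {r}ᶜ (p₂ f) = h₂ * kap {r}ᶜ f * h₂⁻¹)
    (hv : kap {r}ᶜ v = 1) (hv₁ : p₁ v = v) (hv₂ : p₂ v = v)
    (hne : ¬ Commute h₁ h₂ ∨ ¬ Commute (h₁⁻¹ * kap {r}ᶜ g₁) (h₂⁻¹ * kap {r}ᶜ g₂)) :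
    ∃ (c : FreeGroup α) (k : ℤ), v = c * of r ^ k * c⁻¹ := by
  set χ₁ := h₁⁻¹ * kap {r}ᶜ g₁ with hχ₁
  set χ₂ := h₂⁻¹ * kap {r}ᶜ g₂ with hχ₂
  obtain ⟨l₁, hl₁, hl₁v⟩ := exists_conjPerm_split r p₁ hg₁ hh₁
  obtain ⟨l₂, hl₂, hl₂v⟩ := exists_conjPerm_split r p₂ hg₂ hh₂
  let T : FreeGroup α → FreeGroup α → Equiv.Perm (FreeGroup α) := fun h χ =>
    (Equiv.mulLeft h).trans (Equiv.mulRight χ)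
  have hTapp : ∀ h χ w, T h χ w = h * w * χ := fun h χ w => rfl
  have hTpow : ∀ h χ (k : ℕ) w, (T h χ ^ k) w = h ^ k * w * χ ^ k := by
    intro h χ k
    induction k with
    | zero => simp
    | succ k ih =>
      intro w
      rw [pow_succ, Equiv.Perm.mul_apply, ih, hTapp, pow_succ h, pow_succ' χ]
      simp [mul_assoc]
  have hfixed : ∀ h χ w, T h χ w = w ↔ h = w * χ⁻¹ * w⁻¹ := by
    intro h χ w
    rw [hTapp, ← eq_mul_inv_iff_mul_eq, ← eq_mul_inv_iff_mul_eq]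
  have hTorb : ∀ h χ w, ∀ k : ℕ, k ≠ 0 → (T h χ ^ k) w = w → T h χ w = w := by
    intro h χ w k hk hw
    rw [hfixed]
    rw [hTpow, ← eq_mul_inv_iff_mul_eq, ← eq_mul_inv_iff_mul_eq, ← inv_pow, ← conj_pow] at hw
    exact pow_left_injective hk hw
  have hex := exists_zpow_of_two_conjPerm (T₁ := T h₁ χ₁) (T₂ := T h₂ χ₂) (l₁ := l₁) (l₂ := l₂)
    (v := (split r v).left) hl₁ hl₂ ?_ ?_ (hTorb _ _) (hTorb _ _) ?_
  · obtain ⟨w, c, k, hk⟩ := hex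
    have h2 := conjLetter_split r v
    rw [split_right, hv, mul_one, hk, _root_.map_mul, _root_.map_mul, _root_.map_inv, _root_.map_zpow, conjLetter_of,
      conj_zpow] at h2
    refine ⟨conjLetter r c * w, k, ?_⟩
    rw [← h2]; group
  · rw [← hl₁v v hv, hv₁]
  · rw [← hl₂v v hv, hv₂]
  · intro w w' e1 e2 e1' e2'
    rw [hfixed] at e1 e2 e1' e2'
    have hc : ∀ {h χ : FreeGroup α}, h = w * χ⁻¹ * w⁻¹ → h = w' * χ⁻¹ * w'⁻¹ →
        Commute (w⁻¹ * w') χ ∧ Commute (w' * w⁻¹) h := by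
      intro h χ a b
      have e : w * χ⁻¹ * w⁻¹ = w' * χ⁻¹ * w'⁻¹ := a.symm.trans b
      have e2 : χ = w⁻¹ * w' * χ * (w⁻¹ * w')⁻¹ := by
        have := congrArg (fun z => (w⁻¹ * z * w)⁻¹) e
        simpa [mul_assoc] using this
      constructor
      · exact (eq_mul_inv_iff_mul_eq.1 e2).symm
      · change (w' * w⁻¹) * h = h * (w' * w⁻¹)
        conv_lhs => rw [a]
        conv_rhs => rw [b]
        group
    obtain ⟨a1, b1⟩ := hc e1 e1'
    obtain ⟨a2, b2⟩ := hc e2 e2'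
    by_contra hww
    rcases hne with hne | hne
    · refine hne (commute_trans (y := w' * w⁻¹) ?_ b1 b2)
      intro h; exact hww (mul_inv_eq_one.1 h).symm
    · refine hne (commute_trans (y := w⁻¹ * w') ?_ a1 a2)
      intro h; exact hww (inv_mul_eq_one.1 h)

end FreeGroup

/-! ### Braid-like sequences -/

section BraidSeq

variable {H : Type*} [Group H]

/-- `t a * t (a + 1) * ⋯ * t (a + k - 1)`. -/
def ascProd (t : ℕ → H) (a : ℕ) : ℕ → H
  | 0 => 1
  | k + 1 => ascProd t a k * t (a + k)

theorem ascProd_zero (t : ℕ → H) (a : ℕ) : ascProd t a 0 = 1 := rfl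

theorem ascProd_succ (t : ℕ → H) (a k : ℕ) : ascProd t a (k + 1) = ascProd t a k * t (a + k) := rfl

theorem ascProd_succ' (t : ℕ → H) (a k : ℕ) :
    ascProd t a (k + 1) = t a * ascProd t (a + 1) k := by
  induction k with
  | zero => simp [ascProd]
  | succ k ih => rw [ascProd_succ, ih, ascProd_succ, mul_assoc, add_right_comm, add_assoc]

/-- The first `m` terms of `t` satisfy the braid relations. -/
structure BraidSeq (t : ℕ → H) (m : ℕ) : Prop where
  braid : ∀ i, i + 1 < m → t i * t (i + 1) * t i = t (i + 1) * t i * t (i + 1)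
  comm : ∀ i j, i + 2 ≤ j → j < m → Commute (t i) (t j)

theorem BraidSeq.map {K : Type*} [Group K] {t : ℕ → H} {m : ℕ} (h : BraidSeq t m) (f : H →* K) :
    BraidSeq (fun i => f (t i)) m where
  braid i hi := by simp only [← map_mul, h.braid i hi]
  comm i j hij hj := (h.comm i j hij hj).map f

theorem BraidSeq.shift {t : ℕ → H} {m : ℕ} (h : BraidSeq t m) (a : ℕ) :
    BraidSeq (fun i => t (a + i)) (m - a) where
  braid i hi := h.braid (a + i) (by omega)
  comm i j hij hj := h.comm (a + i) (a + j) (by omega) (by omega)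

theorem commute_ascProd {t : ℕ → H} {a k : ℕ} {x : H} (h : ∀ i, a ≤ i → i < a + k → Commute x (t i)) :
    Commute x (ascProd t a k) := by
  induction k with
  | zero => exact Commute.one_right x
  | succ k ih => exact (ih fun i h1 h2 => h i h1 (by omega)).mul_right (h _ (by omega) (by omega))

theorem BraidSeq.ascProd_mul {t : ℕ → H} {m : ℕ} (h : BraidSeq t m) {a k i : ℕ} (hk : a + k ≤ m)
    (hi : a ≤ i) (hik : i + 1 < a + k) : ascProd t a k * t i = t (i + 1) * ascProd t a k := by
  induction k with
  | zero => omega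
  | succ k ih =>
    rcases Nat.lt_or_ge (i + 1) (a + k) with h1 | h1
    · rw [ascProd_succ, mul_assoc, ← (h.comm i (a + k) (by omega) (by omega)).eq, ← mul_assoc,
        ih (by omega) h1, mul_assoc]
    · obtain ⟨j, rfl⟩ : ∃ j, k = j + 1 := ⟨k - 1, by omega⟩
      have e : i = a + j := by omega
      subst e
      have hc : Commute (t (a + j + 1)) (ascProd t a j) :=
        commute_ascProd fun i h1 h2 => (h.comm i (a + j + 1) (by omega) (by omega)).symm
      rw [ascProd_succ, ascProd_succ, ← add_assoc, mul_assoc, mul_assoc, ← mul_assoc (t (a + j)),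
        h.braid (a + j) (by omega), ← mul_assoc, ← mul_assoc, ← hc.eq]
      simp only [mul_assoc]

theorem ascProd_sq {t : ℕ → H} {ρ : H} {m : ℕ} (h : ∀ i, i + 1 < m → ρ * t i = t (i + 1) * ρ) {j : ℕ}
    (hj : j < m) : ρ * ascProd t 0 j = ascProd t 1 j * ρ := by
  induction j with
  | zero => simp [ascProd]
  | succ j ih =>
    rw [ascProd_succ, ← mul_assoc, ih (by omega), mul_assoc, zero_add, h j (by omega), ascProd_succ,
      mul_assoc, add_comm 1 j]

end BraidSeq

/-! ### Presentation of the Artin group of type `B` -/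

/-- The `i`-th standard generator (counted from zero, trivial out of range). -/
def sg (n i : ℕ) : ArtinB n := if h : i < n then PresentedGroup.of ⟨i, h⟩ else 1

theorem rB_eq (n i : ℕ) : rB n i = sg n (i - 1) := rfl

theorem sg_of_ge {n i : ℕ} (h : n ≤ i) : sg n i = 1 := dif_neg (by omega)

theorem sg_braid {n i : ℕ} (h : i + 2 < n) :
    sg n i * sg n (i + 1) * sg n i = sg n (i + 1) * sg n i * sg n (i + 1) := by
  have h1 : i < n := by omega
  have h2 : i + 1 < n := by omega
  rw [sg, sg, dif_pos h1, dif_pos h2]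
  exact PresentedGroup.mk_eq_mk_of_mul_inv_mem
    (Or.inl ⟨⟨i, h1⟩, ⟨i + 1, h2⟩, rfl, h, rfl⟩)

theorem sg_braid_four {n i : ℕ} (h : i + 2 = n) :
    sg n i * sg n (i + 1) * sg n i * sg n (i + 1) = sg n (i + 1) * sg n i * sg n (i + 1) * sg n i := by
  have h1 : i < n := by omega
  have h2 : i + 1 < n := by omega
  rw [sg, sg, dif_pos h1, dif_pos h2]
  exact PresentedGroup.mk_eq_mk_of_mul_inv_mem
    (Or.inr (Or.inl ⟨⟨i, h1⟩, ⟨i + 1, h2⟩, h, h, rfl⟩))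

theorem sg_comm {n i j : ℕ} (h : i + 2 ≤ j) : Commute (sg n i) (sg n j) := by
  by_cases h2 : j < n
  · have h1 : i < n := by omega
    rw [sg, sg, dif_pos h1, dif_pos h2]
    exact PresentedGroup.mk_eq_mk_of_mul_inv_mem
      (Or.inr (Or.inr ⟨⟨i, h1⟩, ⟨j, h2⟩, h, rfl⟩))
  · rw [sg_of_ge (i := j) (by omega)]; exact Commute.one_right _

theorem sg_braidSeq (n : ℕ) : BraidSeq (sg n) (n - 1) where
  braid _ hi := sg_braid (by omega)
  comm _ _ h _ := sg_comm h

theorem closure_sg (n : ℕ) : Subgroup.closure {g | ∃ i < n, g = sg n i} = ⊤ := by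
  rw [eq_top_iff, ← PresentedGroup.closure_range_of]
  refine Subgroup.closure_mono ?_
  rintro _ ⟨i, rfl⟩
  exact ⟨i, i.2, by rw [sg, dif_pos i.2]⟩

theorem ArtinB.induction {n : ℕ} {S : Subgroup (ArtinB n)} (h : ∀ i < n, sg n i ∈ S) (g : ArtinB n) :
    g ∈ S := by
  have : (⊤ : Subgroup (ArtinB n)) ≤ S := by
    rw [← closure_sg, Subgroup.closure_le]
    rintro _ ⟨i, hi, rfl⟩
    exact h i hi
  exact this trivial

theorem ArtinB.hom_ext {n : ℕ} {H : Type*} [Group H] {f g : ArtinB n →* H}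
    (h : ∀ i < n, f (sg n i) = g (sg n i)) : f = g := by
  exact MonoidHom.ext fun x => ArtinB.induction (S := f.eqLocus g) h x

theorem ArtinB.exists_hom {n : ℕ} {H : Type*} [Group H] (t : ℕ → H)
    (h1 : ∀ i, i + 2 < n → t i * t (i + 1) * t i = t (i + 1) * t i * t (i + 1))
    (h2 : ∀ i, i + 2 = n → t i * t (i + 1) * t i * t (i + 1) = t (i + 1) * t i * t (i + 1) * t i)
    (h3 : ∀ i j, i + 2 ≤ j → j < n → Commute (t i) (t j)) :
    ∃ f : ArtinB n →* H, ∀ i < n, f (sg n i) = t i := by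
  refine ⟨PresentedGroup.toGroup (f := fun i : Fin n => t i) ?_, fun i hi => ?_⟩
  · rintro w (⟨i, j, hij, hj, rfl⟩ | ⟨i, j, hi, hj, rfl⟩ | ⟨i, j, hij, rfl⟩)
    · have := h1 i (by omega)
      rw [hij] at this
      simp only [map_mul, map_inv, FreeGroup.lift_apply_of]
      rw [this, mul_inv_cancel]
    · have := h2 i (by omega)
      rw [show (i : ℕ) + 1 = j by omega] at this
      simp only [map_mul, map_inv, FreeGroup.lift_apply_of]
      rw [this, mul_inv_cancel]
    · have := h3 i j hij j.2
      simp only [map_mul, map_inv, FreeGroup.lift_apply_of]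
      rw [this.eq, mul_inv_cancel]
  · rw [sg, dif_pos hi, PresentedGroup.toGroup.of]

theorem ρB_eq (n : ℕ) : ρB n = ascProd (sg n) 0 n := by
  have : ∀ k, ((List.range k).map fun i => rB n (i + 1)).prod = ascProd (sg n) 0 k := by
    intro k
    induction k with
    | zero => rfl
    | succ k ih => rw [List.range_succ, List.map_append, List.prod_append, ih, ascProd_succ]; simp [rB_eq]
  exact this n

/-- `α = t₁ ⋯ t_{n-1}`. -/
def αB (n : ℕ) : ArtinB n := ascProd (sg n) 0 (n - 1)

theorem ρB_eq_αB_mul {n : ℕ} (hn : 1 ≤ n) : ρB n = αB n * sg n (n - 1) := by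
  obtain ⟨m, rfl⟩ : ∃ m, n = m + 1 := ⟨n - 1, by omega⟩
  rw [ρB_eq, ascProd_succ]; simp [αB]

theorem αB_mul_sg {n i : ℕ} (hi : i + 2 < n) : αB n * sg n i = sg n (i + 1) * αB n :=
  (sg_braidSeq n).ascProd_mul (by omega) (by omega) (by omega)

theorem ρB_mul_sg {n i : ℕ} (hi : i + 2 < n) : ρB n * sg n i = sg n (i + 1) * ρB n := by
  rw [ρB_eq_αB_mul (by omega), mul_assoc, ← (sg_comm (n := n) (i := i) (j := n - 1) (by omega)).eq,
    ← mul_assoc, αB_mul_sg hi, mul_assoc]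

theorem ρB_sq_mul_sg {n : ℕ} (hn : 2 ≤ n) : ρB n ^ 2 * sg n (n - 2) = sg n 0 * ρB n ^ 2 := by
  obtain ⟨m, rfl⟩ : ∃ m, n = m + 2 := ⟨n - 2, by omega⟩
  simp only [Nat.add_sub_cancel]
  have h1 : ρB (m + 2) * ascProd (sg (m + 2)) 0 m = ascProd (sg (m + 2)) 1 m * ρB (m + 2) :=
    ascProd_sq (t := sg (m + 2)) (m := m + 1) (fun i hi => ρB_mul_sg (n := m + 2) (i := i) (by omega))
      (by omega)
  have hρ : ρB (m + 2) = ascProd (sg (m + 2)) 0 m * sg (m + 2) m * sg (m + 2) (m + 1) := by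
    rw [ρB_eq, ascProd_succ, ascProd_succ]; simp
  have hρ' : ρB (m + 2) = sg (m + 2) 0 * (ascProd (sg (m + 2)) 1 m * sg (m + 2) (m + 1)) := by
    rw [ρB_eq, ascProd_succ', ascProd_succ]; simp [add_comm]
  have hc : Commute (sg (m + 2) (m + 1)) (ascProd (sg (m + 2)) 0 m) :=
    commute_ascProd fun i _ h2 => (sg_comm (by omega)).symm
  have h3 : ρB (m + 2) * sg (m + 2) m * sg (m + 2) (m + 1) =
      sg (m + 2) (m + 1) * ρB (m + 2) * sg (m + 2) m := by
    have h4 := sg_braid_four (n := m + 2) (i := m) rfl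
    rw [hρ]
    calc _ = ascProd (sg (m + 2)) 0 m * (sg (m + 2) m * sg (m + 2) (m + 1) * sg (m + 2) m *
          sg (m + 2) (m + 1)) := by group
      _ = (ascProd (sg (m + 2)) 0 m * sg (m + 2) (m + 1)) * (sg (m + 2) m * sg (m + 2) (m + 1) *
          sg (m + 2) m) := by rw [h4]; group
      _ = _ := by rw [← hc.eq]; group
  have h2 : ρB (m + 2) ^ 2 = ascProd (sg (m + 2)) 1 m * sg (m + 2) (m + 1) * ρB (m + 2) *
      sg (m + 2) m := by
    calc ρB (m + 2) ^ 2 = (ρB (m + 2) * ascProd (sg (m + 2)) 0 m) * sg (m + 2) m *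
          sg (m + 2) (m + 1) := by rw [pow_two]; conv_lhs => rw [hρ]
                                   conv_rhs => rw [hρ]
                                   group
      _ = ascProd (sg (m + 2)) 1 m * (ρB (m + 2) * sg (m + 2) m * sg (m + 2) (m + 1)) := by
          rw [h1]; group
      _ = _ := by rw [h3]; group
  conv_rhs => rw [h2, ← mul_assoc, ← mul_assoc, ← hρ', ← pow_two]

theorem ArtinB.hom_ext_ρ {n : ℕ} (hn : 1 ≤ n) {H : Type*} [Group H] {f g : ArtinB n →* H}
    (h : ∀ i, i + 1 < n → f (sg n i) = g (sg n i)) (hρ : f (ρB n) = g (ρB n)) : f = g := by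
  apply ArtinB.hom_ext
  intro i hi
  rcases Nat.lt_or_ge (i + 1) n with h1 | h1
  · exact h i h1
  · have hα : ∀ k, k + 1 ≤ n → f (ascProd (sg n) 0 k) = g (ascProd (sg n) 0 k) := by
      intro k
      induction k with
      | zero => intro; simp [ascProd]
      | succ k ih =>
        intro hk
        rw [ascProd_succ, map_mul, map_mul, ih (by omega), zero_add, h k (by omega)]
    have e : i = n - 1 := by omega
    subst e
    rw [ρB_eq_αB_mul hn, map_mul, map_mul, αB, hα _ (by omega)] at hρ
    exact mul_left_cancel hρ

/-- The group is also presented by the `t i` and `ρ`. -/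
theorem ArtinB.exists_hom_ρ {n : ℕ} (hn : 2 ≤ n) {H : Type*} [Group H] {t : ℕ → H} {ρ : H}
    (h : BraidSeq t (n - 1)) (h1 : ∀ i, i + 2 < n → ρ * t i = t (i + 1) * ρ)
    (h2 : ρ ^ 2 * t (n - 2) = t 0 * ρ ^ 2) :
    ∃ f : ArtinB n →* H, (∀ i, i + 1 < n → f (sg n i) = t i) ∧ f (ρB n) = ρ := by
  obtain ⟨m, rfl⟩ : ∃ m, n = m + 2 := ⟨n - 2, by omega⟩
  simp only [Nat.add_sub_cancel, show m + 2 - 1 = m + 1 by omega] at h h2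
  set α := ascProd t 0 (m + 1) with hα
  set r := α⁻¹ * ρ with hr
  have hρ : ρ = α * r := by rw [hr]; group
  have hαt : ∀ i, i + 2 < m + 2 → α * t i = t (i + 1) * α := fun i hi =>
    h.ascProd_mul (by omega) (by omega) (by omega)
  have hcomm : ∀ i, i < m → Commute (t i) r := by
    intro i hi
    have h3 := h1 i (by omega)
    have h4 : α * (r * t i) = α * (t i * r) := by
      rw [← mul_assoc, ← hρ, h3, ← mul_assoc, hαt i (by omega), mul_assoc, ← hρ]
    exact (mul_left_cancel h4).symm
  have hb : t m * r * t m * r = r * t m * r * t m := by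
    have e1 : ρ * ascProd t 0 m = ascProd t 1 m * ρ :=
      ascProd_sq (m := m + 1) (fun i hi => h1 i (by omega)) (by omega)
    have e2 : α * ascProd t 0 m = ascProd t 1 m * α :=
      ascProd_sq (m := m + 1) (fun i hi => hαt i (by omega)) (by omega)
    have e3 : α = ascProd t 0 m * t m := by rw [hα, ascProd_succ, zero_add]
    have e4 : α = t 0 * ascProd t 1 m := by rw [hα, ascProd_succ']
    have e5 : ρ ^ 2 = ascProd t 1 m * ρ * t m * r := by
      rw [pow_two, ← e1]; conv_lhs => rw [hρ, e3]
      conv_rhs => rw [hρ, e3]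
      group
    have e6 : α * α = ascProd t 1 m * α * t m := by
      rw [← e2]; conv_lhs => rw [e3]
      conv_rhs => rw [e3]
      group
    have e7 : ascProd t 1 m * α * (r * t m * r * t m) = ascProd t 1 m * α * (t m * r * t m * r) := by
      calc _ = ascProd t 1 m * ρ * t m * r * t m := by rw [hρ]; group
        _ = t 0 * (ascProd t 1 m * ρ * t m * r) := by rw [← e5, h2]
        _ = α * ρ * t m * r := by
            conv_rhs => rw [e4]
            group
        _ = α * α * r * t m * r := by rw [hρ]; group
        _ = _ := by rw [e6]; group
    exact (mul_left_cancel e7).symm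
  let u : ℕ → H := fun i => if i < m + 1 then t i else r
  have hu : ∀ i, i < m + 1 → u i = t i := fun i hi => if_pos hi
  have hu' : u (m + 1) = r := if_neg (by omega)
  obtain ⟨f, hf⟩ := ArtinB.exists_hom (n := m + 2) u
    (fun i hi => by rw [hu i (by omega), hu (i + 1) (by omega)]; exact h.braid i (by omega))
    (fun i hi => by
      obtain rfl : i = m := by omega
      rw [hu i (by omega), hu']; exact hb)
    (fun i j hij hj => by
      rw [hu i (by omega)]
      rcases Nat.lt_or_ge j (m + 1) with h3 | h3
      · rw [hu j h3]; exact h.comm i j hij h3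
      · obtain rfl : j = m + 1 := by omega
        rw [hu']; exact hcomm i (by omega))
  have hft : ∀ i, i + 1 < m + 2 → f (sg (m + 2) i) = t i := fun i hi => by
    rw [hf i (by omega), hu i (by omega)]
  refine ⟨f, hft, ?_⟩
  have hp : ∀ k, k ≤ m + 1 → f (ascProd (sg (m + 2)) 0 k) = ascProd t 0 k := by
    intro k
    induction k with
    | zero => intro; simp [ascProd]
    | succ k ih =>
      intro hk
      rw [ascProd_succ, map_mul, ih (by omega), zero_add, hft k (by omega), ascProd_succ, zero_add]
  rw [ρB_eq, ascProd_succ, map_mul, hp _ le_rfl, zero_add, hf _ (by omega), hu', ← hα, hρ]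

/-! ### The element `Δ_B` is central of infinite order -/

theorem closure_sg_ρB {n : ℕ} (hn : 1 ≤ n) {S : Subgroup (ArtinB n)}
    (h : ∀ i, i + 1 < n → sg n i ∈ S) (hρ : ρB n ∈ S) (g : ArtinB n) : g ∈ S := by
  apply ArtinB.induction
  intro i hi
  rcases Nat.lt_or_ge (i + 1) n with h1 | h1
  · exact h i h1
  · have e : i = n - 1 := by omega
    subst e
    have hα : ∀ k, k + 1 ≤ n → ascProd (sg n) 0 k ∈ S := by
      intro k
      induction k with
      | zero => intro; exact one_mem _
      | succ k ih =>
        intro hk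
        rw [ascProd_succ]; exact mul_mem (ih (by omega)) (h _ (by omega))
    rw [ρB_eq_αB_mul hn] at hρ
    exact (S.mul_mem_cancel_left (hα (n - 1) (by omega))).1 hρ

theorem ΔB_comm {n : ℕ} (hn : 2 ≤ n) (g : ArtinB n) : Commute (ΔB n) g := by
  suffices h : g ∈ Subgroup.centralizer {ΔB n} from
    (Subgroup.mem_centralizer_singleton_iff.1 h).symm
  refine closure_sg_ρB (by omega) (fun i hi => ?_) ?_ g
  · rw [Subgroup.mem_centralizer_singleton_iff]
    have h1 : ∀ k i, i + k + 1 < n → ρB n ^ k * sg n i = sg n (i + k) * ρB n ^ k := by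
      intro k
      induction k with
      | zero => intro i _; simp
      | succ k ih =>
        intro i hi
        rw [pow_succ, mul_assoc, ρB_mul_sg (by omega), ← mul_assoc, ih _ (by omega), mul_assoc,
          ← pow_succ, add_right_comm, add_assoc]
    have e : n = i + (2 + (n - 2 - i)) := by omega
    have e1 := h1 (n - 2 - i) i (by omega)
    rw [show i + (n - 2 - i) = n - 2 by omega] at e1
    have e2 := h1 i 0 (by omega)
    rw [zero_add] at e2
    have e3 := ρB_sq_mul_sg hn
    have : ΔB n = ρB n ^ i * (ρB n ^ 2 * ρB n ^ (n - 2 - i)) := by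
      rw [ΔB, ← pow_add, ← pow_add, ← e]
    rw [this]
    symm
    rw [mul_assoc, mul_assoc, e1, ← mul_assoc (ρB n ^ 2), e3, ← mul_assoc, ← mul_assoc, e2]
    simp only [mul_assoc]
  · rw [Subgroup.mem_centralizer_singleton_iff]
    exact (Commute.refl (ρB n)).pow_right n

/-- The exponent sums: `r_n ↦ a`, `t_i ↦ b`. -/
theorem exists_degree (n : ℕ) (a b : ℤ) : ∃ f : ArtinB n →* Multiplicative ℤ,
    (∀ i, i + 1 < n → f (sg n i) = Multiplicative.ofAdd b) ∧
    (1 ≤ n → f (sg n (n - 1)) = Multiplicative.ofAdd a) := by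
  obtain ⟨f, hf⟩ := ArtinB.exists_hom (n := n)
    (fun i => if i + 1 < n then Multiplicative.ofAdd b else Multiplicative.ofAdd a)
    (fun i hi => by rw [if_pos (by omega), if_pos (by omega)])
    (fun i hi => by
      simp only [mul_assoc]
      rw [mul_left_comm]
      congr 1
      rw [mul_left_comm]
      congr 1
      exact mul_comm _ _)
    (fun i j _ _ => Commute.all _ _)
  refine ⟨f, fun i hi => ?_, fun h => ?_⟩
  · rw [hf i (by omega), if_pos hi]
  · rw [hf _ (by omega), if_neg (by omega)]

/-! ### The Artin action on a free group -/

open FreeGroup in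
/-- The Artin automorphism `x_{j+1} ↦ x_j`, `x_j ↦ x_j⁻¹ x_{j+1} x_j`. -/
def sig (j : ℕ) : MulAut (FreeGroup ℕ) :=
  MonoidHom.toMulEquiv
    (FreeGroup.lift fun i => if i = j then (of j)⁻¹ * of (j + 1) * of j else
      if i = j + 1 then of j else of i)
    (FreeGroup.lift fun i => if i = j then of (j + 1) else
      if i = j + 1 then of (j + 1) * of j * (of (j + 1))⁻¹ else of i)
    (by
      ext i
      by_cases h1 : i = j
      · simp [h1]; group
      · by_cases h2 : i = j + 1
        · simp [h2]
        · simp [h1, h2])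
    (by
      ext i
      by_cases h1 : i = j
      · simp [h1]
      · by_cases h2 : i = j + 1
        · simp [h2]; group
        · simp [h1, h2])

open FreeGroup in
theorem sig_self (j : ℕ) : sig j (of j) = (of j)⁻¹ * of (j + 1) * of j := by
  simp [sig]

open FreeGroup in
theorem sig_succ (j : ℕ) : sig j (of (j + 1)) = of j := by
  simp [sig]

open FreeGroup in
theorem sig_of_ne {i j : ℕ} (h1 : i ≠ j) (h2 : i ≠ j + 1) : sig j (of i) = of i := by
  simp [sig, h1, h2]

theorem FreeGroup.mulAut_ext {α : Type*} {f g : MulAut (FreeGroup α)}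
    (h : ∀ i, f (FreeGroup.of i) = g (FreeGroup.of i)) : f = g := by
  have : f.toMonoidHom = g.toMonoidHom := by ext i; exact h i
  exact MulEquiv.ext fun x => DFunLike.congr_fun this x

theorem MulAut.mul_conj {H : Type*} [Group H] (f : MulAut H) (x : H) :
    f * MulAut.conj x = MulAut.conj (f x) * f := by
  ext y; simp

theorem sig_braid (j : ℕ) : sig j * sig (j + 1) * sig j = sig (j + 1) * sig j * sig (j + 1) := by
  apply FreeGroup.mulAut_ext
  intro i
  simp only [MulAut.mul_apply]
  by_cases h1 : i = j
  · subst h1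
    simp only [sig_self, sig_succ, map_mul, map_inv,
      sig_of_ne (i := i) (j := i + 1) (by omega) (by omega),
      sig_of_ne (i := i + 1 + 1) (j := i) (by omega) (by omega)]
    group
  by_cases h2 : i = j + 1
  · subst h2
    simp only [sig_self, sig_succ, map_mul, map_inv,
      sig_of_ne (i := j) (j := j + 1) (by omega) (by omega),
      sig_of_ne (i := j + 1 + 1) (j := j) (by omega) (by omega)]
  by_cases h3 : i = j + 2
  · subst h3
    simp only [sig_succ,
      sig_of_ne (i := j) (j := j + 1) (by omega) (by omega),
      sig_of_ne (i := j + 2) (j := j) (by omega) (by omega), show sig (j + 1) (FreeGroup.of (j + 2)) = FreeGroup.of (j + 1) from sig_succ (j + 1)]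
  rw [sig_of_ne (i := i) (j := j + 1) (by omega) (by omega), sig_of_ne h1 h2,
    sig_of_ne (i := i) (j := j + 1) (by omega) (by omega), sig_of_ne h1 h2]

theorem sig_comm {i j : ℕ} (h : i + 2 ≤ j) : Commute (sig i) (sig j) := by
  apply FreeGroup.mulAut_ext
  intro k
  simp only [MulAut.mul_apply]
  by_cases h1 : k = i
  · subst h1
    simp only [sig_self, map_mul, map_inv, sig_of_ne (i := k) (j := j) (by omega) (by omega),
      sig_of_ne (i := k + 1) (j := j) (by omega) (by omega)]
  by_cases h2 : k = i + 1
  · subst h2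
    simp only [sig_succ, sig_of_ne (i := i) (j := j) (by omega) (by omega),
      sig_of_ne (i := i + 1) (j := j) (by omega) (by omega)]
  rw [sig_of_ne (i := k) h1 h2]
  by_cases h3 : k = j
  · subst h3
    simp only [sig_self, map_mul, map_inv, sig_of_ne (i := k) (j := i) (by omega) (by omega),
      sig_of_ne (i := k + 1) (j := i) (by omega) (by omega)]
  by_cases h4 : k = j + 1
  · subst h4
    simp only [sig_succ, sig_of_ne (i := j) (j := i) (by omega) (by omega)]
  rw [sig_of_ne h3 h4, sig_of_ne h1 h2]

theorem exists_act (n : ℕ) : ∃ f : ArtinB n →* MulAut (FreeGroup ℕ),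
    ∀ i < n, f (sg n i) = if i + 1 < n then sig i else MulAut.conj (FreeGroup.of (n - 1)) := by
  refine ArtinB.exists_hom _ (fun i hi => ?_) (fun i hi => ?_) (fun i j hij hj => ?_)
  · rw [if_pos (by omega), if_pos (by omega)]; exact sig_braid i
  · subst hi
    rw [if_pos (by omega), if_neg (by omega), show i + 2 - 1 = i + 1 by omega]
    have h : ∀ (f : MulAut (FreeGroup ℕ)) (x : FreeGroup ℕ), f x * f (f x) = x * f x →
        f * MulAut.conj x * f * MulAut.conj x = MulAut.conj x * f * MulAut.conj x * f := by
      intro f x hx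
      have e1 := MulAut.mul_conj f x
      have e2 := MulAut.mul_conj f (f x)
      have e3 := congrArg MulAut.conj hx
      rw [map_mul, map_mul] at e3
      calc _ = (f * MulAut.conj x) * (f * MulAut.conj x) := by simp only [mul_assoc]
        _ = MulAut.conj (f x) * (f * MulAut.conj (f x)) * f := by rw [e1]; simp only [mul_assoc]
        _ = MulAut.conj (f x) * MulAut.conj (f (f x)) * f * f := by rw [e2]; simp only [mul_assoc]
        _ = MulAut.conj x * (MulAut.conj (f x) * f) * f := by rw [e3]; simp only [mul_assoc]
        _ = _ := by rw [← e1]; simp only [mul_assoc]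
    apply h
    rw [sig_succ, sig_self]; group
  · rw [if_pos (by omega)]
    split_ifs with h
    · exact sig_comm hij
    · rw [Commute, SemiconjBy, MulAut.mul_conj, sig_of_ne (by omega) (by omega)]

/-- The action of the Artin group of type `B` on the free group. -/
noncomputable def act (n : ℕ) : ArtinB n →* MulAut (FreeGroup ℕ) := (exists_act n).choose

theorem act_sg {n i : ℕ} (h : i + 1 < n) : act n (sg n i) = sig i := by
  rw [act, (exists_act n).choose_spec i (by omega), if_pos h]

theorem act_last {n : ℕ} (h : 1 ≤ n) :
    act n (sg n (n - 1)) = MulAut.conj (FreeGroup.of (n - 1)) := by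
  rw [act, (exists_act n).choose_spec _ (by omega), if_neg (by omega)]

/-! ### The free subgroup -/

/-- The element `x_j = t_j ⋯ t_{n-1} r_n (t_j ⋯ t_{n-1})⁻¹`. -/
def xs (n j : ℕ) : ArtinB n :=
  if j < n then ascProd (sg n) j (n - 1 - j) * sg n (n - 1) * (ascProd (sg n) j (n - 1 - j))⁻¹ else 1

theorem xs_last {n : ℕ} (h : 1 ≤ n) : xs n (n - 1) = sg n (n - 1) := by
  rw [xs, if_pos (by omega)]; simp [ascProd]

theorem xs_of_ge {n j : ℕ} (h : n ≤ j) : xs n j = 1 := if_neg (by omega)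

theorem xs_zero {n : ℕ} (h : 1 ≤ n) : xs n 0 = αB n * sg n (n - 1) * (αB n)⁻¹ := by
  rw [xs, if_pos (by omega)]; rfl

theorem sg_mul_xs_succ {n j : ℕ} (h : j + 1 < n) : sg n j * xs n (j + 1) = xs n j * sg n j := by
  rw [xs, if_pos h, xs, if_pos (by omega), show n - 1 - j = (n - 1 - (j + 1)) + 1 by omega,
    ascProd_succ']
  group

theorem sg_mul_xs_of_ne {n i j : ℕ} (h : i + 1 < n) (h1 : j ≠ i) (h2 : j ≠ i + 1) :
    sg n i * xs n j = xs n j * sg n i := by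
  rcases Nat.lt_or_ge j n with hj | hj
  swap
  · rw [xs_of_ge hj]; simp
  rw [xs, if_pos hj]
  rcases Nat.lt_or_ge j i with h3 | h3
  · have e := (sg_braidSeq n).ascProd_mul (a := j) (k := n - 1 - j) (i := i - 1) (by omega) (by omega)
      (by omega)
    rw [show i - 1 + 1 = i by omega] at e
    have e2 := (sg_comm (n := n) (i := i - 1) (j := n - 1) (by omega)).eq
    set c := ascProd (sg n) j (n - 1 - j)
    calc _ = sg n i * c * sg n (n - 1) * c⁻¹ := by group
      _ = c * (sg n (i - 1) * sg n (n - 1)) * c⁻¹ := by rw [← e]; group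
      _ = c * sg n (n - 1) * (c⁻¹ * (c * sg n (i - 1))) * c⁻¹ := by rw [e2]; group
      _ = _ := by rw [e]; group
  · have hc : Commute (sg n i) (ascProd (sg n) j (n - 1 - j)) :=
      commute_ascProd fun k hk _ => sg_comm (by omega)
    exact (hc.mul_right (sg_comm (by omega))).mul_right hc.inv_right

theorem sg_mul_xs_self {n i : ℕ} (h : i + 1 < n) :
    sg n i * xs n i = (xs n i)⁻¹ * xs n (i + 1) * xs n i * sg n i := by
  obtain ⟨k, hk⟩ : ∃ k, i + k + 2 = n := ⟨n - 2 - i, by omega⟩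
  induction k generalizing i with
  | zero =>
    have e := sg_braid_four (n := n) (i := i) (by omega)
    have e2 := sg_mul_xs_succ h
    have e3 := xs_last (n := n) (by omega)
    rw [show n - 1 = i + 1 by omega] at e3
    rw [e3] at e2 ⊢
    have e4 : xs n i = sg n i * sg n (i + 1) * (sg n i)⁻¹ := by rw [e2]; group
    rw [e4]
    calc _ = (sg n i * sg n (i + 1) * (sg n i)⁻¹)⁻¹ * ((sg n i * sg n (i + 1) * sg n i * sg n (i + 1))
          * (sg n i)⁻¹) := by group
      _ = _ := by rw [e]; group
  | succ k ih =>
    have ih' := ih (i := i + 1) (by omega) (by omega)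
    set g := sg n (i + 1) * sg n i with hg
    have c1 : g * sg n (i + 1) * g⁻¹ = sg n i := by
      rw [hg, ← sg_braid (by omega)]; group
    have c2 : g * xs n (i + 1) * g⁻¹ = xs n i := by
      have e1 := sg_mul_xs_succ h
      have e2 := sg_mul_xs_of_ne (n := n) (i := i + 1) (j := i) (by omega) (by omega) (by omega)
      calc _ = sg n (i + 1) * (sg n i * xs n (i + 1)) * (sg n i)⁻¹ * (sg n (i + 1))⁻¹ := by
            rw [hg]; group
        _ = (sg n (i + 1) * xs n i) * (sg n (i + 1))⁻¹ := by rw [e1]; group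
        _ = _ := by rw [e2]; group
    have c3 : g * xs n (i + 1 + 1) * g⁻¹ = xs n (i + 1) := by
      have e1 := sg_mul_xs_of_ne (n := n) (i := i) (j := i + 1 + 1) (by omega) (by omega) (by omega)
      have e2 := sg_mul_xs_succ (n := n) (j := i + 1) (by omega)
      calc _ = sg n (i + 1) * (sg n i * xs n (i + 1 + 1)) * (sg n i)⁻¹ * (sg n (i + 1))⁻¹ := by
            rw [hg]; group
        _ = (sg n (i + 1) * xs n (i + 1 + 1)) * (sg n (i + 1))⁻¹ := by rw [e1]; group
        _ = _ := by rw [e2]; group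
    have e := congrArg (MulAut.conj g) ih'
    simpa only [map_mul, map_inv, MulAut.conj_apply, c1, c2, c3] using e

/-- The homomorphism from the free group onto the subgroup generated by the `x_j`. -/
def X (n : ℕ) : FreeGroup ℕ →* ArtinB n := FreeGroup.lift (xs n)

@[simp] theorem X_of (n j : ℕ) : X n (FreeGroup.of j) = xs n j := FreeGroup.lift_apply_of

theorem conj_X {n : ℕ} (g : ArtinB n) (f : FreeGroup ℕ) : g * X n f * g⁻¹ = X n (act n g f) := by
  let S : Subgroup (ArtinB n) :=
    { carrier := {g | ∀ f, g * X n f * g⁻¹ = X n (act n g f)}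
      one_mem' := fun f => by simp
      mul_mem' := fun {a b} ha hb f => by
        rw [map_mul, MulAut.mul_apply, ← ha, ← hb]; group
      inv_mem' := fun {a} ha f => by
        have := ha (act n a⁻¹ f)
        rw [← MulAut.mul_apply, ← map_mul, mul_inv_cancel, map_one, MulAut.one_apply] at this
        rw [← this]; group }
  refine ArtinB.induction (S := S) (fun i hi => ?_) g f
  suffices h : (MulAut.conj (sg n i)).toMonoidHom.comp (X n) =
      (X n).comp (act n (sg n i)).toMonoidHom from fun f => DFunLike.congr_fun h f
  ext j
  simp only [MonoidHom.comp_apply, X_of, MulEquiv.toMonoidHom_eq_coe, MonoidHom.coe_coe,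
    MulAut.conj_apply]
  rw [mul_inv_eq_iff_eq_mul]
  rcases Nat.lt_or_ge (i + 1) n with h | h
  · rw [act_sg h]
    by_cases h1 : j = i
    · subst h1
      rw [sig_self, sg_mul_xs_self h]; simp
    by_cases h2 : j = i + 1
    · subst h2
      rw [sig_succ, sg_mul_xs_succ h]; simp
    rw [sig_of_ne h1 h2, sg_mul_xs_of_ne h h1 h2]; simp
  · obtain rfl : i = n - 1 := by omega
    rw [act_last (by omega)]
    simp [xs_last (n := n) (by omega)]

theorem act_xs {n j : ℕ} (h : j < n) : act n (xs n j) = MulAut.conj (FreeGroup.of j) := by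
  obtain ⟨k, hk⟩ : ∃ k, j + k + 1 = n := ⟨n - 1 - j, by omega⟩
  induction k generalizing j with
  | zero =>
    obtain rfl : j = n - 1 := by omega
    rw [xs_last (by omega), act_last (by omega)]
  | succ k ih =>
    have e : xs n j = sg n j * xs n (j + 1) * (sg n j)⁻¹ := by
      rw [sg_mul_xs_succ (by omega)]; group
    rw [e, map_mul, map_mul, ih (by omega) (by omega), act_sg (by omega), MulAut.mul_conj, sig_succ,
      map_inv, act_sg (by omega), mul_inv_cancel_right]

theorem act_X {n : ℕ} (f : FreeGroup ℕ) :
    act n (X n f) = MulAut.conj (FreeGroup.kap (Set.Iio n) f) := by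
  suffices h : (act n).comp (X n) = MulAut.conj.comp (FreeGroup.kap (Set.Iio n)) from
    DFunLike.congr_fun h f
  ext j : 1
  rcases Nat.lt_or_ge j n with h | h
  · simp [act_xs h, FreeGroup.kap_of_mem (M := Set.Iio n) (i := j) h]
  · simp [xs_of_ge h, FreeGroup.kap_of_notMem (M := Set.Iio n) (i := j) (by simpa using h)]

theorem X_kap {n : ℕ} (f : FreeGroup ℕ) : X n (FreeGroup.kap (Set.Iio n) f) = X n f := by
  suffices h : (X n).comp (FreeGroup.kap (Set.Iio n)) = X n from DFunLike.congr_fun h f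
  ext j : 1
  rcases Nat.lt_or_ge j n with h | h
  · simp [FreeGroup.kap_of_mem (M := Set.Iio n) (i := j) h]
  · simp [xs_of_ge h, FreeGroup.kap_of_notMem (M := Set.Iio n) (i := j) (by simpa using h)]

theorem FreeGroup.conj_injective : Function.Injective (MulAut.conj : FreeGroup ℕ →* MulAut (FreeGroup ℕ)) := by
  rw [injective_iff_map_eq_one]
  intro h hh
  have hc : ∀ y, Commute h y := fun y => by
    have := DFunLike.congr_fun hh y
    simp only [MulAut.conj_apply, MulAut.one_apply] at this
    exact mul_inv_eq_iff_eq_mul.1 this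
  exact FreeGroup.eq_one_of_commute_of_of (a := 0) (b := 1) (by decide) h (hc _).symm.eq (hc _).symm.eq

theorem X_eq_iff {n : ℕ} {f f' : FreeGroup ℕ} :
    X n f = X n f' ↔ FreeGroup.kap (Set.Iio n) f = FreeGroup.kap (Set.Iio n) f' := by
  constructor
  · intro h
    apply FreeGroup.conj_injective
    rw [← act_X, ← act_X, h]
  · intro h
    rw [← X_kap, h, X_kap]

/-- The braid subgroup on the first `m` strands. -/
def BS (n m : ℕ) : Subgroup (ArtinB n) := Subgroup.closure {g | ∃ i, i + 1 < m ∧ g = sg n i}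

theorem sg_mem_BS {n m i : ℕ} (h : i + 1 < m) : sg n i ∈ BS n m :=
  Subgroup.subset_closure ⟨i, h, rfl⟩

theorem BS_mono {n m k : ℕ} (h : m ≤ k) : BS n m ≤ BS n k := by
  rw [BS, Subgroup.closure_le]
  rintro _ ⟨i, hi, rfl⟩
  exact sg_mem_BS (by omega)

theorem BS_le {n m : ℕ} {S : Subgroup (ArtinB n)} (h : ∀ i, i + 1 < m → sg n i ∈ S) : BS n m ≤ S := by
  rw [BS, Subgroup.closure_le]
  rintro _ ⟨i, hi, rfl⟩
  exact h i hi

theorem ascProd_mem_BS {n m a k : ℕ} (h : a + k < m) : ascProd (sg n) a k ∈ BS n m := by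
  induction k with
  | zero => exact one_mem _
  | succ k ih => exact mul_mem (ih (by omega)) (sg_mem_BS (by omega))

theorem exists_X_mul {n : ℕ} (g : ArtinB n) : ∃ f, ∃ b ∈ BS n n, g = X n f * b := by
  let S : Subgroup (ArtinB n) :=
    { carrier := {g | ∃ f, ∃ b ∈ BS n n, g = X n f * b}
      one_mem' := ⟨1, 1, one_mem _, by simp⟩
      mul_mem' := by
        rintro _ _ ⟨f, b, hb, rfl⟩ ⟨f', b', hb', rfl⟩
        refine ⟨f * act n b f', b * b', mul_mem hb hb', ?_⟩
        rw [map_mul, ← conj_X]; group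
      inv_mem' := by
        rintro _ ⟨f, b, hb, rfl⟩
        refine ⟨act n b⁻¹ f⁻¹, b⁻¹, inv_mem hb, ?_⟩
        rw [← conj_X, map_inv]; group }
  refine ArtinB.induction (S := S) (fun i hi => ?_) g
  rcases Nat.lt_or_ge (i + 1) n with h | h
  · exact ⟨1, _, sg_mem_BS h, by simp⟩
  · obtain rfl : i = n - 1 := by omega
    exact ⟨FreeGroup.of (n - 1), 1, one_mem _, by simp [xs_last (n := n) (by omega)]⟩

/-! ### The underlying permutation -/

theorem exists_prm (n : ℕ) : ∃ f : ArtinB n →* Equiv.Perm ℕ,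
    ∀ i < n, f (sg n i) = if i + 1 < n then Equiv.swap i (i + 1) else 1 := by
  refine ArtinB.exists_hom _ (fun i hi => ?_) (fun i hi => ?_) (fun i j hij hj => ?_)
  · rw [if_pos (by omega), if_pos (by omega)]
    have h1 : Equiv.swap i (i + 1) * Equiv.swap (i + 1) (i + 2) * Equiv.swap i (i + 1) =
        Equiv.swap i (i + 2) := by
      have h := Equiv.mul_swap_eq_swap_mul (Equiv.swap i (i + 1)) (i + 1) (i + 2)
      rw [h, Equiv.swap_apply_right, Equiv.swap_apply_of_ne_of_ne (by omega) (by omega), mul_assoc,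
        Equiv.swap_mul_self, mul_one]
    have h2 : Equiv.swap (i + 1) (i + 2) * Equiv.swap i (i + 1) * Equiv.swap (i + 1) (i + 2) =
        Equiv.swap i (i + 2) := by
      have h := Equiv.mul_swap_eq_swap_mul (Equiv.swap (i + 1) (i + 2)) i (i + 1)
      rw [h, Equiv.swap_apply_left, Equiv.swap_apply_of_ne_of_ne (by omega) (by omega), mul_assoc,
        Equiv.swap_mul_self, mul_one]
    exact h1.trans h2.symm
  · rw [if_pos (by omega), if_neg (by omega)]; simp
  · rw [if_pos (by omega)]
    split_ifs with h
    · have e := Equiv.mul_swap_eq_swap_mul (Equiv.swap i (i + 1)) j (j + 1)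
      rwa [Equiv.swap_apply_of_ne_of_ne (by omega) (by omega),
        Equiv.swap_apply_of_ne_of_ne (by omega) (by omega)] at e
    · exact Commute.one_right _

/-- The permutation of the strands. -/
noncomputable def prm (n : ℕ) : ArtinB n →* Equiv.Perm ℕ := (exists_prm n).choose

theorem prm_sg {n i : ℕ} (h : i + 1 < n) : prm n (sg n i) = Equiv.swap i (i + 1) := by
  rw [prm, (exists_prm n).choose_spec i (by omega), if_pos h]

theorem prm_last {n : ℕ} (h : 1 ≤ n) : prm n (sg n (n - 1)) = 1 := by
  rw [prm, (exists_prm n).choose_spec _ (by omega), if_neg (by omega)]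

theorem prm_xs (n j : ℕ) : prm n (xs n j) = 1 := by
  rw [xs]
  split_ifs with h
  · rw [map_mul, map_mul, prm_last (by omega), mul_one, map_inv, mul_inv_cancel]
  · exact map_one _

theorem prm_X (n : ℕ) (f : FreeGroup ℕ) : prm n (X n f) = 1 := by
  have : (prm n).comp (X n) = 1 := by ext1 j; simp [prm_xs]
  exact DFunLike.congr_fun this f

theorem prm_of_ge {n : ℕ} (g : ArtinB n) {j : ℕ} (h : n ≤ j) : prm n g j = j := by
  have : prm n g ∈ MulAction.stabilizer (Equiv.Perm ℕ) j := by
    refine ArtinB.induction (S := (MulAction.stabilizer (Equiv.Perm ℕ) j).comap (prm n))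
      (fun i hi => ?_) g
    rw [Subgroup.mem_comap, MulAction.mem_stabilizer_iff]
    rcases Nat.lt_or_ge (i + 1) n with h | h
    · rw [prm_sg h]; exact Equiv.swap_apply_of_ne_of_ne (by omega) (by omega)
    · obtain rfl : i = n - 1 := by omega
      rw [prm_last (by omega)]; rfl
  exact this

theorem prm_lt {n : ℕ} (g : ArtinB n) {j : ℕ} (h : j < n) : prm n g j < n := by
  by_contra h1
  have := prm_of_ge g (not_lt.1 h1)
  have := (prm n g).injective this
  omega

theorem act_of {n : ℕ} (g : ArtinB n) (i : ℕ) :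
    ∃ c, act n g (FreeGroup.of i) = c * FreeGroup.of (prm n g i) * c⁻¹ := by
  let S : Subgroup (ArtinB n) :=
    { carrier := {g | ∀ i, ∃ c, act n g (FreeGroup.of i) = c * FreeGroup.of (prm n g i) * c⁻¹}
      one_mem' := fun i => ⟨1, by simp⟩
      mul_mem' := by
        intro a b ha hb i
        obtain ⟨c, hc⟩ := hb i
        obtain ⟨d, hd⟩ := ha (prm n b i)
        refine ⟨act n a c * d, ?_⟩
        rw [map_mul, MulAut.mul_apply, hc, map_mul, map_mul, hd, map_inv, map_mul,
          Equiv.Perm.mul_apply]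
        group
      inv_mem' := by
        intro a ha i
        obtain ⟨c, hc⟩ := ha ((prm n a)⁻¹ i)
        refine ⟨(act n a⁻¹ c)⁻¹, ?_⟩
        have := congrArg (act n a⁻¹) hc
        rw [← MulAut.mul_apply, ← map_mul, inv_mul_cancel, map_one, MulAut.one_apply, map_mul,
          map_mul, ← Equiv.Perm.mul_apply, mul_inv_cancel, Equiv.Perm.one_apply, map_inv] at this
        rw [map_inv (prm n), this, ← map_inv (act n), map_inv (act n a⁻¹)]; group }
  refine ArtinB.induction (S := S) (fun i hi j => ?_) g i
  rcases Nat.lt_or_ge (i + 1) n with h | h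
  · rw [act_sg h, prm_sg h]
    by_cases h1 : j = i
    · subst h1
      exact ⟨(FreeGroup.of j)⁻¹, by rw [sig_self, Equiv.swap_apply_left, inv_inv]⟩
    by_cases h2 : j = i + 1
    · subst h2
      exact ⟨1, by rw [sig_succ, Equiv.swap_apply_right]; simp⟩
    exact ⟨1, by rw [sig_of_ne h1 h2, Equiv.swap_apply_of_ne_of_ne h1 h2]; simp⟩
  · obtain rfl : i = n - 1 := by omega
    exact ⟨FreeGroup.of (n - 1), by rw [act_last (by omega), prm_last (by omega)]; simp⟩

/-! ### Retractions and the action -/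

open FreeGroup (kap)

theorem act_mul (n : ℕ) (g g' : ArtinB n) (f : FreeGroup ℕ) :
    act n (g * g') f = act n g (act n g' f) := by
  rw [map_mul, MulAut.mul_apply]

@[simp] theorem act_inv_act (n : ℕ) (g : ArtinB n) (f : FreeGroup ℕ) :
    act n g⁻¹ (act n g f) = f := by
  rw [← act_mul, inv_mul_cancel, map_one, MulAut.one_apply]

@[simp] theorem act_act_inv (n : ℕ) (g : ArtinB n) (f : FreeGroup ℕ) :
    act n g (act n g⁻¹ f) = f := by
  rw [← act_mul, mul_inv_cancel, map_one, MulAut.one_apply]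

theorem kap_act {n : ℕ} (g : ArtinB n) (M : Set ℕ) (f : FreeGroup ℕ) :
    kap (prm n g '' M) (act n g (kap M f)) = kap (prm n g '' M) (act n g f) := by
  suffices h : ((kap (prm n g '' M)).comp (act n g).toMonoidHom).comp (kap M) =
      (kap (prm n g '' M)).comp (act n g).toMonoidHom from DFunLike.congr_fun h f
  ext i : 1
  by_cases hi : i ∈ M
  · simp [FreeGroup.kap_of_mem hi]
  · obtain ⟨c, hc⟩ := act_of g i
    have : prm n g i ∉ prm n g '' M := by
      rwa [Function.Injective.mem_set_image (prm n g).injective]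
    simp [FreeGroup.kap_of_notMem hi, hc, FreeGroup.kap_of_notMem this]

theorem kap_act_eq {n : ℕ} {g : ArtinB n} {M N : Set ℕ} (h : prm n g '' M = N) (f : FreeGroup ℕ) :
    kap N (act n g (kap M f)) = kap N (act n g f) := by
  subst h; exact kap_act g M f

theorem FreeGroup.kap_of_subset {α : Type*} {M N : Set α} (h : M ⊆ N) (f : FreeGroup α) :
    kap M (kap N f) = kap M f := by
  rw [FreeGroup.kap_kap, Set.inter_eq_left.2 h]

/-- The pure elements acting as inner automorphisms on the letters in `M`. -/
def NM (n : ℕ) (M : Set ℕ) : Subgroup (ArtinB n) where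
  carrier := {p | prm n p = 1 ∧ ∃ h, ∀ f, kap M (act n p f) = h * kap M f * h⁻¹}
  one_mem' := ⟨map_one _, 1, fun f => by simp⟩
  mul_mem' := by
    rintro p q ⟨hp, h, hh⟩ ⟨hq, k, hk⟩
    refine ⟨by rw [map_mul, hp, hq, mul_one], h * k, fun f => ?_⟩
    rw [map_mul, MulAut.mul_apply, hh, hk]; group
  inv_mem' := by
    rintro p ⟨hp, h, hh⟩
    refine ⟨by rw [map_inv, hp, inv_one], h⁻¹, fun f => ?_⟩
    have := hh (act n p⁻¹ f)
    rw [act_act_inv] at this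
    rw [this]; group

theorem mem_NM {n : ℕ} {M : Set ℕ} {p : ArtinB n} :
    p ∈ NM n M ↔ prm n p = 1 ∧ ∃ h, ∀ f, kap M (act n p f) = h * kap M f * h⁻¹ := Iff.rfl

theorem NM_anti {n : ℕ} {M N : Set ℕ} (h : M ⊆ N) : NM n N ≤ NM n M := by
  rintro p ⟨hp, k, hk⟩
  refine ⟨hp, kap M k, fun f => ?_⟩
  rw [← FreeGroup.kap_of_subset h, hk, map_mul, map_mul, map_inv, FreeGroup.kap_of_subset h]

theorem conj_mem_NM {n : ℕ} {M : Set ℕ} {p : ArtinB n} (g : ArtinB n) (hp : p ∈ NM n M) :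
    g * p * g⁻¹ ∈ NM n (prm n g '' M) := by
  obtain ⟨hp, h, hh⟩ := hp
  refine ⟨by simp [hp], kap (prm n g '' M) (act n g h), fun f => ?_⟩
  rw [act_mul, act_mul, ← kap_act, hh, map_mul, map_mul, map_mul, map_mul, kap_act, act_act_inv,
    map_inv, map_inv]

theorem conj_mem_NM' {n : ℕ} {M N : Set ℕ} {p g : ArtinB n} (h : prm n g '' M = N) (hp : p ∈ NM n M) :
    g * p * g⁻¹ ∈ NM n N := h ▸ conj_mem_NM g hp

theorem conj_mem_NM_iff {n : ℕ} {M N : Set ℕ} {p g : ArtinB n} (h : prm n g '' M = N) :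
    g * p * g⁻¹ ∈ NM n N ↔ p ∈ NM n M := by
  refine ⟨fun hp => ?_, conj_mem_NM' h⟩
  have h2 : prm n g⁻¹ '' N = M := by
    rw [← h, Set.image_image]; simp
  have := conj_mem_NM' h2 hp
  convert this using 1; group

theorem X_mem_NM {n : ℕ} {M : Set ℕ} (hM : M ⊆ Set.Iio n) (f : FreeGroup ℕ) : X n f ∈ NM n M :=
  NM_anti hM ⟨prm_X n f, kap (Set.Iio n) f, fun f' => by
    rw [act_X]; simp [FreeGroup.kap_kap_self]⟩

/-! ### The full twists -/

/-- `x_k ⋯ x_1`. -/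
def Pf : ℕ → FreeGroup ℕ
  | 0 => 1
  | k + 1 => FreeGroup.of k * Pf k

theorem sig_Pf {i k : ℕ} (h : k ≠ i + 1) : sig i (Pf k) = Pf k := by
  induction k using Nat.strong_induction_on with
  | _ k ih =>
    match k with
    | 0 => simp [Pf]
    | 1 =>
      rw [Pf, map_mul, sig_of_ne (by omega) (by omega)]; simp [Pf]
    | k + 2 =>
      by_cases h1 : k = i
      · subst h1
        simp only [Pf, map_mul]
        rw [sig_succ, sig_self, ih k (by omega) (by omega)]; group
      · rw [Pf, map_mul, ih (k + 1) (by omega) (by omega), sig_of_ne (by omega) (by omega)]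

theorem act_BS {n m : ℕ} (hm : m ≤ n) {f : FreeGroup ℕ} (h : ∀ i, i + 1 < m → sig i f = f) {b : ArtinB n}
    (hb : b ∈ BS n m) : act n b f = f := by
  have : BS n m ≤ (MulAction.stabilizer (MulAut (FreeGroup ℕ)) f).comap (act n) :=
    BS_le fun i hi => by
      rw [Subgroup.mem_comap, MulAction.mem_stabilizer_iff, act_sg (by omega)]; exact h i hi
  exact this hb

theorem act_BS_Pf {n m k : ℕ} (hm : m ≤ n) (hk : m ≤ k) {b : ArtinB n} (hb : b ∈ BS n m) :
    act n b (Pf k) = Pf k := act_BS hm (fun i hi => sig_Pf (by omega)) hb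

theorem act_BS_of {n m k : ℕ} (hm : m ≤ n) (hk : m ≤ k) {b : ArtinB n} (hb : b ∈ BS n m) :
    act n b (FreeGroup.of k) = FreeGroup.of k :=
  act_BS hm (fun i hi => sig_of_ne (by omega) (by omega)) hb

theorem act_ascProd_of {n k : ℕ} (hk : k + 1 ≤ n) :
    (∀ j, k < j → act n (ascProd (sg n) 0 k) (FreeGroup.of j) = FreeGroup.of j) ∧
    act n (ascProd (sg n) 0 k) (FreeGroup.of k) = FreeGroup.of 0 ∧
    ∀ j, j < k → act n (ascProd (sg n) 0 k) (FreeGroup.of j) =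
      (FreeGroup.of 0)⁻¹ * FreeGroup.of (j + 1) * FreeGroup.of 0 := by
  induction k with
  | zero => simp [ascProd]
  | succ k ih =>
    obtain ⟨h1, h2, h3⟩ := ih (by omega)
    simp only [ascProd_succ, map_mul, MulAut.mul_apply, zero_add]
    rw [act_sg (by omega)]
    refine ⟨fun j hj => ?_, ?_, fun j hj => ?_⟩
    · rw [sig_of_ne (by omega) (by omega), h1 j (by omega)]
    · rw [sig_succ, h2]
    · rcases Nat.lt_or_ge j k with h | h
      · rw [sig_of_ne (by omega) (by omega), h3 j h]
      · obtain rfl : j = k := by omega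
        rw [sig_self, map_mul, map_mul, map_inv, h2, h1 _ (by omega)]

/-- The full twist on the first `m` strands. -/
def zB (n m : ℕ) : ArtinB n := ascProd (sg n) 0 (m - 1) ^ m

theorem zB_mem {n m : ℕ} : zB n m ∈ BS n m := by
  rcases Nat.eq_zero_or_pos m with rfl | h
  · exact one_mem _
  · exact pow_mem (ascProd_mem_BS (by omega)) _

theorem act_ascProd_Pf {n m k : ℕ} (hm : m ≤ n) (hk : k < m) :
    FreeGroup.of 0 * act n (ascProd (sg n) 0 (m - 1)) (Pf k) = Pf (k + 1) := by
  induction k with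
  | zero => simp [Pf]
  | succ k ih =>
    rw [Pf, map_mul, (act_ascProd_of (n := n) (k := m - 1) (by omega)).2.2 k (by omega)]
    rw [Pf, ← ih (by omega)]; group

theorem act_zB_of {n m j : ℕ} (hm : m ≤ n) (hj : j < m) :
    act n (zB n m) (FreeGroup.of j) = (Pf m)⁻¹ * FreeGroup.of j * Pf m := by
  set a := ascProd (sg n) 0 (m - 1) with ha
  set β : MulAut (FreeGroup ℕ) := MulAut.conj (FreeGroup.of 0) * act n a with hβ
  obtain ⟨-, h2, h3⟩ := act_ascProd_of (n := n) (k := m - 1) (by omega)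
  have hb1 : ∀ j, j + 1 < m → β (FreeGroup.of j) = FreeGroup.of (j + 1) := fun j hj => by
    rw [hβ, MulAut.mul_apply, ha, h3 j (by omega), MulAut.conj_apply]; group
  have hb2 : β (FreeGroup.of (m - 1)) = FreeGroup.of 0 := by
    rw [hβ, MulAut.mul_apply, ha, h2, MulAut.conj_apply]; group
  have hb3 : ∀ k j, j + k < m → (β ^ k) (FreeGroup.of j) = FreeGroup.of (j + k) := by
    intro k
    induction k with
    | zero => intro j _; simp
    | succ k ih =>
      intro j hj
      rw [pow_succ, MulAut.mul_apply, hb1 j (by omega), ih _ (by omega)]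
      congr 1; omega
  have hb4 : (β ^ m) (FreeGroup.of j) = FreeGroup.of j := by
    have e : m = j + (1 + (m - 1 - j)) := by omega
    rw [e, pow_add, pow_add, MulAut.mul_apply, MulAut.mul_apply, hb3 _ _ (by omega), pow_one,
      show j + (m - 1 - j) = m - 1 by omega, hb2, hb3 _ _ (by omega), zero_add]
  have hb5 : ∀ k, k ≤ m → β ^ k = MulAut.conj (Pf k) * act n (a ^ k) := by
    intro k
    induction k with
    | zero => intro; simp [Pf]
    | succ k ih =>
      intro hk
      rw [pow_succ', ih (by omega), hβ, mul_assoc, ← mul_assoc (act n a), MulAut.mul_conj,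
        ← mul_assoc, ← mul_assoc, ← map_mul, ha, act_ascProd_Pf hm (by omega), ← ha, mul_assoc,
        ← map_mul, pow_succ']
  rw [hb5 m le_rfl, MulAut.mul_apply, MulAut.conj_apply] at hb4
  rw [zB, ← ha]
  conv_rhs => rw [← hb4]
  group

theorem act_zB_of_ge {n m j : ℕ} (hm : m ≤ n) (hj : m ≤ j) :
    act n (zB n m) (FreeGroup.of j) = FreeGroup.of j := act_BS_of hm hj zB_mem

theorem ρB_pow {n k : ℕ} (hn : 1 ≤ n) (hk : k ≤ n) : ρB n ^ k = X n (Pf k) * αB n ^ k := by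
  have h0 : ρB n = X n (FreeGroup.of 0) * αB n := by
    rw [X_of, xs_zero hn, ρB_eq_αB_mul hn]; group
  induction k with
  | zero => simp [Pf]
  | succ k ih =>
    have h1 : αB n * X n (Pf k) = X n (act n (αB n) (Pf k)) * αB n := by
      rw [← conj_X]; group
    have h2 := act_ascProd_Pf (n := n) (m := n) (k := k) le_rfl (by omega)
    rw [pow_succ', ih (by omega), h0, mul_assoc, ← mul_assoc (αB n), h1, ← mul_assoc, ← mul_assoc,
      ← map_mul, αB, h2, mul_assoc, ← pow_succ']

theorem ΔB_eq {n : ℕ} (hn : 1 ≤ n) : ΔB n = X n (Pf n) * zB n n := ρB_pow hn le_rfl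

theorem kap_Pf {k : ℕ} : kap (Set.Iio k) (Pf k) = Pf k := by
  have : ∀ j, j ≤ k → kap (Set.Iio k) (Pf j) = Pf j := by
    intro j
    induction j with
    | zero => intro; simp [Pf]
    | succ j ih =>
      intro hj
      rw [Pf, map_mul, ih (by omega), FreeGroup.kap_of_mem (show j ∈ Set.Iio k from hj)]
  exact this k le_rfl

theorem kap_act_ΔB {n : ℕ} (hn : 1 ≤ n) (f : FreeGroup ℕ) :
    kap (Set.Iio n) (act n (ΔB n) f) = kap (Set.Iio n) f := by
  suffices h : (kap (Set.Iio n)).comp (act n (ΔB n)).toMonoidHom = kap (Set.Iio n) from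
    DFunLike.congr_fun h f
  ext i : 1
  simp only [MonoidHom.comp_apply, MulEquiv.toMonoidHom_eq_coe, MonoidHom.coe_coe]
  rw [ΔB_eq hn, map_mul, MulAut.mul_apply, act_X, kap_Pf, MulAut.conj_apply]
  rcases Nat.lt_or_ge i n with h | h
  · rw [act_zB_of le_rfl h]; congr 1; group
  · rw [act_zB_of_ge le_rfl h]
    simp [FreeGroup.kap_of_notMem (show i ∉ Set.Iio n from not_lt.2 h)]

theorem prm_ΔB {n : ℕ} (hn : 2 ≤ n) : prm n (ΔB n) = 1 := by
  refine Equiv.ext fun i => ?_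
  rw [Equiv.Perm.one_apply]
  rcases Nat.lt_or_ge i n with h | h
  · by_contra hne
    obtain ⟨c, hc⟩ := act_of (ΔB n) i
    have h1 := kap_act_ΔB (by omega) (n := n) (FreeGroup.of i)
    rw [hc, FreeGroup.kap_of_mem (show i ∈ Set.Iio n from h), map_mul, map_mul,
      FreeGroup.kap_of_mem (show prm n (ΔB n) i ∈ Set.Iio n from prm_lt _ h)] at h1
    have h2 := congrArg (FreeGroup.expSum i) h1
    simp only [map_mul, map_inv, FreeGroup.expSum_of_self] at h2
    rw [FreeGroup.expSum_of_ne hne, mul_one, mul_inv_cancel] at h2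
    exact absurd h2 (by decide)
  · exact prm_of_ge _ h

theorem ΔB_mem_NM {n : ℕ} (hn : 2 ≤ n) {M : Set ℕ} (hM : M ⊆ Set.Iio n) : ΔB n ∈ NM n M :=
  NM_anti hM ⟨prm_ΔB hn, 1, fun f => by rw [kap_act_ΔB (by omega)]; simp⟩

/-! ### The transfer cocycle -/

/-- `p` is pure, inner on the letters in `M`, and its action on the letter `r` relative to `M` is
measured by `c`. -/
def Chi (n : ℕ) (M : Set ℕ) (r : ℕ) (p : ArtinB n) (c : FreeGroup ℕ) : Prop :=
  prm n p = 1 ∧ ∃ h g, (∀ f, kap M (act n p f) = h * kap M f * h⁻¹) ∧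
    act n p (FreeGroup.of r) = g * FreeGroup.of r * g⁻¹ ∧ c = h⁻¹ * kap M g

theorem exists_Chi {n : ℕ} {M : Set ℕ} (r : ℕ) {p : ArtinB n} (h : p ∈ NM n M) : ∃ c, Chi n M r p c := by
  obtain ⟨hp, h, hh⟩ := h
  obtain ⟨g, hg⟩ := act_of p r
  rw [hp] at hg
  exact ⟨_, hp, h, g, hh, hg, rfl⟩

theorem Chi.mul {n : ℕ} {M : Set ℕ} {r : ℕ} {p q : ArtinB n} {c d : FreeGroup ℕ} (hp : Chi n M r p c)
    (hq : Chi n M r q d) : Chi n M r (p * q) (d * c) := by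
  obtain ⟨hp, h, g, hh, hg, rfl⟩ := hp
  obtain ⟨hq, k, l, hk, hl, rfl⟩ := hq
  refine ⟨by rw [map_mul, hp, hq, mul_one], h * k, act n p l * g, fun f => ?_, ?_, ?_⟩
  · rw [map_mul, MulAut.mul_apply, hh, hk]; group
  · rw [map_mul, MulAut.mul_apply, hl, map_mul, map_mul, hg, map_inv]; group
  · rw [map_mul, hh]; group

theorem Chi.inv {n : ℕ} {M : Set ℕ} {r : ℕ} {p : ArtinB n} {c : FreeGroup ℕ} (hp : Chi n M r p c) :
    Chi n M r p⁻¹ c⁻¹ := by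
  obtain ⟨hp, h, g, hh, hg, rfl⟩ := hp
  have h1 : ∀ f, kap M (act n p⁻¹ f) = h⁻¹ * kap M f * h⁻¹⁻¹ := fun f => by
    have := hh (act n p⁻¹ f)
    rw [act_act_inv] at this
    rw [this]; group
  refine ⟨by rw [map_inv, hp, inv_one], h⁻¹, act n p⁻¹ g⁻¹, h1, ?_, ?_⟩
  · have := congrArg (act n p⁻¹) hg
    rw [act_inv_act, map_mul, map_mul, map_inv (act n p⁻¹)] at this
    conv_rhs => rw [this]
    rw [map_inv (act n p⁻¹) g]; group
  · rw [h1, map_inv]; group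

theorem Chi.commutator {n : ℕ} {M : Set ℕ} {r : ℕ} {p q : ArtinB n} {c d : FreeGroup ℕ}
    (hp : Chi n M r p c) (hq : Chi n M r q d) (h : Commute c d) : Chi n M r (p * q * p⁻¹ * q⁻¹) 1 := by
  convert ((hp.mul hq).mul hp.inv).mul hq.inv using 1
  have e := h.eq
  calc 1 = d⁻¹ * (c⁻¹ * (c * d)) := by simp
    _ = d⁻¹ * (c⁻¹ * (d * c)) := by rw [e]

theorem Chi.unique {n : ℕ} {M : Set ℕ} {r i j : ℕ} (hi : i ∈ M) (hj : j ∈ M) (hij : i ≠ j) (hr : r ∉ M)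
    {p : ArtinB n} {c d : FreeGroup ℕ} (hc : Chi n M r p c) (hd : Chi n M r p d) : c = d := by
  obtain ⟨hp, h, g, hh, hg, rfl⟩ := hc
  obtain ⟨-, k, l, hk, hl, rfl⟩ := hd
  have h1 : k⁻¹ * h = 1 := by
    have : ∀ i ∈ M, FreeGroup.of i * (k⁻¹ * h) = k⁻¹ * h * FreeGroup.of i := fun i hi => by
      have e := (hh (FreeGroup.of i)).symm.trans (hk (FreeGroup.of i))
      rw [FreeGroup.kap_of_mem hi] at e
      calc _ = k⁻¹ * (k * FreeGroup.of i * k⁻¹) * h := by group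
        _ = _ := by rw [← e]; group
    exact FreeGroup.eq_one_of_commute_of_of hij _ (this i hi) (this j hj)
  have h2 : kap M (l⁻¹ * g) = 1 := by
    have : FreeGroup.of r * (l⁻¹ * g) = l⁻¹ * g * FreeGroup.of r := by
      have e := hg.symm.trans hl
      calc _ = l⁻¹ * (l * FreeGroup.of r * l⁻¹) * g := by group
        _ = _ := by rw [← e]; group
    obtain ⟨k, hk⟩ := FreeGroup.mem_zpowers_of_commute_of r _ this
    rw [hk, map_zpow, FreeGroup.kap_of_notMem hr, one_zpow]
  rw [map_mul, map_inv, inv_mul_eq_one] at h2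
  rw [inv_mul_eq_one] at h1
  rw [h1, h2]

theorem Chi.conj_one {n : ℕ} {M : Set ℕ} {r : ℕ} {p : ArtinB n} (g : ArtinB n) (h : Chi n M r p 1) :
    Chi n (prm n g '' M) (prm n g r) (g * p * g⁻¹) 1 := by
  obtain ⟨hp, h, u, hh, hu, h1⟩ := h
  obtain ⟨k, hk⟩ := act_of g r
  have hh' : ∀ f, kap (prm n g '' M) (act n (g * p * g⁻¹) f) =
      kap (prm n g '' M) (act n g h) * kap (prm n g '' M) f * (kap (prm n g '' M) (act n g h))⁻¹ :=
    fun f => by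
      rw [act_mul, act_mul, ← kap_act, hh, map_mul, map_mul, map_mul, map_mul, kap_act, act_act_inv,
        map_inv, map_inv]
  refine ⟨by simp [hp], _, act n (g * p * g⁻¹) k⁻¹ * act n g u * k, hh', ?_, ?_⟩
  · have e1 : FreeGroup.of (prm n g r) = k⁻¹ * act n g (FreeGroup.of r) * k := by rw [hk]; group
    have e2 : act n (g * p * g⁻¹) (act n g (FreeGroup.of r)) =
        act n g u * (k * FreeGroup.of (prm n g r) * k⁻¹) * (act n g u)⁻¹ := by
      rw [← MulAut.mul_apply, ← map_mul, inv_mul_cancel_right, map_mul, MulAut.mul_apply, hu, map_mul,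
        map_mul, map_inv, hk]
    conv_lhs => rw [e1]
    rw [map_mul, map_mul, e2, map_inv]; group
  · have e : kap (prm n g '' M) (act n g u) = kap (prm n g '' M) (act n g h) := by
      have : kap M u = kap M h := by
        have e2 : kap M (h⁻¹ * kap M u) = 1 := by rw [← h1, map_one]
        rw [map_mul, map_inv, FreeGroup.kap_kap_self, inv_mul_eq_one] at e2
        exact e2.symm
      rw [← kap_act, this, kap_act]
    rw [map_mul, map_mul, hh', e, map_inv]; group

/-! ### Pure braids pushing one strand -/

open FreeGroup (kap)

theorem conj_ascProd {H : Type*} [Group H] {t : ℕ → H} {ρ : H} {a k : ℕ}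
    (h : ∀ i, a ≤ i → i < a + k → ρ * t i = t (i + 1) * ρ) :
    ρ * ascProd t a k = ascProd t (a + 1) k * ρ := by
  induction k with
  | zero => simp [ascProd]
  | succ k ih =>
    rw [ascProd_succ, ← mul_assoc, ih fun i h1 h2 => h i h1 (by omega), mul_assoc,
      h _ (by omega) (by omega), ascProd_succ, mul_assoc, add_right_comm]

theorem FreeGroup.map_mem {α H : Type*} [Group H] (f : FreeGroup α →* H) {S : Subgroup H}
    (h : ∀ i, f (FreeGroup.of i) ∈ S) (w : FreeGroup α) : f w ∈ S := by
  induction w using FreeGroup.induction_on with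
  | C1 => rw [_root_.map_one]; exact one_mem _
  | of i => exact h i
  | inv_of i hi => rw [_root_.map_inv]; exact inv_mem hi
  | mul x y hx hy => rw [_root_.map_mul]; exact mul_mem hx hy

theorem exists_psi {m n : ℕ} (h : m + 1 ≤ n) : ∃ f : ArtinB m →* ArtinB n,
    ∀ i < m, f (sg m i) = if i + 1 < m then sg n i else sg n (m - 1) ^ 2 := by
  refine ArtinB.exists_hom _ (fun i hi => ?_) (fun i hi => ?_) (fun i j hij hj => ?_)
  · rw [if_pos (by omega), if_pos (by omega)]; exact sg_braid (by omega)
  · subst hi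
    rw [if_pos (by omega), if_neg (by omega), show i + 2 - 1 = i + 1 by omega]
    have e := sg_braid (n := n) (i := i) (by omega)
    set a := sg n i
    set b := sg n (i + 1)
    have e1 : a * b ^ 2 * a * b ^ 2 = (a * b * a) * (a * b * a) :=
      calc a * b ^ 2 * a * b ^ 2 = (a * b) * (b * a * b) * b := by rw [pow_two]; group
        _ = (a * b) * (a * b * a) * b := by rw [e]
        _ = (a * b * a) * (b * a * b) := by group
        _ = _ := by rw [e]
    have e2 : b ^ 2 * a * b ^ 2 * a = (a * b * a) * (a * b * a) :=
      calc b ^ 2 * a * b ^ 2 * a = b * (b * a * b) * (b * a) := by rw [pow_two]; group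
        _ = b * (a * b * a) * (b * a) := by rw [e]
        _ = (b * a * b) * (a * b * a) := by group
        _ = _ := by rw [e]
    rw [e1, ← e2]
  · rw [if_pos (by omega)]
    split_ifs with h1
    · exact sg_comm hij
    · exact (sg_comm (by omega)).pow_right 2

/-- The homomorphism sending `r_m` to the square of the last braid generator. -/
noncomputable def psi {m n : ℕ} (h : m + 1 ≤ n) : ArtinB m →* ArtinB n := (exists_psi h).choose

theorem psi_sg {m n i : ℕ} (h : m + 1 ≤ n) (hi : i + 1 < m) : psi h (sg m i) = sg n i := by
  rw [psi, (exists_psi h).choose_spec i (by omega), if_pos hi]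

theorem psi_last {m n : ℕ} (h : m + 1 ≤ n) (hm : 1 ≤ m) :
    psi h (sg m (m - 1)) = sg n (m - 1) ^ 2 := by
  rw [psi, (exists_psi h).choose_spec _ (by omega), if_neg (by omega)]

theorem psi_ascProd {m n a k : ℕ} (h : m + 1 ≤ n) (hk : a + k < m) :
    psi h (ascProd (sg m) a k) = ascProd (sg n) a k := by
  induction k with
  | zero => exact map_one _
  | succ k ih => rw [ascProd_succ, map_mul, ih (by omega), psi_sg h (by omega), ascProd_succ]

theorem psi_mem_BS {m n : ℕ} (h : m + 1 ≤ n) {b : ArtinB m} (hb : b ∈ BS m m) : psi h b ∈ BS n m := by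
  have : BS m m ≤ (BS n m).comap (psi h) :=
    BS_le fun i hi => by rw [Subgroup.mem_comap, psi_sg h hi]; exact sg_mem_BS hi
  exact this hb

/-- Pushing the strand `m` around the first `m` strands. -/
noncomputable def Dpush {m n : ℕ} (h : m + 1 ≤ n) : FreeGroup ℕ →* ArtinB n := (psi h).comp (X m)

theorem Dpush_of {m n j : ℕ} (h : m + 1 ≤ n) (hj : j < m) : Dpush h (FreeGroup.of j) =
    ascProd (sg n) j (m - 1 - j) * sg n (m - 1) ^ 2 * (ascProd (sg n) j (m - 1 - j))⁻¹ := by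
  rw [Dpush, MonoidHom.comp_apply, X_of, xs, if_pos hj, map_mul, map_mul, map_inv,
    psi_ascProd h (by omega), psi_last h (by omega)]

theorem Dpush_of_ge {m n j : ℕ} (h : m + 1 ≤ n) (hj : m ≤ j) : Dpush h (FreeGroup.of j) = 1 := by
  rw [Dpush, MonoidHom.comp_apply, X_of, xs_of_ge hj, map_one]

theorem prm_ascProd {n a k : ℕ} (h : a + k < n) : prm n (ascProd (sg n) a k) (a + k) = a := by
  induction k with
  | zero => simp [ascProd]
  | succ k ih =>
    rw [ascProd_succ, map_mul, Equiv.Perm.mul_apply, prm_sg (by omega), ← add_assoc,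
      Equiv.swap_apply_right, ih (by omega)]

theorem act_ascProd_last {n a k : ℕ} (h : a + k < n) :
    act n (ascProd (sg n) a k) (FreeGroup.of (a + k)) = FreeGroup.of a := by
  induction k with
  | zero => simp [ascProd]
  | succ k ih =>
    rw [ascProd_succ, act_mul, act_sg (by omega), ← add_assoc, sig_succ, ih (by omega)]

theorem eq_of_act_of {n : ℕ} {g : ArtinB n} {i j : ℕ} {c : FreeGroup ℕ}
    (h : act n g (FreeGroup.of i) = c * FreeGroup.of j * c⁻¹) : prm n g i = j := by
  by_contra hne
  obtain ⟨d, hd⟩ := act_of g i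
  have h2 := congrArg (FreeGroup.expSum j) (hd.symm.trans h)
  simp only [map_mul, map_inv, FreeGroup.expSum_of_self] at h2
  rw [FreeGroup.expSum_of_ne hne, mul_one, mul_inv_cancel, mul_right_comm, mul_inv_cancel,
    one_mul] at h2
  exact absurd h2 (by decide)

theorem prm_BS_of_ge {n m j : ℕ} (hm : m ≤ n) (hj : m ≤ j) {b : ArtinB n} (hb : b ∈ BS n m) :
    prm n b j = j :=
  eq_of_act_of (c := 1) (by rw [act_BS_of hm hj hb]; simp)

/-- The pure elements acting trivially modulo the letter `r`. -/
def Tr (n r : ℕ) : Subgroup (ArtinB n) where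
  carrier := {p | prm n p = 1 ∧ ∀ f, kap {r}ᶜ (act n p f) = kap {r}ᶜ f}
  one_mem' := ⟨map_one _, fun f => by simp⟩
  mul_mem' := by
    rintro p q ⟨hp, h⟩ ⟨hq, k⟩
    exact ⟨by rw [map_mul, hp, hq, mul_one], fun f => by rw [act_mul, h, k]⟩
  inv_mem' := by
    rintro p ⟨hp, h⟩
    refine ⟨by rw [map_inv, hp, inv_one], fun f => ?_⟩
    have := h (act n p⁻¹ f)
    rw [act_act_inv] at this
    exact this.symm

theorem conj_mem_Tr {n r s : ℕ} {p : ArtinB n} {g : ArtinB n} (hs : prm n g r = s) (h : p ∈ Tr n r) :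
    g * p * g⁻¹ ∈ Tr n s := by
  obtain ⟨hp, h⟩ := h
  have hc : prm n g '' {r}ᶜ = {s}ᶜ := by
    rw [Set.image_compl_eq (prm n g).bijective, Set.image_singleton, hs]
  refine ⟨by simp [hp], fun f => ?_⟩
  rw [act_mul, act_mul, ← kap_act_eq hc, h, kap_act_eq hc, act_act_inv]

theorem prm_sg_sq {n i : ℕ} (h : i + 1 < n) : prm n (sg n i ^ 2) = 1 := by
  rw [map_pow, prm_sg h, pow_two, Equiv.swap_mul_self]

theorem act_sg_sq {n i : ℕ} (h : i + 1 < n) (f : FreeGroup ℕ) :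
    act n (sg n i ^ 2) f = sig i (sig i f) := by
  rw [pow_two, act_mul, act_sg h]

theorem kap_sig_sig_succ (i : ℕ) (f : FreeGroup ℕ) :
    kap {i + 1}ᶜ (sig i (sig i f)) = kap {i + 1}ᶜ f := by
  suffices h : (kap {i + 1}ᶜ).comp ((sig i).toMonoidHom.comp (sig i).toMonoidHom) = kap {i + 1}ᶜ from
    DFunLike.congr_fun h f
  have h1 : kap {i + 1}ᶜ (FreeGroup.of (i + 1)) = 1 := FreeGroup.kap_of_notMem (by simp)
  ext j : 1
  by_cases hj : j = i
  · subst hj; simp [sig_self, sig_succ, h1]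
  by_cases hj2 : j = i + 1
  · subst hj2; simp [sig_self, sig_succ, h1]
  simp [sig_of_ne hj hj2]

theorem kap_sig_sig_self (i : ℕ) (f : FreeGroup ℕ) :
    kap {i}ᶜ (sig i (sig i f)) = kap {i}ᶜ f := by
  suffices h : (kap {i}ᶜ).comp ((sig i).toMonoidHom.comp (sig i).toMonoidHom) = kap {i}ᶜ from
    DFunLike.congr_fun h f
  have h1 : kap {i}ᶜ (FreeGroup.of i) = 1 := FreeGroup.kap_of_notMem (by simp)
  ext j : 1
  by_cases hj : j = i
  · subst hj; simp [sig_self, sig_succ, h1]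
  by_cases hj2 : j = i + 1
  · subst hj2; simp [sig_self, sig_succ, h1]
  simp [sig_of_ne hj hj2]

theorem sg_sq_mem_Tr_succ {n i : ℕ} (h : i + 1 < n) : sg n i ^ 2 ∈ Tr n (i + 1) :=
  ⟨prm_sg_sq h, fun f => by rw [act_sg_sq h, kap_sig_sig_succ]⟩

theorem sg_sq_mem_Tr_self {n i : ℕ} (h : i + 1 < n) : sg n i ^ 2 ∈ Tr n i :=
  ⟨prm_sg_sq h, fun f => by rw [act_sg_sq h, kap_sig_sig_self]⟩

theorem Dpush_of_mem_Tr {m n j : ℕ} (h : m + 1 ≤ n) (hj : j < m) : Dpush h (FreeGroup.of j) ∈ Tr n j := by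
  rw [Dpush_of h hj]
  refine conj_mem_Tr ?_ (sg_sq_mem_Tr_self (i := m - 1) (by omega))
  have := prm_ascProd (n := n) (a := j) (k := m - 1 - j) (by omega)
  rwa [show j + (m - 1 - j) = m - 1 by omega] at this

theorem Dpush_mem_Tr {m n : ℕ} (h : m + 1 ≤ n) (w : FreeGroup ℕ) : Dpush h w ∈ Tr n m := by
  refine FreeGroup.map_mem _ (fun j => ?_) w
  rcases Nat.lt_or_ge j m with hj | hj
  · rw [Dpush_of h hj]
    refine conj_mem_Tr (r := m) ?_ ?_
    · exact prm_BS_of_ge (by omega) le_rfl (ascProd_mem_BS (m := m) (by omega))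
    · have := sg_sq_mem_Tr_succ (n := n) (i := m - 1) (by omega)
      rwa [show m - 1 + 1 = m by omega] at this
  · rw [Dpush_of_ge h hj]; exact one_mem _

theorem act_Dpush {m n : ℕ} (h : m + 1 ≤ n) (w : FreeGroup ℕ) :
    ∃ g, act n (Dpush h w) (FreeGroup.of m) = g * FreeGroup.of m * g⁻¹ ∧
      kap {m}ᶜ g = (kap (Set.Iio m) w)⁻¹ := by
  let S : Subgroup (FreeGroup ℕ) :=
    { carrier := {w | ∃ g, act n (Dpush h w) (FreeGroup.of m) = g * FreeGroup.of m * g⁻¹ ∧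
        kap {m}ᶜ g = (kap (Set.Iio m) w)⁻¹}
      one_mem' := ⟨1, by simp, by simp⟩
      mul_mem' := by
        rintro v w ⟨g, hg, hg'⟩ ⟨k, hk, hk'⟩
        refine ⟨act n (Dpush h v) k * g, ?_, ?_⟩
        · rw [map_mul, act_mul, hk, map_mul, map_mul, hg, map_inv]; group
        · rw [map_mul, (Dpush_mem_Tr h v).2, hg', hk', map_mul]; group
      inv_mem' := by
        rintro v ⟨g, hg, hg'⟩
        refine ⟨(act n (Dpush h v)⁻¹ g)⁻¹, ?_, ?_⟩
        · have := congrArg (act n (Dpush h v)⁻¹) hg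
          rw [act_inv_act, map_mul, map_mul, map_inv (act n (Dpush h v)⁻¹)] at this
          conv_rhs => rw [this]
          rw [map_inv (Dpush h)]; group
        · rw [map_inv, (inv_mem (Dpush_mem_Tr h v)).2, hg', map_inv] }
  have hS : ∀ w, MonoidHom.id _ w ∈ S := by
    refine FreeGroup.map_mem _ fun j => ?_
    change ∃ g, act n (Dpush h (FreeGroup.of j)) (FreeGroup.of m) = g * FreeGroup.of m * g⁻¹ ∧
        kap {m}ᶜ g = (kap (Set.Iio m) (FreeGroup.of j))⁻¹
    rcases Nat.lt_or_ge j m with hj | hj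
    · refine ⟨(FreeGroup.of j)⁻¹, ?_, ?_⟩
      · have e1 := act_ascProd_last (n := n) (a := j) (k := m - 1 - j) (by omega)
        rw [show j + (m - 1 - j) = m - 1 by omega] at e1
        have hm : ascProd (sg n) j (m - 1 - j) ∈ BS n m := ascProd_mem_BS (by omega)
        have e2 : sig (m - 1) (FreeGroup.of m) = FreeGroup.of (m - 1) := by
          have := sig_succ (m - 1)
          rwa [show m - 1 + 1 = m by omega] at this
        rw [Dpush_of h hj, act_mul, act_mul, act_BS_of (by omega) le_rfl (inv_mem hm),
          act_sg_sq (by omega), e2, sig_self, show m - 1 + 1 = m by omega, map_mul, map_mul, map_inv, e1,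
          act_BS_of (by omega) le_rfl hm, inv_inv]
      · rw [map_inv, FreeGroup.kap_of_mem (show j ∈ Set.Iio m from hj), FreeGroup.kap_of_mem]
        simp; omega
    · exact ⟨1, by rw [Dpush_of_ge h hj]; simp, by
        rw [FreeGroup.kap_of_notMem (show j ∉ Set.Iio m from not_lt.2 hj)]; simp⟩
  exact hS w

theorem sg_mul_ascProd {m n i j : ℕ} (h : m + 1 ≤ n) (hj : j ≤ m) (hi : i < m) :
    ∃ u ∈ (psi h).range, sg n i * ascProd (sg n) j (m - j) =
      ascProd (sg n) (Equiv.swap i (i + 1) j) (m - Equiv.swap i (i + 1) j) * u := by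
  have hbr := sg_braidSeq n
  by_cases h1 : j = i
  · subst h1
    rw [Equiv.swap_apply_left]
    refine ⟨Dpush h (FreeGroup.of j), ⟨_, rfl⟩, ?_⟩
    rw [Dpush_of h hi]
    have e1 : ascProd (sg n) j (m - j) = ascProd (sg n) j (m - 1 - j) * sg n (m - 1) := by
      rw [show m - j = m - 1 - j + 1 by omega, ascProd_succ]; congr 2; omega
    have e2 : ascProd (sg n) j (m - j) = sg n j * ascProd (sg n) (j + 1) (m - 1 - j) := by
      rw [show m - j = m - 1 - j + 1 by omega, ascProd_succ']
    have e3 : ascProd (sg n) j (m - j) * ascProd (sg n) j (m - 1 - j) =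
        ascProd (sg n) (j + 1) (m - 1 - j) * ascProd (sg n) j (m - j) :=
      conj_ascProd fun i h1 h2 => hbr.ascProd_mul (by omega) h1 (by omega)
    rw [show m - (j + 1) = m - 1 - j by omega]
    set c := ascProd (sg n) j (m - j)
    set d := ascProd (sg n) j (m - 1 - j)
    set c' := ascProd (sg n) (j + 1) (m - 1 - j)
    have e4 : c * d⁻¹ = c'⁻¹ * c := by
      rw [eq_inv_mul_iff_mul_eq, ← mul_assoc, ← e3]; group
    symm
    calc c' * (d * sg n (m - 1) ^ 2 * d⁻¹) = c' * (d * sg n (m - 1)) * sg n (m - 1) * d⁻¹ := by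
          rw [pow_two]; group
      _ = c' * c * sg n (m - 1) * d⁻¹ := by rw [← e1]
      _ = c * (d * sg n (m - 1)) * d⁻¹ := by rw [← e3]; group
      _ = c * (c * d⁻¹) := by rw [← e1]; group
      _ = sg n j * c := by rw [e4]; nth_rewrite 1 [e2]; group
  by_cases h2 : j = i + 1
  · subst h2
    rw [Equiv.swap_apply_right]
    exact ⟨1, one_mem _, by rw [mul_one, show m - i = m - (i + 1) + 1 by omega, ascProd_succ']⟩
  rw [Equiv.swap_apply_of_ne_of_ne h1 h2]
  rcases Nat.lt_or_ge j i with h3 | h3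
  · refine ⟨sg n (i - 1), ⟨sg m (i - 1), psi_sg h (by omega)⟩, ?_⟩
    rw [hbr.ascProd_mul (by omega) (by omega) (by omega), show i - 1 + 1 = i by omega]
  · exact ⟨sg n i, ⟨sg m i, psi_sg h (by omega)⟩,
      commute_ascProd fun k h4 _ => sg_comm (by omega)⟩

theorem exists_push {m n : ℕ} (h : m + 1 ≤ n) {b : ArtinB n} (hb : b ∈ BS n (m + 1))
    (hbm : prm n b m = m) : ∃ w, ∃ b' ∈ BS n m, b = Dpush h w * b' := by
  have h1 : ∃ j ≤ m, ∃ u ∈ (psi h).range, b = ascProd (sg n) j (m - j) * u := by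
    clear hbm
    induction hb using Subgroup.closure_induction_left with
    | one => exact ⟨m, le_rfl, 1, one_mem _, by simp [ascProd]⟩
    | mul_left x hx y _ ih =>
      obtain ⟨i, hi, rfl⟩ := hx
      obtain ⟨j, hj, u, hu, rfl⟩ := ih
      obtain ⟨v, hv, hv'⟩ := sg_mul_ascProd h hj (i := i) (by omega)
      refine ⟨Equiv.swap i (i + 1) j, ?_, v * u, mul_mem hv hu, by rw [← mul_assoc, hv', mul_assoc]⟩
      rw [Equiv.swap_apply_def]; split_ifs <;> omega
    | inv_mul_cancel x hx y _ ih =>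
      obtain ⟨i, hi, rfl⟩ := hx
      obtain ⟨j, hj, u, hu, rfl⟩ := ih
      have hj' : Equiv.swap i (i + 1) j ≤ m := by
        rw [Equiv.swap_apply_def]; split_ifs <;> omega
      obtain ⟨v, hv, hv'⟩ := sg_mul_ascProd h hj' (i := i) (by omega)
      rw [Equiv.swap_apply_self] at hv'
      refine ⟨Equiv.swap i (i + 1) j, hj', v⁻¹ * u, mul_mem (inv_mem hv) hu, ?_⟩
      rw [inv_mul_eq_iff_eq_mul, ← mul_assoc, hv']; group
  obtain ⟨j, hj, u, ⟨g, rfl⟩, rfl⟩ := h1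
  obtain ⟨f, b', hb', rfl⟩ := exists_X_mul g
  rw [map_mul (psi h)] at hbm ⊢
  have e : psi h (X m f) = Dpush h f := rfl
  rw [e] at hbm ⊢
  have hb'' := psi_mem_BS h hb'
  rw [map_mul, map_mul, (Dpush_mem_Tr h f).1, one_mul, Equiv.Perm.mul_apply,
    prm_BS_of_ge (by omega) le_rfl hb''] at hbm
  have := prm_ascProd (n := n) (a := j) (k := m - j) (by omega)
  rw [show j + (m - j) = m by omega, hbm] at this
  subst this
  exact ⟨f, _, hb'', by simp [ascProd]⟩

theorem Dpush_eq_one {m n : ℕ} (h : m + 1 ≤ n) {w : FreeGroup ℕ} (hw : kap (Set.Iio m) w = 1) :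
    Dpush h w = 1 := by
  rw [Dpush, MonoidHom.comp_apply, ← X_kap, hw, map_one, map_one]

/-- The braid group acts faithfully on the free group. -/
theorem BS_eq_one {m n : ℕ} (hm : m ≤ n) {b : ArtinB n} (hb : b ∈ BS n m)
    (h : ∀ i < m, act n b (FreeGroup.of i) = FreeGroup.of i) : b = 1 := by
  induction m generalizing b with
  | zero =>
    have : BS n 0 ≤ ⊥ := BS_le fun i hi => by omega
    exact this hb
  | succ m ih =>
    have h1 : prm n b m = m := eq_of_act_of (c := 1) (by rw [h m (by omega)]; simp)
    obtain ⟨w, b', hb', rfl⟩ := exists_push hm hb h1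
    have h2 := h m (by omega)
    rw [act_mul, act_BS_of (by omega) le_rfl hb'] at h2
    obtain ⟨g, hg, hg'⟩ := act_Dpush hm w
    rw [hg] at h2
    obtain ⟨k, hk⟩ := FreeGroup.mem_zpowers_of_commute_of m g (mul_inv_eq_iff_eq_mul.1 h2).symm
    rw [hk, map_zpow, FreeGroup.kap_of_notMem (by simp), one_zpow, eq_comm, inv_eq_one] at hg'
    rw [Dpush_eq_one hm hg', one_mul] at h ⊢
    exact ih (by omega) hb' fun i hi => h i (by omega)

/-! ### Elements acting by inner automorphisms -/

open FreeGroup (kap)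

theorem kap_Iio_act {n : ℕ} (g : ArtinB n) (f : FreeGroup ℕ) :
    kap (Set.Iio n) (act n g f) = act n g (kap (Set.Iio n) f) := by
  apply FreeGroup.conj_injective
  rw [← act_X, ← conj_X, map_mul, map_mul, map_inv, act_X, MulAut.mul_conj, mul_inv_cancel_right]

theorem FreeGroup.eq_zpow_of_commute_Pf {M : Set ℕ} {a m : ℕ} (ha : a ∈ M) (ham : a < m) {h : FreeGroup ℕ}
    (hc : Commute h (kap M (Pf m))) : ∃ k : ℤ, h = kap M (Pf m) ^ k := by
  have key : ∀ j, expSum a (kap M (Pf j)) = if a < j then Multiplicative.ofAdd 1 else 1 := by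
    intro j
    induction j with
    | zero => simp [Pf]
    | succ j ih =>
      rw [Pf, _root_.map_mul, _root_.map_mul, ih]
      by_cases h1 : j = a
      · subst h1
        rw [kap_of_mem ha, expSum_of_self]; simp
      · have : expSum a (kap M (of j)) = 1 := by
          by_cases h2 : j ∈ M
          · rw [kap_of_mem h2, expSum_of_ne h1]
          · rw [kap_of_notMem h2, _root_.map_one]
        rw [this, one_mul]
        congr 1
        simp; omega
  have h1 := key m
  rw [if_pos ham] at h1
  obtain ⟨c, k, l, rfl, hl⟩ := exists_common_root hc
  rw [hl] at h1 ⊢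
  rw [map_zpow] at h1
  have h2 : l * (expSum a c).toAdd = 1 := by
    have := congrArg Multiplicative.toAdd h1
    simpa using this
  rcases Int.isUnit_iff.1 (IsUnit.of_mul_eq_one _ h2) with rfl | rfl
  · exact ⟨k, by simp⟩
  · exact ⟨-k, by simp⟩

theorem MulAut.zpow_apply_fixed {G : Type*} [Group G] {φ : MulAut G} {c : G} (h : φ c = c) (k : ℤ) :
    (φ ^ k) c = c :=
  MulAction.mem_stabilizer_iff.1
    (zpow_mem (show φ ∈ MulAction.stabilizer (MulAut G) c from MulAction.mem_stabilizer_iff.2 h) k)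

theorem MulAut.zpow_apply_conj {G : Type*} [Group G] {φ : MulAut G} {c x : G} (h : φ c = c)
    (hx : φ x = c * x * c⁻¹) (k : ℤ) : (φ ^ k) x = c ^ k * x * (c ^ k)⁻¹ := by
  have h1 : (MulAut.conj c⁻¹ * φ) x = x := by
    rw [MulAut.mul_apply, hx, MulAut.conj_apply]; group
  have h2 : Commute (MulAut.conj c) (MulAut.conj c⁻¹ * φ) := by
    have : Commute φ (MulAut.conj c) := by
      rw [Commute, SemiconjBy, MulAut.mul_conj, h]
    rw [map_inv]
    exact (Commute.refl _).inv_right.mul_right this.symm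
  have h3 : φ = MulAut.conj c * (MulAut.conj c⁻¹ * φ) := by
    rw [← mul_assoc, ← map_mul, mul_inv_cancel, map_one, one_mul]
  rw [h3, h2.mul_zpow, MulAut.mul_apply, MulAut.zpow_apply_fixed h1, ← map_zpow, MulAut.conj_apply]

/-- Elements acting by inner automorphisms on all letters. -/
theorem exists_X_mul_ΔB {n : ℕ} (hn : 2 ≤ n) {p : ArtinB n} (h : p ∈ NM n (Set.Iio n)) :
    ∃ f, ∃ k : ℤ, p = X n f * ΔB n ^ k := by
  obtain ⟨f, b, hb, rfl⟩ := exists_X_mul p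
  have hb' : b ∈ NM n (Set.Iio n) := by
    have := mul_mem (inv_mem (X_mem_NM le_rfl f)) h
    rwa [inv_mul_cancel_left] at this
  obtain ⟨-, h, hh⟩ := hb'
  have h1 := hh (Pf n)
  rw [act_BS_Pf le_rfl le_rfl hb, kap_Pf] at h1
  have h2 : Commute h (kap (Set.Iio n) (Pf n)) := by
    rw [kap_Pf]; exact (eq_mul_inv_iff_mul_eq.1 h1).symm
  obtain ⟨k, rfl⟩ := FreeGroup.eq_zpow_of_commute_Pf (a := 0) (by simp; omega) (by omega) h2
  rw [kap_Pf] at hh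
  have hz : act n (zB n n) (Pf n) = Pf n := act_BS_Pf le_rfl le_rfl zB_mem
  have h3 : b * zB n n ^ k = 1 := by
    refine BS_eq_one le_rfl (mul_mem hb (zpow_mem zB_mem k)) fun i hi => ?_
    have h4 : act n (zB n n ^ k) (FreeGroup.of i) = Pf n ^ (-k) * FreeGroup.of i * Pf n ^ k := by
      rw [map_zpow, MulAut.zpow_apply_conj (c := (Pf n)⁻¹) (by rw [map_inv, hz])
        (by rw [act_zB_of le_rfl hi, inv_inv])]
      simp
    have h5 := hh (FreeGroup.of i)
    rw [kap_Iio_act, FreeGroup.kap_of_mem (show i ∈ Set.Iio n from hi)] at h5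
    have h6 : act n b (Pf n) = Pf n := act_BS_Pf le_rfl le_rfl hb
    rw [act_mul, h4, map_mul, map_mul, map_zpow, map_zpow, h6, h5]
    group
  have h4 : zB n n = (X n (Pf n))⁻¹ * ΔB n := by rw [ΔB_eq (by omega)]; group
  have hc : Commute ((X n (Pf n))⁻¹) (ΔB n) := (ΔB_comm hn _).symm
  refine ⟨f * Pf n ^ k, -k, ?_⟩
  rw [mul_eq_one_iff_eq_inv] at h3
  rw [h3, h4, hc.mul_zpow, map_mul, map_zpow, mul_inv_rev, zpow_neg, inv_zpow, inv_inv, mul_assoc,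
    ((ΔB_comm hn (X n (Pf n) ^ k)).zpow_left k).inv_left.eq]

/-! ### The transfer cocycle is faithful -/

theorem Dpush_Pf {m n : ℕ} (h : m + 1 ≤ n) (hm : 1 ≤ m) : Dpush h (Pf m) * zB n m = zB n (m + 1) := by
  have hbr := sg_braidSeq n
  have e1 : psi h (zB m m) = zB n m := by
    rw [zB, map_pow, psi_ascProd h (by omega), zB]
  have e2 : psi h (ρB m) = ascProd (sg n) 0 m * sg n (m - 1) := by
    rw [ρB_eq_αB_mul hm, map_mul, psi_last h hm, αB, psi_ascProd h (by omega), pow_two, ← mul_assoc]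
    congr 1
    conv_rhs => rw [show m = m - 1 + 1 by omega, ascProd_succ]
    simp
  have e3 : ∀ k ≤ m, (ascProd (sg n) 0 m * sg n (m - 1)) ^ k =
      ascProd (sg n) 0 m ^ k * ascProd (sg n) (m - k) k := by
    intro k hk
    induction k with
    | zero => simp [ascProd]
    | succ k ih =>
      have e4 : ascProd (sg n) 0 m * ascProd (sg n) (m - (k + 1)) k =
          ascProd (sg n) (m - (k + 1) + 1) k * ascProd (sg n) 0 m :=
        conj_ascProd fun i h1 h2 => hbr.ascProd_mul (by omega) (by omega) (by omega)
      rw [show m - (k + 1) + 1 = m - k by omega] at e4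
      rw [pow_succ, ih (by omega), pow_succ, ascProd_succ, show m - (k + 1) + k = m - 1 by omega]
      simp only [mul_assoc]
      rw [← mul_assoc (ascProd (sg n) (m - k) k), ← e4]
      simp only [mul_assoc]
  have e5 := congrArg (psi h) (ΔB_eq hm)
  rw [map_mul, e1, ΔB, map_pow, e2, e3 m le_rfl, Nat.sub_self, ← pow_succ] at e5
  exact e5.symm

theorem FreeGroup.kap_Iio_sig {i m : ℕ} (h : i + 1 < m) (f : FreeGroup ℕ) :
    kap (Set.Iio m) (sig i f) = sig i (kap (Set.Iio m) f) := by
  suffices h : (kap (Set.Iio m)).comp (sig i).toMonoidHom = (sig i).toMonoidHom.comp (kap (Set.Iio m)) from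
    DFunLike.congr_fun h f
  have h1 : kap (Set.Iio m) (FreeGroup.of i) = FreeGroup.of i := kap_of_mem (by simp; omega)
  have h2 : kap (Set.Iio m) (FreeGroup.of (i + 1)) = FreeGroup.of (i + 1) := kap_of_mem (by simpa using h)
  ext j : 1
  by_cases hj : j = i
  · subst hj; simp [sig_self, h1, h2]
  by_cases hj2 : j = i + 1
  · subst hj2; simp [sig_succ, h1, h2]
  by_cases hj3 : j < m
  · simp [sig_of_ne hj hj2, kap_of_mem (show j ∈ Set.Iio m from hj3)]
  · simp [sig_of_ne hj hj2, kap_of_notMem (show j ∉ Set.Iio m from hj3)]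

theorem kap_Iio_act_BS {n m : ℕ} (hm : m ≤ n) {b : ArtinB n} (hb : b ∈ BS n m) (f : FreeGroup ℕ) :
    kap (Set.Iio m) (act n b f) = act n b (kap (Set.Iio m) f) := by
  let S : Subgroup (ArtinB n) :=
    { carrier := {b | ∀ f, kap (Set.Iio m) (act n b f) = act n b (kap (Set.Iio m) f)}
      one_mem' := fun f => by simp
      mul_mem' := fun {a b} ha hb f => by rw [act_mul, ha, hb, act_mul]
      inv_mem' := fun {a} ha f => by
        have := ha (act n a⁻¹ f)
        rw [act_act_inv] at this
        rw [this, act_inv_act] }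
  have : BS n m ≤ S := BS_le fun i hi f => by
    rw [act_sg (by omega), FreeGroup.kap_Iio_sig hi]
  exact this hb f

theorem kap_act_pure {n : ℕ} {p : ArtinB n} (hp : prm n p = 1) (M : Set ℕ) (f : FreeGroup ℕ) :
    kap M (act n p (kap M f)) = kap M (act n p f) := kap_act_eq (by simp [hp]) f

theorem kap_act_Dpush {m n : ℕ} (h : m + 1 ≤ n) {M : Set ℕ} (w f : FreeGroup ℕ) :
    kap (insert m M) (act n (Dpush h w) f) = kap (insert m M) (act n (Dpush h (kap M w)) f) := by
  have hD := fun w => (Dpush_mem_Tr h w).1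
  induction w using FreeGroup.induction_on generalizing f with
  | C1 => simp
  | of j =>
    by_cases hj : j ∈ M
    · rw [FreeGroup.kap_of_mem hj]
    · rw [FreeGroup.kap_of_notMem hj, map_one, map_one, MulAut.one_apply]
      rcases Nat.lt_or_ge j m with hjm | hjm
      · have hs : insert m M ⊆ {j}ᶜ := by
          rintro x (rfl | hx) rfl
          · omega
          · exact hj hx
        rw [← FreeGroup.kap_of_subset hs, (Dpush_of_mem_Tr h hjm).2, FreeGroup.kap_of_subset hs]
      · rw [Dpush_of_ge h hjm, map_one, MulAut.one_apply]
  | inv_of j ih =>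
    rw [map_inv (kap M), map_inv (Dpush h), map_inv (Dpush h)]
    have h1 := ih (act n (Dpush h (FreeGroup.of j))⁻¹ f)
    rw [act_act_inv] at h1
    have hp : prm n (Dpush h (kap M (FreeGroup.of j)))⁻¹ = 1 := by rw [map_inv, hD, inv_one]
    rw [← kap_act_pure hp, h1, kap_act_pure hp, act_inv_act]
  | mul x y hx hy =>
    rw [map_mul (kap M), map_mul (Dpush h), map_mul (Dpush h), act_mul, act_mul, hx, ← kap_act_pure (hD _), hy, kap_act_pure (hD _)]

theorem mem_NM_of_Chi_last {m n : ℕ} (h : m + 1 = n) {M : Set ℕ} (hM : M ⊆ Set.Iio m) {a : ℕ} (ha : a ∈ M)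
    {y : ArtinB n} (hy : Chi n M m y 1) : y ∈ NM n (insert m M) := by
  have ham : a < m := hM ha
  have hM' : insert m M ⊆ Set.Iio n := by
    rintro x (rfl | hx)
    · simp; omega
    · have := hM hx; simp at this ⊢; omega
  have hMn : M ⊆ Set.Iio n := (Set.subset_insert _ _).trans hM'
  obtain ⟨f, b, hb, rfl⟩ := exists_X_mul y
  have hX : Chi n M m (X n f) 1 := by
    refine ⟨prm_X n f, kap M f, kap (Set.Iio n) f, fun u => ?_, ?_, ?_⟩
    · rw [act_X]; simp [FreeGroup.kap_of_subset hMn]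
    · rw [act_X]; simp
    · rw [FreeGroup.kap_of_subset hMn]; group
  refine mul_mem (X_mem_NM hM' f) ?_
  have hb1 : Chi n M m b 1 := by
    have := hX.inv.mul hy
    rwa [inv_mul_cancel_left, inv_one, one_mul] at this
  clear hy hX
  have hbm : prm n b m = m := by rw [hb1.1, Equiv.Perm.one_apply]
  have hmn : m + 1 ≤ n := h.le
  obtain ⟨w, b', hb', rfl⟩ := exists_push hmn (h ▸ hb) hbm
  have hDT := Dpush_mem_Tr hmn
  have hMm : M ⊆ {m}ᶜ := fun x hx hxm => by have := hM hx; simp at this hxm; omega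
  have hD : Chi n M m (Dpush hmn w) (kap M w)⁻¹ := by
    obtain ⟨g, hg, hg'⟩ := act_Dpush hmn w
    refine ⟨(hDT w).1, 1, g, fun u => ?_, hg, ?_⟩
    · rw [← FreeGroup.kap_of_subset hMm, (hDT w).2, FreeGroup.kap_of_subset hMm]; simp
    · rw [← FreeGroup.kap_of_subset hMm g, hg', map_inv,
        FreeGroup.kap_of_subset hM]; simp
  have hb2 : Chi n M m b' (kap M w) := by
    have := hD.inv.mul hb1
    rwa [inv_mul_cancel_left, inv_inv, one_mul] at this
  obtain ⟨hpb, v, g, hv, hg, hw⟩ := hb2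
  rw [act_BS_of (by omega) le_rfl hb'] at hg
  obtain ⟨l, hl⟩ := FreeGroup.mem_zpowers_of_commute_of m g (eq_mul_inv_iff_mul_eq.1 hg)
  rw [hl, map_zpow, FreeGroup.kap_of_notMem (fun hm => hMm hm rfl), one_zpow, mul_one] at hw
  have hP : Commute v (kap M (Pf m)) := by
    have := hv (Pf m)
    rw [act_BS_Pf (by omega) le_rfl hb'] at this
    exact (eq_mul_inv_iff_mul_eq.1 this).symm
  obtain ⟨k, hk⟩ := FreeGroup.eq_zpow_of_commute_Pf ha ham hP
  -- the action of the full push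
  set A := act n (Dpush hmn (Pf m)) with hA
  set P := Pf m with hPdef
  set Q := Pf (m + 1) with hQdef
  have hAz : A = act n (zB n (m + 1)) * (act n (zB n m))⁻¹ := by
    rw [← Dpush_Pf hmn (by omega), map_mul, mul_inv_cancel_right]
  have hzP : act n (zB n m) P = P := act_BS_Pf (by omega) le_rfl zB_mem
  have hzj : ∀ j < m, (act n (zB n m))⁻¹ (FreeGroup.of j) = P * FreeGroup.of j * P⁻¹ := by
    intro j hj
    have := MulAut.zpow_apply_conj (c := P⁻¹) (by rw [map_inv, hzP])
      (by rw [act_zB_of (by omega) hj, inv_inv]) (-1)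
    rw [zpow_neg_one] at this
    rw [this]; group
  have hzm : (act n (zB n m))⁻¹ (FreeGroup.of m) = FreeGroup.of m := by
    rw [← map_inv, act_BS_of (by omega) le_rfl (inv_mem zB_mem)]
  have hzQ : ∀ u, kap (Set.Iio (m + 1)) u = u → act n (zB n (m + 1)) u = Q⁻¹ * u * Q := by
    intro u hu
    have : (act n (zB n (m + 1))).toMonoidHom.comp (kap (Set.Iio (m + 1))) =
        (MulAut.conj Q⁻¹).toMonoidHom.comp (kap (Set.Iio (m + 1))) := by
      ext j : 1
      by_cases hj : j < m + 1
      · simp [FreeGroup.kap_of_mem (show j ∈ Set.Iio (m + 1) from hj), act_zB_of hmn hj, hQdef]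
      · simp [FreeGroup.kap_of_notMem (show j ∉ Set.Iio (m + 1) from hj)]
    have := DFunLike.congr_fun this u
    simpa [hu] using this
  have hkP : kap (Set.Iio (m + 1)) P = P := by
    have e : kap (Set.Iio m) P = P := kap_Pf
    rw [← e, FreeGroup.kap_kap, Set.inter_eq_right.2 (Set.Iio_subset_Iio (by omega))]
  set τ := MulAut.conj Q * A with hτ
  have hAmem : Dpush hmn (Pf m) ∈ BS n (m + 1) := by
    rw [← mul_inv_eq_iff_eq_mul.2 (Dpush_Pf hmn (by omega)).symm]
    exact mul_mem zB_mem (inv_mem (BS_mono (by omega) zB_mem))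
  have hAQ : A Q = Q := act_BS_Pf hmn le_rfl hAmem
  have hτm : τ (FreeGroup.of m) = FreeGroup.of m := by
    rw [hτ, MulAut.mul_apply, hAz, MulAut.mul_apply, hzm,
      hzQ _ (FreeGroup.kap_of_mem (by simp)), MulAut.conj_apply]
    group
  have hτP : ∀ u, kap (Set.Iio (m + 1)) u = u → (act n (zB n m))⁻¹ u = P * u * P⁻¹ →
      τ u = P * u * P⁻¹ := by
    intro u hu hu'
    rw [hτ, MulAut.mul_apply, hAz, MulAut.mul_apply, hu', hzQ _ (by simp [hu, hkP]), MulAut.conj_apply]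
    group
  have hτPP : τ P = P := by
    rw [hτP P hkP]
    · group
    · rw [← map_inv, hPdef, act_BS_Pf (by omega) le_rfl (inv_mem zB_mem)]; group
  have hτk : ∀ u, (τ ^ (-k)) (kap (Set.Iio m) u) = (P ^ k)⁻¹ * kap (Set.Iio m) u * P ^ k := by
    intro u
    have : (τ ^ (-k)).toMonoidHom.comp (kap (Set.Iio m)) =
        (MulAut.conj (P ^ k))⁻¹.toMonoidHom.comp (kap (Set.Iio m)) := by
      ext j : 1
      by_cases hj : j < m
      · have e := MulAut.zpow_apply_conj hτPP (hτP (FreeGroup.of j)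
          (FreeGroup.kap_of_mem (by simp; omega)) (hzj j hj)) (-k)
        rw [MonoidHom.comp_apply, MonoidHom.comp_apply,
          FreeGroup.kap_of_mem (show j ∈ Set.Iio m from hj)]
        refine e.trans ?_
        rw [zpow_neg, inv_inv]
        exact (MulAut.conj_inv_apply (P ^ k) _).symm
      · simp [FreeGroup.kap_of_notMem (show j ∉ Set.Iio m from hj)]
    exact DFunLike.congr_fun this u
  have hcomm : Commute (MulAut.conj Q) A := by
    have : A * MulAut.conj Q = MulAut.conj Q * A := by rw [MulAut.mul_conj, hAQ]
    exact this.symm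
  have hAk : A ^ (-k) = MulAut.conj (Q ^ k) * τ ^ (-k) := by
    rw [hτ, hcomm.mul_zpow, ← mul_assoc, map_zpow, ← zpow_add]; simp
  have hkv : kap M w = kap M (P ^ (-k)) := by rw [hw, hk, map_zpow, zpow_neg]
  have hMi : insert m M ∩ Set.Iio m = M := by
    ext x
    simp only [Set.mem_inter_iff, Set.mem_insert_iff, Set.mem_Iio]
    exact ⟨fun hx => hx.1.resolve_left (by omega), fun hx => ⟨Or.inr hx, hM hx⟩⟩
  refine ⟨hb1.1, kap (insert m M) Q ^ k, fun f => ?_⟩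
  rw [act_mul, kap_act_Dpush, hkv, ← kap_act_Dpush, map_zpow, map_zpow, ← hA, hAk, MulAut.mul_apply,
    MulAut.conj_apply, map_mul, map_mul, map_inv, map_zpow]
  congr 2
  suffices hh : (kap (insert m M)).comp ((τ ^ (-k)).toMonoidHom.comp (act n b').toMonoidHom) =
      kap (insert m M) from DFunLike.congr_fun hh f
  ext j : 1
  change kap (insert m M) ((τ ^ (-k)) (act n b' (FreeGroup.of j))) = _
  rcases lt_trichotomy j m with hj | hj | hj
  · have e : FreeGroup.of j = kap (Set.Iio m) (FreeGroup.of j) :=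
      (FreeGroup.kap_of_mem (show j ∈ Set.Iio m from hj)).symm
    conv_lhs => rw [e, ← kap_Iio_act_BS (by omega) hb', hτk]
    rw [map_mul, map_mul, map_inv, map_zpow, FreeGroup.kap_kap, hMi, hv]
    have e2 : kap (insert m M) P = kap M P := by
      have e3 : kap (Set.Iio m) P = P := kap_Pf
      rw [← e3, FreeGroup.kap_kap, hMi, ← hMi]
      simp only [FreeGroup.kap_kap, Set.inter_assoc, Set.inter_self]
    have e3 : kap (insert m M) (FreeGroup.of j) = kap M (FreeGroup.of j) := by
      rw [e, FreeGroup.kap_kap, hMi, ← hMi]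
      simp only [FreeGroup.kap_kap, Set.inter_assoc, Set.inter_self]
    rw [e2, e3, hk]; group
  · rw [hj, act_BS_of (by omega) le_rfl hb', MulAut.zpow_apply_fixed hτm]
  · have e : τ ^ (-k) = (MulAut.conj (Q ^ k))⁻¹ * A ^ (-k) := by rw [hAk, inv_mul_cancel_left]
    have e2 : A (FreeGroup.of j) = FreeGroup.of j := act_BS_of hmn hj hAmem
    rw [act_BS_of (by omega) hj.le hb', e, MulAut.mul_apply, MulAut.zpow_apply_fixed e2,
      MulAut.conj_inv_apply, map_mul, map_mul,
      FreeGroup.kap_of_notMem (fun h1 => by have := hM' h1; simp at this; omega), mul_one,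
      ← map_mul, inv_mul_cancel, map_one]

theorem Chi.mem_NM_insert {n r a : ℕ} {M : Set ℕ} (hM : M ⊆ Set.Iio n) (hr : r < n) (hrM : r ∉ M) (ha : a ∈ M)
    {y : ArtinB n} (hy : Chi n M r y 1) : y ∈ NM n (insert r M) := by
  have hn : n - 1 + 1 = n := by omega
  set g := (ascProd (sg n) r (n - 1 - r))⁻¹ with hg
  have hgr : prm n g r = n - 1 := by
    have := prm_ascProd (n := n) (a := r) (k := n - 1 - r) (by omega)
    rw [show r + (n - 1 - r) = n - 1 by omega] at this
    rw [hg, map_inv, Equiv.Perm.inv_eq_iff_eq, this]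
  have h1 := hy.conj_one g
  rw [hgr] at h1
  have hs : prm n g '' M ⊆ Set.Iio (n - 1) := by
    rintro _ ⟨x, hx, rfl⟩
    have h3 : prm n g x < n := prm_lt _ (hM hx)
    have h4 : prm n g x ≠ n - 1 := fun h => hrM (by
      rw [← hgr] at h; rwa [← (prm n g).injective h])
    simp; omega
  have h2 := mem_NM_of_Chi_last hn hs (Set.mem_image_of_mem _ ha) h1
  refine (conj_mem_NM_iff (g := g) ?_).1 h2
  rw [Set.image_insert_eq, hgr]

/-! ### Endomorphisms of the two types -/

open FreeGroup (kap)

theorem tB_of_pos {n i : ℕ} (h : 1 ≤ i) (hi : i < n) : tB n i = sg n (i - 1) := by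
  rw [tB, Nat.mod_eq_of_lt hi, if_neg (by omega), rB_eq]

theorem tB_zero {n : ℕ} : tB n 0 = ρB n * sg n (n - 2) * (ρB n)⁻¹ := by
  rw [tB, if_pos (Nat.zero_mod n), rB_eq, Nat.sub_sub]

theorem tB_self {n : ℕ} : tB n n = tB n 0 := by
  rw [tB, tB, if_pos (Nat.mod_self n), if_pos (Nat.zero_mod n)]

theorem ρB_conj_sg_sub_two {n : ℕ} (hn : 2 ≤ n) :
    (ρB n)⁻¹ * sg n 0 * ρB n = ρB n * sg n (n - 2) * (ρB n)⁻¹ := by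
  have := ρB_sq_mul_sg hn
  rw [pow_two] at this
  rw [eq_mul_inv_iff_mul_eq, mul_assoc, mul_assoc, ← this]; group

theorem conj_zpow_ΔB {n : ℕ} (hn : 2 ≤ n) (x y : ArtinB n) (k p q : ℤ) :
    (x * ΔB n ^ q) * (y ^ k * ΔB n ^ p) * (x * ΔB n ^ q)⁻¹ = (x * y * x⁻¹) ^ k * ΔB n ^ p := by
  have h1 : ∀ (l : ℤ) g, ΔB n ^ l * g = g * ΔB n ^ l := fun l g => ((ΔB_comm hn g).zpow_left l).eq
  rw [mul_inv_rev, mul_assoc x, h1, conj_zpow]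
  calc x * (y ^ k * ΔB n ^ p * ΔB n ^ q) * ((ΔB n ^ q)⁻¹ * x⁻¹) = x * y ^ k * (ΔB n ^ p * x⁻¹) := by group
    _ = _ := by rw [h1, ← mul_assoc]

theorem isType2a_of {n : ℕ} (hn : 2 ≤ n) {φ : ArtinB n →* ArtinB n} {ε p q : ℤ} (hε : ε = 1 ∨ ε = -1)
    (h : ∀ i, i + 1 < n → φ (sg n i) = sg n i ^ ε * ΔB n ^ p) (hρ : φ (ρB n) = ρB n * ΔB n ^ q) :
    IsType2a n ε p q φ := by
  refine ⟨hε, fun i hi => ?_, hρ⟩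
  rcases Nat.eq_zero_or_pos i with rfl | h0
  · rw [tB_zero, map_mul, map_mul, map_inv, hρ, h _ (by omega), conj_zpow_ΔB hn]
  · rw [tB_of_pos h0 hi, h _ (by omega)]

theorem isType2b_of {n : ℕ} (hn : 2 ≤ n) {φ : ArtinB n →* ArtinB n} {ε p q : ℤ} (hε : ε = 1 ∨ ε = -1)
    (h : ∀ i, i + 1 < n → φ (sg n i) = sg n (n - 2 - i) ^ ε * ΔB n ^ p)
    (hρ : φ (ρB n) = (ρB n)⁻¹ * ΔB n ^ q) : IsType2b n ε p q φ := by
  refine ⟨hε, fun i hi => ?_, hρ⟩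
  rcases Nat.eq_zero_or_pos i with rfl | h0
  · rw [Nat.sub_zero, tB_self, tB_zero, map_mul, map_mul, map_inv, hρ, h _ (by omega), conj_zpow_ΔB hn,
      Nat.sub_self, inv_inv, ρB_conj_sg_sub_two hn]
  · rw [tB_of_pos h0 hi, tB_of_pos (by omega) (by omega), h _ (by omega)]
    congr 3; omega

theorem ΔB_zpow_eq_one {n : ℕ} (hn : 2 ≤ n) {k : ℤ} (h : ΔB n ^ k = 1) : k = 0 := by
  obtain ⟨f, h1, h2⟩ := exists_degree n 1 0
  have h3 : f (ρB n) = Multiplicative.ofAdd 1 := by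
    rw [ρB_eq_αB_mul (by omega), map_mul, h2 (by omega), αB]
    have : ∀ k, k + 1 ≤ n → f (ascProd (sg n) 0 k) = 1 := by
      intro k
      induction k with
      | zero => intro; simp [ascProd]
      | succ k ih => intro hk; rw [ascProd_succ, map_mul, ih (by omega), h1 _ (by omega)]; exact one_mul 1
    rw [this _ (by omega), one_mul]
  have h4 : f (ΔB n ^ k) = 1 := by rw [h, map_one]
  rw [ΔB, map_zpow, map_pow, h3] at h4
  have h5 : k * (n * 1) = 0 := by
    simpa only [toAdd_zpow, toAdd_pow, toAdd_ofAdd, toAdd_one, smul_eq_mul, nsmul_eq_mul] using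
      congrArg Multiplicative.toAdd h4
  rcases mul_eq_zero.1 h5 with h6 | h6
  · exact h6
  · omega

theorem eq_mul_ΔB_zpow {n : ℕ} (hn : 2 ≤ n) {χ : ArtinB n →* ArtinB n} {a b : ℤ}
    (h : ∀ i, i + 1 < n → χ (sg n i) = sg n i * ΔB n ^ a) (hρ : χ (ρB n) = ρB n * ΔB n ^ b) (g : ArtinB n) :
    ∃ k : ℤ, χ g = g * ΔB n ^ k := by
  let S : Subgroup (ArtinB n) :=
    { carrier := {g | ∃ k : ℤ, χ g = g * ΔB n ^ k}
      one_mem' := ⟨0, by simp⟩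
      mul_mem' := by
        rintro x y ⟨k, hk⟩ ⟨l, hl⟩
        refine ⟨k + l, ?_⟩
        rw [map_mul, hk, hl, zpow_add, mul_assoc, ← mul_assoc (ΔB n ^ k),
          ((ΔB_comm hn y).zpow_left k).eq]
        simp only [mul_assoc]
      inv_mem' := by
        rintro x ⟨k, hk⟩
        refine ⟨-k, ?_⟩
        rw [map_inv, hk, mul_inv_rev, ← zpow_neg, ((ΔB_comm hn x⁻¹).zpow_left (-k)).eq] }
  exact closure_sg_ρB (S := S) (by omega) (fun i hi => ⟨a, h i hi⟩) ⟨b, hρ⟩ g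

theorem injective_of_mul_ΔB {n : ℕ} (hn : 2 ≤ n) {χ : ArtinB n →* ArtinB n} {a b : ℤ}
    (h : ∀ i, i + 1 < n → χ (sg n i) = sg n i * ΔB n ^ a) (hρ : χ (ρB n) = ρB n * ΔB n ^ b)
    (hb : 1 + n * b ≠ 0) : Function.Injective χ := by
  rw [injective_iff_map_eq_one]
  intro g hg
  obtain ⟨k, hk⟩ := eq_mul_ΔB_zpow hn h hρ g
  rw [hg, eq_comm, mul_eq_one_iff_eq_inv, ← zpow_neg] at hk
  have hΔ : χ (ΔB n) = ΔB n ^ (1 + n * b) := by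
    have hc : Commute (ρB n) (ΔB n ^ b) := ((ΔB_comm hn _).zpow_left b).symm
    rw [ΔB, map_pow, hρ, hc.mul_pow, ← zpow_natCast (ΔB n ^ b), ← zpow_mul, ← ΔB, zpow_add, zpow_one,
      mul_comm b]
  rw [hk, map_zpow, hΔ, ← zpow_mul] at hg
  have h0 := ΔB_zpow_eq_one hn hg
  have hk0 : k = 0 := by simpa [hb] using h0
  rw [hk, hk0]; simp

theorem injective_of_type {n : ℕ} (hn : 2 ≤ n) {ψ : ArtinB n →* ArtinB n} {δ ε p q : ℤ}
    (hδ : δ * δ = 1) (hε : ε * ε = 1) {e : ℕ → ℕ} (he : ∀ i, i + 1 < n → e i + 1 < n ∧ e (e i) = i)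
    (h : ∀ i, i + 1 < n → ψ (sg n i) = sg n (e i) ^ ε * ΔB n ^ p)
    (hρ : ψ (ρB n) = ρB n ^ δ * ΔB n ^ q) : Function.Injective ψ := by
  have hΔ : ψ (ΔB n) = ΔB n ^ (δ + n * q) := by
    have hc : Commute (ρB n ^ δ) (ΔB n ^ q) := ((ΔB_comm hn _).zpow_left q).symm
    rw [ΔB, map_pow, hρ, hc.mul_pow, ← zpow_natCast, ← zpow_natCast, ← zpow_mul, ← zpow_mul, mul_comm δ,
      zpow_mul, zpow_natCast, ← ΔB, mul_comm q, zpow_add]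
  have h1 : Function.Injective (ψ.comp ψ) := by
    refine injective_of_mul_ΔB hn (a := p * ε + (δ + n * q) * p) (b := q * δ + (δ + n * q) * q)
      (fun i hi => ?_) ?_ ?_
    · have hc : Commute (sg n i ^ ε) (ΔB n ^ p) := ((ΔB_comm hn _).zpow_left p).symm
      rw [MonoidHom.comp_apply, h i hi, map_mul, map_zpow, map_zpow, hΔ, h _ (he i hi).1, (he i hi).2,
        hc.mul_zpow, ← zpow_mul, hε, zpow_one, mul_assoc, ← zpow_mul, ← zpow_mul, ← zpow_add]
    · have hc : Commute (ρB n ^ δ) (ΔB n ^ q) := ((ΔB_comm hn _).zpow_left q).symm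
      rw [MonoidHom.comp_apply, hρ, map_mul, map_zpow, map_zpow, hΔ, hρ,
        hc.mul_zpow, ← zpow_mul, hδ, zpow_one, mul_assoc, ← zpow_mul, ← zpow_mul, ← zpow_add]
    · intro h0
      have h2 : (δ + n * q) * (δ + n * q) = 0 := by linear_combination h0 + hδ
      have h3 : δ + n * q = 0 := mul_self_eq_zero.1 h2
      have h4 : (n : ℤ) ∣ 1 := ⟨-q * δ, by linear_combination -hδ + δ * h3⟩
      have := Int.le_of_dvd one_pos h4
      omega
  exact Function.Injective.of_comp (f := ψ) (g := ψ) h1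

theorem injective_of_isType {n : ℕ} (hn : 2 ≤ n) {φ : ArtinB n →* ArtinB n}
    (h : (∃ ε p q : ℤ, IsType2a n ε p q φ) ∨ ∃ ε p q : ℤ, IsType2b n ε p q φ) : Function.Injective φ := by
  rcases h with ⟨ε, p, q, hε, h, hρ⟩ | ⟨ε, p, q, hε, h, hρ⟩
  · refine injective_of_type hn (δ := 1) (ε := ε) (p := p) (q := q) (e := id) rfl ?_
      (fun i hi => ⟨hi, rfl⟩) (fun i hi => ?_) (by rw [hρ, zpow_one])
    · rcases hε with rfl | rfl <;> rfl
    · have := h (i + 1) hi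
      rwa [tB_of_pos (by omega) hi] at this
  · refine injective_of_type hn (δ := -1) (ε := ε) (p := p) (q := q) (e := fun i => n - 2 - i) rfl ?_
      (fun i hi => ⟨by omega, by omega⟩) (fun i hi => ?_) (by rw [hρ, zpow_neg_one])
    · rcases hε with rfl | rfl <;> rfl
    · have := h (i + 1) hi
      rwa [tB_of_pos (by omega) hi, tB_of_pos (by omega) (by omega), Nat.add_sub_cancel,
        show n - (i + 1) - 1 = n - 2 - i by omega] at this

/-! ### Two involutive automorphisms -/

theorem exists_ι {n : ℕ} (hn : 2 ≤ n) : ∃ f : ArtinB n →* ArtinB n,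
    (∀ i, i + 1 < n → f (sg n i) = sg n (n - 2 - i)) ∧ f (ρB n) = (ρB n)⁻¹ := by
  have hb := sg_braidSeq n
  refine ArtinB.exists_hom_ρ hn ⟨fun i hi => ?_, fun i j hij hj => ?_⟩ (fun i hi => ?_) ?_
  · have := sg_braid (n := n) (i := n - 2 - (i + 1)) (by omega)
    rw [show n - 2 - (i + 1) + 1 = n - 2 - i by omega] at this
    exact this.symm
  · exact (sg_comm (by omega)).symm
  · have := ρB_mul_sg (n := n) (i := n - 2 - (i + 1)) (by omega)
    rw [show n - 2 - (i + 1) + 1 = n - 2 - i by omega] at this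
    rw [inv_mul_eq_iff_eq_mul, ← mul_assoc, this]; group
  · rw [inv_pow, inv_mul_eq_iff_eq_mul, ← mul_assoc, Nat.sub_self, Nat.sub_zero, ρB_sq_mul_sg hn]; group

theorem exists_μ {n : ℕ} (hn : 2 ≤ n) : ∃ f : ArtinB n →* ArtinB n,
    (∀ i, i + 1 < n → f (sg n i) = (sg n (n - 2 - i))⁻¹) ∧ f (ρB n) = (ρB n)⁻¹ := by
  refine ArtinB.exists_hom_ρ hn ⟨fun i hi => ?_, fun i j hij hj => ?_⟩ (fun i hi => ?_) ?_
  · have := sg_braid (n := n) (i := n - 2 - (i + 1)) (by omega)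
    rw [show n - 2 - (i + 1) + 1 = n - 2 - i by omega] at this
    have := congrArg (·⁻¹) this
    simpa [mul_assoc] using this.symm
  · exact (sg_comm (by omega)).symm.inv_inv
  · have := ρB_mul_sg (n := n) (i := n - 2 - (i + 1)) (by omega)
    rw [show n - 2 - (i + 1) + 1 = n - 2 - i by omega] at this
    rw [← mul_inv_rev, ← mul_inv_rev, this]
  · rw [inv_pow, ← mul_inv_rev, ← mul_inv_rev, Nat.sub_self, Nat.sub_zero, ρB_sq_mul_sg hn]

/-! ### Transfer of commutation and realisation of permutations -/

open FreeGroup (kap)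

theorem commutator_mem_NM_insert {n r i j : ℕ} {M : Set ℕ} (hM : M ⊆ Set.Iio n) (hr : r < n) (hrM : r ∉ M)
    (hi : i ∈ M) (hj : j ∈ M) (hij : i ≠ j) {y a b : ArtinB n} (hy : y ∈ NM n M) (ha : a ∈ NM n M)
    (hb : b ∈ NM n M) (hya : Commute y a) (hyb : Commute y b) (hyr : y ∉ NM n (insert r M)) :
    a * b * a⁻¹ * b⁻¹ ∈ NM n (insert r M) := by
  obtain ⟨u, hu⟩ := exists_Chi r hy
  obtain ⟨c, hc⟩ := exists_Chi r ha
  obtain ⟨d, hd⟩ := exists_Chi r hb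
  have huc : Commute u c := (hc.mul hu).unique hi hj hij hrM (hya.eq ▸ hu.mul hc)
  have hud : Commute u d := (hd.mul hu).unique hi hj hij hrM (hyb.eq ▸ hu.mul hd)
  have hu1 : u ≠ 1 := by
    rintro rfl
    exact hyr (hu.mem_NM_insert hM hr hrM hi)
  exact (hc.commutator hd (FreeGroup.commute_trans hu1 huc hud)).mem_NM_insert hM hr hrM hi

theorem not_commute_of_Chi {n r i : ℕ} {M : Set ℕ} (hM : M ⊆ Set.Iio n) (hr : r < n) (hrM : r ∉ M)
    (hi : i ∈ M) {a b : ArtinB n} {c d : FreeGroup ℕ} (ha : Chi n M r a c) (hb : Chi n M r b d)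
    (h : a * b * a⁻¹ * b⁻¹ ∉ NM n (insert r M)) : ¬Commute c d :=
  fun hcd => h ((ha.commutator hb hcd).mem_NM_insert hM hr hrM hi)

theorem mem_NM_pair {n i j : ℕ} (hi : i < n) (hj : j < n) (hij : i ≠ j) {p : ArtinB n} (hp : prm n p = 1) :
    p ∈ NM n {i, j} := by
  obtain ⟨g, hg⟩ := act_of p i
  obtain ⟨u, hu⟩ := act_of p j
  rw [hp] at hg hu
  rw [Equiv.Perm.one_apply] at hg hu
  have h1 : ∀ f, kap {i} (act n p f) = kap {i} f := by
    intro f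
    obtain ⟨k, hk⟩ := FreeGroup.kap_subsingleton (subset_refl {i}) g
    obtain ⟨l, hl⟩ := FreeGroup.kap_subsingleton (subset_refl {i}) f
    rw [← kap_act_pure hp, hl, map_zpow, hg, map_zpow, map_mul, map_mul, map_inv, hk,
      FreeGroup.kap_of_mem (Set.mem_singleton i), (Commute.self_zpow _ k).symm.eq, mul_inv_cancel_right]
  rw [Set.pair_comm]
  refine Chi.mem_NM_insert (M := {i}) (r := j) (a := i) (by simpa using hi) hj (by simpa using hij.symm) rfl
    ⟨hp, kap {i} u, u, fun f => ?_, hu, by simp⟩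
  obtain ⟨k, hk⟩ := FreeGroup.kap_subsingleton (subset_refl {i}) u
  obtain ⟨l, hl⟩ := FreeGroup.kap_subsingleton (subset_refl {i}) f
  rw [h1, hk, hl, ((Commute.refl _).zpow_zpow k l).eq, mul_inv_cancel_right]

theorem exists_Dpush {m n i : ℕ} (h : m + 1 = n) {M : Set ℕ} (hM : M ⊆ Set.Iio m) (hi : i ∈ M)
    {p : ArtinB n} (hp : p ∈ NM n M) :
    ∃ w, kap M w = w ∧ p * (Dpush h.le w)⁻¹ ∈ NM n (insert m M) := by
  have hmM : m ∉ M := fun hm => absurd (hM hm) (by simp)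
  obtain ⟨hp1, k, hk⟩ := hp
  obtain ⟨g, hg⟩ := act_of p m
  rw [hp1] at hg
  have hk' : ∀ f, kap M (act n p f) = kap M k * kap M f * (kap M k)⁻¹ := fun f => by
    rw [← FreeGroup.kap_kap_self, hk, map_mul, map_mul, map_inv, FreeGroup.kap_kap_self]
  set c := (kap M k)⁻¹ * kap M g with hc
  have hcM : kap M c = c := by rw [hc, map_mul, map_inv, FreeGroup.kap_kap_self, FreeGroup.kap_kap_self]
  have h1 : Chi n M m p c := ⟨hp1, _, g, hk', hg, hc⟩
  refine ⟨c⁻¹, by rw [map_inv, hcM], ?_⟩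
  obtain ⟨hD, hD'⟩ := Dpush_mem_Tr h.le c⁻¹
  obtain ⟨u, hu, hu'⟩ := act_Dpush h.le c⁻¹
  have hsub : M ⊆ {m}ᶜ := fun x hx hxm => hmM (hxm ▸ hx)
  have h2 : Chi n M m (Dpush h.le c⁻¹) c := by
    refine ⟨hD, 1, u, fun f => ?_, hu, ?_⟩
    · rw [← FreeGroup.kap_of_subset hsub, hD', FreeGroup.kap_of_subset hsub]; simp
    · rw [← FreeGroup.kap_of_subset hsub, hu', map_inv, FreeGroup.kap_of_subset hM, map_inv, hcM]; simp
  have h3 := h1.mul h2.inv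
  rw [inv_mul_cancel] at h3
  refine h3.mem_NM_insert (fun x hx => ?_) (by omega) hmM hi
  have := hM hx
  simp only [Set.mem_Iio] at *; omega

/-- The subgroup generated by the `sg i` with `a ≤ i` and `i + 1 < b`. -/
def BI (n a b : ℕ) : Subgroup (ArtinB n) := Subgroup.closure {g | ∃ i, a ≤ i ∧ i + 1 < b ∧ g = sg n i}

theorem sg_mem_BI {n a b i : ℕ} (h1 : a ≤ i) (h2 : i + 1 < b) : sg n i ∈ BI n a b :=
  Subgroup.subset_closure ⟨i, h1, h2, rfl⟩

theorem BI_le {n a b : ℕ} {S : Subgroup (ArtinB n)} (h : ∀ i, a ≤ i → i + 1 < b → sg n i ∈ S) :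
    BI n a b ≤ S := by
  rw [BI, Subgroup.closure_le]
  rintro _ ⟨i, h1, h2, rfl⟩
  exact h i h1 h2

theorem commute_BI {n a b : ℕ} {x g : ArtinB n} (hg : g ∈ BI n a b)
    (h : ∀ i, a ≤ i → i + 1 < b → Commute x (sg n i)) : Commute x g := by
  have : g ∈ Subgroup.centralizer {x} :=
    BI_le (S := Subgroup.centralizer {x})
      (fun i h1 h2 => Subgroup.mem_centralizer_singleton_iff.2 (h i h1 h2).symm.eq) hg
  exact (Subgroup.mem_centralizer_singleton_iff.1 this).symm

theorem exists_prm_eq_swap {n a b : ℕ} (hb : b ≤ n) {i j : ℕ} (h1 : a ≤ i) (h2 : i < j) (h3 : j < b) :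
    ∃ g ∈ BI n a b, prm n g = Equiv.swap i j := by
  obtain ⟨k, rfl⟩ := Nat.exists_eq_add_of_lt h2
  induction k with
  | zero => exact ⟨sg n i, sg_mem_BI h1 h3, prm_sg (by omega)⟩
  | succ k ih =>
    obtain ⟨g, hg, hg'⟩ := ih (by omega) (by omega)
    have hs : sg n (i + k + 1) ∈ BI n a b := sg_mem_BI (by omega) (by omega)
    refine ⟨sg n (i + k + 1) * g * (sg n (i + k + 1))⁻¹, mul_mem (mul_mem hs hg) (inv_mem hs), ?_⟩
    rw [map_mul, map_mul, map_inv, hg', prm_sg (by omega), ← Equiv.swap_apply_apply]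
    congr 1
    · rw [Equiv.swap_apply_of_ne_of_ne] <;> omega
    · rw [Equiv.swap_apply_left]; rfl

theorem exists_prm_eq {n m : ℕ} (hm : m ≤ n) {σ : Equiv.Perm ℕ} (h : ∀ i, m ≤ i → σ i = i) :
    ∃ g, prm n g = σ := by
  induction m generalizing σ with
  | zero => exact ⟨1, by ext i; simp [h i]⟩
  | succ m ih =>
    have hσ : σ m ≤ m := by
      by_contra hc
      have := σ.injective (h (σ m) (by omega))
      omega
    have h2 : ∃ g, prm n g = Equiv.swap (σ m) m := by
      rcases hσ.lt_or_eq with h3 | h3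
      · obtain ⟨g, -, hg⟩ := exists_prm_eq_swap (a := 0) hm (Nat.zero_le _) h3 (Nat.lt_succ_self m)
        exact ⟨g, hg⟩
      · exact ⟨1, by rw [h3, Equiv.swap_self, map_one]; rfl⟩
    obtain ⟨g, hg⟩ := h2
    obtain ⟨g', hg'⟩ := ih (by omega) (σ := Equiv.swap (σ m) m * σ) (fun i hi => by
      rw [Equiv.Perm.mul_apply]
      rcases hi.lt_or_eq with h3 | rfl
      · rw [h i h3, Equiv.swap_apply_of_ne_of_ne] <;> omega
      · rw [Equiv.swap_apply_left])
    refine ⟨g * g', ?_⟩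
    rw [map_mul, hg, hg', ← mul_assoc, Equiv.swap_mul_self, one_mul]

theorem exists_image_eq {n a b : ℕ} (hb : b ≤ n) (M N : Finset ℕ) (hc : M.card = N.card)
    (hM : ∀ i ∈ M, i ∉ N → a ≤ i ∧ i < b) (hN : ∀ i ∈ N, i ∉ M → a ≤ i ∧ i < b) :
    ∃ g ∈ BI n a b, prm n g '' M = N := by
  obtain ⟨k, hk⟩ : ∃ k, (M \ N).card = k := ⟨_, rfl⟩
  induction k generalizing M with
  | zero =>
    have h1 : M ⊆ N := by rwa [Finset.card_eq_zero, Finset.sdiff_eq_empty_iff_subset] at hk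
    have h2 := Finset.eq_of_subset_of_card_le h1 hc.ge
    exact ⟨1, one_mem _, by simp [h2]⟩
  | succ k ih =>
    have hk' : (N \ M).card = k + 1 := by rw [← hk]; exact (Finset.card_sdiff_comm hc).symm
    obtain ⟨x, hx⟩ := Finset.card_pos.1 (by omega : 0 < (M \ N).card)
    obtain ⟨y, hy⟩ := Finset.card_pos.1 (by omega : 0 < (N \ M).card)
    rw [Finset.mem_sdiff] at hx hy
    have hxy : x ≠ y := fun h => hx.2 (h ▸ hy.1)
    obtain ⟨s, hs, hs'⟩ : ∃ g ∈ BI n a b, prm n g = Equiv.swap x y := by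
      have h1 := hM x hx.1 hx.2
      have h2 := hN y hy.1 hy.2
      rcases hxy.lt_or_gt with h | h
      · exact exists_prm_eq_swap hb h1.1 h h2.2
      · rw [Equiv.swap_comm]; exact exists_prm_eq_swap hb h2.1 h h1.2
    have hmem : ∀ i, i ∈ M.map (Equiv.swap x y).toEmbedding ↔ i = y ∨ (i ∈ M ∧ i ≠ x) := by
      intro i
      rw [Finset.mem_map_equiv, Equiv.symm_swap]
      by_cases h1 : i = x
      · subst h1; simp [hxy, hy.2]
      · by_cases h2 : i = y
        · subst h2; simp [hx.1]
        · rw [Equiv.swap_apply_of_ne_of_ne h1 h2]; simp [h1, h2]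
    obtain ⟨g, hg, hg'⟩ := ih (M.map (Equiv.swap x y).toEmbedding) (by rw [Finset.card_map, hc])
      (fun i hi hi' => by
        rcases (hmem i).1 hi with rfl | h
        · exact absurd hy.1 hi'
        · exact hM i h.1 hi')
      (fun i hi hi' => by
        rw [hmem] at hi'
        push Not at hi'
        exact hN i hi fun h => hx.2 (hi'.2 h ▸ hi))
      (by
        have : M.map (Equiv.swap x y).toEmbedding \ N = (M \ N).erase x := by
          ext i
          rw [Finset.mem_sdiff, hmem, Finset.mem_erase, Finset.mem_sdiff]
          constructor
          · rintro ⟨rfl | h, h'⟩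
            · exact absurd hy.1 h'
            · exact ⟨h.2, h.1, h'⟩
          · rintro ⟨h1, h2, h3⟩; exact ⟨Or.inr ⟨h2, h1⟩, h3⟩
        rw [this, Finset.card_erase_of_mem (Finset.mem_sdiff.2 hx), hk, Nat.add_sub_cancel])
    refine ⟨g * s, mul_mem hg hs, ?_⟩
    rw [map_mul, Equiv.Perm.coe_mul, Set.image_comp, hs', ← hg', Finset.coe_map]
    rfl

/-! ### A representation of the stabiliser of the last three strands -/

open FreeGroup (kap)
open scoped MatrixGroups Matrix

/-- The upper unitriangular matrices with even entry. -/
def upperTwo : Multiplicative ℤ →* SL(2, ℤ) where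
  toFun k := ⟨!![1, 2 * k.toAdd; 0, 1], by simp⟩
  map_one' := by ext i j; fin_cases i <;> fin_cases j <;> simp
  map_mul' k l := Subtype.ext <| by
    change !![1, 2 * (k.toAdd + l.toAdd); 0, 1] = !![1, 2 * k.toAdd; 0, 1] * !![1, 2 * l.toAdd; 0, 1]
    rw [Matrix.mul_fin_two]; simp; ring

/-- The lower unitriangular matrices with even entry. -/
def lowerTwo : Multiplicative ℤ →* SL(2, ℤ) where
  toFun k := ⟨!![1, 0; -2 * k.toAdd, 1], by simp⟩
  map_one' := by ext i j; fin_cases i <;> fin_cases j <;> simp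
  map_mul' k l := Subtype.ext <| by
    change !![1, 0; -2 * (k.toAdd + l.toAdd), 1] = !![1, 0; -2 * k.toAdd, 1] * !![1, 0; -2 * l.toAdd, 1]
    rw [Matrix.mul_fin_two]; simp; ring

theorem upperTwo_val (k : Multiplicative ℤ) : (upperTwo k).1 = !![1, 2 * k.toAdd; 0, 1] := rfl

theorem lowerTwo_val (k : Multiplicative ℤ) : (lowerTwo k).1 = !![1, 0; -2 * k.toAdd, 1] := rfl

theorem lt_abs_add_two_mul {x y k : ℤ} (h : |x| < |y|) (hk : k ≠ 0) : |y| < |x + 2 * k * y| := by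
  have h1 : 1 ≤ |k| := Int.one_le_abs hk
  have h2 : |2 * k * y| - |x| ≤ |x + 2 * k * y| := by
    have := abs_sub_abs_le_abs_sub (2 * k * y) (-x)
    rw [abs_neg, sub_neg_eq_add, add_comm (2 * k * y)] at this
    exact this
  have h3 : |2 * k * y| = 2 * (|k| * |y|) := by rw [abs_mul, abs_mul, abs_two, mul_assoc]
  nlinarith [abs_nonneg y]

open Monoid in
theorem sanov_injective : Function.Injective (CoprodI.lift
    (fun b : Bool => Matrix.SpecialLinearGroup.toLin'.comp (cond b upperTwo lowerTwo)) :
    CoprodI (fun _ : Bool => Multiplicative ℤ) →* ((Fin 2 → ℤ) ≃ₗ[ℤ] (Fin 2 → ℤ))) := by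
  refine CoprodI.lift_injective_of_ping_pong _ (Or.inr ⟨true, ?_⟩)
    (fun b : Bool => {v : Fin 2 → ℤ | cond b (|v 1| < |v 0|) (|v 0| < |v 1|)}) ?_ ?_ ?_
  · exact (Cardinal.natCast_lt_aleph0 (n := 3)).le.trans (Cardinal.aleph0_le_mk _)
  · rintro (_ | _)
    · exact ⟨![0, 1], by simp⟩
    · exact ⟨![1, 0], by simp⟩
  · have : ∀ b c : Bool, b ≠ c → Disjoint {v : Fin 2 → ℤ | cond b (|v 1| < |v 0|) (|v 0| < |v 1|)}
        {v : Fin 2 → ℤ | cond c (|v 1| < |v 0|) (|v 0| < |v 1|)} := by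
      intro b c hbc
      rw [Set.disjoint_left]
      intro v hv hv'
      rcases b <;> rcases c <;> simp_all <;> omega
    exact this
  · have : ∀ b c : Bool, b ≠ c → ∀ k : Multiplicative ℤ, k ≠ 1 → ∀ v : Fin 2 → ℤ,
        cond c (|v 1| < |v 0|) (|v 0| < |v 1|) →
        cond b (|(((cond b upperTwo lowerTwo) k).1 *ᵥ v) 1| < |(((cond b upperTwo lowerTwo) k).1 *ᵥ v) 0|)
          (|(((cond b upperTwo lowerTwo) k).1 *ᵥ v) 0| < |(((cond b upperTwo lowerTwo) k).1 *ᵥ v) 1|) := by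
      rintro (_ | _) (_ | _) hbc k hk v hv
      · exact absurd rfl hbc
      · have := lt_abs_add_two_mul (k := -k.toAdd) hv (by simpa using hk)
        simpa [lowerTwo_val, Matrix.mulVec, dotProduct, Fin.sum_univ_two, add_comm] using this
      · have := lt_abs_add_two_mul (k := k.toAdd) hv (by simpa using hk)
        simpa [upperTwo_val, Matrix.mulVec, dotProduct, Fin.sum_univ_two, add_comm] using this
      · exact absurd rfl hbc
    intro b c hbc k hk
    rintro _ ⟨v, hv, rfl⟩
    exact this b c hbc k hk v hv

open Monoid in
theorem eq_one_of_sanov {a b : ℕ} (hab : a ≠ b) {S : FreeGroup ℕ →* SL(2, ℤ)}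
    (ha : S (FreeGroup.of a) = upperTwo (Multiplicative.ofAdd 1))
    (hb : S (FreeGroup.of b) = lowerTwo (Multiplicative.ofAdd 1))
    {w : FreeGroup ℕ} (hw : kap {a, b} w = w) (h : S w = 1) : w = 1 := by
  let H := fun _ : Bool => Multiplicative ℤ
  let e : FreeGroup ℕ →* CoprodI H := FreeGroup.lift fun i =>
    if i = a then CoprodI.of (M := H) (i := true) (Multiplicative.ofAdd 1)
    else if i = b then CoprodI.of (M := H) (i := false) (Multiplicative.ofAdd 1) else 1
  let g : CoprodI H →* FreeGroup ℕ := CoprodI.lift fun c =>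
    zpowersHom _ (cond c (FreeGroup.of a) (FreeGroup.of b))
  have h1 : g.comp e = kap {a, b} := by
    ext i
    by_cases hia : i = a
    · subst hia; simp only [g, e, kap]; simp [H]
    · by_cases hib : i = b
      · subst hib; simp only [g, e, kap]; simp [H, hia]
      · simp [e, kap, hia, hib]
  have h2 : (CoprodI.lift (fun b : Bool => Matrix.SpecialLinearGroup.toLin'.comp
      (cond b upperTwo lowerTwo))).comp e = (Matrix.SpecialLinearGroup.toLin'.comp S).comp
      (kap {a, b}) := by
    ext1 i
    by_cases hia : i = a
    · subst hia; simp [e, kap, ha]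
    · by_cases hib : i = b
      · subst hib; simp [e, kap, hia, hb]
      · simp [e, kap, hia, hib]
  have h3 : e w = 1 := by
    apply sanov_injective
    rw [map_one]
    have := DFunLike.congr_fun h2 w
    rw [MonoidHom.comp_apply, MonoidHom.comp_apply, MonoidHom.comp_apply, hw, h, map_one] at this
    exact this
  rw [← hw, ← h1, MonoidHom.comp_apply, h3, map_one]

/-- The infinite dihedral-type representation of the free group given by three point reflections. -/
def refl3 (n : ℕ) : FreeGroup ℕ →* Equiv.Perm (Fin 2 → ℤ) :=
  FreeGroup.lift fun l => if l + 3 = n then Equiv.subLeft ![2, 0] else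
    if l + 2 = n then Equiv.subLeft ![0, 2] else if l + 1 = n then Equiv.subLeft 0 else 1

/-- The last three letters. -/
def M0 (n : ℕ) : Set ℕ := {i | n ≤ i + 3 ∧ i < n}

theorem refl3_fst {n l : ℕ} (h : l + 3 = n) (v : Fin 2 → ℤ) : refl3 n (FreeGroup.of l) v = ![2, 0] - v := by
  simp [refl3, h]

theorem refl3_snd {n l : ℕ} (h : l + 2 = n) (v : Fin 2 → ℤ) : refl3 n (FreeGroup.of l) v = ![0, 2] - v := by
  simp [refl3, h, show l + 3 ≠ n by omega]

theorem refl3_last {n l : ℕ} (h : l + 1 = n) (v : Fin 2 → ℤ) : refl3 n (FreeGroup.of l) v = -v := by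
  simp [refl3, h, show l + 3 ≠ n by omega, show l + 2 ≠ n by omega]

theorem refl3_of_notMem {n l : ℕ} (h : l ∉ M0 n) (v : Fin 2 → ℤ) : refl3 n (FreeGroup.of l) v = v := by
  simp only [M0, Set.mem_ofPred_eq, not_and_or, not_le, not_lt] at h
  simp [refl3, show l + 3 ≠ n by omega, show l + 2 ≠ n by omega, show l + 1 ≠ n by omega]

theorem refl3_kap (n : ℕ) (f : FreeGroup ℕ) : refl3 n (kap (M0 n) f) = refl3 n f := by
  rw [← MonoidHom.comp_apply]
  congr 1
  ext1 l
  by_cases h : l ∈ M0 n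
  · rw [MonoidHom.comp_apply, FreeGroup.kap_of_mem h]
  · rw [MonoidHom.comp_apply, FreeGroup.kap_of_notMem h, map_one]
    ext v : 1
    rw [refl3_of_notMem h, Equiv.Perm.one_apply]

/-- `A` is the matrix of `g` on differences of reflection centres. -/
def MRep (n : ℕ) (g : ArtinB n) (A : SL(2, ℤ)) : Prop :=
  ∃ u : Fin 2 → ℤ, ∀ f v, refl3 n (act n g f) (A.1 *ᵥ v + u) = A.1 *ᵥ (refl3 n f v) + u

theorem MRep.mul {n : ℕ} {g h : ArtinB n} {A B : SL(2, ℤ)} (hg : MRep n g A) (hh : MRep n h B) :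
    MRep n (g * h) (A * B) := by
  obtain ⟨u, hu⟩ := hg
  obtain ⟨w, hw⟩ := hh
  refine ⟨A.1 *ᵥ w + u, fun f v => ?_⟩
  have := hu (act n h f) (B.1 *ᵥ v + w)
  rw [hw, Matrix.mulVec_add, Matrix.mulVec_mulVec, Matrix.mulVec_add, Matrix.mulVec_mulVec, add_assoc,
    add_assoc] at this
  rw [act_mul, Matrix.SpecialLinearGroup.coe_mul]
  exact this

theorem MRep.one (n : ℕ) : MRep n 1 1 := ⟨0, fun f v => by simp⟩

theorem MRep.inv {n : ℕ} {g : ArtinB n} {A : SL(2, ℤ)} (hg : MRep n g A) : MRep n g⁻¹ A⁻¹ := by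
  obtain ⟨u, hu⟩ := hg
  have e1 : ∀ v : Fin 2 → ℤ, A.1 *ᵥ ((A⁻¹).1 *ᵥ v) = v := fun v => by
    rw [Matrix.mulVec_mulVec, ← Matrix.SpecialLinearGroup.coe_mul, mul_inv_cancel]; simp
  have e2 : ∀ v : Fin 2 → ℤ, (A⁻¹).1 *ᵥ (A.1 *ᵥ v) = v := fun v => by
    rw [Matrix.mulVec_mulVec, ← Matrix.SpecialLinearGroup.coe_mul, inv_mul_cancel]; simp
  refine ⟨-((A⁻¹).1 *ᵥ u), fun f v => ?_⟩
  have := hu (act n g⁻¹ f) ((A⁻¹).1 *ᵥ v - (A⁻¹).1 *ᵥ u)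
  rw [act_act_inv, ← Matrix.mulVec_sub, e1, sub_add_cancel, ← sub_eq_iff_eq_add] at this
  rw [← sub_eq_add_neg, ← sub_eq_add_neg, ← Matrix.mulVec_sub, ← Matrix.mulVec_sub, this, e2]

theorem MRep.unique {n : ℕ} (hn : 3 ≤ n) {g : ArtinB n} {A B : SL(2, ℤ)} (hA : MRep n g A) (hB : MRep n g B) :
    A = B := by
  have key : ∀ {A : SL(2, ℤ)} {u : Fin 2 → ℤ},
      (∀ f v, refl3 n (act n g f) (A.1 *ᵥ v + u) = A.1 *ᵥ (refl3 n f v) + u) →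
      ∀ l c, (∀ v, refl3 n (FreeGroup.of l) v = c - v) →
        refl3 n (act n g (FreeGroup.of l)) 0 = A.1 *ᵥ c + 2 * u := by
    intro A u hu l c hc
    have e1 : ∀ v : Fin 2 → ℤ, A.1 *ᵥ ((A⁻¹).1 *ᵥ v) = v := fun v => by
      rw [Matrix.mulVec_mulVec, ← Matrix.SpecialLinearGroup.coe_mul, mul_inv_cancel]; simp
    have := hu (FreeGroup.of l) ((A⁻¹).1 *ᵥ (-u))
    rw [e1, neg_add_cancel, hc, Matrix.mulVec_sub, e1] at this
    rw [this]; ring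
  obtain ⟨u, hu⟩ := hA
  obtain ⟨w, hw⟩ := hB
  have r1 : ∀ v, refl3 n (FreeGroup.of (n - 3)) v = ![2, 0] - v := refl3_fst (by omega)
  have r2 : ∀ v, refl3 n (FreeGroup.of (n - 2)) v = ![0, 2] - v := refl3_snd (by omega)
  have r3 : ∀ v, refl3 n (FreeGroup.of (n - 1)) v = 0 - v := fun v => by rw [refl3_last (by omega), zero_sub]
  have h1 := (key hu _ _ r1).symm.trans (key hw _ _ r1)
  have h2 := (key hu _ _ r2).symm.trans (key hw _ _ r2)
  have h3 := (key hu _ _ r3).symm.trans (key hw _ _ r3)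
  rw [Matrix.mulVec_zero, Matrix.mulVec_zero, zero_add, zero_add] at h3
  rw [h3, add_right_cancel_iff] at h1 h2
  ext i j
  have h1 := congrFun h1 i
  have h2 := congrFun h2 i
  simp only [Matrix.mulVec, dotProduct, Fin.sum_univ_two, Matrix.cons_val_zero, Matrix.cons_val_one,
    mul_zero, add_zero, zero_add] at h1 h2
  fin_cases j
  · simpa using h1
  · simpa using h2

theorem MRep.commute {n : ℕ} (hn : 3 ≤ n) {g h : ArtinB n} {A B : SL(2, ℤ)} (hg : MRep n g A)
    (hh : MRep n h B) (hc : Commute g h) : Commute A B :=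
  (hg.mul hh).unique hn (hc.eq ▸ hh.mul hg)

theorem MRep.of_generators {n : ℕ} {g : ArtinB n} {A : SL(2, ℤ)} {u : Fin 2 → ℤ}
    (h : ∀ i v, refl3 n (act n g (FreeGroup.of i)) (A.1 *ᵥ v + u) = A.1 *ᵥ (refl3 n (FreeGroup.of i) v) + u) :
    MRep n g A := by
  refine ⟨u, fun f => ?_⟩
  induction f using FreeGroup.induction_on with
  | C1 => intro v; simp
  | of i => exact h i
  | inv_of i hi =>
    intro v
    have := hi (refl3 n (FreeGroup.of i)⁻¹ v)
    rw [map_inv (refl3 n), ← Equiv.Perm.mul_apply, mul_inv_cancel, Equiv.Perm.one_apply] at this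
    rw [map_inv (act n g), map_inv, Equiv.Perm.inv_eq_iff_eq, map_inv]
    exact this.symm
  | mul x y hx hy =>
    intro v
    rw [map_mul (act n g), map_mul, map_mul, Equiv.Perm.mul_apply, Equiv.Perm.mul_apply, hy, hx]

/-- The matrix of `sg n (n - 3)`. -/
def U1 : SL(2, ℤ) := ⟨!![2, 1; -1, 0], by simp⟩

/-- The matrix of `sg n (n - 2)`. -/
def U2 : SL(2, ℤ) := ⟨!![1, 0; -1, 1], by simp⟩

theorem U1_mulVec (v : Fin 2 → ℤ) : U1.1 *ᵥ v = ![2 * v 0 + v 1, -v 0] := by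
  ext i
  fin_cases i
  · change 2 * v 0 + (1 * v 1 + 0) = 2 * v 0 + v 1
    ring
  · change -1 * v 0 + (0 * v 1 + 0) = -v 0
    ring

theorem U2_mulVec (v : Fin 2 → ℤ) : U2.1 *ᵥ v = ![v 0, -v 0 + v 1] := by
  ext i
  fin_cases i
  · change 1 * v 0 + (0 * v 1 + 0) = v 0
    ring
  · change -1 * v 0 + (1 * v 1 + 0) = -v 0 + v 1
    ring

theorem MRep.sg_sub_three {n : ℕ} (h : 3 ≤ n) : MRep n (sg n (n - 3)) U1 := by
  obtain ⟨m, rfl⟩ := Nat.exists_eq_add_of_le' h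
  refine MRep.of_generators (u := 0) fun l v => ?_
  rw [act_sg (by omega), Nat.add_sub_cancel]
  by_cases h1 : l = m
  · subst h1
    rw [sig_self, map_mul, map_mul, map_inv, Equiv.Perm.mul_apply, Equiv.Perm.mul_apply,
      Equiv.Perm.inv_eq_iff_eq, refl3_fst rfl, refl3_fst rfl, refl3_snd rfl, refl3_fst rfl]
    rw [U1_mulVec, U1_mulVec]
    ext i
    fin_cases i <;> simp <;> ring
  · by_cases h2 : l = m + 1
    · subst h2
      rw [sig_succ, refl3_fst rfl, refl3_snd rfl]
      rw [U1_mulVec, U1_mulVec]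
      ext i
      fin_cases i <;> simp <;> ring
    · rw [sig_of_ne h1 h2]
      by_cases h3 : l = m + 2
      · subst h3
        rw [refl3_last rfl, refl3_last rfl, Matrix.mulVec_neg, add_zero, add_zero]
      · have : l ∉ M0 (m + 3) := fun h => by simp only [M0, Set.mem_ofPred_eq] at h; omega
        rw [refl3_of_notMem this, refl3_of_notMem this]

theorem MRep.sg_sub_two {n : ℕ} (h : 3 ≤ n) : MRep n (sg n (n - 2)) U2 := by
  obtain ⟨m, rfl⟩ := Nat.exists_eq_add_of_le' h
  refine MRep.of_generators (u := ![0, 1]) fun l v => ?_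
  rw [act_sg (by omega), show m + 3 - 2 = m + 1 by omega]
  by_cases h1 : l = m + 1
  · subst h1
    rw [sig_self, map_mul, map_mul, map_inv, Equiv.Perm.mul_apply, Equiv.Perm.mul_apply,
      Equiv.Perm.inv_eq_iff_eq, refl3_snd rfl, refl3_snd rfl, refl3_last rfl, refl3_snd rfl]
    rw [U2_mulVec, U2_mulVec]
    ext i
    fin_cases i <;> simp <;> ring
  · by_cases h2 : l = m + 1 + 1
    · subst h2
      rw [sig_succ, refl3_snd rfl, refl3_last rfl]
      rw [U2_mulVec, U2_mulVec]
      ext i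
      fin_cases i <;> simp <;> ring
    · rw [sig_of_ne h1 h2]
      by_cases h3 : l = m
      · subst h3
        rw [refl3_fst rfl, refl3_fst rfl]
        rw [U2_mulVec, U2_mulVec]
        ext i
        fin_cases i <;> simp <;> ring
      · have : l ∉ M0 (m + 3) := fun h => by simp only [M0, Set.mem_ofPred_eq] at h; omega
        rw [refl3_of_notMem this, refl3_of_notMem this]

theorem refl3_affine (n : ℕ) (f : FreeGroup ℕ) :
    ∃ (s : SL(2, ℤ)) (u : Fin 2 → ℤ), (s = 1 ∨ s = -1) ∧ ∀ v, refl3 n f v = s.1 *ᵥ v + u := by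
  induction f using FreeGroup.induction_on with
  | C1 => exact ⟨1, 0, Or.inl rfl, by simp⟩
  | of i =>
    by_cases h : i ∈ M0 n
    · simp only [M0, Set.mem_ofPred_eq] at h
      obtain h | h | h : i + 3 = n ∨ i + 2 = n ∨ i + 1 = n := by omega
      · exact ⟨-1, ![2, 0], Or.inr rfl, fun v => by
          rw [refl3_fst h, sub_eq_neg_add, Matrix.SpecialLinearGroup.coe_neg,
            Matrix.SpecialLinearGroup.coe_one, Matrix.neg_mulVec, Matrix.one_mulVec]⟩
      · exact ⟨-1, ![0, 2], Or.inr rfl, fun v => by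
          rw [refl3_snd h, sub_eq_neg_add, Matrix.SpecialLinearGroup.coe_neg,
            Matrix.SpecialLinearGroup.coe_one, Matrix.neg_mulVec, Matrix.one_mulVec]⟩
      · exact ⟨-1, 0, Or.inr rfl, fun v => by rw [refl3_last h]; simp [Matrix.neg_mulVec]⟩
    · exact ⟨1, 0, Or.inl rfl, fun v => by rw [refl3_of_notMem h]; simp⟩
  | inv_of i hi =>
    obtain ⟨s, u, hs, h⟩ := hi
    refine ⟨s, -(s.1 *ᵥ u), hs, fun v => ?_⟩
    rw [map_inv, Equiv.Perm.inv_eq_iff_eq, h]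
    rcases hs with rfl | rfl <;> simp [Matrix.neg_mulVec]
  | mul x y hx hy =>
    obtain ⟨s, u, hs, h⟩ := hx
    obtain ⟨s', u', hs', h'⟩ := hy
    refine ⟨s * s', s.1 *ᵥ u' + u, ?_, fun v => ?_⟩
    · rcases hs with rfl | rfl <;> rcases hs' with rfl | rfl <;> simp
    · rw [map_mul, Equiv.Perm.mul_apply, h, h', Matrix.mulVec_add, Matrix.mulVec_mulVec, add_assoc,
        Matrix.SpecialLinearGroup.coe_mul]

theorem exists_MRep_of_mem_NM {n : ℕ} {p : ArtinB n} (hp : p ∈ NM n (M0 n)) :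
    ∃ s, (s = 1 ∨ s = -1) ∧ MRep n p s := by
  obtain ⟨-, h, hh⟩ := hp
  obtain ⟨s, u, hs, hu⟩ := refl3_affine n h
  refine ⟨s, hs, u, fun f v => ?_⟩
  rw [← hu, ← hu, ← refl3_kap, hh, map_mul, map_mul, map_inv, refl3_kap, Equiv.Perm.mul_apply,
    Equiv.Perm.mul_apply, ← Equiv.Perm.mul_apply _⁻¹, inv_mul_cancel, Equiv.Perm.one_apply]

theorem M0_eq {n : ℕ} (h : 3 ≤ n) : M0 n = insert (n - 1) {n - 3, n - 2} := by
  ext i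
  simp only [M0, Set.mem_ofPred_eq, Set.mem_insert_iff, Set.mem_singleton_iff]
  omega

theorem exists_MRep_Dpush {n : ℕ} (h : 3 ≤ n) : ∃ S : FreeGroup ℕ →* SL(2, ℤ),
    S (FreeGroup.of (n - 3)) = upperTwo (Multiplicative.ofAdd 1) ∧
    S (FreeGroup.of (n - 2)) = lowerTwo (Multiplicative.ofAdd 1) ∧
    (∀ w, S w ∈ CongruenceSubgroup.Gamma 2) ∧
    ∀ w, kap {n - 3, n - 2} w = w → MRep n (Dpush (show n - 1 + 1 ≤ n by omega) w) (S w) := by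
  let S : FreeGroup ℕ →* SL(2, ℤ) := FreeGroup.lift fun i =>
    if i = n - 3 then upperTwo (Multiplicative.ofAdd 1) else
      if i = n - 2 then lowerTwo (Multiplicative.ofAdd 1) else 1
  have hS1 : S (FreeGroup.of (n - 3)) = upperTwo (Multiplicative.ofAdd 1) := by simp [S]
  have hS2 : S (FreeGroup.of (n - 2)) = lowerTwo (Multiplicative.ofAdd 1) := by
    simp [S, show n - 2 ≠ n - 3 by omega]
  have hm : n - 1 + 1 ≤ n := by omega
  have h1 : MRep n (Dpush hm (FreeGroup.of (n - 2))) (lowerTwo (Multiplicative.ofAdd 1)) := by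
    rw [Dpush_of hm (by omega), show n - 1 - 1 - (n - 2) = 0 by omega, ascProd_zero, one_mul, inv_one,
      mul_one, show n - 1 - 1 = n - 2 by omega, pow_two]
    have := (MRep.sg_sub_two h).mul (MRep.sg_sub_two h)
    rwa [show U2 * U2 = lowerTwo (Multiplicative.ofAdd 1) from by decide] at this
  have h2 : MRep n (Dpush hm (FreeGroup.of (n - 3))) (upperTwo (Multiplicative.ofAdd 1)) := by
    rw [Dpush_of hm (by omega), show n - 1 - 1 - (n - 3) = 1 by omega, ascProd_succ, ascProd_zero, one_mul,
      add_zero, show n - 1 - 1 = n - 2 by omega, pow_two]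
    have := ((MRep.sg_sub_three h).mul ((MRep.sg_sub_two h).mul (MRep.sg_sub_two h))).mul
      (MRep.sg_sub_three h).inv
    rwa [show U1 * (U2 * U2) * U1⁻¹ = upperTwo (Multiplicative.ofAdd 1) from by decide] at this
  refine ⟨S, hS1, hS2, fun w => FreeGroup.map_mem S (fun i => ?_) w, fun w hw => ?_⟩
  · simp only [S, FreeGroup.lift_apply_of]
    split_ifs
    · rw [CongruenceSubgroup.Gamma_mem]; decide
    · rw [CongruenceSubgroup.Gamma_mem]; decide
    · exact one_mem _
  · rw [← hw]
    clear hw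
    induction w using FreeGroup.induction_on with
    | C1 => simpa using MRep.one n
    | of i =>
      by_cases hi : i ∈ ({n - 3, n - 2} : Set ℕ)
      · rw [FreeGroup.kap_of_mem hi]
        rcases hi with rfl | hi
        · rwa [hS1]
        · rw [Set.mem_singleton_iff] at hi
          subst hi
          rwa [hS2]
      · rw [FreeGroup.kap_of_notMem hi]; simpa using MRep.one n
    | inv_of i hi => rw [map_inv, map_inv, map_inv]; exact hi.inv
    | mul x y hx hy => rw [map_mul, map_mul, map_mul]; exact hx.mul hy

theorem exists_MRep_of_pure {n : ℕ} (h : 3 ≤ n) {p : ArtinB n} (hp : prm n p = 1) :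
    ∃ A ∈ CongruenceSubgroup.Gamma 2, MRep n p A ∧ (A = 1 ∨ A = -1 → p ∈ NM n (M0 n)) := by
  obtain ⟨S, h1, h2, hS, hD⟩ := exists_MRep_Dpush h
  obtain ⟨w, hw, hpw⟩ := exists_Dpush (show n - 1 + 1 = n by omega) (M := {n - 3, n - 2}) (i := n - 3)
    (by rintro i (rfl | rfl) <;> simp <;> omega) (by simp)
    (mem_NM_pair (p := p) (by omega) (by omega) (by omega) hp)
  rw [← M0_eq h] at hpw
  obtain ⟨s, hs, hps⟩ := exists_MRep_of_mem_NM hpw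
  have hp' := hps.mul (hD w hw)
  rw [inv_mul_cancel_right] at hp'
  refine ⟨s * S w, mul_mem ?_ (hS w), hp', fun hA => ?_⟩
  · rcases hs with rfl | rfl
    · exact one_mem _
    · rw [CongruenceSubgroup.Gamma_mem]; decide
  · have h3 : S (w * w) = 1 := by
      have : S w = 1 ∨ S w = -1 := by
        rcases hs with rfl | rfl
        · simpa using hA
        · simp only [neg_mul, one_mul, neg_eq_iff_eq_neg, neg_neg] at hA
          exact hA.symm
      rw [map_mul]
      rcases this with h | h <;> rw [h] <;> simp
    have h4 := eq_one_of_sanov (by omega) h1 h2 (by rw [map_mul, hw]) h3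
    have h5 : w = 1 := by
      rw [← pow_two] at h4
      exact (pow_eq_one_iff_left two_ne_zero).1 h4
    rw [h5, map_one, inv_one, mul_one] at hpw
    exact hpw

theorem mem_NM_of_MRep {n : ℕ} (h : 3 ≤ n) {p : ArtinB n} (hp : prm n p = 1) {A : SL(2, ℤ)}
    (hA : MRep n p A) (hA' : A = 1 ∨ A = -1) : p ∈ NM n (M0 n) := by
  obtain ⟨B, -, hB, h1⟩ := exists_MRep_of_pure h hp
  exact h1 (hB.unique h hA ▸ hA')

open FreeGroup (kap)
open scoped MatrixGroups Matrix

/-! ### Two by two integer matrices -/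

theorem sl2_det (A : SL(2, ℤ)) : A.1 0 0 * A.1 1 1 - A.1 0 1 * A.1 1 0 = 1 := by
  rw [← Matrix.det_fin_two]; exact A.2

theorem sl2_mul (A B : SL(2, ℤ)) : (A * B).1 0 0 = A.1 0 0 * B.1 0 0 + A.1 0 1 * B.1 1 0 ∧
    (A * B).1 0 1 = A.1 0 0 * B.1 0 1 + A.1 0 1 * B.1 1 1 ∧
    (A * B).1 1 0 = A.1 1 0 * B.1 0 0 + A.1 1 1 * B.1 1 0 ∧
    (A * B).1 1 1 = A.1 1 0 * B.1 0 1 + A.1 1 1 * B.1 1 1 := by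
  rw [Matrix.SpecialLinearGroup.coe_mul]
  exact Matrix.two_mul_expl _ _

theorem sl2_ext_iff {A B : SL(2, ℤ)} : A = B ↔ A.1 0 0 = B.1 0 0 ∧ A.1 0 1 = B.1 0 1 ∧ A.1 1 0 = B.1 1 0 ∧
    A.1 1 1 = B.1 1 1 := by
  refine ⟨by rintro rfl; simp, fun h => ?_⟩
  ext i j
  fin_cases i <;> fin_cases j
  · exact h.1
  · exact h.2.1
  · exact h.2.2.1
  · exact h.2.2.2

theorem sl2_commute_iff {A B : SL(2, ℤ)} : Commute A B ↔ A.1 0 1 * B.1 1 0 = A.1 1 0 * B.1 0 1 ∧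
    A.1 0 1 * (B.1 0 0 - B.1 1 1) = B.1 0 1 * (A.1 0 0 - A.1 1 1) ∧
    A.1 1 0 * (B.1 0 0 - B.1 1 1) = B.1 1 0 * (A.1 0 0 - A.1 1 1) := by
  obtain ⟨a1, a2, a3, a4⟩ := sl2_mul A B
  obtain ⟨b1, b2, b3, b4⟩ := sl2_mul B A
  rw [commute_iff_eq, sl2_ext_iff, a1, a2, a3, a4, b1, b2, b3, b4]
  constructor
  · rintro ⟨h1, h2, h3, h4⟩
    exact ⟨by linarith, by linarith, by linarith⟩
  · rintro ⟨h1, h2, h3⟩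
    exact ⟨by linarith, by linarith, by linarith, by linarith⟩

theorem sl2_eq_one_or_neg {A : SL(2, ℤ)} (h1 : A.1 0 1 = 0) (h2 : A.1 1 0 = 0) (h3 : A.1 0 0 = A.1 1 1) :
    A = 1 ∨ A = -1 := by
  have := sl2_det A
  rw [h1, zero_mul, sub_zero, h3] at this
  rcases mul_self_eq_one_iff.1 this with h | h
  · left; rw [sl2_ext_iff, h1, h2, h3, h]; simp
  · right; rw [sl2_ext_iff, h1, h2, h3, h]; simp

theorem sl2_commute_trans {A B C : SL(2, ℤ)} (hA : ¬(A = 1 ∨ A = -1)) (hB : Commute A B) (hC : Commute A C) :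
    Commute B C := by
  rw [sl2_commute_iff] at hB hC ⊢
  obtain ⟨b1, b2, b3⟩ := hB
  obtain ⟨c1, c2, c3⟩ := hC
  by_cases h1 : A.1 0 1 = 0
  · by_cases h2 : A.1 1 0 = 0
    · have h3 : A.1 0 0 - A.1 1 1 ≠ 0 := fun h => hA (sl2_eq_one_or_neg h1 h2 (sub_eq_zero.1 h))
      rw [h1, zero_mul, eq_comm, mul_eq_zero, or_iff_left h3] at b2 c2
      rw [h2, zero_mul, eq_comm, mul_eq_zero, or_iff_left h3] at b3 c3
      simp [b2, b3, c2, c3]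
    · refine ⟨mul_left_cancel₀ h2 ?_, mul_left_cancel₀ (mul_ne_zero h2 h2) ?_, mul_left_cancel₀ h2 ?_⟩
      · linear_combination B.1 1 0 * c1 - C.1 1 0 * b1
      · rw [h1] at b1 c1
        have b4 : B.1 0 1 = 0 := by simpa [h2] using b1.symm
        have c4 : C.1 0 1 = 0 := by simpa [h2] using c1.symm
        simp [b4, c4]
      · linear_combination B.1 1 0 * c3 - C.1 1 0 * b3
  · refine ⟨mul_left_cancel₀ h1 ?_, mul_left_cancel₀ h1 ?_, mul_left_cancel₀ (mul_ne_zero h1 h1) ?_⟩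
    · linear_combination B.1 0 1 * c1 - C.1 0 1 * b1
    · linear_combination B.1 0 1 * c2 - C.1 0 1 * b2
    · linear_combination A.1 0 1 * (C.1 0 0 - C.1 1 1) * b1 - A.1 0 1 * (B.1 0 0 - B.1 1 1) * c1 +
        A.1 1 0 * B.1 0 1 * c2 - A.1 1 0 * C.1 0 1 * b2

/-- The trace. -/
def sl2Tr (A : SL(2, ℤ)) : ℤ := A.1 0 0 + A.1 1 1

theorem sl2Tr_comm (A B : SL(2, ℤ)) : sl2Tr (A * B) = sl2Tr (B * A) := by
  obtain ⟨a1, -, -, a4⟩ := sl2_mul A B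
  obtain ⟨b1, -, -, b4⟩ := sl2_mul B A
  rw [sl2Tr, sl2Tr, a1, a4, b1, b4]; ring

theorem sl2_sq (A : SL(2, ℤ)) : (A * A).1 0 0 = sl2Tr A * A.1 0 0 - 1 ∧ (A * A).1 0 1 = sl2Tr A * A.1 0 1 ∧
    (A * A).1 1 0 = sl2Tr A * A.1 1 0 ∧ (A * A).1 1 1 = sl2Tr A * A.1 1 1 - 1 := by
  obtain ⟨a1, a2, a3, a4⟩ := sl2_mul A A
  have := sl2_det A
  rw [a1, a2, a3, a4, sl2Tr]
  exact ⟨by linear_combination -this, by ring, by ring, by linear_combination -this⟩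

theorem sl2Tr_sq (A : SL(2, ℤ)) : sl2Tr (A * A) = sl2Tr A ^ 2 - 2 := by
  obtain ⟨h1, -, -, h4⟩ := sl2_sq A
  rw [sl2Tr, h1, h4, sl2Tr]; ring

theorem sl2_sq_eq {A : SL(2, ℤ)} (h : A * A = 1 ∨ A * A = -1) (hA : ¬(A = 1 ∨ A = -1)) :
    A * A = -1 ∧ sl2Tr A = 0 := by
  obtain ⟨h1, h2, h3, h4⟩ := sl2_sq A
  have ht : sl2Tr A = 0 := by
    by_contra ht
    have e : (A * A).1 0 1 = 0 ∧ (A * A).1 1 0 = 0 ∧ (A * A).1 0 0 = (A * A).1 1 1 := by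
      rcases h with h | h <;> rw [h] <;> simp
    obtain ⟨e1, e2, e3⟩ := e
    rw [h2] at e1
    rw [h3] at e2
    rw [h1, h4] at e3
    refine hA (sl2_eq_one_or_neg ?_ ?_ (mul_left_cancel₀ ht (by linarith)))
    · simpa [ht] using e1
    · simpa [ht] using e2
  refine ⟨h.resolve_left fun h => ?_, ht⟩
  rw [h, ht] at h1
  simp at h1

theorem sl2_cube {A : SL(2, ℤ)} (h : A * A * A = 1 ∨ A * A * A = -1) (hA : ¬(A = 1 ∨ A = -1)) :
    (A * A * A = 1 ∧ sl2Tr A = -1) ∨ (A * A * A = -1 ∧ sl2Tr A = 1) := by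
  obtain ⟨h1, h2, h3, h4⟩ := sl2_sq A
  obtain ⟨a1, a2, a3, a4⟩ := sl2_mul (A * A) A
  have hd := sl2_det A
  set t := sl2Tr A with ht
  rw [sl2Tr] at ht
  have a1' : (A * A * A).1 0 0 = (t ^ 2 - 1) * A.1 0 0 - t := by
    rw [a1, h1, h2, ht]; linear_combination -(A.1 0 0 + A.1 1 1) * hd
  have a2' : (A * A * A).1 0 1 = (t ^ 2 - 1) * A.1 0 1 := by rw [a2, h1, h2, ht]; ring
  have a3' : (A * A * A).1 1 0 = (t ^ 2 - 1) * A.1 1 0 := by rw [a3, h3, h4, ht]; ring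
  have a4' : (A * A * A).1 1 1 = (t ^ 2 - 1) * A.1 1 1 - t := by
    rw [a4, h3, h4, ht]; linear_combination -(A.1 0 0 + A.1 1 1) * hd
  have ht1 : t ^ 2 - 1 = 0 := by
    by_contra h0
    have e : (A * A * A).1 0 1 = 0 ∧ (A * A * A).1 1 0 = 0 ∧ (A * A * A).1 0 0 = (A * A * A).1 1 1 := by
      rcases h with h | h <;> rw [h] <;> simp
    obtain ⟨e1, e2, e3⟩ := e
    refine hA (sl2_eq_one_or_neg ?_ ?_ (mul_left_cancel₀ h0 (by linarith)))
    · simpa [h0] using a2'.symm.trans e1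
    · simpa [h0] using a3'.symm.trans e2
  rw [ht1, zero_mul, zero_sub] at a1'
  rcases h with h | h
  · left
    refine ⟨h, ?_⟩
    rw [h] at a1'
    simp at a1'
    linarith
  · right
    refine ⟨h, ?_⟩
    rw [h] at a1'
    simp at a1'
    linarith

theorem sl2_eq_of_commute {A E S : SL(2, ℤ)} (hAE : Commute A E) (t1 : sl2Tr S = 0) (t2 : sl2Tr (S * A) = -1)
    (hy : sl2Tr (S * E) = 1 ∨ sl2Tr (S * E) = -1) : (E = A ∨ E = -A) ∨ (A * E = 1 ∨ A * E = -1) := by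
  obtain ⟨c1, c2, c3⟩ := sl2_commute_iff.1 hAE
  obtain ⟨p1, -, -, p4⟩ := sl2_mul S A
  obtain ⟨q1, -, -, q4⟩ := sl2_mul S E
  obtain ⟨r1, r2, r3, r4⟩ := sl2_mul A E
  have dE := sl2_det E
  have dA := sl2_det A
  rw [sl2Tr, p1, p4] at t2
  rw [sl2Tr, q1, q4] at hy
  rw [sl2Tr] at t1
  rw [sl2_ext_iff, sl2_ext_iff, Matrix.SpecialLinearGroup.coe_neg]
  simp only [Matrix.neg_apply]
  suffices H : (E.1 0 0 = A.1 0 0 ∧ E.1 0 1 = A.1 0 1 ∧ E.1 1 0 = A.1 1 0 ∧ E.1 1 1 = A.1 1 1 ∨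
      E.1 0 0 = -A.1 0 0 ∧ E.1 0 1 = -A.1 0 1 ∧ E.1 1 0 = -A.1 1 0 ∧ E.1 1 1 = -A.1 1 1) ∨
      ((A * E).1 0 1 = 0 ∧ (A * E).1 1 0 = 0 ∧ (A * E).1 0 0 = (A * E).1 1 1) from
    H.imp_right fun ⟨h1, h2, h3⟩ => sl2_eq_one_or_neg h1 h2 h3
  rw [r1, r2, r3, r4]
  generalize A.1 0 0 = a, A.1 0 1 = b, A.1 1 0 = c, A.1 1 1 = d, E.1 0 0 = e, E.1 0 1 = f, E.1 1 0 = g,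
    E.1 1 1 = h, S.1 0 0 = x, S.1 0 1 = s, S.1 1 0 = t, S.1 1 1 = u at *
  obtain rfl : u = -x := by linarith
  obtain ⟨y, hy2⟩ : ∃ y, y = -(x * e + s * g + (t * f + -x * h)) := ⟨_, rfl⟩
  have k1 : f = y * b := by
    rw [hy2]; linear_combination f * t2 + x * c2 + s * c1
  have k2 : g = y * c := by
    rw [hy2]; linear_combination g * t2 + x * c3 - t * c1
  have k3 : e - h = y * (a - d) := by
    rw [hy2]; linear_combination (e - h) * t2 - t * c2 - s * c3
  have hy1 : y = 1 ∨ y = -1 := by rcases hy with hy | hy <;> [right; left] <;> linarith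
  have y2 : y * y = 1 := by rcases hy1 with h | h <;> rw [h] <;> norm_num
  have key : (h - y * d) * (h + y * a) = 0 := by
    rw [k1, k2, show e = h + y * (a - d) by linarith] at dE
    linear_combination dE - dA + (-a * d + b * c) * y2
  rcases mul_eq_zero.1 key with h0 | h0
  · left
    rcases hy1 with rfl | rfl
    · left; exact ⟨by linarith, by linarith, by linarith, by linarith⟩
    · right; exact ⟨by linarith, by linarith, by linarith, by linarith⟩
  · right
    obtain rfl : h = -y * a := by linarith
    obtain rfl : e = -y * d := by linarith
    rw [k1, k2]
    exact ⟨by ring, by ring, by ring⟩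

/-- Two noncommuting matrices satisfying the braid relation. -/
structure BraidPair (A B : SL(2, ℤ)) : Prop where
  braid : A * B * A = B * A * B
  not_commute : ¬Commute A B

namespace BraidPair

variable {A B : SL(2, ℤ)}

theorem eq_of_commute (h : BraidPair A B) {C : SL(2, ℤ)} (hA : Commute C A) (hB : Commute C B) :
    C = 1 ∨ C = -1 := by
  by_contra hC
  exact h.not_commute (sl2_commute_trans hC hA hB)

theorem commute_cube (h : BraidPair A B) : A * B * A * (A * B * A) = 1 ∨ A * B * A * (A * B * A) = -1 := by
  have e1 : A * B * A * A = B * (A * B * A) :=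
    (congrArg (· * A) h.braid).trans (by simp only [mul_assoc])
  have e2 : A * B * A * B = A * (A * B * A) := by
    calc _ = A * (B * A * B) := by simp [mul_assoc]
      _ = _ := by rw [← h.braid]
  apply h.eq_of_commute
  · rw [commute_iff_eq]
    calc A * B * A * (A * B * A) * A = A * B * A * (A * B * A * A) := by simp only [mul_assoc]
      _ = A * B * A * B * (A * B * A) := by rw [e1]; simp only [mul_assoc]
      _ = A * (A * B * A * (A * B * A)) := by rw [e2]; simp only [mul_assoc]
  · rw [commute_iff_eq]
    calc A * B * A * (A * B * A) * B = A * B * A * (A * B * A * B) := by simp only [mul_assoc]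
      _ = A * B * A * A * (A * B * A) := by rw [e2]; simp only [mul_assoc]
      _ = B * (A * B * A * (A * B * A)) := by rw [e1]; simp only [mul_assoc]

theorem sq_eq (h : BraidPair A B) : A * B * A * (A * B * A) = -1 ∧ sl2Tr (A * B * A) = 0 := by
  refine sl2_sq_eq h.commute_cube fun hS => h.not_commute ?_
  have e1 : A * B * A * A = B * (A * B * A) :=
    (congrArg (· * A) h.braid).trans (by simp only [mul_assoc])
  have : A = B := by rcases hS with hS | hS <;> rw [hS] at e1 <;> simpa using e1
  rw [this]

theorem tr_mul (h : BraidPair A B) : sl2Tr (A * B) = 1 := by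
  have hW : ¬(A * B = 1 ∨ A * B = -1) := by
    intro hW
    apply h.not_commute
    have : A = B := by
      have e2 : A * B * A * B = A * (A * B * A) := by
        calc _ = A * (B * A * B) := by simp [mul_assoc]
          _ = _ := by rw [← h.braid]
      rcases hW with hW | hW <;> rw [hW] at e2 <;> simpa using e2.symm
    rw [this]
  have e : A * B * (A * B) * (A * B) = -1 := by
    rw [← h.sq_eq.1]
    calc A * B * (A * B) * (A * B) = A * B * A * (B * A * B) := by simp only [mul_assoc]
      _ = _ := by rw [← h.braid]
  rcases sl2_cube (Or.inr e) hW with h1 | h1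
  · rw [e] at h1
    have := (sl2_ext_iff.1 h1.1).1
    simp at this
  · exact h1.2

theorem tr_mul_left (h : BraidPair A B) : sl2Tr (A * B * A * A) = -1 := by
  have : A * B * A * A = (B * A) * (B * A) := by rw [h.braid]; simp only [mul_assoc]
  rw [this, sl2Tr_sq, sl2Tr_comm, h.tr_mul]
  norm_num

theorem tr_ne_zero (h : BraidPair A B) : sl2Tr A ≠ 0 := by
  intro ht
  have h1 := h.sq_eq.2
  have h2 := h.tr_mul_left
  set S := A * B * A
  obtain ⟨s1, -, -, s4⟩ := sl2_mul S A
  have dS := sl2_det S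
  have dA := sl2_det A
  rw [sl2Tr, s1, s4] at h2
  rw [sl2Tr] at ht h1
  have e1 : S.1 1 1 = -S.1 0 0 := by linarith
  have e2 : A.1 1 1 = -A.1 0 0 := by linarith
  rw [e1] at dS h2
  rw [e2] at dA h2
  have k1 : (2 * (S.1 0 0 * A.1 0 0) + 1) ^ 2 = (S.1 0 1 * A.1 1 0 + S.1 1 0 * A.1 0 1) ^ 2 := by
    rw [show 2 * (S.1 0 0 * A.1 0 0) + 1 = -(S.1 0 1 * A.1 1 0 + S.1 1 0 * A.1 0 1) by linarith]; ring
  have k2 : (S.1 0 1 * S.1 1 0) * (A.1 0 1 * A.1 1 0) = (1 + S.1 0 0 ^ 2) * (1 + A.1 0 0 ^ 2) := by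
    rw [show S.1 0 1 * S.1 1 0 = -(1 + S.1 0 0 ^ 2) by linarith,
      show A.1 0 1 * A.1 1 0 = -(1 + A.1 0 0 ^ 2) by linarith]; ring
  nlinarith [sq_nonneg (S.1 0 1 * A.1 1 0 - S.1 1 0 * A.1 0 1), sq_nonneg (S.1 0 0 - A.1 0 0),
    sq_nonneg (S.1 0 0), sq_nonneg (A.1 0 0)]

theorem not_commute_sq (h : BraidPair A B) : ¬Commute (A * A) (B * B) := by
  intro hc
  have hA : ∀ C : SL(2, ℤ), sl2Tr C ≠ 0 → ∀ D : SL(2, ℤ), Commute (C * C) D → Commute C D := by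
    intro C hC D hD
    obtain ⟨c1, c2, c3, c4⟩ := sl2_sq C
    rw [sl2_commute_iff, c1, c2, c3, c4] at hD
    rw [sl2_commute_iff]
    obtain ⟨d1, d2, d3⟩ := hD
    exact ⟨mul_left_cancel₀ hC (by linarith), mul_left_cancel₀ hC (by linarith),
      mul_left_cancel₀ hC (by linarith)⟩
  have h' : BraidPair B A := ⟨h.braid.symm, fun hc => h.not_commute hc.symm⟩
  exact h.not_commute (hA _ h'.tr_ne_zero _ (hA _ h.tr_ne_zero _ hc).symm).symm

/-- A matrix commuting with `A` whose product with `A * B` has central cube is `± 1` or `± A²`. -/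
theorem dichotomy (h : BraidPair A B) {D : SL(2, ℤ)} (hAD : Commute A D)
    (h1 : A * B * D * (A * B * D) * (A * B * D) = 1 ∨ A * B * D * (A * B * D) * (A * B * D) = -1) :
    (D = 1 ∨ D = -1) ∨ (D = A * A ∨ D = -(A * A)) := by
  have hR : ¬(A * B * D = 1 ∨ A * B * D = -1) := by
    intro hR
    apply h.not_commute
    have : A * B = D⁻¹ ∨ A * B = -D⁻¹ := by
      rcases hR with hR | hR
      · left; exact eq_inv_of_mul_eq_one_left hR
      · right
        rw [← neg_eq_iff_eq_neg]
        exact eq_inv_of_mul_eq_one_left (by rw [neg_mul, hR, neg_neg])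
    have h2 : Commute A (A * B) := by
      rcases this with h | h <;> rw [h]
      · exact hAD.inv_right
      · exact (hAD.inv_right).neg_right
    have := h2.eq
    rw [mul_assoc A B A, mul_left_cancel_iff] at this
    exact this
  obtain ⟨E, rfl⟩ : ∃ E, D = A * E := ⟨A⁻¹ * D, by simp⟩
  have hAE : Commute A E := by
    have := hAD.eq
    rw [mul_assoc A E A, mul_left_cancel_iff] at this
    exact this
  rw [← mul_assoc (A * B) A E] at hR h1
  have hy : sl2Tr (A * B * A * E) = 1 ∨ sl2Tr (A * B * A * E) = -1 := by
    rcases sl2_cube h1 hR with h | h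
    · exact Or.inr h.2
    · exact Or.inl h.2
  rcases sl2_eq_of_commute hAE h.sq_eq.2 h.tr_mul_left hy with (rfl | rfl) | h
  · exact Or.inr (Or.inl rfl)
  · exact Or.inr (Or.inr (mul_neg _ _))
  · exact Or.inl h

end BraidPair

open FreeGroup (kap)
open scoped MatrixGroups Matrix

/-! ### Endomorphisms compatible with the permutation -/

theorem gamma_not_anticommute {A B : SL(2, ℤ)} (hA : A ∈ CongruenceSubgroup.Gamma 2)
    (hB : B ∈ CongruenceSubgroup.Gamma 2) : A * B ≠ -(B * A) := by
  intro h
  rw [CongruenceSubgroup.Gamma_mem] at hA hB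
  obtain ⟨h1, -, -, -⟩ := sl2_ext_iff.1 h
  rw [Matrix.SpecialLinearGroup.coe_neg, Matrix.neg_apply, (sl2_mul A B).1, (sl2_mul B A).1] at h1
  obtain ⟨a1, a2, a3, -⟩ := hA
  obtain ⟨b1, b2, b3, -⟩ := hB
  have e : ∀ x : ℤ, (x : ZMod 2) = 0 → ∃ k, x = 2 * k := fun x hx =>
    (ZMod.intCast_zmod_eq_zero_iff_dvd x 2).1 hx
  have o : ∀ x : ℤ, (x : ZMod 2) = 1 → ∃ k, x = 2 * k + 1 := fun x hx => by
    obtain ⟨k, hk⟩ := e (x - 1) (by rw [Int.cast_sub, hx]; simp)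
    exact ⟨k, by linarith⟩
  obtain ⟨a, ha⟩ := o _ a1
  obtain ⟨b, hb⟩ := e _ a2
  obtain ⟨c, hc⟩ := e _ a3
  obtain ⟨a', ha'⟩ := o _ b1
  obtain ⟨b', hb'⟩ := e _ b2
  obtain ⟨c', hc'⟩ := e _ b3
  rw [ha, hb, hc, ha', hb', hc'] at h1
  ring_nf at h1
  omega

theorem U_not_commute {A B : SL(2, ℤ)} (hA : A ∈ CongruenceSubgroup.Gamma 2)
    (hB : B ∈ CongruenceSubgroup.Gamma 2) : ¬Commute (U1 * A) (U2 * B) := by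
  intro h
  have h1 := h.map (Matrix.SpecialLinearGroup.map (n := Fin 2) (Int.castRingHom (ZMod 2)))
  rw [map_mul, map_mul, MonoidHom.mem_ker.1 hA, MonoidHom.mem_ker.1 hB, mul_one, mul_one] at h1
  revert h1
  rw [commute_iff_eq]
  decide

theorem exists_MRep_mul {n : ℕ} (h : 3 ≤ n) {g k : ArtinB n} {U : SL(2, ℤ)} (hk : MRep n k U)
    (hg : prm n g = prm n k) : ∃ A ∈ CongruenceSubgroup.Gamma 2, MRep n g (U * A) := by
  obtain ⟨A, hA, hA', -⟩ := exists_MRep_of_pure h (p := k⁻¹ * g) (by rw [map_mul, map_inv, hg, inv_mul_cancel])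
  have := hk.mul hA'
  rw [mul_inv_cancel_left] at this
  exact ⟨A, hA, this⟩

theorem exists_braidPair {n : ℕ} (h : 3 ≤ n) {φ : ArtinB n →* ArtinB n} (hφ : ∀ g, prm n (φ g) = prm n g) :
    ∃ A B, MRep n (φ (sg n (n - 3))) A ∧ MRep n (φ (sg n (n - 2))) B ∧ BraidPair A B := by
  obtain ⟨A, hA, hA'⟩ := exists_MRep_mul h (MRep.sg_sub_three h) (hφ _)
  obtain ⟨B, hB, hB'⟩ := exists_MRep_mul h (MRep.sg_sub_two h) (hφ _)
  refine ⟨_, _, hA', hB', ((hA'.mul hB').mul hA').unique h ?_, U_not_commute hA hB⟩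
  rw [← map_mul, ← map_mul]
  have := sg_braid (n := n) (i := n - 3) (by omega)
  rw [show n - 3 + 1 = n - 2 by omega] at this
  rw [this, map_mul, map_mul]
  exact (hB'.mul hA').mul hB'

section

variable {n : ℕ} {φ : ArtinB n →* ArtinB n}

theorem hom_conj_mem_iff (hφ : ∀ g, prm n (φ g) = prm n g) {M N : Set ℕ} {g x : ArtinB n}
    (h : prm n g '' M = N) : φ (g * x * g⁻¹) ∈ NM n N ↔ φ x ∈ NM n M := by
  rw [map_mul, map_mul, map_inv]
  exact conj_mem_NM_iff (by rw [hφ, h])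

theorem hom_mem_iff_of_commute (hφ : ∀ g, prm n (φ g) = prm n g) {M N : Set ℕ} {g x : ArtinB n}
    (hc : Commute x g) (h : prm n g '' M = N) : φ x ∈ NM n N ↔ φ x ∈ NM n M := by
  rw [← hom_conj_mem_iff hφ h, ← hc.eq, mul_inv_cancel_right]

theorem hom_mem_M0 (h : 3 ≤ n) (hφ : ∀ g, prm n (φ g) = prm n g) {x : ArtinB n} (hx : prm n x = 1)
    (h1 : Commute x (sg n (n - 3))) (h2 : Commute x (sg n (n - 2))) : φ x ∈ NM n (M0 n) := by
  obtain ⟨A, B, hA, hB, hAB⟩ := exists_braidPair h hφ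
  obtain ⟨C, -, hC, hC'⟩ := exists_MRep_of_pure h ((hφ x).trans hx)
  exact hC' (hAB.eq_of_commute (hC.commute h hA (h1.map φ)) (hC.commute h hB (h2.map φ)))

theorem M0_coe (h : 3 ≤ n) : (({n - 3, n - 2, n - 1} : Finset ℕ) : Set ℕ) = M0 n := by
  ext i
  simp only [M0, Finset.coe_insert, Finset.coe_singleton, Set.mem_ofPred_eq, Set.mem_insert_iff,
    Set.mem_singleton_iff]
  omega

theorem M0_card (h : 3 ≤ n) : ({n - 3, n - 2, n - 1} : Finset ℕ).card = 3 := by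
  rw [Finset.card_eq_three]
  exact ⟨n - 3, n - 2, n - 1, by omega, by omega, by omega, rfl⟩

theorem prm_ascProd_lt {k i : ℕ} (hk : k < n) (hi : i < k) : prm n (ascProd (sg n) 0 k) i = i + 1 := by
  induction k with
  | zero => omega
  | succ k ih =>
    rw [ascProd_succ, zero_add, map_mul, Equiv.Perm.mul_apply, prm_sg (by omega)]
    by_cases h : i = k
    · subst h
      rw [Equiv.swap_apply_left]
      exact prm_BS_of_ge (m := i + 1) (by omega) le_rfl (ascProd_mem_BS (by omega))
    · rw [Equiv.swap_apply_of_ne_of_ne h (by omega), ih (by omega) (by omega)]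

theorem prm_ρB_pow {i k : ℕ} (h : i + k < n) : prm n (ρB n ^ k) i = i + k := by
  induction k with
  | zero => simp
  | succ k ih =>
    rw [pow_succ', map_mul, Equiv.Perm.mul_apply, ih (by omega), ρB_eq_αB_mul (by omega), map_mul,
      prm_last (by omega), mul_one, αB, prm_ascProd_lt (by omega) (by omega), add_assoc]

theorem ρB_pow_mul_sg {i k : ℕ} (h : i + k + 1 < n) : ρB n ^ k * sg n i = sg n (i + k) * ρB n ^ k := by
  induction k with
  | zero => simp
  | succ k ih =>
    rw [pow_succ', mul_assoc, ih (by omega), ← mul_assoc, ρB_mul_sg (by omega), mul_assoc, add_assoc]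

theorem ρB_pow_conj_sg {i k : ℕ} (h : i + k + 1 < n) : ρB n ^ k * sg n i * (ρB n ^ k)⁻¹ = sg n (i + k) := by
  rw [ρB_pow_mul_sg h, mul_inv_cancel_right]

theorem ρB_pow_conj_sg_sq {i k : ℕ} (h : i + k + 1 < n) :
    ρB n ^ k * sg n i ^ 2 * (ρB n ^ k)⁻¹ = sg n (i + k) ^ 2 := by
  rw [← conj_pow, ρB_pow_conj_sg h]

theorem image_three (σ : Equiv.Perm ℕ) (a b c : ℕ) :
    σ '' (({a, b, c} : Finset ℕ) : Set ℕ) = (({σ a, σ b, σ c} : Finset ℕ) : Set ℕ) := by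
  simp [Set.image_insert_eq]

theorem hom_commutator_notMem (hφ : ∀ g, prm n (φ g) = prm n g) {i : ℕ} (hi : i + 2 < n) :
    φ (sg n i ^ 2) * φ (sg n (i + 1) ^ 2) * (φ (sg n i ^ 2))⁻¹ * (φ (sg n (i + 1) ^ 2))⁻¹ ∉
      NM n (({i, i + 1, i + 2} : Finset ℕ) : Set ℕ) := by
  have h : 3 ≤ n := by omega
  have e : φ (sg n i ^ 2) * φ (sg n (i + 1) ^ 2) * (φ (sg n i ^ 2))⁻¹ * (φ (sg n (i + 1) ^ 2))⁻¹ =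
    φ (sg n i ^ 2 * sg n (i + 1) ^ 2 * (sg n i ^ 2)⁻¹ * (sg n (i + 1) ^ 2)⁻¹) := by simp
  rw [e]
  obtain ⟨k, rfl⟩ : ∃ k, n = i + k + 3 := ⟨n - i - 3, by omega⟩
  have hM : prm (i + k + 3) (ρB (i + k + 3) ^ k) '' (({i, i + 1, i + 2} : Finset ℕ) : Set ℕ) =
      M0 (i + k + 3) := by
    rw [image_three, prm_ρB_pow (by omega), prm_ρB_pow (by omega), prm_ρB_pow (by omega), ← M0_coe h]
    rw [show i + k + 3 - 3 = i + k by omega, show i + k + 3 - 2 = i + 1 + k by omega,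
      show i + k + 3 - 1 = i + 2 + k by omega]
  rw [← hom_conj_mem_iff hφ hM]
  have e2 : ∀ g x y : ArtinB (i + k + 3), g * (x * y * x⁻¹ * y⁻¹) * g⁻¹ =
    g * x * g⁻¹ * (g * y * g⁻¹) * (g * x * g⁻¹)⁻¹ * (g * y * g⁻¹)⁻¹ := fun g x y => by group
  rw [e2, ρB_pow_conj_sg_sq (by omega), ρB_pow_conj_sg_sq (by omega)]
  intro hmem
  obtain ⟨A, B, hA, hB, hAB⟩ := exists_braidPair h hφ
  rw [show i + k + 3 - 3 = i + k by omega] at hA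
  rw [show i + k + 3 - 2 = i + 1 + k by omega] at hB
  have pure : ∀ j, j + 1 < i + k + 3 → prm (i + k + 3) (φ (sg (i + k + 3) j * sg (i + k + 3) j)) = 1 :=
    fun j hj => by rw [hφ, ← pow_two, prm_sg_sq hj]
  have hA2 := hA.mul hA
  have hB2 := hB.mul hB
  rw [← map_mul] at hA2 hB2
  obtain ⟨A', hA', hA'', -⟩ := exists_MRep_of_pure h (pure (i + k) (by omega))
  obtain ⟨B', hB', hB'', -⟩ := exists_MRep_of_pure h (pure (i + 1 + k) (by omega))
  obtain rfl := hA''.unique h hA2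
  obtain rfl := hB''.unique h hB2
  obtain ⟨s, hs, hms⟩ := exists_MRep_of_mem_NM hmem
  have := hms.unique h (by
    rw [map_mul, map_mul, map_mul, map_inv, map_inv, pow_two, pow_two]
    exact ((hA2.mul hB2).mul hA2.inv).mul hB2.inv)
  rcases hs with rfl | rfl
  · apply hAB.not_commute_sq
    rw [eq_comm, mul_inv_eq_one, mul_inv_eq_iff_eq_mul] at this
    exact this
  · refine gamma_not_anticommute hA' hB' ?_
    rw [eq_mul_inv_iff_mul_eq, eq_mul_inv_iff_mul_eq] at this
    rw [← this]; simp

theorem pair_conj {G : Type*} [Group G] {d e a b : G} (h2 : e * a * e = a * e * a)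
    (h3 : a * b * a = b * a * b) (heb : Commute e b) :
    d * b⁻¹ * a⁻¹ * e ^ 2 * (d * b⁻¹ * a⁻¹)⁻¹ = d * e * a * b ^ 2 * (d * e * a)⁻¹ := by
  have c1 : a * b * a⁻¹ = b⁻¹ * a * b := by
    rw [mul_inv_eq_iff_eq_mul, mul_assoc, mul_assoc, eq_inv_mul_iff_mul_eq, ← mul_assoc, ← mul_assoc, h3]
  have c2 : e * a * e⁻¹ = a⁻¹ * e * a := by
    rw [mul_inv_eq_iff_eq_mul, mul_assoc, mul_assoc, eq_inv_mul_iff_mul_eq, ← mul_assoc, ← mul_assoc, h2]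
  have c3 : e * (a * b * a⁻¹) * e⁻¹ = b⁻¹ * a⁻¹ * e * (b⁻¹ * a⁻¹)⁻¹ := by
    calc e * (a * b * a⁻¹) * e⁻¹ = (e * b⁻¹) * a * (b * e⁻¹) := by rw [c1]; group
      _ = (b⁻¹ * e) * a * (e⁻¹ * b) := by rw [heb.inv_right.eq, heb.inv_left.eq]
      _ = b⁻¹ * (e * a * e⁻¹) * b := by group
      _ = _ := by rw [c2]; group
  calc _ = d * (b⁻¹ * a⁻¹ * e * (b⁻¹ * a⁻¹)⁻¹) ^ 2 * d⁻¹ := by rw [conj_pow]; group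
    _ = d * (e * (a * b * a⁻¹) * e⁻¹) ^ 2 * d⁻¹ := by rw [c3]
    _ = _ := by rw [conj_pow, conj_pow]; group

theorem hom_sq_mem_M0 (h : 5 ≤ n) (hφ : ∀ g, prm n (φ g) = prm n g) : φ (sg n (n - 4) ^ 2) ∈ NM n (M0 n) := by
  have h3 : 3 ≤ n := by omega
  obtain ⟨A, B, hA, hB, hAB⟩ := exists_braidPair h3 hφ
  have r1 := sg_braid (n := n) (i := n - 5) (by omega)
  have r2 := sg_braid (n := n) (i := n - 4) (by omega)
  have r3 := sg_braid (n := n) (i := n - 3) (by omega)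
  rw [show n - 5 + 1 = n - 4 by omega] at r1
  rw [show n - 4 + 1 = n - 3 by omega] at r2
  rw [show n - 3 + 1 = n - 2 by omega] at r3
  have hda := sg_comm (n := n) (i := n - 5) (j := n - 3) (by omega)
  have hdb := sg_comm (n := n) (i := n - 5) (j := n - 2) (by omega)
  have heb := sg_comm (n := n) (i := n - 4) (j := n - 2) (by omega)
  have hpair := pair_conj (d := sg n (n - 5)) r2 r3 heb
  have pd := prm_sg (n := n) (i := n - 5) (by omega)
  have pa := prm_sg (n := n) (i := n - 3) (by omega)
  have pb := prm_sg (n := n) (i := n - 2) (by omega)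
  set d := sg n (n - 5)
  set e := sg n (n - 4)
  set a := sg n (n - 3)
  set b := sg n (n - 2)
  set c := d * e * a * b ^ 2 * (d * e * a)⁻¹ with hc
  have cce : Commute c e := by
    have k : e = d * e * a * d * (d * e * a)⁻¹ := by
      rw [eq_mul_inv_iff_mul_eq]
      calc e * (d * e * a) = (e * d * e) * a := by group
        _ = d * e * (d * a) := by rw [← r1]; group
        _ = _ := by rw [hda.eq]; group
    rw [k]
    exact Commute.conj_iff _ |>.2 (hdb.symm.pow_left 2)
  have cca : Commute c a := by
    have k : a = d * e * a * e * (d * e * a)⁻¹ := by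
      rw [eq_mul_inv_iff_mul_eq]
      calc a * (d * e * a) = (a * d) * e * a := by group
        _ = d * (a * e * a) := by rw [← hda.eq]; group
        _ = _ := by rw [← r2]; group
    rw [k]
    exact Commute.conj_iff _ |>.2 (heb.symm.pow_left 2)
  have pe : prm n (e ^ 2) = 1 := prm_sg_sq (by omega)
  have pc : prm n c = 1 := by rw [← hpair, map_mul, map_mul, pe, mul_one, map_inv, mul_inv_cancel]
  obtain ⟨C, -, hC, hC'⟩ := exists_MRep_of_pure h3 ((hφ _).trans pc)
  obtain ⟨D, -, hD, hD'⟩ := exists_MRep_of_pure h3 ((hφ _).trans pe)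
  by_cases hC1 : C = 1 ∨ C = -1
  · have := hC' hC1
    rw [← hpair] at this
    refine (hom_conj_mem_iff hφ ?_).1 this
    have inv : ∀ σ : Equiv.Perm ℕ, (∀ i, i ∈ M0 n ↔ σ i ∈ M0 n) → σ '' M0 n = M0 n := fun σ hσ => by
      ext i
      constructor
      · rintro ⟨j, hj, rfl⟩
        exact (hσ j).1 hj
      · intro hi
        exact ⟨σ⁻¹ i, (hσ _).2 (by simpa using hi), by simp⟩
    rw [map_mul, map_mul, map_inv, map_inv, pd, pa, pb, Equiv.swap_inv, Equiv.swap_inv]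
    apply inv
    intro i
    simp only [M0, Set.mem_ofPred_eq, Equiv.Perm.mul_apply, Equiv.swap_apply_def]
    split_ifs <;> omega
  · refine hD' (by_contra fun hD1 => hAB.not_commute ?_)
    have k1 := sl2_commute_trans hC1 (hC.commute h3 hA (cca.map φ))
      (hC.commute h3 hD ((cce.pow_right 2).map φ))
    exact sl2_commute_trans hD1 k1.symm (hD.commute h3 hB ((heb.pow_left 2).map φ))

/-- Squares of generators act trivially on all `m`-element subsets not containing both strands. -/
def PairGood (φ : ArtinB n →* ArtinB n) (m : ℕ) : Prop :=
  ∀ M : Finset ℕ, M ⊆ Finset.range n → M.card = m → ¬(0 ∈ M ∧ 1 ∈ M) → φ (sg n 0 ^ 2) ∈ NM n M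

/-- The last generator acts trivially on all `m`-element subsets. -/
def LastGood (φ : ArtinB n →* ArtinB n) (m : ℕ) : Prop :=
  ∀ M : Finset ℕ, M ⊆ Finset.range n → M.card = m → φ (sg n (n - 1)) ∈ NM n M

theorem exists_preimage {M : Finset ℕ} (hM : M ⊆ Finset.range n) (g : ArtinB n) :
    ∃ N : Finset ℕ, N ⊆ Finset.range n ∧ N.card = M.card ∧ (∀ i, i ∈ N ↔ prm n g i ∈ M) ∧
      prm n g '' (N : Set ℕ) = M := by
  have key : ∀ i, i ∈ M.map (prm n g⁻¹).toEmbedding ↔ prm n g i ∈ M := fun i => by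
    rw [Finset.mem_map]
    constructor
    · rintro ⟨j, hj, rfl⟩; simpa using hj
    · intro hi
      exact ⟨_, hi, by simp⟩
  refine ⟨M.map (prm n g⁻¹).toEmbedding, fun i hi => ?_, Finset.card_map _, key, ?_⟩
  · rw [Finset.mem_map] at hi
    obtain ⟨j, hj, rfl⟩ := hi
    exact Finset.mem_range.2 (prm_lt _ (Finset.mem_range.1 (hM hj)))
  · ext i
    constructor
    · rintro ⟨j, hj, rfl⟩
      exact (key j).1 hj
    · intro hi
      exact ⟨(prm n g)⁻¹ i, (key _).2 (by simpa using hi), by simp⟩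

theorem PairGood.sq (hφ : ∀ g, prm n (φ g) = prm n g) {m : ℕ} (h : PairGood φ m) {i : ℕ} (hi : i + 1 < n)
    {M : Finset ℕ} (hM : M ⊆ Finset.range n) (hc : M.card = m) (hiM : ¬(i ∈ M ∧ i + 1 ∈ M)) :
    φ (sg n i ^ 2) ∈ NM n M := by
  obtain ⟨N, hN, hN', hN'', hNM⟩ := exists_preimage hM (ρB n ^ i)
  have := (hom_conj_mem_iff hφ hNM).2 (h N hN (hN'.trans hc) (by
    rwa [hN'', hN'', prm_ρB_pow (by omega), prm_ρB_pow (by omega), zero_add, add_comm 1]))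
  rwa [ρB_pow_conj_sg_sq (by omega), zero_add] at this

theorem pairGood_three (h : 5 ≤ n) (hφ : ∀ g, prm n (φ g) = prm n g) : PairGood φ 3 := by
  have key : ∀ M : Finset ℕ, M ⊆ Finset.range n → M.card = 3 → 0 ∉ M → φ (sg n 0 ^ 2) ∈ NM n M := by
    intro M hM hc h0
    have hlt : ∀ i ∈ M, i < n := fun i hi => Finset.mem_range.1 (hM hi)
    have move : ∀ N : Finset ℕ, N.card = 3 → (∀ i ∈ M, i ∉ N → 2 ≤ i ∧ i < n) →
        (∀ i ∈ N, i ∉ M → 2 ≤ i ∧ i < n) → φ (sg n 0 ^ 2) ∈ NM n N → φ (sg n 0 ^ 2) ∈ NM n M := by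
      intro N hN h1 h2 h3
      obtain ⟨g, hg, hg'⟩ := exists_image_eq le_rfl M N (hc.trans hN.symm) h1 h2
      refine (hom_mem_iff_of_commute hφ (commute_BI hg fun i hi _ => ?_) hg').1 h3
      exact (sg_comm (by omega)).pow_left 2
    by_cases h1 : 1 ∈ M
    · refine move {1, 2, 3} rfl (fun i hi hi' => ⟨?_, hlt i hi⟩) (fun i hi hi' => ?_) ?_
      · by_contra hlt
        obtain rfl | rfl : i = 0 ∨ i = 1 := by omega
        · exact h0 hi
        · exact hi' (by simp)
      · simp only [Finset.mem_insert, Finset.mem_singleton] at hi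
        rcases hi with rfl | rfl | rfl
        · exact absurd h1 hi'
        · omega
        · omega
      · refine (hom_conj_mem_iff hφ (g := ρB n ^ (n - 4)) (N := M0 n) ?_).1 ?_
        · rw [image_three, prm_ρB_pow (by omega), prm_ρB_pow (by omega), prm_ρB_pow (by omega),
            ← M0_coe (by omega)]
          rw [show 1 + (n - 4) = n - 3 by omega, show 2 + (n - 4) = n - 2 by omega,
            show 3 + (n - 4) = n - 1 by omega]
        · rw [ρB_pow_conj_sg_sq (by omega), zero_add]
          exact hom_sq_mem_M0 h hφ
    · refine move {n - 3, n - 2, n - 1} (M0_card (by omega)) (fun i hi _ => ⟨?_, hlt i hi⟩)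
        (fun i hi _ => ?_) ?_
      · by_contra hlt
        obtain rfl | rfl : i = 0 ∨ i = 1 := by omega
        · exact h0 hi
        · exact h1 hi
      · simp only [Finset.mem_insert, Finset.mem_singleton] at hi
        omega
      · rw [M0_coe (by omega)]
        exact hom_mem_M0 (by omega) hφ (prm_sg_sq (by omega)) ((sg_comm (by omega)).pow_left 2)
          ((sg_comm (by omega)).pow_left 2)
  intro M hM hc h01
  by_cases h0 : 0 ∈ M
  · obtain ⟨N, hN, hN', hN'', hNM⟩ := exists_preimage hM (sg n 0)
    refine (hom_mem_iff_of_commute hφ ((Commute.refl _).pow_left 2) hNM).2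
      (key N hN (hN'.trans hc) ?_)
    rw [hN'', prm_sg (by omega), Equiv.swap_apply_left]
    exact fun h1 => h01 ⟨h0, h1⟩
  · exact key M hM hc h0

theorem PairGood.succ (h : 5 ≤ n) (hφ : ∀ g, prm n (φ g) = prm n g) {m : ℕ} (hm : 3 ≤ m)
    (hP : PairGood φ m) : PairGood φ (m + 1) := by
  intro M hM hc h01
  have hlt : ∀ i ∈ M, i < n := fun i hi => Finset.mem_range.1 (hM hi)
  have hc2 : 3 ≤ (M.filter (2 ≤ ·)).card := by
    have : (M.filter fun i => ¬2 ≤ i).card ≤ 1 := by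
      rw [Finset.card_le_one]
      intro a ha b hb
      simp only [Finset.mem_filter] at ha hb
      by_contra hab
      obtain ⟨rfl, rfl⟩ | ⟨rfl, rfl⟩ : a = 0 ∧ b = 1 ∨ a = 1 ∧ b = 0 := by omega
      · exact h01 ⟨ha.1, hb.1⟩
      · exact h01 ⟨hb.1, ha.1⟩
    have := Finset.card_filter_add_card_filter_not (s := M) (2 ≤ ·)
    omega
  obtain ⟨N, g, hN, hNc, h01', h234, hg, hgM⟩ : ∃ (N : Finset ℕ) (g : ArtinB n), N ⊆ Finset.range n ∧
      N.card = m + 1 ∧ ¬(0 ∈ N ∧ 1 ∈ N) ∧ (2 ∈ N ∧ 3 ∈ N ∧ 4 ∈ N) ∧ g ∈ BI n 2 n ∧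
      prm n g '' M = N := by
    obtain ⟨T, hT, hT3⟩ := Finset.exists_subset_card_eq hc2
    obtain ⟨g, hg, hgM⟩ := exists_image_eq le_rfl T {2, 3, 4} hT3 (a := 2)
      (fun i hi _ => by have := Finset.mem_filter.1 (hT hi); exact ⟨this.2, hlt i this.1⟩)
      (fun i hi _ => by simp only [Finset.mem_insert, Finset.mem_singleton] at hi; omega)
    obtain ⟨N, hN, hN', hN'', hNM⟩ := exists_preimage hM g⁻¹
    have fix : ∀ i, i < 2 → prm n g⁻¹ i = i := by
      intro i hi
      have : BI n 2 n ≤ ((MulAction.stabilizer (Equiv.Perm ℕ) i).comap (prm n)) :=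
        BI_le fun j h1 h2 => by
          rw [Subgroup.mem_comap, MulAction.mem_stabilizer_iff, prm_sg h2, Equiv.Perm.smul_def]
          exact Equiv.swap_apply_of_ne_of_ne (by omega) (by omega)
      exact this (inv_mem hg)
    have hin : ∀ i ∈ ({2, 3, 4} : Finset ℕ), i ∈ N := by
      intro i hi
      rw [hN'']
      have : i ∈ prm n g '' (T : Set ℕ) := by rw [hgM]; exact hi
      obtain ⟨j, hj, rfl⟩ := this
      simpa using (Finset.mem_filter.1 (hT hj)).1
    refine ⟨N, g, hN, hN'.trans hc, ?_, ⟨hin 2 (by simp), hin 3 (by simp), hin 4 (by simp)⟩, hg, ?_⟩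
    · rwa [hN'', hN'', fix 0 (by omega), fix 1 (by omega)]
    · rw [← hNM, Set.image_image]; simp
  refine (hom_mem_iff_of_commute hφ (commute_BI hg fun i hi _ => (sg_comm (by omega)).pow_left 2) hgM).1 ?_
  obtain ⟨h2, h3, h4⟩ := h234
  have hNe : ((N : Set ℕ)) = insert 3 ((N.erase 3 : Finset ℕ) : Set ℕ) := by
    rw [← Finset.coe_insert, Finset.insert_erase h3]
  have hNn : N.erase 3 ⊆ Finset.range n := (Finset.erase_subset _ _).trans hN
  have hcard : (N.erase 3).card = m := by rw [Finset.card_erase_of_mem h3, hNc]; rfl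
  have n3 : 3 ∉ N.erase 3 := Finset.notMem_erase _ _
  rw [hNe]
  by_contra hy
  have hnot := hom_commutator_notMem hφ (i := 2) (by omega)
  apply hnot
  refine NM_anti ?_ (commutator_mem_NM_insert (i := 2) (j := 4) (y := φ (sg n 0 ^ 2)) (fun i hi => ?_) (by omega)
    (by simp) (by simp [h2]) (by simp [h4]) (by norm_num)
    (hP _ hNn hcard fun hh => h01' ⟨Finset.mem_of_mem_erase hh.1, Finset.mem_of_mem_erase hh.2⟩)
    (hP.sq hφ (by omega) hNn hcard fun hh => n3 hh.2)
    (hP.sq hφ (by omega) hNn hcard fun hh => n3 hh.1)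
    (((sg_comm (by omega)).pow_pow 2 2).map φ) (((sg_comm (by omega)).pow_pow 2 2).map φ) hy)
  · rw [← hNe]
    intro i hi
    simp only [Finset.coe_insert, Finset.coe_singleton, Set.mem_insert_iff, Set.mem_singleton_iff] at hi
    rcases hi with rfl | rfl | rfl
    exacts [h2, h3, h4]
  · exact Finset.mem_range.1 (hNn hi)

end

open FreeGroup (kap)
open scoped MatrixGroups Matrix

/-! ### The image of the last generator -/

section

variable {n : ℕ} {φ : ArtinB n →* ArtinB n}

theorem exists_move {a b : ℕ} (hb : b ≤ n) {M T : Finset ℕ} (hM : M ⊆ Finset.range n)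
    (hT : ∀ i ∈ T, a ≤ i ∧ i < b) (hc : T.card ≤ (M.filter fun i => a ≤ i ∧ i < b).card) :
    ∃ N : Finset ℕ, ∃ g ∈ BI n a b, N ⊆ Finset.range n ∧ N.card = M.card ∧ T ⊆ N ∧
      prm n g '' M = N := by
  obtain ⟨S, hS, hS3⟩ := Finset.exists_subset_card_eq hc
  obtain ⟨g, hg, hgM⟩ := exists_image_eq hb S T hS3
    (fun i hi _ => (Finset.mem_filter.1 (hS hi)).2) (fun i hi _ => hT i hi)
  obtain ⟨N, hN, hN', hN'', hNM⟩ := exists_preimage hM g⁻¹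
  refine ⟨N, g, hg, hN, hN', fun i hi => ?_, ?_⟩
  · rw [hN'']
    have : i ∈ prm n g '' (S : Set ℕ) := by rw [hgM]; exact hi
    obtain ⟨j, hj, rfl⟩ := this
    simpa using (Finset.mem_filter.1 (hS hj)).1
  · rw [← hNM, Set.image_image]; simp

theorem commute_last_BI {g : ArtinB n} (hg : g ∈ BI n 0 (n - 1)) : Commute (sg n (n - 1)) g :=
  commute_BI hg fun _ _ _ => (sg_comm (by omega)).symm

theorem commute_xs_zero_sg {i : ℕ} (h1 : 1 ≤ i) (h : i + 1 < n) : Commute (xs n 0) (sg n i) :=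
  (sg_mul_xs_of_ne h (by omega) (by omega)).symm

theorem lastGood_three (h : 5 ≤ n) (hφ : ∀ g, prm n (φ g) = prm n g)
    (h0 : φ (sg n (n - 1)) ∈ NM n (M0 n)) : LastGood φ 3 := by
  intro M hM hc
  have hlt : ∀ i ∈ M, i < n := fun i hi => Finset.mem_range.1 (hM hi)
  by_cases hn : n - 1 ∈ M
  · obtain ⟨g, hg, hgM⟩ := exists_image_eq (Nat.sub_le n 1) M {n - 3, n - 2, n - 1}
      (hc.trans (M0_card (by omega)).symm) (a := 0)
      (fun i hi hi' => by
        have := hlt i hi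
        simp only [Finset.mem_insert, Finset.mem_singleton] at hi'
        omega)
      (fun i hi hi' => by
        simp only [Finset.mem_insert, Finset.mem_singleton] at hi
        rcases hi with rfl | rfl | rfl
        exacts [by omega, by omega, absurd hn hi'])
    rw [M0_coe (by omega)] at hgM
    exact (hom_mem_iff_of_commute hφ (commute_last_BI hg) hgM).1 h0
  · have hα : prm n (αB n) (n - 1) = 0 := by
      have := prm_ascProd (n := n) (a := 0) (k := n - 1) (by omega)
      rwa [zero_add] at this
    obtain ⟨N, hN, hN', hN'', hNM⟩ := exists_preimage hM (αB n)⁻¹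
    have hMN : prm n (αB n) '' M = N := by rw [← hNM, Set.image_image]; simp
    refine (hom_conj_mem_iff hφ hMN).1 ?_
    rw [← xs_zero (by omega)]
    have n0 : 0 ∉ N := by
      rw [hN'', ← hα, map_inv]
      simpa using hn
    have hltN : ∀ i ∈ N, i < n := fun i hi => Finset.mem_range.1 (hN hi)
    obtain ⟨g, hg, hgM⟩ := exists_image_eq le_rfl N {n - 3, n - 2, n - 1}
      ((hN'.trans hc).trans (M0_card (by omega)).symm) (a := 1)
      (fun i hi hi' => ⟨Nat.one_le_iff_ne_zero.2 fun h0 => n0 (h0 ▸ hi), hltN i hi⟩)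
      (fun i hi hi' => by
        simp only [Finset.mem_insert, Finset.mem_singleton] at hi
        omega)
    rw [M0_coe (by omega)] at hgM
    refine (hom_mem_iff_of_commute hφ (commute_BI hg fun i h1 h2 => commute_xs_zero_sg h1 h2) hgM).1 ?_
    exact hom_mem_M0 (by omega) hφ (prm_xs n 0) (commute_xs_zero_sg (by omega) (by omega))
      (commute_xs_zero_sg (by omega) (by omega))

theorem LastGood.succ (h : 5 ≤ n) (hφ : ∀ g, prm n (φ g) = prm n g) {m : ℕ} (hm : 3 ≤ m)
    (hP : PairGood φ m) (hL : LastGood φ m) : LastGood φ (m + 1) := by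
  intro M hM hc
  have hlt : ∀ i ∈ M, i < n := fun i hi => Finset.mem_range.1 (hM hi)
  have hc2 : ({0, 1, 2} : Finset ℕ).card ≤ (M.filter fun i => 0 ≤ i ∧ i < n - 1).card := by
    have : M.erase (n - 1) ⊆ M.filter fun i => 0 ≤ i ∧ i < n - 1 := fun i hi => by
      rw [Finset.mem_erase] at hi
      have := hlt i hi.2
      exact Finset.mem_filter.2 ⟨hi.2, by omega, by omega⟩
    have := Finset.card_le_card this
    have := Finset.pred_card_le_card_erase (s := M) (a := n - 1)
    simp only [Finset.card_insert_of_notMem, Finset.card_singleton, Finset.mem_insert,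
      Finset.mem_singleton, zero_ne_one, OfNat.zero_ne_ofNat, OfNat.one_ne_ofNat, or_self,
      not_false_eq_true]
    omega
  obtain ⟨N, g, hg, hN, hNc, hT, hgM⟩ := exists_move (Nat.sub_le n 1) hM (fun i hi => by
    simp only [Finset.mem_insert, Finset.mem_singleton] at hi
    omega) hc2
  refine (hom_mem_iff_of_commute hφ (commute_last_BI hg) hgM).1 ?_
  have h1 : 1 ∈ N := hT (by simp)
  have hNe : ((N : Set ℕ)) = insert 1 ((N.erase 1 : Finset ℕ) : Set ℕ) := by
    rw [← Finset.coe_insert, Finset.insert_erase h1]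
  have hNn : N.erase 1 ⊆ Finset.range n := (Finset.erase_subset _ _).trans hN
  have hcard : (N.erase 1).card = m := by rw [Finset.card_erase_of_mem h1, hNc, hc]; rfl
  have n1 : 1 ∉ N.erase 1 := Finset.notMem_erase _ _
  rw [hNe]
  by_contra hy
  apply hom_commutator_notMem hφ (i := 0) (by omega)
  refine NM_anti ?_ (commutator_mem_NM_insert (i := 0) (j := 2) (y := φ (sg n (n - 1)))
    (fun i hi => Finset.mem_range.1 (hNn hi)) (by omega)
    (by simp) (by simpa using hT (by simp)) (by simpa using hT (by simp)) (by norm_num)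
    (hL _ hNn hcard)
    (hP.sq hφ (by omega) hNn hcard fun hh => n1 hh.2)
    (hP.sq hφ (by omega) hNn hcard fun hh => n1 hh.1)
    (((sg_comm (by omega)).symm.pow_right 2).map φ) (((sg_comm (by omega)).symm.pow_right 2).map φ) hy)
  rw [← hNe]
  exact_mod_cast hT

theorem hom_last_mem (h : 5 ≤ n) (hφ : ∀ g, prm n (φ g) = prm n g)
    (h0 : φ (sg n (n - 1)) ∈ NM n (M0 n)) : φ (sg n (n - 1)) ∈ NM n (Set.Iio n) := by
  have key : ∀ m, 3 ≤ m → PairGood φ m ∧ LastGood φ m := fun m hm => by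
    induction m, hm using Nat.le_induction with
    | base => exact ⟨pairGood_three h hφ, lastGood_three h hφ h0⟩
    | succ m hm ih => exact ⟨ih.1.succ h hφ hm, ih.2.succ h hφ hm ih.1⟩
  have := (key n (by omega)).2 (Finset.range n) subset_rfl (Finset.card_range n)
  rwa [Finset.coe_range] at this

/-- The descending product `t (k - 1) * ⋯ * t 0`. -/
def descProd {G : Type*} [Mul G] [One G] (t : ℕ → G) : ℕ → G
  | 0 => 1
  | k + 1 => t k * descProd t k

theorem map_ascProd_eq_descProd {H : Type*} [Group H] {f : ArtinB n →* H} {t : ℕ → H} {m : ℕ}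
    (hf : ∀ i, i < m → f (sg n i) = t (m - 1 - i)) :
    f (ascProd (sg n) 0 m) = descProd t m := by
  have : ∀ k j, k + j = m → f (ascProd (sg n) j k) = descProd t k := by
    intro k
    induction k with
    | zero => intro j _; simp [ascProd, descProd]
    | succ k ih =>
      intro j hj
      rw [ascProd_succ', map_mul, hf j (by omega), ih (j + 1) (by omega), descProd,
        show m - 1 - j = k by omega]
  exact this m 0 rfl

/-- The element `t₁ ⋯ tₙ₋₁ rₙ tₙ₋₁ ⋯ t₁`. -/
def w1 (n : ℕ) : ArtinB n := αB n * sg n (n - 1) * descProd (sg n) (n - 1)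

theorem ι_last (h : 2 ≤ n) {ι : ArtinB n →* ArtinB n}
    (h1 : ∀ i, i + 1 < n → ι (sg n i) = sg n (n - 2 - i)) (h2 : ι (ρB n) = (ρB n)⁻¹) :
    ι (sg n (n - 1)) = (w1 n)⁻¹ := by
  have e : ι (αB n) = descProd (sg n) (n - 1) := by
    refine map_ascProd_eq_descProd fun i hi => ?_
    rw [h1 i (by omega), show n - 2 - i = n - 1 - 1 - i by omega]
  have := h2
  rw [ρB_eq_αB_mul (by omega), map_mul, e, ← eq_inv_mul_iff_mul_eq] at this
  rw [this, w1]
  group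

theorem commute_w1_sg (h : 2 ≤ n) {i : ℕ} (hi : 1 ≤ i) (hin : i + 1 < n) : Commute (w1 n) (sg n i) := by
  obtain ⟨ι, h1, h2⟩ := exists_ι h
  have := (sg_comm (n := n) (i := n - 2 - i) (j := n - 1) (by omega)).map ι
  rw [h1 _ (by omega), show n - 2 - (n - 2 - i) = i by omega, ι_last h h1 h2, Commute.inv_right_iff] at this
  exact this.symm

theorem prm_descProd_mul {k : ℕ} (hk : k < n) : prm n (descProd (sg n) k * ascProd (sg n) 0 k) = 1 := by
  induction k with
  | zero => simp [descProd, ascProd]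
  | succ k ih =>
    rw [ascProd_succ, descProd, zero_add, mul_assoc, ← mul_assoc (descProd _ _), map_mul, map_mul _ _ (sg n k),
      ih (by omega), one_mul, ← map_mul, ← pow_two, prm_sg_sq (by omega)]

theorem hom_loop_mem (hφ : ∀ g, prm n (φ g) = prm n g) (hP : PairGood φ 3) {k : ℕ} (hk : k < n)
    {M : Finset ℕ} (hM : M ⊆ Finset.range n) (hc : M.card = 3) (h : ∀ j < k, ¬(j ∈ M ∧ k ∈ M)) :
    φ (descProd (sg n) k * ascProd (sg n) 0 k) ∈ NM n M := by
  induction k generalizing M with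
  | zero => simp [descProd, ascProd]
  | succ k ih =>
    have e : descProd (sg n) (k + 1) * ascProd (sg n) 0 (k + 1) =
      sg n k * (descProd (sg n) k * ascProd (sg n) 0 k) * (sg n k)⁻¹ * sg n k ^ 2 := by
      rw [ascProd_succ, descProd, zero_add]; group
    rw [e, map_mul]
    refine mul_mem ?_ (hP.sq hφ (by omega) hM hc fun hh => h k (by omega) hh)
    obtain ⟨N, hN, hN', hN'', hNM⟩ := exists_preimage hM (sg n k)
    refine (hom_conj_mem_iff hφ hNM).2 (ih (by omega) hN (hN'.trans hc) fun j hj => ?_)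
    rw [hN'', hN'', prm_sg (by omega), Equiv.swap_apply_left,
      Equiv.swap_apply_of_ne_of_ne (by omega) (by omega)]
    exact h j (by omega)

theorem hom_cube_commute (h : 3 ≤ n) : Commute
    ((sg n (n - 3) * sg n (n - 2) * sg n (n - 1)) ^ 3) (sg n (n - 3)) ∧ Commute
    ((sg n (n - 3) * sg n (n - 2) * sg n (n - 1)) ^ 3) (sg n (n - 2)) := by
  obtain ⟨f, hf⟩ := ArtinB.exists_hom (n := 3) (fun i => sg n (n - 3 + i))
    (fun i hi => by
      obtain rfl : i = 0 := by omega
      exact sg_braid (by omega))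
    (fun i hi => by
      obtain rfl : i = 1 := by omega
      exact sg_braid_four (by omega))
    (fun i j hij hj => sg_comm (by omega))
  have e : f (ΔB 3) = (sg n (n - 3) * sg n (n - 2) * sg n (n - 1)) ^ 3 := by
    rw [ΔB, map_pow, ρB_eq]
    simp only [ascProd_succ, ascProd_zero, one_mul, zero_add, map_mul]
    rw [hf 0 (by omega), hf 1 (by omega), hf 2 (by omega), show n - 3 + 1 = n - 2 by omega,
      show n - 3 + 2 = n - 1 by omega, add_zero]
  rw [← e]
  constructor
  · have := (ΔB_comm (n := 3) (by omega) (sg 3 0)).map f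
    rwa [hf 0 (by omega)] at this
  · have := (ΔB_comm (n := 3) (by omega) (sg 3 1)).map f
    rwa [hf 1 (by omega), show n - 3 + 1 = n - 2 by omega] at this

theorem hom_w1_mem (h : 5 ≤ n) (hφ : ∀ g, prm n (φ g) = prm n g) {A B D : SL(2, ℤ)}
    (hA : MRep n (φ (sg n (n - 3))) A) (hB : MRep n (φ (sg n (n - 2))) B)
    (hD : MRep n (φ (sg n (n - 1))) D) (hAB : BraidPair A B) (hDA : D = A * A ∨ D = -(A * A)) :
    φ (w1 n) ∈ NM n (({0, 1, 2} : Finset ℕ) : Set ℕ) := by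
  have h3 : 3 ≤ n := by omega
  obtain ⟨g, hg, hgM⟩ := exists_image_eq le_rfl ({0, 1, 2} : Finset ℕ) {0, n - 2, n - 1} (n := n) (a := 1) (by
      rw [eq_comm, Finset.card_eq_three.2 ⟨0, n - 2, n - 1, by omega, by omega, by omega, rfl⟩]; rfl)
    (fun i hi hi' => by
      simp only [Finset.mem_insert, Finset.mem_singleton] at hi hi'
      omega)
    (fun i hi hi' => by
      simp only [Finset.mem_insert, Finset.mem_singleton] at hi hi'
      omega)
  refine (hom_mem_iff_of_commute hφ (commute_BI hg fun i hi hi' => commute_w1_sg (by omega) hi hi') hgM).1 ?_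
  set u := ascProd (sg n) 0 (n - 3) with hu
  have hu' : prm n u '' M0 n = (({0, n - 2, n - 1} : Finset ℕ) : Set ℕ) := by
    have e0 := prm_ascProd (n := n) (a := 0) (k := n - 3) (by omega)
    rw [zero_add] at e0
    have e1 : ∀ j, n - 2 ≤ j → prm n u j = j := fun j hj =>
      prm_BS_of_ge (m := n - 2) (by omega) hj (ascProd_mem_BS (by omega))
    rw [← M0_coe h3, image_three, e0, e1 _ le_rfl, e1 _ (by omega)]
  set v := descProd (sg n) (n - 3) * u with hv
  set L := sg n (n - 3) * sg n (n - 2) * sg n (n - 1) * sg n (n - 2) * sg n (n - 3) * v with hL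
  have eL : w1 n = u * L * u⁻¹ := by
    rw [w1, αB, hL, hv, show n - 1 = n - 3 + 1 + 1 by omega, ascProd_succ, ascProd_succ, descProd, descProd,
      zero_add, zero_add, show n - 3 + 1 = n - 2 by omega, ← hu]
    group
  rw [eL, hom_conj_mem_iff hφ hu']
  have hvM : φ v ∈ NM n (M0 n) := by
    rw [← M0_coe h3]
    refine hom_loop_mem hφ (pairGood_three h hφ) (by omega) (fun i hi => ?_) (M0_card h3) fun j hj hh => ?_
    · simp only [Finset.mem_insert, Finset.mem_singleton] at hi
      rw [Finset.mem_range]; omega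
    · have := hh.1
      simp only [Finset.mem_insert, Finset.mem_singleton] at this
      omega
  obtain ⟨s, hs, hsv⟩ := exists_MRep_of_mem_NM hvM
  have hpL : prm n (φ L) = 1 := by
    rw [hφ, hL, map_mul, prm_descProd_mul (by omega), mul_one]
    simp only [map_mul]
    rw [prm_last (by omega), mul_one, prm_sg (by omega), prm_sg (by omega)]
    simp [mul_assoc]
  refine mem_NM_of_MRep h3 hpL (A := A * B * D * B * A * s) ?_ ?_
  · rw [hL]
    simp only [map_mul] at hsv ⊢
    exact ((((hA.mul hB).mul hD).mul hB).mul hA).mul hsv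
  · have key : A * B * (A * A) * B * A = -1 := by
      have := hAB.sq_eq.1
      rw [hAB.braid] at this
      rw [← this, ← hAB.braid]
      nth_rw 2 [hAB.braid]
      nth_rw 1 [← hAB.braid]
      simp only [mul_assoc]
    rcases hDA with rfl | rfl <;> rcases hs with rfl | rfl <;> simp [key]

theorem exists_rev_perm (n : ℕ) :
    ∃ σ : Equiv.Perm ℕ, (∀ i, i < n → σ i = n - 1 - i) ∧ ∀ i, n ≤ i → σ i = i := by
  have hf : Function.Involutive fun i => if i < n then n - 1 - i else i := fun i => by
    dsimp only
    split_ifs <;> omega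
  exact ⟨hf.toPerm, fun i hi => if_pos hi, fun i hi => if_neg (by omega)⟩

theorem hom_last_mem_or (h : 5 ≤ n) (hφ : ∀ g, prm n (φ g) = prm n g) :
    φ (sg n (n - 1)) ∈ NM n (Set.Iio n) ∨ φ (w1 n) ∈ NM n (Set.Iio n) := by
  have h3 : 3 ≤ n := by omega
  obtain ⟨A, B, hA, hB, hAB⟩ := exists_braidPair h3 hφ
  obtain ⟨D, -, hD, hD'⟩ := exists_MRep_of_pure h3 ((hφ _).trans (prm_last (n := n) (by omega)))
  have hAD : Commute A D := hA.commute h3 hD ((sg_comm (by omega)).map φ)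
  obtain ⟨c1, c2⟩ := hom_cube_commute h3
  have hR := ((hA.mul hB).mul hD)
  have hR3 := (hR.mul hR).mul hR
  rw [← map_mul, ← map_mul, ← map_mul, ← map_mul, ← pow_three'] at hR3
  rcases hAB.dichotomy hAD (hAB.eq_of_commute (hR3.commute h3 hA (c1.map φ))
    (hR3.commute h3 hB (c2.map φ))) with h1 | h1
  · exact Or.inl (hom_last_mem h hφ (hD' h1))
  · right
    obtain ⟨ι, ι1, ι2⟩ := exists_ι (n := n) (by omega)
    obtain ⟨w0, hw0, hw0'⟩ := exists_rev_perm n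
    obtain ⟨g, hg⟩ := exists_prm_eq le_rfl hw0'
    have hψ : ∀ x, prm n ((φ.comp ((MulAut.conj g).toMonoidHom.comp ι)) x) = prm n x := by
      intro x
      suffices (prm n).comp (φ.comp ((MulAut.conj g).toMonoidHom.comp ι)) = prm n from DFunLike.congr_fun this x
      refine ArtinB.hom_ext fun i hi => ?_
      simp only [MonoidHom.comp_apply, MulEquiv.coe_toMonoidHom, MulAut.conj_apply]
      rw [hφ]
      by_cases hin : i + 1 < n
      · rw [ι1 i hin, map_mul, map_mul, map_inv, hg, prm_sg (by omega), prm_sg hin,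
          Equiv.mul_swap_eq_swap_mul, mul_inv_cancel_right, hw0 _ (by omega), hw0 _ (by omega),
          Equiv.swap_comm]
        congr 1 <;> omega
      · obtain rfl : i = n - 1 := by omega
        rw [ι_last (by omega) ι1 ι2, prm_last (by omega), w1, αB]
        have := prm_descProd_mul (n := n) (k := n - 1) (by omega)
        rw [map_mul, mul_eq_one_iff_eq_inv] at this
        simp [this, prm_last (n := n) (by omega)]
    have e : (φ.comp ((MulAut.conj g).toMonoidHom.comp ι)) (sg n (n - 1)) = φ (g * (w1 n)⁻¹ * g⁻¹) := by
      simp [ι_last (n := n) (by omega) ι1 ι2]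
    have hI : prm n g '' Set.Iio n = Set.Iio n := by
      ext i
      constructor
      · rintro ⟨j, hj, rfl⟩; exact prm_lt g hj
      · intro hi
        exact ⟨prm n g⁻¹ i, prm_lt _ hi, by simp⟩
    have := hom_last_mem h hψ (by
      rw [e, hom_conj_mem_iff hφ (M := (({0, 1, 2} : Finset ℕ) : Set ℕ)), map_inv, inv_mem_iff]
      · exact hom_w1_mem h hφ hA hB hD hAB h1
      · rw [image_three, hg, hw0 _ (by omega), hw0 _ (by omega), hw0 _ (by omega), ← M0_coe h3,
          show n - 1 - 0 = n - 1 by omega, show n - 1 - 1 = n - 2 by omega, show n - 1 - 2 = n - 3 by omega]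
        congr 1
        ext i
        simp only [Finset.mem_insert, Finset.mem_singleton]
        tauto)
    rwa [e, hom_conj_mem_iff hφ hI, map_inv, inv_mem_iff] at this

end

open FreeGroup (kap of kap_of_mem kap_of_notMem)

/-! ### The images of the free generators -/

theorem FreeGroup.exists_conj_zpow_of_fixed_lt {n r : ℕ} (hr : r < n) {p₁ p₂ : FreeGroup ℕ →* FreeGroup ℕ}
    {g₁ h₁ g₂ h₂ v : FreeGroup ℕ} {M : Set ℕ} (hM : M = Set.Iio n \ {r})
    (hg₁ : p₁ (of r) = g₁ * of r * g₁⁻¹) (hh₁ : ∀ j < n, kap M (p₁ (of j)) = h₁ * kap M (of j) * h₁⁻¹)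
    (hg₂ : p₂ (of r) = g₂ * of r * g₂⁻¹) (hh₂ : ∀ j < n, kap M (p₂ (of j)) = h₂ * kap M (of j) * h₂⁻¹)
    (hk₁ : kap M h₁ = h₁) (hk₂ : kap M h₂ = h₂) (hv : kap M v = 1) (hvn : kap (Set.Iio n) v = v) (hv₁ : p₁ v = v) (hv₂ : p₂ v = v)
    (hne : ¬Commute h₁ h₂ ∨ ¬Commute (h₁⁻¹ * kap M g₁) (h₂⁻¹ * kap M g₂)) :
    ∃ (c : FreeGroup ℕ) (k : ℤ), v = c * of r ^ k * c⁻¹ := by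
  have hM' : ({r}ᶜ : Set ℕ) ∩ Set.Iio n = M := by
    rw [hM, Set.sdiff_eq, Set.inter_comm]
  have hk : ∀ f : FreeGroup ℕ, kap {r}ᶜ (kap (Set.Iio n) f) = kap M f := fun f => by
    rw [FreeGroup.kap_kap, hM']
  let P : (FreeGroup ℕ →* FreeGroup ℕ) → FreeGroup ℕ → (FreeGroup ℕ →* FreeGroup ℕ) := fun p h =>
    FreeGroup.lift fun j => if j < n then kap (Set.Iio n) (p (of j)) else h * of j * h⁻¹
  have hP : ∀ p h j, P p h (of j) = if j < n then kap (Set.Iio n) (p (of j)) else h * of j * h⁻¹ :=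
    fun p h j => FreeGroup.lift_apply_of
  have P1 : ∀ p h g, p (of r) = g * of r * g⁻¹ →
      P p h (of r) = kap (Set.Iio n) g * of r * (kap (Set.Iio n) g)⁻¹ := fun p h g hg => by
    rw [hP, if_pos hr, hg, _root_.map_mul, _root_.map_mul, _root_.map_inv, kap_of_mem (M := Set.Iio n) hr]
  have P2 : ∀ p h, kap M h = h → (∀ j < n, kap M (p (of j)) = h * kap M (of j) * h⁻¹) → ∀ f,
      kap {r}ᶜ (P p h f) = h * kap {r}ᶜ f * h⁻¹ := by
    intro p h hkh hh f
    suffices (kap {r}ᶜ).comp (P p h) = (MulAut.conj h).toMonoidHom.comp (kap {r}ᶜ) from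
      DFunLike.congr_fun this f
    ext j : 1
    simp only [MonoidHom.comp_apply, MulEquiv.coe_toMonoidHom, MulAut.conj_apply]
    rw [hP]
    split_ifs with hj
    · rw [hk, hh j hj, ← hk (of j), kap_of_mem (M := Set.Iio n) hj]
    · have : kap {r}ᶜ h = h := by rw [← hkh, FreeGroup.kap_kap, ← hM', ← Set.inter_assoc, Set.inter_self]
      rw [_root_.map_mul, _root_.map_mul, _root_.map_inv, this]
  have P3 : ∀ p h, p v = v → P p h v = v := by
    intro p h hv
    have : (P p h).comp (kap (Set.Iio n)) = (kap (Set.Iio n)).comp (p.comp (kap (Set.Iio n))) := by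
      ext j : 1
      simp only [MonoidHom.comp_apply]
      by_cases hj : j < n
      · rw [kap_of_mem (M := Set.Iio n) hj, hP, if_pos hj]
      · rw [kap_of_notMem (M := Set.Iio n) hj]; simp
    have := DFunLike.congr_fun this v
    simpa only [MonoidHom.comp_apply, hvn, hv] using this
  refine exists_conj_zpow_of_fixed r (P1 p₁ h₁ g₁ hg₁) (P2 p₁ h₁ hk₁ hh₁) (P1 p₂ h₂ g₂ hg₂) (P2 p₂ h₂ hk₂ hh₂) ?_
    (P3 _ _ hv₁) (P3 _ _ hv₂) ?_
  · rw [← hvn, hk, hv]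
  · rwa [hk, hk]

section

variable {n : ℕ} {φ : ArtinB n →* ArtinB n}

theorem image_Iio (g : ArtinB n) : prm n g '' Set.Iio n = Set.Iio n := by
  ext i
  constructor
  · rintro ⟨j, hj, rfl⟩; exact prm_lt g hj
  · intro hi
    exact ⟨prm n g⁻¹ i, prm_lt _ hi, by simp⟩

theorem conj_mem_NM_Iio {g p : ArtinB n} :
    g * p * g⁻¹ ∈ NM n (Set.Iio n) ↔ p ∈ NM n (Set.Iio n) :=
  conj_mem_NM_iff (image_Iio g)

/-- Elements of the free group fixed by two independent elements acting trivially off one strand. -/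
theorem exists_conj_zpow_of_mem_NM {r i : ℕ} (hr : r < n) (hi : i < n) (hir : i ≠ r) {p q : ArtinB n}
    {M : Set ℕ} (hM : M = Set.Iio n \ {r}) (hp : p ∈ NM n M) (hq : q ∈ NM n M)
    (hpq : p * q * p⁻¹ * q⁻¹ ∉ NM n (Set.Iio n)) {v : FreeGroup ℕ} (hv : kap M v = 1)
    (hvn : kap (Set.Iio n) v = v) (hv₁ : act n p v = v) (hv₂ : act n q v = v) :
    ∃ (c : FreeGroup ℕ) (k : ℤ), v = c * of r ^ k * c⁻¹ := by
  have key : ∀ p ∈ NM n M, ∃ h g, kap M h = h ∧ (∀ f, kap M (act n p f) = h * kap M f * h⁻¹) ∧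
      act n p (of r) = g * of r * g⁻¹ ∧ Chi n M r p (h⁻¹ * kap M g) := by
    rintro p ⟨hp, h, hh⟩
    obtain ⟨g, hg⟩ := act_of p r
    rw [hp, Equiv.Perm.one_apply] at hg
    have hh' : ∀ f, kap M (act n p f) = kap M h * kap M f * (kap M h)⁻¹ := fun f => by
      rw [← FreeGroup.kap_kap_self, hh, map_mul, map_mul, map_inv, FreeGroup.kap_kap_self]
    exact ⟨kap M h, g, FreeGroup.kap_kap_self _ _, hh', hg, hp, _, g, hh', hg, rfl⟩
  obtain ⟨h₁, g₁, hk₁, hh₁, hg₁, hc₁⟩ := key p hp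
  obtain ⟨h₂, g₂, hk₂, hh₂, hg₂, hc₂⟩ := key q hq
  have hMn : insert r M = Set.Iio n := by
    rw [hM, Set.insert_sdiff_singleton, Set.insert_eq_of_mem (show r ∈ Set.Iio n from hr)]
  have hne := not_commute_of_Chi (hM ▸ Set.sdiff_subset) hr (by simp [hM]) (i := i)
    (by rw [hM]; exact ⟨hi, hir⟩) hc₁ hc₂ (hMn ▸ hpq)
  exact FreeGroup.exists_conj_zpow_of_fixed_lt (p₁ := (act n p).toMonoidHom) (p₂ := (act n q).toMonoidHom)
    hr hM hg₁ (fun j _ => hh₁ _) hg₂ (fun j _ => hh₂ _) hk₁ hk₂ hv hvn hv₁ hv₂ (Or.inr hne)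

theorem hom_sq_mem_NM (h : 5 ≤ n) (hφ : ∀ g, prm n (φ g) = prm n g) {i r : ℕ} (hi : i + 1 < n)
    (hr : r = i ∨ r = i + 1) : φ (sg n i ^ 2) ∈ NM n (Set.Iio n \ {r}) := by
  have key : ∀ m, 3 ≤ m → PairGood φ m := fun m hm => by
    induction m, hm using Nat.le_induction with
    | base => exact pairGood_three h hφ
    | succ m hm ih => exact ih.succ h hφ hm
  have := (key (n - 1) (by omega)).sq hφ hi (M := (Finset.range n).erase r) (Finset.erase_subset _ _)
    (by rw [Finset.card_erase_of_mem (by simp; omega), Finset.card_range]) (by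
      rw [Finset.mem_erase, Finset.mem_erase]; omega)
  rwa [Finset.coe_erase, Finset.coe_range] at this

theorem hom_commutator_notMem_Iio (hφ : ∀ g, prm n (φ g) = prm n g) {i : ℕ} (hi : i + 2 < n) :
    φ (sg n i ^ 2) * φ (sg n (i + 1) ^ 2) * (φ (sg n i ^ 2))⁻¹ * (φ (sg n (i + 1) ^ 2))⁻¹ ∉
      NM n (Set.Iio n) := by
  intro h
  refine hom_commutator_notMem hφ hi (NM_anti ?_ h)
  intro j hj
  simp at hj
  simp; omega

/-- `Y` records the images of the free generators under `φ`. -/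
structure FreePart (φ : ArtinB n →* ArtinB n) (Y : FreeGroup ℕ →* FreeGroup ℕ) (c : ℤ) : Prop where
  kap_eq : ∀ f, kap (Set.Iio n) (Y f) = Y f
  act_eq : ∀ g f, act n (φ g) (Y f) = Y (act n g f)
  map_xs : ∀ j < n, φ (xs n j) = X n (Y (of j)) * ΔB n ^ c
  inj : Function.Injective φ → ∀ f, Y f = 1 → kap (Set.Iio n) f = 1

theorem X_central (h : 2 ≤ n) {f : FreeGroup ℕ} (hf : ∀ j, Commute (X n f) (xs n j)) :
    kap (Set.Iio n) f = 1 := by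
  have key : ∀ j < n, of j * kap (Set.Iio n) f = kap (Set.Iio n) f * of j := fun j hj => by
    have := (hf j).eq
    rw [← X_of, ← map_mul, ← map_mul, X_eq_iff, map_mul, map_mul, kap_of_mem (M := Set.Iio n) hj] at this
    exact this.symm
  exact FreeGroup.eq_one_of_commute_of_of zero_ne_one _ (key 0 (by omega)) (key 1 (by omega))

theorem exists_freePart (h : 2 ≤ n) (hg : φ (sg n (n - 1)) ∈ NM n (Set.Iio n)) :
    ∃ Y c, FreePart φ Y c := by
  obtain ⟨f₀, c, hc⟩ := exists_X_mul_ΔB h hg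
  let Y : FreeGroup ℕ →* FreeGroup ℕ := FreeGroup.lift fun j =>
    if j < n then kap (Set.Iio n) (act n (φ (ascProd (sg n) j (n - 1 - j))) f₀) else 1
  have hY : ∀ j < n, Y (of j) = kap (Set.Iio n) (act n (φ (ascProd (sg n) j (n - 1 - j))) f₀) :=
    fun j hj => by rw [FreeGroup.lift_apply_of, if_pos hj]
  have hY' : ∀ j, n ≤ j → Y (of j) = 1 := fun j hj => by
    rw [FreeGroup.lift_apply_of, if_neg (by omega)]
  have hYx : ∀ j < n, φ (xs n j) = X n (Y (of j)) * ΔB n ^ c := fun j hj => by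
    rw [xs, if_pos hj, hY j hj, X_kap, map_mul, map_mul, map_inv, hc, ← conj_X]
    have := ((ΔB_comm h (φ (ascProd (sg n) j (n - 1 - j)))⁻¹).zpow_left c).eq
    simp only [mul_assoc]
    rw [this]
  let e : FreeGroup ℕ →* Multiplicative ℤ := FreeGroup.lift fun j =>
    if j < n then Multiplicative.ofAdd c else 1
  have he : ∀ j, e (of j) = if j < n then Multiplicative.ofAdd c else 1 := fun j => FreeGroup.lift_apply_of
  have hX : ∀ f, φ (X n f) = X n (Y f) * ΔB n ^ (e f).toAdd := by
    let E : FreeGroup ℕ →* ArtinB n :=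
      { toFun := fun f => X n (Y f) * ΔB n ^ (e f).toAdd
        map_one' := by simp
        map_mul' := fun a b => by
          rw [map_mul, map_mul, map_mul, toAdd_mul, zpow_add]
          have := ((ΔB_comm h (X n (Y b))).zpow_left (e a).toAdd).eq
          simp only [mul_assoc]
          rw [← mul_assoc (ΔB n ^ (e a).toAdd) (X n (Y b)), this]
          simp only [mul_assoc] }
    suffices φ.comp (X n) = E from fun f => DFunLike.congr_fun this f
    ext j
    change φ (X n (of j)) = X n (Y (of j)) * ΔB n ^ (e (of j)).toAdd
    rw [X_of]
    by_cases hj : j < n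
    · rw [hYx j hj, he, if_pos hj, toAdd_ofAdd]
    · rw [hY' j (by omega), he, if_neg hj, xs_of_ge (by omega)]; simp
  have hea : ∀ g f, e (act n g f) = e f := fun g f => by
    suffices e.comp (act n g).toMonoidHom = e from DFunLike.congr_fun this f
    ext j
    change e (act n g (of j)) = e (of j)
    obtain ⟨d, hd⟩ := act_of g j
    rw [hd, map_mul, map_mul, map_inv, mul_right_comm, mul_inv_cancel, one_mul, he, he]
    by_cases hj : j < n
    · rw [if_pos hj, if_pos (prm_lt g hj)]
    · rw [if_neg hj, prm_of_ge g (by omega), if_neg hj]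
  have hYk : ∀ f, kap (Set.Iio n) (Y f) = Y f := fun f => by
    suffices (kap (Set.Iio n)).comp Y = Y from DFunLike.congr_fun this f
    ext j : 1
    simp only [MonoidHom.comp_apply]
    by_cases hj : j < n
    · rw [hY j hj, FreeGroup.kap_kap_self]
    · rw [hY' j (by omega), map_one]
  refine ⟨Y, c, hYk, fun g f => ?_, hYx, fun hinj f hf => ?_⟩
  · have h1 := congrArg φ (conj_X g f)
    rw [map_mul, map_mul, map_inv, hX, hX, hea] at h1
    have h2 := ((ΔB_comm h (φ g)⁻¹).zpow_left (e f).toAdd).eq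
    rw [← mul_assoc (φ g), mul_assoc _ (ΔB n ^ _), h2, ← mul_assoc, conj_X, mul_left_inj, X_eq_iff,
      kap_Iio_act, hYk, hYk] at h1
    exact h1
  · refine X_central h fun j => hinj ?_
    rw [map_mul, map_mul, hX f, hf, map_one, one_mul]
    exact ((ΔB_comm h _).zpow_left _).eq

end

open FreeGroup (kap of kap_of_mem kap_of_notMem)

section

variable {n : ℕ} {φ : ArtinB n →* ArtinB n} {Y : FreeGroup ℕ →* FreeGroup ℕ} {c : ℤ}

theorem FreePart.kap_eq_one_of (hY : FreePart φ Y c) (hφ : ∀ g, prm n (φ g) = prm n g) {g : ArtinB n}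
    {M N : Set ℕ} (h : prm n g '' M = N) {w : FreeGroup ℕ} (hw : kap M (Y w) = 1) :
    kap N (Y (act n g w)) = 1 := by
  rw [← hY.act_eq, ← kap_act_eq ((hφ g).symm ▸ h), hw, map_one, map_one]

theorem FreeGroup.of_commutator_ne_one {i j : ℕ} (hij : i ≠ j) : ¬Commute (of i) (of j) := fun h => by
  have := FreeGroup.eq_one_of_commute_of_of hij (of i) rfl h.eq.symm
  exact FreeGroup.of_ne_one i this

theorem image_sdiff (g : ArtinB n) {i j : ℕ} (h : prm n g i = j) :
    prm n g '' (Set.Iio n \ {i}) = Set.Iio n \ {j} := by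
  rw [Set.image_sdiff (prm n g).injective, image_Iio, Set.image_singleton, h]

theorem act_sg_sq_self {i : ℕ} (hi : i + 1 < n) :
    act n (sg n i ^ 2) (of i) = (of (i + 1) * of i)⁻¹ * of i * (of (i + 1) * of i) := by
  rw [act_sg_sq hi, sig_self, map_mul, map_mul, map_inv, sig_self, sig_succ]
  group

/-- The image of the first free generator dies when the first strand is removed. -/
theorem FreePart.kap_of_zero (hY : FreePart φ Y c) (h : 5 ≤ n) (hφ : ∀ g, prm n (φ g) = prm n g)
    (hinj : Function.Injective φ) : kap (Set.Iio n \ {0}) (Y (of 0)) = 1 := by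
  by_cases hc : ∃ i j, 2 ≤ i ∧ 2 ≤ j ∧ i < n ∧ j < n ∧
      ¬Commute (kap (Set.Iio n \ {0}) (Y (of i))) (kap (Set.Iio n \ {0}) (Y (of j)))
  · obtain ⟨i, j, hi, hj, hin, hjn, hc⟩ := hc
    obtain ⟨-, k, hk⟩ := hom_sq_mem_NM h hφ (i := 0) (r := 0) (by omega) (Or.inl rfl)
    have hk1 : ∀ i, 2 ≤ i → Commute k (kap (Set.Iio n \ {0}) (Y (of i))) := fun i hi => by
      have := hk (Y (of i))
      rw [hY.act_eq, act_sg_sq (by omega), sig_of_ne (by omega) (by omega),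
        sig_of_ne (by omega) (by omega)] at this
      exact (mul_inv_eq_iff_eq_mul.1 this.symm)
    have hk2 : k = 1 := by
      by_contra hk2
      exact hc (FreeGroup.commute_trans hk2 (hk1 i hi) (hk1 j hj))
    have h01 : Commute (kap (Set.Iio n \ {0}) (Y (of 0))) (kap (Set.Iio n \ {0}) (Y (of 1))) := by
      have := hk (Y (of 0))
      rw [hk2, hY.act_eq, act_sg_sq_self (by omega)] at this
      simp only [map_mul, map_inv, one_mul, inv_one, mul_one, mul_inv_rev, zero_add] at this
      have e : ∀ {a b : FreeGroup ℕ}, a⁻¹ * b⁻¹ * a * (b * a) = a → Commute a b := fun {a b} h => by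
        have h1 : a * b = b * a * (a⁻¹ * b⁻¹ * a * (b * a)) * a⁻¹ := by group
        rw [h, mul_inv_cancel_right] at h1
        exact h1
      exact e this
    have h0 : ∀ j, 1 ≤ j → j < n →
        Commute (kap (Set.Iio n \ {0}) (Y (of 0))) (kap (Set.Iio n \ {0}) (Y (of j))) := by
      intro j hj
      induction j, hj using Nat.le_induction with
      | base => exact fun _ => h01
      | succ j hj ih =>
        intro hjn
        have ih := ih (by omega)
        have := hY.kap_eq_one_of hφ (g := sg n j) (image_sdiff _ (i := 0) (j := 0) (by
          rw [prm_sg hjn, Equiv.swap_apply_of_ne_of_ne (by omega) (by omega)]))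
          (w := of 0 * of j * (of 0)⁻¹ * (of j)⁻¹) (by
            simp only [map_mul, map_inv]
            rw [ih.eq]; group)
        rw [act_sg hjn] at this
        simp only [map_mul, map_inv, sig_self, sig_of_ne (show 0 ≠ j by omega) (show 0 ≠ j + 1 by omega)]
          at this
        have h1 := mul_inv_eq_iff_eq_mul.1 (mul_inv_eq_one.1 this)
        have h2 := (Commute.mul_right ih h1).mul_right ih.inv_right
        simpa only [mul_assoc, mul_inv_cancel_left, mul_inv_cancel, mul_one] using h2
    by_contra hne
    exact hc (FreeGroup.commute_trans hne (h0 i (by omega) hin) (h0 j (by omega) hjn))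
  · exfalso
    push Not at hc
    have hw1 := hY.kap_eq_one_of hφ (g := sg n 0) (image_sdiff _ (i := 0) (j := 1) (by
          rw [prm_sg (by omega), Equiv.swap_apply_left]))
          (w := of 3 * of 4 * (of 3)⁻¹ * (of 4)⁻¹) (by
            simp only [map_mul, map_inv]
            rw [hc 3 4 (by omega) (by omega) (by omega) (by omega)]; group)
    have hw0 : kap (Set.Iio n \ {0}) (Y (of 3 * of 4 * (of 3)⁻¹ * (of 4)⁻¹)) = 1 := by
      simp only [map_mul, map_inv]
      rw [hc 3 4 (by omega) (by omega) (by omega) (by omega)]; group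
    have hs : ∀ i ≤ 1, act n (sg n i) (of 3 * of 4 * (of 3)⁻¹ * (of 4)⁻¹) =
        of 3 * of 4 * (of 3)⁻¹ * (of 4)⁻¹ := fun i hi => by
      rw [act_sg (by omega)]
      simp only [map_mul, map_inv, sig_of_ne (show 3 ≠ i by omega) (show 3 ≠ i + 1 by omega),
        sig_of_ne (show 4 ≠ i by omega) (show 4 ≠ i + 1 by omega)]
    rw [hs 0 (by omega)] at hw1
    obtain ⟨d, k, hd⟩ := exists_conj_zpow_of_mem_NM (i := 0) (r := 1) (by omega) (by omega) (by omega)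
      rfl (hom_sq_mem_NM h hφ (by omega) (Or.inr rfl))
      (hom_sq_mem_NM h hφ (i := 1) (by omega) (Or.inl rfl)) (hom_commutator_notMem_Iio hφ (i := 0) (by omega))
      hw1 (hY.kap_eq _) (by rw [hY.act_eq, pow_two, act_mul, hs 0 (by omega), hs 0 (by omega)])
      (by rw [hY.act_eq, pow_two, act_mul, hs 1 (by omega), hs 1 (by omega)])
    have hk : k = 0 := by
      rw [hd, map_mul, map_mul, map_inv, conj_eq_one_iff, map_zpow, kap_of_mem (by simp; omega)] at hw0
      by_contra hk
      exact FreeGroup.of_ne_one 1 (FreeGroup.eq_of_zpow_eq hk (hw0.trans (one_zpow k).symm))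
    rw [hk, zpow_zero, mul_one, mul_inv_cancel] at hd
    have := hY.inj hinj _ hd
    simp only [map_mul, map_inv, kap_of_mem (M := Set.Iio n) (show 3 ∈ Set.Iio n by simp; omega),
      kap_of_mem (M := Set.Iio n) (show 4 ∈ Set.Iio n by simp; omega)] at this
    refine FreeGroup.of_commutator_ne_one (show 3 ≠ 4 by omega) ?_
    exact mul_inv_eq_iff_eq_mul.1 (mul_inv_eq_one.1 this)

theorem FreePart.exists_conj_zpow (hY : FreePart φ Y c) (h : 5 ≤ n) (hφ : ∀ g, prm n (φ g) = prm n g)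
    (hinj : Function.Injective φ) :
    ∃ k : ℤ, k ≠ 0 ∧ ∀ j < n, ∃ d, Y (of j) = d * of j ^ k * d⁻¹ := by
  have hmem : ∀ j < n, φ (xs n j) ∈ NM n (Set.Iio n) := fun j hj => by
    rw [hY.map_xs j hj]
    exact mul_mem (X_mem_NM le_rfl _) (zpow_mem (ΔB_mem_NM (by omega) le_rfl) _)
  have hq : φ (xs n 1 * xs n 0 * sg n 0 ^ 2) ∈ NM n (Set.Iio n \ {0}) := by
    rw [map_mul, map_mul]
    exact mul_mem (NM_anti Set.sdiff_subset (mul_mem (hmem 1 (by omega)) (hmem 0 (by omega))))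
      (hom_sq_mem_NM h hφ (by omega) (Or.inl rfl))
  have hq0 : act n (xs n 1 * xs n 0 * sg n 0 ^ 2) (of 0) = of 0 := by
    rw [act_mul, act_mul, act_sg_sq_self (by omega), act_xs (by omega), act_xs (by omega)]
    simp only [MulAut.conj_apply]
    group
  have ht : act n (sg n 1) (of 0) = of 0 := by
    rw [act_sg (by omega), sig_of_ne (by omega) (by omega)]
  obtain ⟨d, k, hd⟩ := exists_conj_zpow_of_mem_NM (i := 1) (r := 0) (by omega) (by omega) (by omega)
    rfl hq (q := φ (sg n 1 * (xs n 1 * xs n 0 * sg n 0 ^ 2) * (sg n 1)⁻¹)) (by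
      rw [map_mul, map_mul, map_inv]
      refine conj_mem_NM' (image_sdiff _ ?_) hq
      rw [hφ, prm_sg (by omega), Equiv.swap_apply_of_ne_of_ne (by omega) (by omega)])
    (by
      let N : Subgroup (ArtinB n) := (NM n (Set.Iio n)).comap φ
      have hN : N.Normal := ⟨fun p hp g => by
        rw [Subgroup.mem_comap] at hp ⊢
        rwa [map_mul, map_mul, map_inv, conj_mem_NM_Iio]⟩
      have e1 : (QuotientGroup.mk' N) (xs n 1 * xs n 0) = 1 := by
        rw [QuotientGroup.mk'_apply, QuotientGroup.eq_one_iff, Subgroup.mem_comap, map_mul]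
        exact mul_mem (hmem 1 (by omega)) (hmem 0 (by omega))
      have e2 : sg n 1 * sg n 0 ^ 2 * (sg n 1)⁻¹ = (sg n 0)⁻¹ * sg n 1 ^ 2 * sg n 0 := by
        have := sg_braid (n := n) (i := 0) (by omega)
        rw [zero_add] at this
        have h1 : sg n 1 * sg n 0 * (sg n 1)⁻¹ = (sg n 0)⁻¹ * sg n 1 * sg n 0 := by
          rw [mul_inv_eq_iff_eq_mul, mul_assoc, mul_assoc, eq_inv_mul_iff_mul_eq, ← mul_assoc, ← mul_assoc,
            this]
        have h2 := congrArg (· ^ 2) h1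
        simp only [conj_pow] at h2
        rw [h2, pow_two, pow_two]
        group
      intro hc
      refine hom_commutator_notMem_Iio hφ (i := 0) (by omega) ?_
      rw [← map_mul, ← map_inv, ← map_mul, ← map_inv, ← map_mul] at hc ⊢
      rw [zero_add]
      change _ ∈ N at hc
      change _ ∈ N
      rw [← QuotientGroup.eq_one_iff, ← QuotientGroup.mk'_apply] at hc ⊢
      rw [← conj_eq_one_iff (a := QuotientGroup.mk' N (sg n 0)⁻¹)]
      rw [map_mul, map_mul, map_mul, map_inv, map_inv, map_mul _ (_ * xs n 0), e1, one_mul,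
        map_mul, map_mul _ _ (_ * xs n 0 * _), map_mul _ (_ * xs n 0), e1, one_mul, ← map_mul, ← map_mul, e2] at hc
      rw [← hc]
      simp only [map_mul, map_inv, map_pow]
      group)
    (hY.kap_of_zero h hφ hinj) (hY.kap_eq _) (by rw [hY.act_eq, hq0]) (by
      rw [hY.act_eq, act_mul, act_mul, ← ht, act_inv_act, ht, hq0, ht])
  refine ⟨k, ?_, fun j hj => ?_⟩
  · rintro rfl
    rw [zpow_zero, mul_one, mul_inv_cancel] at hd
    have := hY.inj hinj _ hd
    rw [kap_of_mem (by simp; omega)] at this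
    exact FreeGroup.of_ne_one 0 this
  · obtain ⟨g, hg⟩ : ∃ g, prm n g 0 = j := ⟨ρB n ^ j, by rw [prm_ρB_pow (by omega), zero_add]⟩
    obtain ⟨u, hu⟩ := act_of g 0
    obtain ⟨u', hu'⟩ := act_of (φ g) 0
    rw [hg] at hu
    rw [hφ, hg] at hu'
    have := hY.act_eq g (of 0)
    rw [hd, hu, map_mul, map_mul, map_mul, map_mul, map_inv, map_inv, map_zpow, hu', conj_zpow] at this
    refine ⟨(Y u)⁻¹ * act n (φ g) d * u', ?_⟩
    have e : Y (of j) = (Y u)⁻¹ * (Y u * Y (of j) * (Y u)⁻¹) * Y u := by group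
    rw [e, ← this]
    group

end

open FreeGroup (kap of kap_of_mem kap_of_notMem)

/-! ### Filling in the outer puncture -/

theorem kap_Pf_of_subset {M : Set ℕ} {k : ℕ} (h : Set.Iio k ⊆ M) : kap M (Pf k) = Pf k := by
  rw [← kap_Pf, FreeGroup.kap_kap, Set.inter_eq_self_of_subset_right h]

/-- The retraction killing the loop around all punctures. -/
def kinf (n : ℕ) : FreeGroup ℕ →* FreeGroup ℕ :=
  FreeGroup.lift fun j => if j = n - 1 then (Pf (n - 1))⁻¹ else of j

theorem kinf_last (n : ℕ) : kinf n (of (n - 1)) = (Pf (n - 1))⁻¹ := by simp [kinf]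

theorem kinf_of_ne {n j : ℕ} (h : j ≠ n - 1) : kinf n (of j) = of j := by simp [kinf, h]

theorem map_Pf_eq {f g : FreeGroup ℕ →* FreeGroup ℕ} {k : ℕ} (h : ∀ j < k, f (of j) = g (of j)) :
    f (Pf k) = g (Pf k) := by
  induction k with
  | zero => simp [Pf]
  | succ k ih => rw [Pf, map_mul, map_mul, h k (by omega), ih fun j hj => h j (by omega)]

theorem kinf_Pf_of_lt {n k : ℕ} (h : k < n) : kinf n (Pf k) = Pf k :=
  map_Pf_eq (g := MonoidHom.id _) fun j hj => kinf_of_ne (by omega)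

theorem Pf_eq {n : ℕ} (h : 1 ≤ n) : Pf n = of (n - 1) * Pf (n - 1) := by
  obtain ⟨m, rfl⟩ : ∃ m, n = m + 1 := ⟨n - 1, by omega⟩
  rfl

theorem kinf_Pf {n : ℕ} (h : 1 ≤ n) : kinf n (Pf n) = 1 := by
  rw [Pf_eq h, map_mul, kinf_last, kinf_Pf_of_lt (by omega), inv_mul_cancel]

theorem exists_act_Pf {n : ℕ} (g : ArtinB n) : ∃ u, act n g (Pf n) = u * Pf n * u⁻¹ := by
  obtain ⟨f, b, hb, rfl⟩ := exists_X_mul g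
  exact ⟨kap (Set.Iio n) f, by rw [act_mul, act_BS_Pf le_rfl le_rfl hb, act_X, MulAut.conj_apply]⟩

theorem kap_eq_self_ext {n : ℕ} {H : Type*} [Group H] {f g : FreeGroup ℕ →* H}
    (h : ∀ j < n, f (of j) = g (of j)) {w : FreeGroup ℕ} (hw : kap (Set.Iio n) w = w) : f w = g w := by
  suffices f.comp (kap (Set.Iio n)) = g.comp (kap (Set.Iio n)) by
    have := DFunLike.congr_fun this w
    simpa only [MonoidHom.comp_apply, hw] using this
  ext j
  simp only [MonoidHom.comp_apply]
  by_cases hj : j < n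
  · rw [kap_of_mem (M := Set.Iio n) hj, h j hj]
  · rw [kap_of_notMem (M := Set.Iio n) hj, map_one, map_one]

theorem kinf_act_kinf {n : ℕ} (h : 1 ≤ n) (g : ArtinB n) {w : FreeGroup ℕ}
    (hw : kap (Set.Iio n) w = w) : kinf n (act n g (kinf n w)) = kinf n (act n g w) := by
  refine kap_eq_self_ext (f := (kinf n).comp ((act n g).toMonoidHom.comp (kinf n)))
    (g := (kinf n).comp (act n g).toMonoidHom) (fun j hj => ?_) hw
  change kinf n (act n g (kinf n (of j))) = kinf n (act n g (of j))
  by_cases hjn : j = n - 1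
  · obtain ⟨u, hu⟩ := exists_act_Pf g
    have h1 : kinf n (act n g (Pf n)) = 1 := by
      rw [hu, map_mul, map_mul, map_inv, kinf_Pf h, mul_one, mul_inv_cancel]
    rw [Pf_eq h, map_mul, map_mul, mul_eq_one_iff_eq_inv] at h1
    rw [hjn, kinf_last, map_inv, map_inv, h1]
  · rw [kinf_of_ne hjn]

theorem kap_act_self {n : ℕ} (g : ArtinB n) {w : FreeGroup ℕ} (hw : kap (Set.Iio n) w = w) :
    kap (Set.Iio n) (act n g w) = act n g w := by rw [kap_Iio_act, hw]

/-- The elements acting trivially once the outer puncture is filled in. -/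
def Sinf (n : ℕ) : Subgroup (ArtinB n) where
  carrier := {p | ∀ w, kap (Set.Iio n) w = w → kinf n (act n p w) = kinf n w}
  one_mem' := fun w _ => by simp
  mul_mem' := fun {p q} hp hq w hw => by rw [act_mul, hp _ (kap_act_self q hw), hq w hw]
  inv_mem' := fun {p} hp w hw => by
    have := hp _ (kap_act_self p⁻¹ hw)
    rwa [act_act_inv, eq_comm] at this

theorem mem_Sinf_of {n : ℕ} {p : ArtinB n} (h : ∀ j < n, kinf n (act n p (of j)) = kinf n (of j)) :
    p ∈ Sinf n := fun _ hw =>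
  kap_eq_self_ext (f := (kinf n).comp (act n p).toMonoidHom) h hw

theorem Sinf_normal {n : ℕ} (h : 1 ≤ n) : (Sinf n).Normal :=
  ⟨fun p hp g w hw => by
    have hw' := kap_act_self g⁻¹ hw
    rw [act_mul, act_mul, ← kinf_act_kinf h g (kap_act_self p hw'), hp _ hw', kinf_act_kinf h g hw',
      act_act_inv]⟩

theorem ΔB_mem_Sinf {n : ℕ} (h : 1 ≤ n) : ΔB n ∈ Sinf n := fun w hw => by
  rw [← kap_act_self (ΔB n) hw, kap_act_ΔB h, hw]

theorem descProd_mem_BS {n m : ℕ} (h : m + 1 ≤ n) : descProd (sg n) m ∈ BS n n := by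
  induction m with
  | zero => exact one_mem _
  | succ m ih => exact mul_mem (sg_mem_BS (by omega)) (ih (by omega))

theorem act_descProd_of {n k : ℕ} (hk : k + 1 ≤ n) :
    (∀ j, k < j → act n (descProd (sg n) k) (of j) = of j) ∧
    act n (descProd (sg n) k) (of 0) = (Pf k)⁻¹ * of k * Pf k ∧
    ∀ j, j < k → act n (descProd (sg n) k) (of (j + 1)) = of j := by
  induction k with
  | zero => simp [descProd, Pf]
  | succ k ih =>
    obtain ⟨h1, h2, h3⟩ := ih (by omega)
    refine ⟨fun j hj => ?_, ?_, fun j hj => ?_⟩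
    · rw [descProd, act_mul, h1 j (by omega), act_sg (by omega), sig_of_ne (by omega) (by omega)]
    · rw [descProd, act_mul, h2, act_sg (by omega), map_mul, map_mul, map_inv, sig_Pf (by omega), sig_self, Pf]
      group
    · rw [descProd, act_mul, act_sg (by omega)]
      rcases Nat.lt_succ_iff_lt_or_eq.1 hj with h | rfl
      · rw [h3 j h, sig_of_ne (by omega) (by omega)]
      · rw [h1 _ (by omega), sig_succ]

/-- The braid `r_{n-1} ⋯ r_1 r_1 ⋯ r_{n-1}`. -/
def aB (n : ℕ) : ArtinB n := descProd (sg n) (n - 1) * αB n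

theorem aB_mem_BS {n : ℕ} (h : 1 ≤ n) : aB n ∈ BS n n :=
  mul_mem (descProd_mem_BS (by omega)) (ascProd_mem_BS (by omega))

theorem w1_eq (n : ℕ) : w1 n = αB n * (sg n (n - 1) * aB n) * (αB n)⁻¹ := by
  rw [w1, aB]; group

theorem last_mul_aB_mem_Sinf {n : ℕ} (h : 1 ≤ n) : sg n (n - 1) * aB n ∈ Sinf n := by
  obtain ⟨-, h2, h3⟩ := act_ascProd_of (n := n) (k := n - 1) (by omega)
  obtain ⟨-, h5, h6⟩ := act_descProd_of (n := n) (k := n - 1) (by omega)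
  refine mem_Sinf_of fun j hj => ?_
  rw [aB, act_mul, act_mul, act_last h, αB]
  by_cases hjn : j = n - 1
  · rw [hjn, h2, h5]
    simp only [map_mul, map_inv, MulAut.conj_apply, kinf_last, kinf_Pf_of_lt (show n - 1 < n by omega)]
    group
  · rw [h3 j (by omega)]
    simp only [map_mul, map_inv, h5, h6 j (by omega)]
    simp only [map_mul, map_inv, MulAut.conj_apply, kinf_last, kinf_Pf_of_lt (show n - 1 < n by omega),
      kinf_of_ne hjn]
    group

theorem w1_mem_Sinf {n : ℕ} (h : 1 ≤ n) : w1 n ∈ Sinf n := by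
  rw [w1_eq]
  exact (Sinf_normal h).conj_mem _ (last_mul_aB_mem_Sinf h) _

theorem ι_X_mem_Sinf {n : ℕ} (h : 2 ≤ n) {ι : ArtinB n →* ArtinB n}
    (h1 : ∀ i, i + 1 < n → ι (sg n i) = sg n (n - 2 - i)) (h2 : ι (ρB n) = (ρB n)⁻¹) (f : FreeGroup ℕ) :
    ι (X n f) ∈ Sinf n := by
  have : ∀ j, (of j : FreeGroup ℕ) ∈ (Sinf n).comap (ι.comp (X n)) := fun j => by
    change ι (X n (of j)) ∈ Sinf n
    rw [X_of, xs]
    split_ifs with hj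
    · rw [map_mul, map_mul, map_inv]
      refine (Sinf_normal (by omega)).conj_mem _ ?_ _
      rw [ι_last h h1 h2]
      exact inv_mem (w1_mem_Sinf (by omega))
    · rw [map_one]; exact one_mem _
  exact FreeGroup.induction_on (C := fun f => f ∈ (Sinf n).comap (ι.comp (X n))) f (one_mem _) this
    (fun j hj => inv_mem hj) (fun a b ha hb => mul_mem ha hb)

theorem ι_ι {n : ℕ} (h : 2 ≤ n) {ι : ArtinB n →* ArtinB n}
    (h1 : ∀ i, i + 1 < n → ι (sg n i) = sg n (n - 2 - i)) (h2 : ι (ρB n) = (ρB n)⁻¹) (g : ArtinB n) :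
    ι (ι g) = g := by
  suffices ι.comp ι = MonoidHom.id _ from DFunLike.congr_fun this g
  refine ArtinB.hom_ext_ρ (by omega) (fun i hi => ?_) ?_
  · simp only [MonoidHom.comp_apply, MonoidHom.id_apply]
    rw [h1 i hi, h1 _ (by omega)]
    congr 1; omega
  · simp [h2]

theorem mem_Sinf_of_ι_mem {n : ℕ} (h : 2 ≤ n) {ι : ArtinB n →* ArtinB n}
    (h1 : ∀ i, i + 1 < n → ι (sg n i) = sg n (n - 2 - i)) (h2 : ι (ρB n) = (ρB n)⁻¹) {p : ArtinB n}
    (hp : ι p ∈ NM n (Set.Iio n)) : p ∈ Sinf n := by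
  obtain ⟨f, k, hf⟩ := exists_X_mul_ΔB h hp
  rw [← ι_ι h h1 h2 p, hf, map_mul]
  refine mul_mem (ι_X_mem_Sinf h h1 h2 f) ?_
  rw [map_zpow, ΔB, map_pow, h2]
  exact zpow_mem (by rw [inv_pow]; exact inv_mem (ΔB_mem_Sinf (by omega))) _

theorem X_mem_Sinf {n : ℕ} (h : 3 ≤ n) {f : FreeGroup ℕ} (hf : kap (Set.Iio n) f = f)
    (hX : X n f ∈ Sinf n) : kinf n f = 1 := by
  have key : ∀ j < n - 1, of j * kinf n f = kinf n f * of j := fun j hj => by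
    have := hX (of j) (kap_of_mem (by simp; omega))
    rw [act_X, hf, MulAut.conj_apply, map_mul, map_mul, map_inv, kinf_of_ne (by omega)] at this
    exact (mul_inv_eq_iff_eq_mul.1 this).symm
  exact FreeGroup.eq_one_of_commute_of_of zero_ne_one _ (key 0 (by omega)) (key 1 (by omega))

/-! ### The inverse outer twist -/

/-- The automorphism taking the last generator to the loop around all punctures. -/
def xi (n : ℕ) : FreeGroup ℕ →* FreeGroup ℕ :=
  FreeGroup.lift fun j => if j = n - 1 then Pf n else of j

/-- The inverse of `xi`. -/
def xiInv (n : ℕ) : FreeGroup ℕ →* FreeGroup ℕ :=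
  FreeGroup.lift fun j => if j = n - 1 then of (n - 1) * (Pf (n - 1))⁻¹ else of j

theorem xi_last (n : ℕ) : xi n (of (n - 1)) = Pf n := by simp [xi]

theorem xi_of_ne {n j : ℕ} (h : j ≠ n - 1) : xi n (of j) = of j := by simp [xi, h]

theorem xiInv_last (n : ℕ) : xiInv n (of (n - 1)) = of (n - 1) * (Pf (n - 1))⁻¹ := by simp [xiInv]

theorem xiInv_of_ne {n j : ℕ} (h : j ≠ n - 1) : xiInv n (of j) = of j := by simp [xiInv, h]

theorem xi_xiInv {n : ℕ} (h : 1 ≤ n) (f : FreeGroup ℕ) : xi n (xiInv n f) = f := by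
  suffices (xi n).comp (xiInv n) = MonoidHom.id _ from DFunLike.congr_fun this f
  ext j : 1
  simp only [MonoidHom.comp_apply, MonoidHom.id_apply]
  by_cases hj : j = n - 1
  · rw [hj, xiInv_last, map_mul, map_inv, xi_last,
      map_Pf_eq (g := MonoidHom.id _) (fun j hj => xi_of_ne (by omega)), MonoidHom.id_apply, Pf_eq h,
      mul_inv_cancel_right]
  · rw [xiInv_of_ne hj, xi_of_ne hj]

theorem xiInv_Pf {n : ℕ} (h : 1 ≤ n) : xiInv n (Pf n) = of (n - 1) := by
  rw [Pf_eq h, map_mul, xiInv_last, map_Pf_eq (g := MonoidHom.id _) (fun j hj => xiInv_of_ne (by omega)),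
    MonoidHom.id_apply, inv_mul_cancel_right]

theorem kap_xiInv {n : ℕ} {w : FreeGroup ℕ} (hw : kap (Set.Iio n) w = w) :
    kap (Set.Iio n \ {n - 1}) (xiInv n w) = kinf n w := by
  refine kap_eq_self_ext (f := (kap (Set.Iio n \ {n - 1})).comp (xiInv n)) (g := kinf n) (fun j hj => ?_) hw
  rw [MonoidHom.comp_apply]
  by_cases hjn : j = n - 1
  · rw [hjn, xiInv_last, kinf_last, map_mul, kap_of_notMem (by simp), map_inv,
      kap_Pf_of_subset (fun i hi => by simp at hi ⊢; omega), one_mul]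
  · rw [xiInv_of_ne hjn, kinf_of_ne hjn, kap_of_mem (M := Set.Iio n \ {n - 1}) ⟨hj, hjn⟩]

theorem kap_xi_of {n j : ℕ} (hj : j < n) : kap (Set.Iio n) (xi n (of j)) = xi n (of j) := by
  by_cases hjn : j = n - 1
  · rw [hjn, xi_last, kap_Pf]
  · rw [xi_of_ne hjn, kap_of_mem (M := Set.Iio n) hj]

theorem kap_xiInv_self {n : ℕ} {w : FreeGroup ℕ} (hw : kap (Set.Iio n) w = w) :
    kap (Set.Iio n) (xiInv n w) = xiInv n w := by
  refine kap_eq_self_ext (f := (kap (Set.Iio n)).comp (xiInv n)) (g := xiInv n) (fun j hj => ?_) hw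
  rw [MonoidHom.comp_apply]
  by_cases hjn : j = n - 1
  · rw [hjn, xiInv_last, map_mul, kap_of_mem (by simp; omega), map_inv,
      kap_Pf_of_subset (fun i hi => by simp at hi ⊢; omega)]
  · rw [xiInv_of_ne hjn, kap_of_mem (M := Set.Iio n) hj]

theorem kinf_xi_of {n j : ℕ} (h : 1 ≤ n) (hj : j < n) :
    kinf n (xi n (of j)) = kap (Set.Iio n \ {n - 1}) (of j) := by
  by_cases hjn : j = n - 1
  · rw [hjn, xi_last, kinf_Pf h, kap_of_notMem (by simp)]
  · rw [xi_of_ne hjn, kinf_of_ne hjn, kap_of_mem (M := Set.Iio n \ {n - 1}) ⟨hj, hjn⟩]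

open FreeGroup (kap of kap_of_mem kap_of_notMem expSum expSum_of_self expSum_of_ne)

/-! ### The product of the free generators -/

theorem expSum_Pf {a m : ℕ} (h : a < m) : expSum a (Pf m) = Multiplicative.ofAdd 1 := by
  have key : ∀ m, m ≤ a → expSum a (Pf m) = 1 := fun m hm => by
    induction m with
    | zero => simp [Pf]
    | succ m ih => rw [Pf, map_mul, ih (by omega), expSum_of_ne (by omega), one_mul]
  induction m, (show a + 1 ≤ m by omega) using Nat.le_induction with
  | base => rw [Pf, map_mul, key a le_rfl, expSum_of_self, mul_one]
  | succ m hm ih => rw [Pf, map_mul, ih (by omega), expSum_of_ne (by omega), one_mul]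

theorem MonoidHom.map_conj_comm {G A : Type*} [Group G] [CommGroup A] (f : G →* A) (d a : G) :
    f (d * a * d⁻¹) = f a := by
  rw [map_mul, map_mul, map_inv, mul_right_comm, mul_inv_cancel, one_mul]

theorem Multiplicative.ofAdd_one_zpow_eq {k m : ℤ} :
    (Multiplicative.ofAdd (1 : ℤ)) ^ k = (Multiplicative.ofAdd (1 : ℤ)) ^ m ↔ k = m := by
  rw [← ofAdd_zsmul, ← ofAdd_zsmul]; simp

theorem Multiplicative.ofAdd_one_zpow_eq_one {k : ℤ} :
    (Multiplicative.ofAdd (1 : ℤ)) ^ k = 1 ↔ k = 0 := by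
  rw [← ofAdd_zsmul]; simp

theorem prm_conj_ι {n : ℕ} (h : 2 ≤ n) {ι : ArtinB n →* ArtinB n}
    (h1 : ∀ i, i + 1 < n → ι (sg n i) = sg n (n - 2 - i)) (h2 : ι (ρB n) = (ρB n)⁻¹) {g : ArtinB n}
    (hg : ∀ i < n, prm n g i = n - 1 - i) (x : ArtinB n) : prm n (g * ι x * g⁻¹) = prm n x := by
  suffices (prm n).comp ((MulAut.conj g).toMonoidHom.comp ι) = prm n from DFunLike.congr_fun this x
  refine ArtinB.hom_ext fun i hi => ?_
  simp only [MonoidHom.comp_apply, MulEquiv.coe_toMonoidHom, MulAut.conj_apply]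
  by_cases hin : i + 1 < n
  · rw [h1 i hin, map_mul, map_mul, map_inv, prm_sg (by omega), prm_sg hin,
      Equiv.mul_swap_eq_swap_mul, mul_inv_cancel_right, hg _ (by omega), hg _ (by omega),
      Equiv.swap_comm]
    congr 1 <;> omega
  · obtain rfl : i = n - 1 := by omega
    rw [ι_last h h1 h2, prm_last (by omega), w1, αB]
    have := prm_descProd_mul (n := n) (k := n - 1) (by omega)
    rw [map_mul, mul_eq_one_iff_eq_inv] at this
    simp [this, prm_last (n := n) (by omega)]

theorem exists_prm_rev (n : ℕ) : ∃ g, ∀ i < n, prm n g i = n - 1 - i := by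
  obtain ⟨w0, hw0, hw0'⟩ := exists_rev_perm n
  obtain ⟨g, hg⟩ := exists_prm_eq le_rfl hw0'
  exact ⟨g, by rwa [hg]⟩

theorem kinf_act_of_mul_mem {n : ℕ} {y : FreeGroup ℕ} (hy : kap (Set.Iio n) y = y)
    {q : ArtinB n} (hq : X n y * q ∈ Sinf n) {w : FreeGroup ℕ} (hw : kap (Set.Iio n) w = w) :
    kinf n (act n q w) = (kinf n y)⁻¹ * kinf n w * kinf n y := by
  have := hq w hw
  rw [act_mul, act_X, hy, MulAut.conj_apply, map_mul, map_mul, map_inv] at this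
  rw [← this]
  group

section

variable {n : ℕ} {φ : ArtinB n →* ArtinB n} {Y : FreeGroup ℕ →* FreeGroup ℕ} {c : ℤ}

theorem expSum_map_Pf {k : ℤ} (hy : ∀ j < n, ∃ d, Y (of j) = d * of j ^ k * d⁻¹) {m : ℕ} (hm : m ≤ n) (a : ℕ) :
    expSum a (Y (Pf m)) = expSum a (Pf m) ^ k := by
  induction m with
  | zero => simp [Pf]
  | succ m ih =>
    obtain ⟨d, hd⟩ := hy m (by omega)
    rw [Pf, map_mul, map_mul, map_mul, ih (by omega), mul_zpow, hd, MonoidHom.map_conj_comm, map_zpow]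

theorem FreePart.mul_mem_Sinf (hY : FreePart φ Y c) (h : 2 ≤ n) {j : ℕ} (hj : j < n) {q : ArtinB n}
    (hq : φ (xs n j) * q ∈ Sinf n) : X n (Y (of j)) * q ∈ Sinf n := by
  rw [hY.map_xs j hj, mul_assoc, ((ΔB_comm h q).zpow_left c).eq, ← mul_assoc] at hq
  exact ((Sinf n).mul_mem_cancel_right (zpow_mem (ΔB_mem_Sinf (by omega)) c)).1 hq

theorem FreePart.last_notMem_Sinf (hY : FreePart φ Y c) (h : 3 ≤ n) {k : ℤ} (hk : k ≠ 0)
    (hy : ∀ j < n, ∃ d, Y (of j) = d * of j ^ k * d⁻¹) : φ (sg n (n - 1)) ∉ Sinf n := by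
  intro hm
  rw [← xs_last (by omega), ← mul_one (φ _)] at hm
  have h1 := hY.mul_mem_Sinf (by omega) (by omega) hm
  rw [mul_one] at h1
  have h2 := X_mem_Sinf h (hY.kap_eq _) h1
  obtain ⟨d, hd⟩ := hy (n - 1) (by omega)
  rw [hd, map_mul, map_mul, map_inv, map_zpow, kinf_last, conj_eq_one_iff] at h2
  have h3 := congrArg (expSum 0) h2
  rw [map_zpow, map_inv, expSum_Pf (by omega), inv_zpow, map_one (expSum 0), inv_eq_one,
    Multiplicative.ofAdd_one_zpow_eq_one] at h3
  exact hk h3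

theorem FreePart.exists_conj_Pf (hY : FreePart φ Y c) (h : 5 ≤ n) (hφ : ∀ g, prm n (φ g) = prm n g) {k : ℤ}
    (hk : k ≠ 0) (hy : ∀ j < n, ∃ d, Y (of j) = d * of j ^ k * d⁻¹) :
    ∃ d, kap (Set.Iio n) d = d ∧ Y (Pf n) = d * Pf n ^ k * d⁻¹ := by
  have h1n : 1 ≤ n := by omega
  obtain ⟨ι, i1, i2⟩ := exists_ι (n := n) (by omega)
  obtain ⟨g, hg⟩ := exists_prm_rev n
  have hψ : ∀ x, prm n (((MulAut.conj g).toMonoidHom.comp (ι.comp φ)) x) = prm n x := fun x =>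
    (prm_conj_ι (by omega) i1 i2 hg (φ x)).trans (hφ x)
  have hψ' : ∀ x, ((MulAut.conj g).toMonoidHom.comp (ι.comp φ)) x ∈ NM n (Set.Iio n) → φ x ∈ Sinf n := fun x hx =>
    mem_Sinf_of_ι_mem (by omega) i1 i2 (conj_mem_NM_Iio.1 hx)
  have hN := Sinf_normal h1n
  have hS : φ (xs n (n - 1)) * φ (aB n) ∈ Sinf n := by
    rcases hom_last_mem_or h hψ with h1 | h1
    · exact absurd (hψ' _ h1) (hY.last_notMem_Sinf (by omega) hk hy)
    · have := hN.conj_mem _ (hψ' _ h1) (φ (αB n))⁻¹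
      rw [w1_eq, map_mul, map_mul, map_inv, map_mul] at this
      rw [xs_last h1n]
      simpa only [mul_assoc, inv_mul_cancel_left, inv_inv, inv_mul_cancel, mul_one] using this
  have hS' : φ (xs n (n - 2)) * φ (sg n (n - 2) * aB n * (sg n (n - 2))⁻¹) ∈ Sinf n := by
    have e := sg_mul_xs_succ (n := n) (j := n - 2) (by omega)
    rw [show n - 2 + 1 = n - 1 by omega] at e
    have := hN.conj_mem _ hS (φ (sg n (n - 2)))
    rw [← map_mul, ← map_inv, ← map_mul, ← map_mul, ← mul_assoc, e] at this
    rw [← map_mul]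
    simpa only [mul_assoc] using this
  have hb : aB n ∈ BS n n := aB_mem_BS h1n
  have hb' : sg n (n - 2) * aB n * (sg n (n - 2))⁻¹ ∈ BS n n :=
    mul_mem (mul_mem (sg_mem_BS (by omega)) hb) (inv_mem (sg_mem_BS (by omega)))
  have hv : ∀ q ∈ BS n n, act n (φ q) (Y (Pf n)) = Y (Pf n) := fun q hq => by
    rw [hY.act_eq, act_BS_Pf le_rfl le_rfl hq]
  have hv1 := hv _ hb
  have hv2 := hv _ hb'
  have k1 := fun w => kinf_act_of_mul_mem (w := w) (hY.kap_eq _) (hY.mul_mem_Sinf (by omega) (by omega) hS)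
  have k2 := fun w => kinf_act_of_mul_mem (w := w) (hY.kap_eq _) (hY.mul_mem_Sinf (by omega) (by omega) hS')
  generalize φ (aB n) = q₁ at *
  generalize φ (sg n (n - 2) * aB n * (sg n (n - 2))⁻¹) = q₂ at *
  have hnc : ¬Commute (kinf n (Y (of (n - 1)))) (kinf n (Y (of (n - 2)))) := by
    intro hc
    obtain ⟨e, p, q, hp, hq⟩ := FreeGroup.exists_common_root hc
    obtain ⟨d, hd⟩ := hy (n - 1) (by omega)
    obtain ⟨d', hd'⟩ := hy (n - 2) (by omega)
    have e1 := congrArg (expSum 0) hp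
    have e2 := congrArg (expSum 0) hq
    have e3 := congrArg (expSum (n - 2)) hq
    rw [hd, map_mul (kinf n), map_mul (kinf n), map_inv (kinf n), MonoidHom.map_conj_comm, map_zpow, map_zpow, map_zpow, kinf_last, map_inv,
      expSum_Pf (by omega)] at e1
    rw [hd', map_mul (kinf n), map_mul (kinf n), map_inv (kinf n), MonoidHom.map_conj_comm, map_zpow, map_zpow, map_zpow,
      kinf_of_ne (by omega)] at e2 e3
    rw [expSum_of_ne (by omega), one_zpow] at e2
    rw [expSum_of_self] at e3
    have hq0 : q = 0 := by
      have := congrArg Multiplicative.toAdd e2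
      rw [toAdd_one, toAdd_zpow, smul_eq_mul, eq_comm, mul_eq_zero] at this
      refine this.resolve_right fun h0 => hk ?_
      have h1 : expSum 0 e = 1 := h0
      rw [h1, one_zpow, inv_zpow, inv_eq_one, Multiplicative.ofAdd_one_zpow_eq_one] at e1
      exact e1
    rw [hq0, zpow_zero, Multiplicative.ofAdd_one_zpow_eq_one] at e3
    exact hk e3
  have hkv : kinf n (Y (Pf n)) = 1 := by
    by_contra hne
    refine hnc (FreeGroup.commute_trans hne ?_ ?_)
    · have := k1 _ (hY.kap_eq (Pf n))
      rw [hv1, mul_assoc, eq_inv_mul_iff_mul_eq] at this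
      exact this.symm
    · have := k2 _ (hY.kap_eq (Pf n))
      rw [hv2, mul_assoc, eq_inv_mul_iff_mul_eq] at this
      exact this.symm
  have hr : ∀ q, ∃ u, ((xiInv n).comp ((act n q).toMonoidHom.comp (xi n))) (of (n - 1)) = u * of (n - 1) * u⁻¹ := by
    intro q
    obtain ⟨u, hu⟩ := exists_act_Pf (n := n) q
    refine ⟨xiInv n u, ?_⟩
    change xiInv n (act n q (xi n (of (n - 1)))) = _
    rw [xi_last, hu, map_mul, map_mul, map_inv, xiInv_Pf h1n]
  have hh : ∀ q y, (∀ w, kap (Set.Iio n) w = w → kinf n (act n q w) = (kinf n y)⁻¹ * kinf n w * kinf n y) →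
      ∀ j < n, kap (Set.Iio n \ {n - 1}) (((xiInv n).comp ((act n q).toMonoidHom.comp (xi n))) (of j)) =
        (kinf n y)⁻¹ * kap (Set.Iio n \ {n - 1}) (of j) * (kinf n y)⁻¹⁻¹ := by
    intro q y hq j hj
    change kap (Set.Iio n \ {n - 1}) (xiInv n (act n q (xi n (of j)))) = _
    rw [kap_xiInv (kap_act_self q (kap_xi_of hj)), hq _ (kap_xi_of hj), kinf_xi_of h1n hj, inv_inv]
  have hky : ∀ j, kap (Set.Iio n \ {n - 1}) (kinf n (Y (of j)))⁻¹ = (kinf n (Y (of j)))⁻¹ := fun j => by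
    rw [← kap_xiInv (hY.kap_eq _), map_inv, FreeGroup.kap_kap_self]
  have hvv : ∀ q, act n q (Y (Pf n)) = Y (Pf n) →
      ((xiInv n).comp ((act n q).toMonoidHom.comp (xi n))) (xiInv n (Y (Pf n))) = xiInv n (Y (Pf n)) := by
    intro q hq
    change xiInv n (act n q (xi n (xiInv n (Y (Pf n))))) = _
    rw [xi_xiInv h1n, hq]
  obtain ⟨u₁, hu₁⟩ := hr q₁
  obtain ⟨u₂, hu₂⟩ := hr q₂
  obtain ⟨d, m, hd⟩ := FreeGroup.exists_conj_zpow_of_fixed_lt (by omega : n - 1 < n) rfl hu₁ (hh _ _ k1) hu₂ (hh _ _ k2)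
    (hky _) (hky _) (by rw [kap_xiInv (hY.kap_eq _), hkv]) (kap_xiInv_self (hY.kap_eq _)) (hvv _ hv1) (hvv _ hv2)
    (Or.inl (by rwa [Commute.inv_inv_iff]))
  have hd' := congrArg (xi n) hd
  rw [xi_xiInv h1n, map_mul, map_mul, map_inv, map_zpow, xi_last] at hd'
  have hm := congrArg (expSum 0) hd'
  rw [MonoidHom.map_conj_comm, expSum_map_Pf hy le_rfl, map_zpow, expSum_Pf (by omega),
    Multiplicative.ofAdd_one_zpow_eq] at hm
  refine ⟨kap (Set.Iio n) (xi n d), FreeGroup.kap_kap_self _ _, ?_⟩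
  rw [← hY.kap_eq, hd', map_mul, map_mul, map_inv, map_zpow, kap_Pf, hm]

end

open FreeGroup (kap of kap_of_mem kap_of_notMem expSum expSum_of_self expSum_of_ne)

/-! ### The exponent is a sign -/

theorem exists_zpow_eq_one_mul_zpow_ne_one {k : ℤ} (hk : 2 ≤ k.natAbs) :
    ∃ a b : Equiv.Perm ℂ, a ^ k = 1 ∧ b ^ k = 1 ∧ (b * a) ^ k ≠ 1 := by
  have hz := Complex.isPrimitiveRoot_exp k.natAbs (by omega)
  have hu := hz.isUnit (by omega)
  obtain ⟨u, hu⟩ := hu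
  rw [← hu, IsPrimitiveRoot.coe_units_iff] at hz
  have hu1 : (u : ℂ) ≠ 1 := fun h => hz.ne_one (by omega) (Units.ext h)
  let A : Equiv.Perm ℂ := MulAction.toPermHom ℂˣ ℂ u
  let T : Equiv.Perm ℂ := Equiv.addRight (1 / (1 - (u : ℂ)⁻¹))
  have hA : A ^ k = 1 := by
    rw [← pow_natAbs_eq_one, ← map_pow, hz.pow_eq_one, map_one]
  have hBA : ∀ z, (T * A⁻¹ * T⁻¹ * A) z = z + 1 := fun z => by
    have h1 : 1 - (u : ℂ)⁻¹ ≠ 0 := by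
      rw [sub_ne_zero, ne_eq, eq_comm, inv_eq_one]
      exact hu1
    have hA' : A⁻¹ = MulAction.toPermHom ℂˣ ℂ u⁻¹ := (map_inv _ _).symm
    have e : ∀ y, T⁻¹ y = y - 1 / (1 - (u : ℂ)⁻¹) := fun y => by
      rw [Equiv.Perm.inv_eq_iff_eq]
      simp [T]
    rw [hA', Equiv.Perm.mul_apply, Equiv.Perm.mul_apply, Equiv.Perm.mul_apply, e]
    change ((u⁻¹ : ℂˣ) : ℂ) * ((u : ℂ) * z - 1 / (1 - (u : ℂ)⁻¹)) + 1 / (1 - (u : ℂ)⁻¹) = z + 1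
    rw [Units.val_inv_eq_inv_val, mul_sub, inv_mul_cancel_left₀ u.ne_zero]
    field_simp
    ring
  refine ⟨A, T * A⁻¹ * T⁻¹, hA, ?_, fun h => ?_⟩
  · rw [conj_zpow, inv_zpow, hA]; simp
  · rw [← pow_natAbs_eq_one] at h
    have : ∀ m : ℕ, ((T * A⁻¹ * T⁻¹ * A) ^ m) 0 = m := fun m => by
      induction m with
      | zero => simp
      | succ m ih => rw [pow_succ', Equiv.Perm.mul_apply, ih, hBA]; push_cast; rfl
    have h0 := this k.natAbs
    rw [h, Equiv.Perm.one_apply] at h0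
    have : k.natAbs = 0 := by exact_mod_cast h0.symm
    omega

theorem natAbs_le_one_of_map_Pf {n : ℕ} (h : 2 ≤ n) {Y : FreeGroup ℕ →* FreeGroup ℕ} {k : ℤ}
    (hy : ∀ j < n, ∃ d, Y (of j) = d * of j ^ k * d⁻¹) {d : FreeGroup ℕ} (hd : Y (Pf n) = d * Pf n ^ k * d⁻¹) :
    k.natAbs ≤ 1 := by
  by_contra hk
  obtain ⟨a, b, ha, hb, hab⟩ := exists_zpow_eq_one_mul_zpow_ne_one (show 2 ≤ k.natAbs by omega)
  let f : FreeGroup ℕ →* Equiv.Perm ℂ := FreeGroup.lift fun j => if j = 0 then a else if j = 1 then b else 1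
  have hf : ∀ j, f (of j) = if j = 0 then a else if j = 1 then b else 1 := fun j => FreeGroup.lift_apply_of
  have hfP : ∀ m, 2 ≤ m → f (Pf m) = b * a := fun m hm => by
    induction m, hm using Nat.le_induction with
    | base => simp [Pf, hf]
    | succ m hm ih => rw [Pf, map_mul, ih, hf, if_neg (by omega), if_neg (by omega), one_mul]
  have hfY : f (Y (Pf n)) = 1 := by
    have key : ∀ m, m ≤ n → f (Y (Pf m)) = 1 := fun m hm => by
      induction m with
      | zero => simp [Pf]
      | succ m ih =>
        obtain ⟨d, hd⟩ := hy m (by omega)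
        rw [Pf, map_mul, map_mul, ih (by omega), mul_one, hd, map_mul, map_mul, map_inv, map_zpow, conj_eq_one_iff, hf]
        split_ifs <;> simp [ha, hb]
    exact key n le_rfl
  rw [hd, map_mul, map_mul, map_inv, map_zpow, conj_eq_one_iff, hfP n h] at hfY
  exact hab hfY

open FreeGroup (kap of kap_of_mem kap_of_notMem)

/-! ### Artin's characterisation of braid automorphisms -/

namespace FreeGroup

variable {α : Type*} [DecidableEq α]

theorem toWord_mul_of_norm {u v : FreeGroup α} (h : norm (u * v) = norm u + norm v) :
    (u * v).toWord = u.toWord ++ v.toWord :=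
  (toWord_mul_sublist u v).eq_of_length (by rw [List.length_append]; exact h)

theorem norm_mul_mul {u v w : FreeGroup α} (hv : v ≠ 1) (h1 : norm (u * v) = norm u + norm v)
    (h2 : norm (v * w) = norm v + norm w) : norm (u * v * w) = norm u + norm v + norm w := by
  have e1 := toWord_mul_of_norm h1
  have e2 := toWord_mul_of_norm h2
  have r1 : IsReduced (u.toWord ++ v.toWord) := e1 ▸ isReduced_toWord
  have r2 : IsReduced (v.toWord ++ w.toWord) := e2 ▸ isReduced_toWord
  have r3 := r1.append_overlap r2 (by rwa [ne_eq, toWord_eq_nil_iff])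
  have e : (u * v * w).toWord = u.toWord ++ v.toWord ++ w.toWord := by
    rw [toWord_mul, e1, r3.reduce_eq]
  rw [norm, e, List.length_append, List.length_append]; rfl

theorem norm_of_mul (a : α) (w : FreeGroup α) :
    norm (of a * w) = norm w + 1 ∨ norm (of a * w) + 1 = norm w := by
  have h : (of a * w).toWord = reduce ((a, true) :: w.toWord) := by rw [toWord_mul, toWord_of]; rfl
  rw [norm, norm, h, reduce.cons, reduce_toWord]
  cases w.toWord with
  | nil => left; rfl
  | cons b L =>
    dsimp only
    split_ifs
    · right; rfl
    · left; rfl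

theorem norm_of_inv_mul (a : α) (w : FreeGroup α) :
    norm ((of a)⁻¹ * w) = norm w + 1 ∨ norm ((of a)⁻¹ * w) + 1 = norm w := by
  have := norm_of_mul a ((of a)⁻¹ * w)
  rw [mul_inv_cancel_left] at this
  omega

theorem norm_mul_of_inv (a : α) (w : FreeGroup α) :
    norm (w * (of a)⁻¹) = norm w + 1 ∨ norm (w * (of a)⁻¹) + 1 = norm w := by
  have := norm_of_mul a w⁻¹
  rwa [norm_inv_eq, ← norm_inv_eq, mul_inv_rev, inv_inv] at this

theorem norm_mul_of (a : α) (w : FreeGroup α) :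
    norm (w * of a) = norm w + 1 ∨ norm (w * of a) + 1 = norm w := by
  have := norm_of_inv_mul a w⁻¹
  rwa [norm_inv_eq, ← norm_inv_eq, mul_inv_rev, inv_inv, inv_inv] at this

theorem norm_of_mul_inv_mul {g h : FreeGroup α} {a : α} (hg : norm g ≤ norm (g * (of a)⁻¹))
    (hh : norm h ≤ norm (g * of a * g⁻¹ * h)) : norm (of a * (g⁻¹ * h)) = norm (g⁻¹ * h) + 1 := by
  refine (norm_of_mul a _).resolve_right fun h1 => ?_
  have h2 := (norm_mul_of_inv a g).resolve_right (by omega)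
  have h3 : norm (of a)⁻¹ = 1 := by rw [norm_inv_eq, norm_of]
  have := norm_mul_mul (u := g) (v := (of a)⁻¹) (w := of a * (g⁻¹ * h)) (inv_ne_one.2 (of_ne_one a))
    (by omega) (by rw [inv_mul_cancel_left]; omega)
  have e : g * (of a)⁻¹ * (of a * (g⁻¹ * h)) = h := by group
  rw [e] at this
  have h4 := norm_mul_le g (of a * (g⁻¹ * h))
  have e' : g * (of a * (g⁻¹ * h)) = g * of a * g⁻¹ * h := by group
  rw [e'] at h4
  omega

theorem norm_inv_mul_mul_of {g h : FreeGroup α} {a : α} (hh : norm h ≤ norm (h * of a))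
    (hg : norm g ≤ norm (h * (of a)⁻¹ * h⁻¹ * g)) : norm (g⁻¹ * h * of a) = norm (g⁻¹ * h) + 1 := by
  refine (norm_mul_of a _).resolve_right fun h1 => ?_
  have h2 := (norm_mul_of a h).resolve_right (by omega)
  have h3 : norm (of a) = 1 := norm_of a
  have h5 : norm ((of a)⁻¹ * (h⁻¹ * g)) = norm (g⁻¹ * h * of a) := by
    rw [← norm_inv_eq]; congr 1; group
  have h6 : norm (h⁻¹ * g) = norm (g⁻¹ * h) := by
    rw [← norm_inv_eq]; congr 1; group
  have := norm_mul_mul (u := h) (v := of a) (w := (of a)⁻¹ * (h⁻¹ * g)) (of_ne_one a)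
    (by omega) (by rw [mul_inv_cancel_left]; omega)
  have e : h * of a * ((of a)⁻¹ * (h⁻¹ * g)) = g := by group
  rw [e] at this
  have h4 := norm_mul_le h ((of a)⁻¹ * (h⁻¹ * g))
  have e' : h * ((of a)⁻¹ * (h⁻¹ * g)) = h * (of a)⁻¹ * h⁻¹ * g := by group
  rw [e'] at h4
  omega

theorem norm_of_mul_mul_of {a b : α} {w : FreeGroup α} (h1 : norm (of a * w) = norm w + 1)
    (h2 : norm (w * of b) = norm w + 1) : norm (of a * w * of b) = norm w + 2 := by
  have ha := norm_of a
  have hb := norm_of b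
  by_cases hw : w = 1
  · subst hw
    have r : IsReduced [(a, true), (b, true)] := by simp [IsReduced]
    have e : of a * of b = mk [(a, true), (b, true)] := rfl
    rw [mul_one, norm, e, toWord_mk, r.reduce_eq]; rfl
  · have := norm_mul_mul (u := of a) (v := w) (w := of b) hw (by omega) (by omega)
    omega

end FreeGroup

theorem toWord_map_Pf {f : FreeGroup ℕ →* FreeGroup ℕ} {τ : ℕ → ℕ} {m : ℕ} (h : ∀ j < m, f (of j) = of (τ j)) :
    (f (Pf m)).toWord = ((List.range m).map fun j => (τ j, true)).reverse := by
  have hr : ∀ L : List (ℕ × Bool), (∀ p ∈ L, p.2 = true) → FreeGroup.IsReduced L := fun L hL => by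
    refine List.Pairwise.isChain (List.pairwise_iff_forall_sublist.2 fun hs _ => ?_)
    rw [hL _ (hs.subset (by simp)), hL _ (hs.subset (by simp))]
  induction m with
  | zero => simp [Pf]
  | succ m ih =>
    rw [Pf, map_mul, FreeGroup.toWord_mul, ih fun j hj => h j (by omega), h m (by omega), FreeGroup.toWord_of,
      List.range_succ, List.map_append, List.reverse_append]
    refine (hr _ ?_).reduce_eq
    intro p
    simp only [List.mem_append, List.mem_reverse, List.mem_map, List.mem_singleton]
    rintro (rfl | ⟨j, -, rfl⟩) <;> rfl

theorem eq_of_map_Pf {f : FreeGroup ℕ →* FreeGroup ℕ} {τ : ℕ → ℕ} {n : ℕ} (h : ∀ j < n, f (of j) = of (τ j))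
    (hf : f (Pf n) = Pf n) : ∀ j < n, τ j = j := by
  have e1 := toWord_map_Pf h
  have e2 := toWord_map_Pf (f := MonoidHom.id _) (τ := id) (m := n) fun _ _ => rfl
  rw [hf] at e1
  rw [MonoidHom.id_apply, e1, List.reverse_inj, List.map_inj_left] at e2
  intro j hj
  exact congrArg Prod.fst (e2 j (List.mem_range.2 hj))

theorem norm_Pf_le (n : ℕ) : (Pf n).norm ≤ n := by
  induction n with
  | zero => simp [Pf]
  | succ n ih =>
    have := FreeGroup.norm_mul_le (of n) (Pf n)
    rw [FreeGroup.norm_of] at this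
    rw [Pf]; omega

section

variable {f : FreeGroup ℕ →* FreeGroup ℕ} {τ : ℕ → ℕ} {g : ℕ → FreeGroup ℕ} {n : ℕ}

theorem conj_eq_one_of_norm_le (hn : 1 ≤ n) (hf : ∀ j < n, f (of j) = g j * of (τ j) * (g j)⁻¹) (hP : f (Pf n) = Pf n)
    (hA : ∀ j < n, (g j).norm ≤ (g j * of (τ j)).norm) (hA' : ∀ j < n, (g j).norm ≤ (g j * (of (τ j))⁻¹).norm)
    (hB : ∀ j, j + 1 < n → (g j).norm ≤ (g (j + 1) * of (τ (j + 1)) * (g (j + 1))⁻¹ * g j).norm)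
    (hC : ∀ j, j + 1 < n → (g (j + 1)).norm ≤ (g j * (of (τ j))⁻¹ * (g j)⁻¹ * g (j + 1)).norm) :
    ∀ j < n, g j = 1 := by
  have key : ∀ m < n, (of (τ m) * ((g m)⁻¹ * f (Pf m))).norm = ((g m)⁻¹ * f (Pf m)).norm + 1 ∧
      m ≤ ((g m)⁻¹ * f (Pf m)).norm ∧ (((g m)⁻¹ * f (Pf m)).norm = m → ∀ j ≤ m, g j = 1) := by
    intro m hm
    induction m with
    | zero =>
      rw [Pf, map_one, mul_one]
      refine ⟨(FreeGroup.norm_of_mul _ _).resolve_right fun h => ?_, by omega, fun h j hj => ?_⟩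
      · rw [FreeGroup.norm_inv_eq, ← FreeGroup.norm_inv_eq, mul_inv_rev, inv_inv] at h
        have := hA' 0 hm
        omega
      · obtain rfl : j = 0 := by omega
        rwa [FreeGroup.norm_eq_zero, inv_eq_one] at h
    | succ m ih =>
      obtain ⟨i1, i2, i3⟩ := ih (by omega)
      have e : (g (m + 1))⁻¹ * f (Pf (m + 1)) =
          (g (m + 1))⁻¹ * g m * of (τ m) * ((g m)⁻¹ * f (Pf m)) := by
        rw [Pf, map_mul, hf m (by omega)]; group
      have h1 := FreeGroup.norm_of_mul_inv_mul (hA' (m + 1) hm) (hB m hm)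
      have h2 := FreeGroup.norm_inv_mul_mul_of (hA m (by omega)) (hC m hm)
      have h3 := FreeGroup.norm_of_mul_mul_of h1 h2
      have hx := FreeGroup.norm_of (τ m)
      have h4 := FreeGroup.norm_mul_mul (FreeGroup.of_ne_one (τ m)) (by omega) (i1.trans (by omega)) (u := (g (m + 1))⁻¹ * g m)
      have h5 := FreeGroup.norm_mul_mul (FreeGroup.of_ne_one (τ m)) (by omega) (i1.trans (by omega))
        (u := of (τ (m + 1)) * ((g (m + 1))⁻¹ * g m))
      rw [e]
      refine ⟨?_, by omega, fun h j hj => ?_⟩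
      · simp only [mul_assoc] at *
        omega
      · have hw : ((g (m + 1))⁻¹ * g m).norm = 0 := by omega
        rw [FreeGroup.norm_eq_zero, inv_mul_eq_one] at hw
        have h6 := i3 (by omega)
        rcases Nat.le_succ_iff.1 hj with h | rfl
        · exact h6 j h
        · rw [hw, h6 m le_rfl]
  obtain ⟨m, rfl⟩ : ∃ m, n = m + 1 := ⟨n - 1, by omega⟩
  obtain ⟨i1, i2, i3⟩ := key m (by omega)
  have hx := FreeGroup.norm_of (τ m)
  have h1 := (FreeGroup.norm_mul_of (τ m) (g m)).resolve_right (by have := hA m (by omega); omega)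
  have h2 := FreeGroup.norm_mul_mul (FreeGroup.of_ne_one (τ m)) (h1.trans (by omega)) (i1.trans (by omega))
  have e : g m * of (τ m) * ((g m)⁻¹ * f (Pf m)) = Pf (m + 1) := by
    rw [← hP, Pf, map_mul, hf m (by omega)]; group
  rw [e] at h2
  have h3 := norm_Pf_le (m + 1)
  exact fun j hj => i3 (by omega) j (by omega)

theorem sum_range_lt_of_swap {a a' : ℕ → ℕ} {j : ℕ} (hj : j + 1 < n)
    (h : a' j + a' (j + 1) < a j + a (j + 1)) (h' : ∀ i, i ≠ j → i ≠ j + 1 → a' i = a i) :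
    ∑ i ∈ Finset.range n, a' i < ∑ i ∈ Finset.range n, a i := by
  obtain ⟨r, rfl⟩ : ∃ r, n = j + 1 + 1 + r := ⟨n - (j + 2), by omega⟩
  have e : ∀ b : ℕ → ℕ, ∑ i ∈ Finset.range (j + 1 + 1 + r), b i =
      ∑ i ∈ Finset.range j, b i + b j + b (j + 1) + ∑ i ∈ Finset.range r, b (j + 1 + 1 + i) := fun b => by
    rw [Finset.sum_range_add _ (j + 1 + 1), Finset.sum_range_succ, Finset.sum_range_succ]
  have e1 : ∑ i ∈ Finset.range j, a' i = ∑ i ∈ Finset.range j, a i :=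
    Finset.sum_congr rfl fun i hi => by
      have := Finset.mem_range.1 hi
      exact h' i (by omega) (by omega)
  have e2 : ∑ i ∈ Finset.range r, a' (j + 1 + 1 + i) = ∑ i ∈ Finset.range r, a (j + 1 + 1 + i) :=
    Finset.sum_congr rfl fun i _ => h' _ (by omega) (by omega)
  rw [e, e, e1, e2]
  omega

theorem exists_act_of_comp (k : ArtinB n) (h : ∃ b, ∀ i < n, act n b (of i) = f (act n k (of i))) :
    ∃ b, ∀ i < n, act n b (of i) = f (of i) := by
  obtain ⟨b, hb⟩ := h
  refine ⟨b * k⁻¹, fun i hi => ?_⟩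
  rw [act_mul]
  have := kap_eq_self_ext (f := (act n b).toMonoidHom) (g := f.comp (act n k).toMonoidHom) hb
    (kap_act_self k⁻¹ (kap_of_mem (M := Set.Iio n) hi))
  refine this.trans ?_
  change f (act n k (act n k⁻¹ (of i))) = f (of i)
  rw [act_act_inv]

theorem exists_act_eq (hn : 1 ≤ n) (hf : ∀ j < n, f (of j) = g j * of (τ j) * (g j)⁻¹) (hP : f (Pf n) = Pf n) :
    ∃ b, ∀ i < n, act n b (of i) = f (of i) := by
  obtain ⟨N, hN⟩ : ∃ N, ∑ j ∈ Finset.range n, (g j).norm = N := ⟨_, rfl⟩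
  induction N using Nat.strong_induction_on generalizing f τ g with
  | _ N ih =>
  subst hN
  have upd : ∀ j < n, ∀ u : FreeGroup ℕ, u.norm < (g j).norm → f (of j) = u * of (τ j) * u⁻¹ →
      ∃ b, ∀ i < n, act n b (of i) = f (of i) := by
    intro j hj u hu he
    refine ih _ ?_ (g := Function.update g j u) (τ := τ) (fun i hi => ?_) hP rfl
    · refine Finset.sum_lt_sum (fun i hi => ?_) ⟨j, Finset.mem_range.2 hj, by simpa⟩
      by_cases hij : i = j
      · subst hij; simpa using hu.le
      · simp [hij]
    · by_cases hij : i = j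
      · subst hij; simpa using he
      · simpa [hij] using hf i hi
  by_cases hA : ∀ j < n, (g j).norm ≤ (g j * of (τ j)).norm
  swap
  · push Not at hA
    obtain ⟨j, hj, h⟩ := hA
    exact upd j hj _ h (by rw [hf j hj]; group)
  by_cases hA' : ∀ j < n, (g j).norm ≤ (g j * (of (τ j))⁻¹).norm
  swap
  · push Not at hA'
    obtain ⟨j, hj, h⟩ := hA'
    exact upd j hj _ h (by rw [hf j hj]; group)
  by_cases hB : ∀ j, j + 1 < n → (g j).norm ≤ (g (j + 1) * of (τ (j + 1)) * (g (j + 1))⁻¹ * g j).norm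
  swap
  · push Not at hB
    obtain ⟨j, hj, h⟩ := hB
    have a1 : act n (sg n j)⁻¹ (of j) = of (j + 1) := by
      rw [← act_inv_act (n := n) (sg n j) (of (j + 1)), act_sg hj, sig_succ]
    have a2 : act n (sg n j)⁻¹ (of (j + 1)) = of (j + 1) * of j * (of (j + 1))⁻¹ := by
      rw [← act_inv_act (n := n) (sg n j) (of (j + 1) * of j * (of (j + 1))⁻¹)]
      congr 1
      rw [act_sg hj, map_mul, map_mul, map_inv, sig_succ, sig_self]; group
    have a3 : ∀ i, i ≠ j → i ≠ j + 1 → act n (sg n j)⁻¹ (of i) = of i := fun i h1 h2 => by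
      have := act_inv_act n (sg n j) (of i)
      rwa [act_sg hj, sig_of_ne h1 h2] at this
    refine exists_act_of_comp (sg n j)⁻¹ (ih _ ?_ (f := f.comp (act n (sg n j)⁻¹).toMonoidHom)
      (g := fun i => if i = j then g (j + 1) else if i = j + 1 then
        g (j + 1) * of (τ (j + 1)) * (g (j + 1))⁻¹ * g j else g i)
      (τ := fun i => if i = j then τ (j + 1) else if i = j + 1 then τ j else τ i) (fun i hi => ?_) ?_ rfl)
    · refine sum_range_lt_of_swap hj ?_ fun i h1 h2 => ?_
      · simp; omega
      · simp [h1, h2]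
    · change f (act n (sg n j)⁻¹ (of i)) = _
      by_cases h1 : i = j
      · subst h1; rw [a1, hf _ hj]; simp
      by_cases h2 : i = j + 1
      · subst h2; rw [a2, map_mul, map_mul, map_inv, hf _ hj, hf j (by omega)]; simp; group
      · rw [a3 i h1 h2, hf i hi]; simp [h1, h2]
    · change f (act n (sg n j)⁻¹ (Pf n)) = _
      rw [act_BS_Pf le_rfl le_rfl (inv_mem (sg_mem_BS hj)), hP]
  by_cases hC : ∀ j, j + 1 < n → (g (j + 1)).norm ≤ (g j * (of (τ j))⁻¹ * (g j)⁻¹ * g (j + 1)).norm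
  swap
  · push Not at hC
    obtain ⟨j, hj, h⟩ := hC
    refine exists_act_of_comp (sg n j) (ih _ ?_ (f := f.comp (act n (sg n j)).toMonoidHom)
      (g := fun i => if i = j + 1 then g j else if i = j then
        g j * (of (τ j))⁻¹ * (g j)⁻¹ * g (j + 1) else g i)
      (τ := fun i => if i = j + 1 then τ j else if i = j then τ (j + 1) else τ i) (fun i hi => ?_) ?_ rfl)
    · refine sum_range_lt_of_swap hj ?_ fun i h1 h2 => ?_
      · simp; omega
      · simp [h1, h2]
    · change f (act n (sg n j) (of i)) = _
      rw [act_sg hj]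
      by_cases h1 : i = j + 1
      · subst h1; rw [sig_succ, hf j (by omega)]; simp
      by_cases h2 : i = j
      · subst h2; rw [sig_self, map_mul, map_mul, map_inv, hf _ hj, hf i (by omega)]; simp; group
      · rw [sig_of_ne h2 h1, hf i hi]; simp [h1, h2]
    · change f (act n (sg n j) (Pf n)) = _
      rw [act_BS_Pf le_rfl le_rfl (sg_mem_BS hj), hP]
  have hg := conj_eq_one_of_norm_le hn hf hP hA hA' hB hC
  have hf' : ∀ j < n, f (of j) = of (τ j) := fun j hj => by rw [hf j hj, hg j hj]; simp
  have hτ := eq_of_map_Pf hf' hP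
  exact ⟨1, fun i hi => by rw [hf' i hi, hτ i hi]; simp⟩

end

open FreeGroup (kap of kap_of_mem kap_of_notMem expSum expSum_of_self expSum_of_ne)

/-! ### Normal form of permutation-preserving injective endomorphisms -/

theorem exists_zpow_of_act_eq {n : ℕ} (h : 2 ≤ n) {u : ArtinB n} (hu : ∀ i < n, act n u (of i) = of i) :
    ∃ k : ℤ, u = ΔB n ^ k := by
  have hw : ∀ w, kap (Set.Iio n) w = w → act n u w = w := fun w hw =>
    kap_eq_self_ext (f := (act n u).toMonoidHom) (g := MonoidHom.id _) hu hw
  have hp : prm n u = 1 := by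
    ext i
    rcases Nat.lt_or_ge i n with hi | hi
    · exact eq_of_act_of (c := 1) (by rw [hu i hi, Equiv.Perm.one_apply, one_mul, inv_one, mul_one])
    · exact prm_of_ge u hi
  have hm : u ∈ NM n (Set.Iio n) := mem_NM.2 ⟨hp, 1, fun f => by
    rw [kap_Iio_act, hw _ (FreeGroup.kap_kap_self _ _)]; group⟩
  obtain ⟨f, k, hfk⟩ := exists_X_mul_ΔB h hm
  refine ⟨k, ?_⟩
  have : kap (Set.Iio n) f = 1 := X_central h fun j => by
    rcases Nat.lt_or_ge j n with hj | hj
    · have e := conj_X u (of j)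
      rw [hu j hj, X_of, hfk, mul_inv_rev, mul_assoc (X n f), (((ΔB_comm h (xs n j)).zpow_left k)).eq] at e
      rw [Commute, SemiconjBy, ← mul_inv_eq_iff_eq_mul]
      simpa only [mul_assoc, mul_inv_cancel_left] using e
    · rw [xs_of_ge hj]; exact Commute.one_right _
  rw [hfk, ← X_kap, this, map_one, one_mul]

variable {n : ℕ} {φ : ArtinB n →* ArtinB n} {Y : FreeGroup ℕ →* FreeGroup ℕ} {c : ℤ}

theorem FreePart.exists_normal (hY : FreePart φ Y c) (h : 2 ≤ n)
    (hy : ∀ j < n, ∃ d, Y (of j) = d * of j * d⁻¹) {d : FreeGroup ℕ} (hd : kap (Set.Iio n) d = d)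
    (hP : Y (Pf n) = d * Pf n * d⁻¹) : ∃ x, ∀ g, ∃ m : ℤ, x * φ g * x⁻¹ = g * ΔB n ^ m := by
  choose! v hv using hy
  obtain ⟨b, hb⟩ := exists_act_eq (n := n) (f := (MulAut.conj d⁻¹).toMonoidHom.comp Y) (g := fun j => d⁻¹ * v j)
    (τ := id) (by omega) (fun j hj => by
      simp only [MonoidHom.comp_apply, MulEquiv.coe_toMonoidHom, MulAut.conj_apply, hv j hj, id]; group)
    (by simp only [MonoidHom.comp_apply, MulEquiv.coe_toMonoidHom, MulAut.conj_apply, hP]; group)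
  refine ⟨b⁻¹ * X n d⁻¹, fun g => ?_⟩
  set x := b⁻¹ * X n d⁻¹ with hx
  have hxY : ∀ j < n, act n x (Y (of j)) = of j := fun j hj => by
    have := hb j hj
    simp only [MonoidHom.comp_apply, MulEquiv.coe_toMonoidHom, MulAut.conj_apply] at this
    rw [hx, act_mul, act_X, map_inv (kap (Set.Iio n)), hd, MulAut.conj_apply, ← this, act_inv_act]
  have hxY' : ∀ w, kap (Set.Iio n) w = w → act n x (Y w) = w := fun w hw =>
    kap_eq_self_ext (f := (act n x).toMonoidHom.comp Y) (g := MonoidHom.id _) hxY hw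
  obtain ⟨k, hk⟩ := exists_zpow_of_act_eq (u := g⁻¹ * (x * φ g * x⁻¹)) h fun i hi => by
    have hi' := kap_of_mem (M := Set.Iio n) hi
    have e : act n x⁻¹ (of i) = Y (of i) := by rw [← hxY i hi, act_inv_act, hxY i hi]
    rw [act_mul, act_mul, act_mul, e, hY.act_eq, hxY' _ (kap_act_self g hi'), act_inv_act]
  exact ⟨k, by rw [← hk, mul_inv_cancel_left]⟩

theorem FreePart.degree_eq (hY : FreePart φ Y c) (h : 2 ≤ n) {k : ℤ} {d : FreeGroup ℕ}
    (hd : Y (of (n - 1)) = d * of (n - 1) ^ k * d⁻¹) {f : ArtinB n →* Multiplicative ℤ}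
    (h1 : ∀ i, i + 1 < n → f (sg n i) = 1) (h2 : f (sg n (n - 1)) = Multiplicative.ofAdd 1) :
    f (φ (sg n (n - 1))) = Multiplicative.ofAdd (k + n * c) := by
  have e := hY.map_xs (n - 1) (by omega)
  rw [xs_last (by omega)] at e
  have hα : ∀ k, k + 1 ≤ n → f (ascProd (sg n) 0 k) = 1 := fun k hk => by
    induction k with
    | zero => exact map_one f
    | succ k ih => rw [ascProd_succ, map_mul, ih (by omega), Nat.zero_add, h1 k (by omega), mul_one]
  rw [e, hd, map_mul, map_mul, map_mul, map_inv, map_mul, map_mul, map_inv, mul_right_comm _ _ (f (X n d))⁻¹,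
    mul_inv_cancel, one_mul, map_zpow, X_of, xs_last (by omega),
    map_zpow, map_zpow, h2, ΔB, map_pow, ρB_eq_αB_mul (by omega), map_mul, αB, hα _ (by omega), one_mul, h2,
    ← ofAdd_zsmul, ← ofAdd_nsmul, ← ofAdd_zsmul, ← ofAdd_add]
  congr 1
  simp [mul_comm]

theorem prm_conj_μ {n : ℕ} (h : 2 ≤ n) {μ : ArtinB n →* ArtinB n}
    (h1 : ∀ i, i + 1 < n → μ (sg n i) = (sg n (n - 2 - i))⁻¹) (h2 : μ (ρB n) = (ρB n)⁻¹) {g : ArtinB n}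
    (hg : ∀ i < n, prm n g i = n - 1 - i) (x : ArtinB n) : prm n (g * μ x * g⁻¹) = prm n x := by
  obtain ⟨ι, i1, i2⟩ := exists_ι h
  rw [← prm_conj_ι h i1 i2 hg x, map_mul, map_mul, map_mul, map_mul]
  congr 2
  suffices (prm n).comp μ = (prm n).comp ι from DFunLike.congr_fun this x
  refine ArtinB.hom_ext_ρ (by omega) (fun i hi => ?_) ?_
  · simp only [MonoidHom.comp_apply]
    rw [h1 i hi, i1 i hi, map_inv, prm_sg (by omega), Equiv.swap_inv]
  · simp only [MonoidHom.comp_apply]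
    rw [h2, i2]

theorem μ_last {n : ℕ} (h : 2 ≤ n) {μ : ArtinB n →* ArtinB n}
    (h1 : ∀ i, i + 1 < n → μ (sg n i) = (sg n (n - 2 - i))⁻¹) (h2 : μ (ρB n) = (ρB n)⁻¹) :
    μ (sg n (n - 1)) = αB n * (sg n (n - 1))⁻¹ * (αB n)⁻¹ := by
  have e : μ (αB n) = descProd (fun i => (sg n i)⁻¹) (n - 1) := by
    refine map_ascProd_eq_descProd fun i hi => ?_
    rw [h1 i (by omega), show n - 2 - i = n - 1 - 1 - i by omega]
  have e' : ∀ k, descProd (fun i => (sg n i)⁻¹) k = (ascProd (sg n) 0 k)⁻¹ := fun k => by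
    induction k with
    | zero => simp [descProd, ascProd]
    | succ k ih => rw [descProd, ih, ascProd_succ, mul_inv_rev, Nat.zero_add]
  have := h2
  rw [ρB_eq_αB_mul (by omega), map_mul, e, e', ← αB, inv_mul_eq_iff_eq_mul] at this
  rw [this]; group

theorem exists_normal_of_mem (h : 5 ≤ n) (hφ : ∀ g, prm n (φ g) = prm n g) (hinj : Function.Injective φ)
    (hg : φ (sg n (n - 1)) ∈ NM n (Set.Iio n)) {μ : ArtinB n →* ArtinB n}
    (h1 : ∀ i, i + 1 < n → μ (sg n i) = (sg n (n - 2 - i))⁻¹) (h2 : μ (ρB n) = (ρB n)⁻¹)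
    (hμ : Function.Injective μ) :
    (∃ x, ∀ y, ∃ m : ℤ, x * φ y * x⁻¹ = y * ΔB n ^ m) ∨
      ∃ x, ∀ y, ∃ m : ℤ, x * φ (μ y) * x⁻¹ = y * ΔB n ^ m := by
  have key : ∀ ψ : ArtinB n →* ArtinB n, (∀ g, prm n (ψ g) = prm n g) → Function.Injective ψ →
      ψ (sg n (n - 1)) ∈ NM n (Set.Iio n) → ∃ (Y : FreeGroup ℕ →* FreeGroup ℕ) (c k : ℤ) (d : FreeGroup ℕ), FreePart ψ Y c ∧ (k = 1 ∨ k = -1) ∧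
        Y (of (n - 1)) = d * of (n - 1) ^ k * d⁻¹ ∧
        (k = 1 → ∃ x, ∀ y, ∃ m : ℤ, x * ψ y * x⁻¹ = y * ΔB n ^ m) := fun ψ hψ hinj hg => by
    obtain ⟨Y, c, hY⟩ := exists_freePart (by omega) hg
    obtain ⟨k, hk, hy⟩ := hY.exists_conj_zpow h hψ hinj
    obtain ⟨d, hd, hd'⟩ := hY.exists_conj_Pf h hψ hk hy
    have := natAbs_le_one_of_map_Pf (by omega) hy hd'
    obtain ⟨e, he⟩ := hy (n - 1) (by omega)
    refine ⟨Y, c, k, e, hY, by omega, he, ?_⟩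
    rintro rfl
    simp only [zpow_one] at hy hd'
    exact hY.exists_normal (by omega) hy hd hd'
  obtain ⟨Y, c, k, d, hY, hk, hd, hk1⟩ := key φ hφ hinj hg
  rcases hk with rfl | rfl
  · exact Or.inl (hk1 rfl)
  right
  obtain ⟨g, hrev⟩ := exists_prm_rev n
  set ψ : ArtinB n →* ArtinB n := φ.comp ((MulAut.conj g).toMonoidHom.comp μ) with hψ
  have hψa : ∀ y, ψ y = φ g * φ (μ y) * (φ g)⁻¹ := fun y => by simp [hψ]
  have hr : ψ (sg n (n - 1)) = (φ g * φ (αB n)) * (φ (sg n (n - 1)))⁻¹ * (φ g * φ (αB n))⁻¹ := by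
    rw [hψa, μ_last (by omega) h1 h2]; simp only [map_mul, map_inv]; group
  obtain ⟨Y', c', k', d', hY', hk', hd', hk1'⟩ := key ψ (fun y => by
      rw [hψa, ← prm_conj_μ (by omega) h1 h2 hrev y, ← map_inv, ← map_mul, ← map_mul, hφ])
    (hinj.comp ((MulAut.conj g).injective.comp hμ)) (by rw [hr]; exact conj_mem_NM_Iio.2 (inv_mem hg))
  obtain ⟨f, hf1, hf2⟩ := exists_degree n 1 0
  have d1 := hY.degree_eq (by omega) hd (f := f) (by simpa using hf1) (hf2 (by omega))
  have d2 := hY'.degree_eq (by omega) hd' (f := f) (by simpa using hf1) (hf2 (by omega))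
  rw [hr, MonoidHom.map_conj_comm, map_inv, d1, ← ofAdd_neg] at d2
  have d3 : -(-1 + n * c) = k' + n * c' := d2
  have hk1 : k' = 1 := by
    refine hk'.resolve_right ?_
    rintro rfl
    have : (n : ℤ) ∣ 2 := ⟨c + c', by linarith⟩
    have := Int.le_of_dvd (by norm_num) this
    omega
  obtain ⟨x, hx⟩ := hk1' hk1
  refine ⟨x * φ g, fun y => ?_⟩
  obtain ⟨m, hm⟩ := hx y
  exact ⟨m, by rw [← hm, hψa]; group⟩

theorem exists_type_of_prm (h : 5 ≤ n) (hφ : ∀ g, prm n (φ g) = prm n g) (hinj : Function.Injective φ) :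
    ∃ x, (∃ ε p q : ℤ, IsType2a n ε p q (conjComp x φ)) ∨ ∃ ε p q : ℤ, IsType2b n ε p q (conjComp x φ) := by
  have h2n : 2 ≤ n := by omega
  obtain ⟨ι, i1, i2⟩ := exists_ι h2n
  obtain ⟨μ, m1, m2⟩ := exists_μ h2n
  have hμμ : ∀ y, μ (μ y) = y := fun y => by
    suffices μ.comp μ = MonoidHom.id _ from DFunLike.congr_fun this y
    refine ArtinB.hom_ext_ρ (by omega) (fun i hi => ?_) ?_
    · simp only [MonoidHom.comp_apply, MonoidHom.id_apply]
      rw [m1 i hi, map_inv, m1 _ (by omega), inv_inv]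
      congr 1
      omega
    · simp [m2]
  have hιι := ι_ι h2n i1 i2
  have hnorm : ∀ N : ArtinB n →* ArtinB n, (∀ y, ∃ m : ℤ, N y = y * ΔB n ^ m) →
      ∃ p q : ℤ, (∀ i, i + 1 < n → N (sg n i) = sg n i * ΔB n ^ p) ∧ N (ρB n) = ρB n * ΔB n ^ q := fun N hN => by
    obtain ⟨p, hp⟩ := hN (sg n 0)
    obtain ⟨q, hq⟩ := hN (ρB n)
    refine ⟨p, q, fun i hi => ?_, hq⟩
    induction i with
    | zero => exact hp
    | succ i ih =>
      have e : sg n (i + 1) = ρB n * sg n i * (ρB n)⁻¹ := eq_mul_inv_of_mul_eq (ρB_mul_sg (by omega)).symm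
      have hc : ∀ g : ArtinB n, ∀ k : ℤ, ΔB n ^ k * g = g * ΔB n ^ k := fun g k =>
        ((ΔB_comm h2n g).zpow_left k).eq
      rw [e, map_mul, map_mul, map_inv, hq, ih (by omega), mul_inv_rev, mul_assoc (ρB n), hc]
      simp only [mul_assoc]
      rw [← mul_assoc (ΔB n ^ q), mul_inv_cancel, one_mul, hc]
  have hinv : ∀ (N : ArtinB n →* ArtinB n) {y : ArtinB n} {p : ℤ}, N y = y * ΔB n ^ p → N y⁻¹ = y⁻¹ * ΔB n ^ (-p) :=
    fun N y p hN => by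
      rw [map_inv, hN, mul_inv_rev, zpow_neg]
      exact ((((ΔB_comm h2n y⁻¹).zpow_left p)).inv_left).eq
  obtain ⟨g, hrev⟩ := exists_prm_rev n
  have hcomp : ∀ τ : ArtinB n →* ArtinB n, ∀ x, (∀ y, ∃ m : ℤ, x * φ (τ y) * x⁻¹ = y * ΔB n ^ m) →
      ∃ p q : ℤ, (∀ i, i + 1 < n → conjComp x φ (τ (sg n i)) = sg n i * ΔB n ^ p) ∧
        conjComp x φ (τ (ρB n)) = ρB n * ΔB n ^ q := fun τ x hx => hnorm ((conjComp x φ).comp τ) hx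
  rcases hom_last_mem_or h hφ with hm | hm
  · rcases exists_normal_of_mem h hφ hinj hm m1 m2 (Function.LeftInverse.injective hμμ) with ⟨x, hx⟩ | ⟨x, hx⟩
    · obtain ⟨p, q, hp, hq⟩ := hcomp (MonoidHom.id _) x hx
      exact ⟨x, Or.inl ⟨1, p, q, isType2a_of h2n (Or.inl rfl) (fun i hi => by rw [zpow_one]; exact hp i hi) hq⟩⟩
    · obtain ⟨p, q, hp, hq⟩ := hcomp μ x hx
      refine ⟨x, Or.inr ⟨-1, -p, -q, isType2b_of h2n (Or.inr rfl) (fun i hi => ?_) ?_⟩⟩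
      · have := hinv ((conjComp x φ).comp μ) (hp (n - 2 - i) (by omega))
        rw [MonoidHom.comp_apply, map_inv, m1 _ (by omega), inv_inv, show n - 2 - (n - 2 - i) = i by omega] at this
        rw [this, zpow_neg_one]
      · have := hinv ((conjComp x φ).comp μ) hq
        rwa [MonoidHom.comp_apply, map_inv, m2, inv_inv] at this
  · set ψ : ArtinB n →* ArtinB n := φ.comp ((MulAut.conj g).toMonoidHom.comp ι) with hψ
    have hψa : ∀ y, ψ y = φ g * φ (ι y) * (φ g)⁻¹ := fun y => by simp [hψ]
    have hxg : ∀ x y, x * ψ y * x⁻¹ = (x * φ g) * φ (ι y) * (x * φ g)⁻¹ := fun x y => by rw [hψa]; group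
    rcases exists_normal_of_mem (φ := ψ) h (fun y => by
        rw [hψa, ← prm_conj_ι h2n i1 i2 hrev y, ← map_inv, ← map_mul, ← map_mul, hφ])
      (hinj.comp ((MulAut.conj g).injective.comp (Function.LeftInverse.injective hιι)))
      (by rw [hψa, ι_last h2n i1 i2, map_inv]; exact conj_mem_NM_Iio.2 (inv_mem hm)) m1 m2
      (Function.LeftInverse.injective hμμ) with ⟨x, hx⟩ | ⟨x, hx⟩
    · obtain ⟨p, q, hp, hq⟩ := hcomp ι (x * φ g) fun y => by simpa only [hxg] using hx y
      refine ⟨x * φ g, Or.inr ⟨1, p, -q, isType2b_of h2n (Or.inl rfl) (fun i hi => ?_) ?_⟩⟩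
      · have := hp (n - 2 - i) (by omega)
        rw [i1 _ (by omega), show n - 2 - (n - 2 - i) = i by omega] at this
        rw [this, zpow_one]
      · have := hinv ((conjComp (x * φ g) φ).comp ι) hq
        rwa [MonoidHom.comp_apply, map_inv, i2, inv_inv] at this
    · obtain ⟨p, q, hp, hq⟩ := hcomp (ι.comp μ) (x * φ g) fun y => by
        simpa only [hxg, MonoidHom.comp_apply] using hx y
      refine ⟨x * φ g, Or.inl ⟨-1, -p, q, isType2a_of h2n (Or.inr rfl) (fun i hi => ?_) ?_⟩⟩
      · have := hinv ((conjComp (x * φ g) φ).comp (ι.comp μ)) (hp i hi)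
        rw [map_inv, MonoidHom.comp_apply, MonoidHom.comp_apply, m1 _ hi, map_inv ι, map_inv, inv_inv, i1 _ (by omega),
          show n - 2 - (n - 2 - i) = i by omega] at this
        rw [this, zpow_neg_one]
      · rwa [MonoidHom.comp_apply, m2, map_inv, i2, inv_inv] at hq

open FreeGroup (kap of kap_of_mem kap_of_notMem expSum expSum_of_self expSum_of_ne)

/-! ### Perfect subgroups of the pure group -/

theorem mem_NM_insert_of_perfect {n r i j : ℕ} {M : Set ℕ} (hM : M ⊆ Set.Iio n) (hr : r < n) (hrM : r ∉ M)
    (hi : i ∈ M) (hj : j ∈ M) (hij : i ≠ j) {Q : Type*} [Group Q] (hQ : commutator Q = ⊤) (f : Q →* ArtinB n)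
    (hf : ∀ q, f q ∈ NM n M) (q : Q) : f q ∈ NM n (insert r M) := by
  choose c hc using fun q => exists_Chi r (hf q)
  let F : Q →* FreeGroup ℕ := MonoidHom.mk' (fun q => (c q)⁻¹) fun a b => by
    have h1 := (hc a).mul (hc b)
    rw [← map_mul] at h1
    rw [Chi.unique hi hj hij hrM (hc (a * b)) h1, mul_inv_rev]
  have h1 : (c q)⁻¹ = 1 := FreeGroup.hom_eq_one_of_perfect hQ F q
  refine Chi.mem_NM_insert hM hr hrM hi ?_
  rw [← inv_eq_one.1 h1]
  exact hc q

theorem eq_one_of_perfect {n : ℕ} (h : 2 ≤ n) {Q : Type*} [Group Q] (hQ : commutator Q = ⊤) (f : Q →* ArtinB n)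
    (hf : ∀ q, prm n (f q) = 1) (q : Q) : f q = 1 := by
  have h1 : ∀ m, 2 ≤ m → m ≤ n → ∀ q, f q ∈ NM n (Set.Iio m) := by
    intro m hm
    induction m, hm using Nat.le_induction with
    | base =>
      intro hn q
      have : Set.Iio 2 = ({0, 1} : Set ℕ) := by ext i; simp only [Set.mem_Iio, Set.mem_insert_iff, Set.mem_singleton_iff]; omega
      rw [this]
      exact mem_NM_pair (by omega) (by omega) (by omega) (hf q)
    | succ m hm ih =>
      intro hn q
      have : Set.Iio (m + 1) = insert m (Set.Iio m) := by ext i; simp only [Set.mem_Iio, Set.mem_insert_iff]; omega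
      rw [this]
      exact mem_NM_insert_of_perfect (i := 0) (j := 1) (Set.Iio_subset_Iio (by omega)) (by omega)
        (Set.self_notMem_Iio) (Set.mem_Iio.2 (by omega)) (Set.mem_Iio.2 (by omega)) (by omega) hQ f (ih (by omega)) q
  choose g k hg using fun q => exists_X_mul_ΔB h (h1 n h le_rfl q)
  have hX : ∀ w (l : ℤ), X n w = ΔB n ^ l → kap (Set.Iio n) w = 1 := fun w l hw =>
    X_central h fun j => hw ▸ (ΔB_comm h _).zpow_left l
  have hmul : ∀ a b, kap (Set.Iio n) (g (a * b)) = kap (Set.Iio n) (g a) * kap (Set.Iio n) (g b) := fun a b => by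
    have e := map_mul f a b
    rw [hg, hg a, hg b, mul_assoc (X n (g a)), ← mul_assoc (ΔB n ^ k a), ((ΔB_comm h (X n (g b))).zpow_left _).eq,
      mul_assoc (X n (g b)), ← mul_assoc (X n (g a)), ← zpow_add, ← map_mul (X n)] at e
    have e2 := hX ((g (a * b))⁻¹ * (g a * g b)) (k (a * b) - (k a + k b)) (by
      rw [map_mul (X n), map_inv, inv_mul_eq_iff_eq_mul, zpow_sub, ← mul_assoc, e, mul_assoc, mul_inv_cancel, mul_one])
    rw [map_mul, map_inv, inv_mul_eq_one, map_mul] at e2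
    exact e2
  let F : Q →* FreeGroup ℕ := MonoidHom.mk' (fun q => kap (Set.Iio n) (g q)) hmul
  have h2 : ∀ q, f q = ΔB n ^ k q := fun q => by
    have : kap (Set.Iio n) (g q) = 1 := FreeGroup.hom_eq_one_of_perfect hQ F q
    rw [hg q, ← X_kap, this, map_one, one_mul]
  have h3 : commutator Q ≤ f.ker := by
    rw [commutator_def, Subgroup.commutator_le]
    intro a _ b _
    rw [MonoidHom.mem_ker, map_commutatorElement, h2, h2, commutatorElement_eq_one_iff_commute]
    exact (Commute.refl _).zpow_zpow _ _
  rw [hQ] at h3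
  exact h3 (Subgroup.mem_top q)

/-! ### Braid sequences in general groups -/

theorem BraidSeq.eq_of_commute {H : Type*} [Group H] {s : ℕ → H} {m : ℕ} (h : BraidSeq s m) {i : ℕ} (hi : i + 1 < m)
    (hc : Commute (s i) (s (i + 1))) : s i = s (i + 1) := by
  have := h.braid i hi
  rwa [hc.eq, mul_assoc, mul_assoc, mul_right_inj, hc.eq, mul_left_inj] at this

theorem BraidSeq.eq_of_adjacent {H : Type*} [Group H] {s : ℕ → H} {m : ℕ} (h : BraidSeq s m) {i : ℕ} (hi : i + 1 < m)
    (he : s i = s (i + 1)) {j : ℕ} (hj : j < m) : s j = s 0 := by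
  have up : ∀ k, i + k + 1 < m → s (i + k) = s (i + k + 1) := by
    intro k
    induction k with
    | zero => exact fun _ => he
    | succ k ih =>
      intro hk
      refine h.eq_of_commute (by omega) ?_
      have := h.comm (i + k) (i + (k + 1) + 1) (by omega) (by omega)
      rwa [ih (by omega)] at this
  have down : ∀ k, k ≤ i → s (i - k) = s (i - k + 1) := by
    intro k
    induction k with
    | zero => exact fun _ => he
    | succ k ih =>
      intro hk
      refine h.eq_of_commute (by omega) ?_
      have := h.comm (i - (k + 1)) (i - k + 1) (by omega) (by omega)
      rwa [← ih (by omega), show i - k = i - (k + 1) + 1 by omega] at this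
  have all : ∀ k, k + 1 < m → s k = s (k + 1) := fun k hk => by
    rcases le_total i k with h1 | h1
    · obtain ⟨d, rfl⟩ := Nat.exists_eq_add_of_le h1
      exact up d hk
    · have := down (i - k) (by omega)
      rwa [Nat.sub_sub_self h1] at this
  induction j with
  | zero => rfl
  | succ j ih => rw [← all j hj, ih (by omega)]

theorem BraidSeq.eq_of_commute_div {H : Type*} [Group H] {s : ℕ → H} {m : ℕ} (h : BraidSeq s m) {i : ℕ} (hi : i + 3 < m)
    (hc : Commute (s i * (s (i + 3))⁻¹) (s (i + 1) * (s (i + 3))⁻¹)) : s i = s (i + 1) := by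
  refine h.eq_of_commute (by omega) ?_
  have h0 : Commute (s i) (s (i + 3)) := h.comm _ _ (by omega) (by omega)
  have h1 : Commute (s (i + 1)) (s (i + 3)) := h.comm _ _ (by omega) (by omega)
  have h3 : Commute (s (i + 1) * (s (i + 3))⁻¹) (s (i + 3)) := h1.mul_left (Commute.refl _).inv_left
  have h4 : Commute (s i) (s (i + 1) * (s (i + 3))⁻¹) := by
    simpa using hc.mul_left h3.symm
  simpa using h4.mul_right h0

theorem BraidSeq.eq_zero_of_eq {H : Type*} [Group H] {s : ℕ → H} {m : ℕ} (h : BraidSeq s m) {i j : ℕ} (hij : i < j)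
    (hj : j < m) (hm : 4 ≤ m) (he : s i = s j) {k : ℕ} (hk : k < m) : s k = s 0 := by
  rcases Nat.eq_or_lt_of_le hij with h1 | h1
  · exact h.eq_of_adjacent (i := i) (by omega) (by rw [he, ← h1]) hk
  rcases Nat.eq_zero_or_pos i with h2 | h2
  · rcases Nat.lt_or_ge (j + 1) m with h3 | h3
    · have := h.comm i (j + 1) (by omega) h3
      rw [he] at this
      exact h.eq_of_adjacent h3 (h.eq_of_commute h3 this) hk
    · obtain ⟨j, rfl⟩ := Nat.exists_eq_add_of_le' (show 1 ≤ j by omega)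
      have := h.comm i j (by omega) (by omega)
      rw [he] at this
      exact h.eq_of_adjacent hj (h.eq_of_commute hj this.symm) hk
  · obtain ⟨i, rfl⟩ := Nat.exists_eq_add_of_le' h2
    have := h.comm i j (by omega) hj
    rw [← he] at this
    exact h.eq_of_adjacent (i := i) (by omega) (h.eq_of_commute (by omega) this) hk

/-- The commutator subgroup of a group generated by a braid sequence of length at least four is perfect. -/
theorem BraidSeq.commutator_perfect {H : Type*} [Group H] {s : ℕ → H} {m : ℕ} (h : BraidSeq s m) (hm : 4 ≤ m)
    (hg : Subgroup.closure {g | ∃ i < m, g = s i} = ⊤) : commutator (commutator H) = ⊤ := by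
  set D := commutator H with hD
  let p := QuotientGroup.mk' ⁅D, D⁆
  have hab : ∀ {K : Type _} [Group K] (f : H →* K), (∀ i < m, f (s i) = f (s 0)) → D ≤ f.ker := by
    intro K _ f hf
    have : ∀ x, f x ∈ Subgroup.zpowers (f (s 0)) := fun x => by
      have hx : x ∈ (Subgroup.zpowers (f (s 0))).comap f := by
        have : (⊤ : Subgroup H) ≤ (Subgroup.zpowers (f (s 0))).comap f := by
          rw [← hg, Subgroup.closure_le]
          rintro _ ⟨i, hi, rfl⟩
          exact Subgroup.mem_comap.2 (hf i hi ▸ Subgroup.mem_zpowers _)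
        exact this (Subgroup.mem_top x)
      exact hx
    rw [hD, commutator_def, Subgroup.commutator_le]
    intro a _ b _
    obtain ⟨k, hk⟩ := this a
    obtain ⟨l, hl⟩ := this b
    rw [MonoidHom.mem_ker, map_commutatorElement, ← hk, ← hl, commutatorElement_eq_one_iff_commute]
    exact (Commute.refl _).zpow_zpow _ _
  have hmem : ∀ i j, i < m → j < m → s i * (s j)⁻¹ ∈ D := fun i j hi hj => by
    have h1 := (h.map (Abelianization.of))
    have h2 : ∀ k, k < m → Abelianization.of (s k) = Abelianization.of (s 0) := fun k hk =>
      h1.eq_of_adjacent (i := 0) (by omega) (h1.eq_of_commute (by omega) (Commute.all _ _)) hk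
    rw [hD, ← Abelianization.ker_of, MonoidHom.mem_ker, map_mul, map_inv, h2 i hi, h2 j hj, mul_inv_cancel]
  have hp := h.map p
  have h3 : p (s 0) = p (s 1) := hp.eq_of_commute_div (i := 0) (by omega) (by
    rw [← map_inv, ← map_mul, ← map_mul, ← commutatorElement_eq_one_iff_commute, ← map_commutatorElement]
    exact (QuotientGroup.eq_one_iff _).2 (Subgroup.commutator_mem_commutator (hmem _ _ (by omega) (by omega))
      (hmem _ _ (by omega) (by omega))))
  have h4 : D ≤ ⁅D, D⁆ := by
    have := hab p fun i hi => hp.eq_of_adjacent (i := 0) (by omega) h3 hi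
    rwa [QuotientGroup.ker_mk'] at this
  rw [commutator_def, eq_top_iff]
  rintro ⟨x, hx⟩ _
  have h5 : Subgroup.map D.subtype ⁅(⊤ : Subgroup D), (⊤ : Subgroup D)⁆ = ⁅D, D⁆ := by
    rw [Subgroup.map_commutator, ← MonoidHom.range_eq_map, Subgroup.range_subtype]
  obtain ⟨y, hy, rfl⟩ := h5 ▸ h4 hx
  exact hy

theorem prm_map_sg_ne {n : ℕ} (h : 5 ≤ n) {φ : ArtinB n →* ArtinB n} (hinj : Function.Injective φ) :
    prm n (φ (sg n 0)) ≠ prm n (φ (sg n 1)) := by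
  intro he
  let T : ℕ → BS n n := fun i => if hi : i + 1 < n then ⟨sg n i, sg_mem_BS hi⟩ else 1
  have hT : ∀ i, i + 1 < n → (T i : ArtinB n) = sg n i := fun i hi => by simp [T, hi]
  have hb : BraidSeq T (n - 1) := ⟨fun i hi => Subtype.ext (by
      rw [Subgroup.coe_mul, Subgroup.coe_mul, Subgroup.coe_mul, Subgroup.coe_mul, hT _ (by omega), hT _ (by omega)]
      exact sg_braid (by omega)), fun i j hij hj => Subtype.ext (by
      rw [Subgroup.coe_mul, Subgroup.coe_mul, hT _ (by omega), hT _ (by omega)]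
      exact sg_comm hij)⟩
  have hg : Subgroup.closure {g | ∃ i < n - 1, g = T i} = ⊤ := by
    have : (Subgroup.closure {g | ∃ i < n - 1, g = T i}).map (BS n n).subtype = BS n n := by
      rw [MonoidHom.map_closure]
      conv_rhs => rw [BS]
      congr 1
      ext x
      constructor
      · rintro ⟨_, ⟨i, hi, rfl⟩, rfl⟩
        exact ⟨i, by omega, hT i (by omega)⟩
      · rintro ⟨i, hi, rfl⟩
        exact ⟨T i, ⟨i, by omega, rfl⟩, hT i hi⟩
    rw [eq_top_iff]
    rintro ⟨x, hx⟩ _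
    obtain ⟨y, hy, rfl⟩ := this.symm ▸ hx
    exact hy
  have hperf := hb.commutator_perfect (by omega) hg
  let f : commutator (BS n n) →* ArtinB n := φ.comp ((BS n n).subtype.comp (commutator (BS n n)).subtype)
  have hker : commutator (BS n n) ≤ ((prm n).comp (φ.comp (BS n n).subtype)).ker := by
    have hs := hb.map ((prm n).comp (φ.comp (BS n n).subtype))
    have hs' : ∀ i < n - 1, prm n (φ (T i)) = prm n (φ (T 0)) := fun i hi =>
      hs.eq_of_adjacent (i := 0) (by omega) (by
        simp only [MonoidHom.comp_apply, Subgroup.coe_subtype]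
        rw [hT _ (by omega), hT _ (by omega), he]) hi
    have : ∀ x : BS n n, prm n (φ x) ∈ Subgroup.zpowers (prm n (φ (T 0))) := fun x => by
      have hle : (⊤ : Subgroup (BS n n)) ≤
          (Subgroup.zpowers (prm n (φ (T 0)))).comap ((prm n).comp (φ.comp (BS n n).subtype)) := by
        rw [← hg, Subgroup.closure_le]
        rintro _ ⟨i, hi, rfl⟩
        exact Subgroup.mem_comap.2 ((hs' i hi).symm ▸ Subgroup.mem_zpowers _ : prm n (φ (T i)) ∈ _)
      exact hle (Subgroup.mem_top x)
    rw [commutator_def, Subgroup.commutator_le]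
    intro a _ b _
    obtain ⟨k, hk⟩ := this a
    obtain ⟨l, hl⟩ := this b
    rw [MonoidHom.mem_ker, map_commutatorElement, commutatorElement_eq_one_iff_commute]
    change Commute (prm n (φ a)) (prm n (φ b))
    rw [← hk, ← hl]
    exact (Commute.refl _).zpow_zpow _ _
  have hone := eq_one_of_perfect (by omega) hperf f fun q => hker q.2
  have hmem : T 0 * (T 1)⁻¹ ∈ commutator (BS n n) := by
    have h1 := (hb.map (Abelianization.of))
    have := h1.eq_of_commute (i := 0) (by omega) (Commute.all _ _)
    rw [← Abelianization.ker_of, MonoidHom.mem_ker, map_mul, map_inv, this, mul_inv_cancel]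
  have h1 : φ (sg n 0 * (sg n 1)⁻¹) = 1 := by
    have := hone ⟨_, hmem⟩
    rwa [← hT 0 (by omega), ← hT 1 (by omega)]
  have h2 : sg n 0 = sg n 1 := mul_inv_eq_one.1 (hinj (by rw [h1, map_one]))
  have h3 := congrArg (fun g => prm n g 0) h2
  simp only [prm_sg (show 0 + 1 < n by omega), prm_sg (show 1 + 1 < n by omega)] at h3
  rw [Equiv.swap_apply_left, Equiv.swap_apply_of_ne_of_ne (by omega) (by omega)] at h3
  omega

/-! ### Braid sequences in small symmetric groups -/

theorem BraidSeq.exists_lift {H : Type*} [Group H] {s : ℕ → H} {m : ℕ} (h : BraidSeq s m) {K : Subgroup H}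
    (hK : ∀ i < m, s i ∈ K) : ∃ T : ℕ → K, (∀ i < m, (T i : H) = s i) ∧ BraidSeq T m := by
  let T : ℕ → K := fun i => if hi : i < m then ⟨s i, hK i hi⟩ else 1
  have hT : ∀ i < m, (T i : H) = s i := fun i hi => by simp [T, hi]
  refine ⟨T, hT, fun i hi => Subtype.ext ?_, fun i j hij hj => Subtype.ext ?_⟩
  · simp only [Subgroup.coe_mul, hT i (by omega), hT (i + 1) hi, h.braid i hi]
  · simp only [Subgroup.coe_mul, hT i (by omega), hT j hj, (h.comm i j hij hj).eq]

theorem BraidSeq.conj_succ {H : Type*} [Group H] {s : ℕ → H} {m : ℕ} (h : BraidSeq s m) {i : ℕ} (hi : i + 1 < m) :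
    (s i * s (i + 1)) * s i * (s i * s (i + 1))⁻¹ = s (i + 1) := by
  rw [h.braid i hi]; group

theorem BraidSeq.pow_eq_one {H : Type*} [Group H] {s : ℕ → H} {m : ℕ} (h : BraidSeq s m) {k : ℕ} (h0 : s 0 ^ k = 1)
    {i : ℕ} (hi : i < m) : s i ^ k = 1 := by
  induction i with
  | zero => exact h0
  | succ i ih => rw [← h.conj_succ hi, conj_pow, ih (by omega), mul_one, mul_inv_cancel]

/-- Restriction of permutations to an invariant subset. -/
def restr {Ω : Type*} (K : Subgroup (Equiv.Perm Ω)) (p : Ω → Prop) (hp : ∀ g ∈ K, ∀ x, p (g x) ↔ p x) :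
    K →* Equiv.Perm {x // p x} :=
  MonoidHom.mk' (fun g => (g : Equiv.Perm Ω).subtypePerm (hp g g.2)) fun _ _ => rfl

theorem apply_ne_iff_of_mem_centralizer {Ω : Type*} {a g : Equiv.Perm Ω} (hg : g ∈ Subgroup.centralizer {a}) (x : Ω) :
    a (g x) ≠ g x ↔ a x ≠ x := by
  rw [not_iff_not, ← Equiv.Perm.mul_apply, ← Subgroup.mem_centralizer_singleton_iff.1 hg, Equiv.Perm.mul_apply,
    g.injective.eq_iff]

theorem zpow_apply_comm {Ω : Type*} {a : Equiv.Perm Ω} {k : Equiv.Perm Ω} (hk : k ∈ Subgroup.centralizer {a}) (i : ℤ) (x : Ω) :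
    k ((a ^ i) x) = (a ^ i) (k x) := by
  have : Commute k (a ^ i) := Commute.zpow_right (Subgroup.mem_centralizer_singleton_iff.1 hk) i
  rw [← Equiv.Perm.mul_apply, this.eq, Equiv.Perm.mul_apply]

section
open Equiv.Perm Equiv.Perm.OnCycleFactors

variable {Ω : Type} [Fintype Ω] [DecidableEq Ω] {a : Equiv.Perm Ω}

theorem sameCycle_of_mem_ker {k : Subgroup.centralizer {a}} (hk : toPermHom a k = 1) {x : Ω} (hx : a x ≠ x) :
    a.SameCycle x ((k : Equiv.Perm Ω) x) := by
  have h1 := (mem_ker_toPermHom_iff a k).1 hk _ (cycleOf_mem_cycleFactorsFinset_iff.2 (mem_support.2 hx))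
  have h2 : (k : Equiv.Perm Ω) x ∈ (a.cycleOf x).support := by
    rw [mem_support, ← mul_apply, ← h1.eq, mul_apply, (k : Equiv.Perm Ω).injective.ne_iff, cycleOf_apply_self]
    exact hx
  exact (mem_support_cycleOf_iff.1 h2).1

/-- Restriction of the centralizer to the support. -/
def restrSupp (a : Equiv.Perm Ω) : Subgroup.centralizer {a} →* Equiv.Perm {x // a x ≠ x} :=
  restr _ _ fun _ hg => apply_ne_iff_of_mem_centralizer hg

/-- Restriction of the centralizer to the fixed points. -/
def restrFix (a : Equiv.Perm Ω) : Subgroup.centralizer {a} →* Equiv.Perm {x // a x = x} :=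
  restr _ _ fun _ hg x => not_iff_not.1 (apply_ne_iff_of_mem_centralizer hg x)

theorem restrSupp_commute {k l : Subgroup.centralizer {a}} (hk : toPermHom a k = 1) (hl : toPermHom a l = 1) :
    Commute (restrSupp a k) (restrSupp a l) := by
  ext ⟨x, hx⟩
  obtain ⟨i, hi⟩ := sameCycle_of_mem_ker hk hx
  obtain ⟨j, hj⟩ := sameCycle_of_mem_ker hl hx
  change (k : Equiv.Perm Ω) ((l : Equiv.Perm Ω) x) = (l : Equiv.Perm Ω) ((k : Equiv.Perm Ω) x)
  rw [← hi, ← hj, zpow_apply_comm k.2, zpow_apply_comm l.2, ← hi, ← hj, ← mul_apply, ← mul_apply, ← zpow_add, ← zpow_add,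
    add_comm]

theorem restrSupp_pow_eq_one {k : Subgroup.centralizer {a}} (hk : toPermHom a k = 1) {d : ℕ} (hd : a ^ d = 1) :
    restrSupp a k ^ d = 1 := by
  ext ⟨x, hx⟩
  obtain ⟨i, hi⟩ := sameCycle_of_mem_ker hk hx
  have h : ∀ e : ℕ, ((k : Equiv.Perm Ω) ^ e) x = (a ^ (i * e)) x := fun e => by
    induction e with
    | zero => simp
    | succ e ih =>
      rw [pow_succ', mul_apply, ih, zpow_apply_comm k.2, ← hi, ← mul_apply, ← zpow_add, Nat.cast_succ, mul_add, mul_one]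
  rw [← map_pow]
  change ((k : Equiv.Perm Ω) ^ d) x = x
  rw [h, mul_comm, zpow_mul, zpow_natCast, hd, one_zpow, one_apply]

theorem card_cycleFactors_le (a : Equiv.Perm Ω) : 2 * Fintype.card a.cycleFactorsFinset ≤ a.support.card := by
  rw [Fintype.card_coe, ← sum_cycleType, show a.cycleFactorsFinset.card = Multiset.card a.cycleType by
    rw [cycleType_def, Multiset.card_map]; rfl, mul_comm]
  exact Multiset.card_nsmul_le_sum fun _ hx => two_le_of_mem_cycleType hx

theorem pow_two_eq_one_of_card_cycleFactors (h : a.support.card ≤ 2 * Fintype.card a.cycleFactorsFinset) :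
    a ^ 2 = 1 := by
  have h1 : ∀ x ∈ a.cycleType, x = 2 := by
    by_contra! hc
    obtain ⟨x, hx, hx2⟩ := hc
    have h2 : Multiset.card a.cycleType * 2 < a.cycleType.sum := by
      obtain ⟨t, ht⟩ := Multiset.exists_cons_of_mem hx
      have h3 := two_le_of_mem_cycleType hx
      have h4 : Multiset.card t • 2 ≤ t.sum :=
        Multiset.card_nsmul_le_sum fun y hy => two_le_of_mem_cycleType (ht ▸ Multiset.mem_cons_of_mem hy)
      rw [ht, Multiset.card_cons, Multiset.sum_cons]
      simp only [smul_eq_mul] at h4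
      omega
    rw [Fintype.card_coe, ← sum_cycleType, show a.cycleFactorsFinset.card = Multiset.card a.cycleType by
      rw [cycleType_def, Multiset.card_map]; rfl] at h
    omega
  rw [← orderOf_dvd_iff_pow_eq_one, ← lcm_cycleType, Multiset.lcm_dvd]
  exact fun x hx => (h1 x hx).dvd

/-- If two cycles are exchanged and there are no others, then all cycles have the same length. -/
theorem exists_pow_eq_one_of_toPermHom_ne {k : Subgroup.centralizer {a}} (hk : toPermHom a k ≠ 1)
    (hc : Fintype.card a.cycleFactorsFinset ≤ 2) : ∃ l, 2 * l = a.support.card ∧ a ^ l = 1 := by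
  obtain ⟨c, hc'⟩ : ∃ c, toPermHom a k c ≠ c := by
    by_contra! h
    exact hk (Equiv.ext h)
  have h1 : ∀ d, d = c ∨ d = toPermHom a k c := fun d => by
    by_contra! h
    have : ({d, c, toPermHom a k c} : Finset _).card ≤ 2 := (Finset.card_le_univ _).trans hc
    rw [Finset.card_insert_of_notMem (by simp [h.1, h.2]), Finset.card_insert_of_notMem (by simpa using hc'.symm),
      Finset.card_singleton] at this
    omega
  have h2 : ∀ x ∈ a.cycleType, x = (c : Equiv.Perm Ω).support.card := fun x hx => by
    rw [cycleType_def, Multiset.mem_map] at hx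
    obtain ⟨d, hd, rfl⟩ := hx
    rcases h1 ⟨d, hd⟩ with h | h
    · rw [← h]; rfl
    · have := congrArg Subtype.val h
      rw [coe_toPermHom] at this
      change d = _ at this
      rw [this, Function.comp_apply, card_support_conj]
  have h3 : Fintype.card a.cycleFactorsFinset = 2 := by
    refine le_antisymm hc ?_
    have : ({c, toPermHom a k c} : Finset _).card ≤ Fintype.card a.cycleFactorsFinset := Finset.card_le_univ _
    rwa [Finset.card_insert_of_notMem (by simpa using hc'.symm), Finset.card_singleton] at this
  refine ⟨(c : Equiv.Perm Ω).support.card, ?_, ?_⟩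
  · rw [← sum_cycleType a, Multiset.eq_replicate_card.2 h2, Multiset.sum_replicate, smul_eq_mul,
      show Multiset.card a.cycleType = a.cycleFactorsFinset.card by rw [cycleType_def, Multiset.card_map]; rfl,
      ← Fintype.card_coe a.cycleFactorsFinset, h3]
  · rw [← orderOf_dvd_iff_pow_eq_one, ← lcm_cycleType, Multiset.lcm_dvd]
    exact fun x hx => (h2 x hx).dvd

theorem commute_of_card_le_two {X : Type*} [Fintype X] (h : Fintype.card X ≤ 2) (f g : Equiv.Perm X) : Commute f g := by
  classical
  ext x
  have key : ∀ y z : X, y ≠ x → z ≠ x → y = z := fun y z hy hz => by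
    by_contra hyz
    have : ({x, y, z} : Finset X).card ≤ 2 := (Finset.card_le_univ _).trans h
    rw [Finset.card_insert_of_notMem (by simp [hy.symm, hz.symm]), Finset.card_insert_of_notMem (by simpa using hyz),
      Finset.card_singleton] at this
    omega
  rw [mul_apply, mul_apply]
  by_cases hf : f x = x
  · rw [hf]
    by_cases hg : g x = x
    · rw [hg, hf]
    · exact key _ _ (fun e => hg (f.injective (e.trans hf.symm))) hg
  · by_cases hg : g x = x
    · rw [hg]
      exact key _ _ hf fun e => hf (g.injective (e.trans hg.symm))
    · have h1 : f x = g x := key _ _ hf hg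
      have h2 : f (f x) = x := by
        by_contra h2
        exact hf (f.injective (key _ _ h2 hf))
      have h3 : g (g x) = x := by
        by_contra h3
        exact hg (g.injective (key _ _ h3 hg))
      rw [← h1, h2, h1, h3]

end

section
open Equiv.Perm Equiv.Perm.OnCycleFactors

variable {Ω : Type} [Fintype Ω] [DecidableEq Ω] {a : Equiv.Perm Ω}

/-- In a small symmetric group, later members of a braid sequence agree on the support of the first one. -/
theorem BraidSeq.restrSupp_eq {n : ℕ} (hn : 5 ≤ n) (hΩ : Fintype.card Ω ≤ n)
    {T : ℕ → Subgroup.centralizer {a}} (hTb : BraidSeq T (n - 3)) (hT1 : ∀ l, a ^ l = 1 → T 1 ^ l = 1)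
    (ih : 7 ≤ n → ∀ {X : Type} [Fintype X] [DecidableEq X] {t : ℕ → Equiv.Perm X}, BraidSeq t (n - 3) →
      Fintype.card X < n - 2 → t 0 = t 1)
    (hex : ¬(n = 6 ∧ Fintype.card Ω = 6 ∧ a ^ 2 = 1 ∧ ∀ x, a x ≠ x)) :
    restrSupp a (T 0) = restrSupp a (T 1) := by
  have hC := card_cycleFactors_le a
  have hS : a.support.card ≤ Fintype.card Ω := Finset.card_le_univ _
  have hP := hTb.map (toPermHom a)
  have hR := hTb.map (restrSupp a)
  rcases Nat.lt_or_ge n 7 with h7 | h7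
  · have hC2 : Fintype.card a.cycleFactorsFinset ≤ 2 := by
      by_contra hc
      have h6 : n = 6 := by omega
      refine hex ⟨h6, by omega, pow_two_eq_one_of_card_cycleFactors (by omega), fun x => ?_⟩
      have : a.support = Finset.univ := Finset.eq_univ_of_card _ (by omega)
      exact mem_support.1 (this ▸ Finset.mem_univ x)
    have h01 : toPermHom a (T 0) = toPermHom a (T 1) :=
      hP.eq_of_commute (by omega) (commute_of_card_le_two hC2 _ _)
    set u := T 0 * (T 1)⁻¹ with hu
    have hTu : T 0 = u * T 1 := by rw [hu, inv_mul_cancel_right]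
    have hu1 : toPermHom a u = 1 := by rw [hu, map_mul, map_inv, h01, mul_inv_cancel]
    have hs2 : toPermHom a (T 1 ^ 2) = 1 := by
      rw [map_pow]
      have h := Nat.factorial_dvd_factorial hC2
      rw [← Fintype.card_perm] at h
      exact orderOf_dvd_iff_pow_eq_one.1 (orderOf_dvd_card.trans h)
    have hb : u * T 1 ^ 2 * u = T 1 * u * T 1 := by
      have := hTb.braid 0 (by omega)
      rw [zero_add, hTu] at this
      have h2 := congrArg (· * (T 1)⁻¹) this
      simp only [mul_assoc, mul_inv_cancel, mul_one] at h2
      rw [pow_two]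
      simp only [mul_assoc]
      exact h2
    set U := restrSupp a u with hU
    set V := restrSupp a (T 1) with hV
    have hUV : Commute U (V ^ 2) := by
      rw [hU, hV, ← map_pow]
      exact restrSupp_commute hu1 hs2
    have hb' : U * V ^ 2 * U = V * U * V := by
      simp only [hU, hV, ← map_mul, ← map_pow, hb]
    have h1 : U ^ 2 = V * U * V⁻¹ := by
      rw [mul_assoc, ← hUV.eq, ← mul_assoc] at hb'
      rw [eq_mul_inv_iff_mul_eq]
      refine mul_right_cancel (b := V) ?_
      rw [← hb', pow_two, pow_two]
      group
    have h3 : U ^ 3 = 1 := by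
      have h4 : (U ^ 2) ^ 2 = V ^ 2 * U * (V ^ 2)⁻¹ := by
        rw [h1, conj_pow, h1, pow_two, mul_inv_rev]; simp only [mul_assoc]
      rw [← hUV.eq, mul_inv_cancel_right] at h4
      refine mul_right_cancel (b := U) ?_
      rw [← pow_succ, one_mul, ← pow_mul] at *
      exact h4
    have hU1 : U = 1 := by
      by_cases hV1 : toPermHom a (T 1) = 1
      · have : Commute V U := restrSupp_commute hV1 hu1
        rw [this.eq, mul_inv_cancel_right, pow_two] at h1
        exact mul_eq_left.1 h1
      · obtain ⟨l, hl, hal⟩ := exists_pow_eq_one_of_toPermHom_ne hV1 hC2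
        have hl2 : 2 ≤ l := by
          by_contra hl2
          have hl0 : a.support.card = 0 := by
            rcases (show l = 0 ∨ l = 1 by omega) with rfl | rfl
            · omega
            · rw [pow_one] at hal
              rw [hal, support_one, Finset.card_empty]
          have : IsEmpty a.cycleFactorsFinset := Fintype.card_eq_zero_iff.1 (by omega)
          exact hV1 (Subsingleton.elim _ _)
        rcases (show l = 2 ∨ l = 3 by omega) with rfl | rfl
        · have h4 : U ^ 2 = 1 := restrSupp_pow_eq_one hu1 hal
          rwa [pow_succ, h4, one_mul] at h3
        · have h4 := congrArg (toPermHom a) (hT1 3 hal)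
          rw [pow_succ, map_mul, hs2, one_mul, map_one] at h4
          exact absurd h4 hV1
    rw [hTu, map_mul, ← hU, hU1, one_mul]
  · have hP0 := ih h7 hP (by omega)
    have hall : ∀ i < n - 3, toPermHom a (T i) = toPermHom a (T 0) := fun i hi =>
      hP.eq_of_adjacent (i := 0) (by omega) hP0 hi
    refine hR.eq_of_commute_div (i := 0) (by omega) ?_
    simp only [← map_inv, ← map_mul]
    refine restrSupp_commute ?_ ?_
    · rw [map_mul, map_inv, hall 0 (by omega), hall (0 + 3) (by omega), mul_inv_cancel]
    · rw [map_mul, map_inv, hall (0 + 1) (by omega), hall (0 + 3) (by omega), mul_inv_cancel]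

end

theorem eq_of_perm_fin_three : ∀ f g h : Equiv.Perm (Fin 3), f * g * f = g * f * g → g * h * g = h * g * h →
    f * h = h * f → f ≠ g → f = h := by
  decide

theorem BraidSeq.eq_of_card_eq_three {X : Type*} [Fintype X] (hX : Fintype.card X = 3) {s : ℕ → Equiv.Perm X}
    (hs : BraidSeq s 3) (hne : s 0 ≠ s 1) : s 0 = s 2 := by
  let e := (Fintype.equivFinOfCardEq hX).permCongrHom
  have h := hs.map e.toMonoidHom
  refine e.injective (eq_of_perm_fin_three _ _ _ (h.braid 0 (by omega)) (h.braid 1 (by omega))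
    (h.comm 0 2 (by omega) (by omega)).eq (e.injective.ne hne))

theorem card_fix_add_card_support {Ω : Type*} [Fintype Ω] [DecidableEq Ω] (a : Equiv.Perm Ω) :
    Fintype.card {x // a x = x} + a.support.card = Fintype.card Ω := by
  rw [Fintype.card_subtype, Equiv.Perm.support, Finset.card_filter_add_card_filter_not, Finset.card_univ]

theorem eq_of_restr_eq {Ω : Type} {a : Equiv.Perm Ω} {k l : Subgroup.centralizer {a}}
    (h1 : restrSupp a k = restrSupp a l) (h2 : restrFix a k = restrFix a l) : k = l := by
  refine Subtype.ext (Equiv.ext fun x => ?_)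
  by_cases hx : a x = x
  · exact congrArg Subtype.val (DFunLike.congr_fun h2 ⟨x, hx⟩)
  · exact congrArg Subtype.val (DFunLike.congr_fun h1 ⟨x, hx⟩)

/-- Noncommuting braid sequences in the symmetric group on at most `n` points. -/
theorem BraidSeq.card_support {n : ℕ} (hn : 5 ≤ n) {Ω : Type} [Fintype Ω] [DecidableEq Ω] {s : ℕ → Equiv.Perm Ω}
    (hs : BraidSeq s (n - 1)) (hΩ : Fintype.card Ω ≤ n) (hne : s 0 ≠ s 1) :
    Fintype.card Ω = n ∧ ((s 0).support.card = 2 ∨ n = 6 ∧ s 0 ^ 2 = 1 ∧ ∀ x, s 0 x ≠ x) := by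
  induction n using Nat.strong_induction_on generalizing Ω with
  | _ n ih =>
  by_cases hex : n = 6 ∧ Fintype.card Ω = 6 ∧ s 0 ^ 2 = 1 ∧ ∀ x, s 0 x ≠ x
  · exact ⟨hex.1 ▸ hex.2.1, Or.inr ⟨hex.1, hex.2.2⟩⟩
  have ih' : 7 ≤ n → ∀ {X : Type} [Fintype X] [DecidableEq X] {t : ℕ → Equiv.Perm X}, BraidSeq t (n - 3) →
      Fintype.card X < n - 2 → t 0 = t 1 := fun h7 X _ _ t ht hX => by
    by_contra hc
    have := (ih (n - 2) (by omega) (by omega) (s := t) (by rwa [show n - 2 - 1 = n - 3 by omega]) (by omega) hc).1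
    omega
  have hdist : ∀ i j, i < j → j < n - 1 → s i ≠ s j := fun i j hij hj he =>
    hne (hs.eq_zero_of_eq hij hj (by omega) he (k := 1) (by omega)).symm
  obtain ⟨T, hT, hTb⟩ := (hs.shift 2).exists_lift (K := Subgroup.centralizer {s 0}) fun i hi =>
    Subgroup.mem_centralizer_singleton_iff.2 (hs.comm 0 (2 + i) (by omega) (by omega)).symm.eq
  rw [show n - 1 - 2 = n - 3 by omega] at hT hTb
  have hR := hTb.map (restrSupp (s 0))
  have hF := hTb.map (restrFix (s 0))
  have hR0 := BraidSeq.restrSupp_eq hn hΩ hTb (fun l hl => Subtype.ext (by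
    rw [Subgroup.coe_pow, hT 1 (by omega)]
    exact hs.pow_eq_one hl (by omega))) ih' hex
  have hT01 : ∀ i j, i < j → j < n - 3 → T i ≠ T j := fun i j hij hj he =>
    hdist (2 + i) (2 + j) (by omega) (by omega) (by rw [← hT i (by omega), ← hT j hj, he])
  have hF0 : restrFix (s 0) (T 0) ≠ restrFix (s 0) (T 1) := fun h =>
    hT01 0 1 (by omega) (by omega) (eq_of_restr_eq hR0 h)
  have hs1 : s 0 ≠ 1 := fun h => hne (hs.eq_of_commute (i := 0) (by omega) (h ▸ Commute.one_left _))
  have h2 := Equiv.Perm.two_le_card_support_of_ne_one hs1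
  have hsum := card_fix_add_card_support (s 0)
  have hfix : n - 2 ≤ Fintype.card {x // s 0 x = x} := by
    by_contra hlt
    rcases Nat.lt_or_ge n 7 with h7 | h7
    · have h3 : ¬ Fintype.card {x // s 0 x = x} ≤ 2 := fun h3 =>
        hF0 (hF.eq_of_commute (i := 0) (by omega) (commute_of_card_le_two h3 _ _))
      obtain rfl : n = 6 := by omega
      have h4 := BraidSeq.eq_of_card_eq_three (by omega) hF hF0
      have h5 := hR.eq_of_adjacent (i := 0) (by omega) hR0 (j := 2) (by omega)
      exact hT01 0 2 (by omega) (by omega) (eq_of_restr_eq h5.symm h4)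
    · exact hF0 (ih' h7 hF (by omega))
  omega

/-! ### The crossing cocycle -/

/-- The crossing of the strands `k` and `k + 1`, acting on pairs of positions with a counter. -/
def crossing (k : ℕ) : Equiv.Perm ((ℕ × ℕ) × ℤ) where
  toFun x := ((Equiv.swap k (k + 1) x.1.1, Equiv.swap k (k + 1) x.1.2),
    x.2 + if x.1 = (k, k + 1) ∨ x.1 = (k + 1, k) then 1 else 0)
  invFun x := ((Equiv.swap k (k + 1) x.1.1, Equiv.swap k (k + 1) x.1.2),
    x.2 - if x.1 = (k, k + 1) ∨ x.1 = (k + 1, k) then 1 else 0)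
  left_inv x := by
    obtain ⟨⟨i, j⟩, z⟩ := x
    simp only [Equiv.swap_apply_self, Prod.mk.injEq, Equiv.swap_apply_eq_iff, Equiv.swap_apply_left,
      Equiv.swap_apply_right, or_comm, add_sub_cancel_right]
  right_inv x := by
    obtain ⟨⟨i, j⟩, z⟩ := x
    simp only [Equiv.swap_apply_self, Prod.mk.injEq, Equiv.swap_apply_eq_iff, Equiv.swap_apply_left,
      Equiv.swap_apply_right, or_comm, sub_add_cancel]

theorem crossing_apply (k i j : ℕ) (z : ℤ) : crossing k ((i, j), z) =
    ((Equiv.swap k (k + 1) i, Equiv.swap k (k + 1) j),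
      z + if i = k ∧ j = k + 1 ∨ i = k + 1 ∧ j = k then 1 else 0) := by
  simp [crossing]

theorem crossing_braid (k : ℕ) : crossing k * crossing (k + 1) * crossing k =
    crossing (k + 1) * crossing k * crossing (k + 1) := by
  ext1 ⟨⟨i, j⟩, z⟩
  simp only [Equiv.Perm.mul_apply, crossing_apply]
  have h1 : k ≠ k + 1 := by omega
  have h2 : k ≠ k + 1 + 1 := by omega
  have h3 : k + 1 ≠ k + 1 + 1 := by omega
  generalize k + 1 + 1 = r at *
  generalize k + 1 = q at *
  have h : ∀ i, i = k ∨ i = q ∨ i = r ∨ (i ≠ k ∧ i ≠ q ∧ i ≠ r) := fun i => by tauto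
  rcases h i with e | e | e | ⟨e1, e2, e3⟩ <;> rcases h j with d | d | d | ⟨d1, d2, d3⟩ <;>
    simp [Equiv.swap_apply_def, h1.symm, h2.symm, h3.symm, *]

theorem crossing_comm {k l : ℕ} (h : k + 2 ≤ l) : Commute (crossing k) (crossing l) := by
  refine Equiv.ext fun ⟨⟨i, j⟩, z⟩ => ?_
  have h1 : k ≠ l := by omega
  have h2 : k ≠ l + 1 := by omega
  have h3 : k + 1 ≠ l := by omega
  have h4 : k + 1 ≠ l + 1 := by omega
  have h5 : k ≠ k + 1 := by omega
  have h6 : l ≠ l + 1 := by omega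
  simp only [Equiv.Perm.mul_apply, crossing_apply]
  generalize k + 1 = p at *
  generalize l + 1 = q at *
  have h : ∀ i, i = k ∨ i = p ∨ i = l ∨ i = q ∨ (i ≠ k ∧ i ≠ p ∧ i ≠ l ∧ i ≠ q) := fun i => by tauto
  rcases h i with e | e | e | e | ⟨e1, e2, e3, e4⟩ <;> rcases h j with d | d | d | d | ⟨d1, d2, d3, d4⟩ <;>
    simp [Equiv.swap_apply_def, h1.symm, h2.symm, h3.symm, h4.symm, h5.symm, h6.symm, *]

theorem exists_cocycle (n : ℕ) : ∃ S : ArtinB n → ℕ → ℕ → ℤ,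
    (∀ g h i j, S (g * h) i j = S h i j + S g (prm n h i) (prm n h j)) ∧ (∀ g i j, S g i j = S g j i) ∧
    ∀ g i j, i ≠ j → (2 ∣ S g i j ↔ (i < j ↔ prm n g i < prm n g j)) := by
  obtain ⟨Θ, hΘ⟩ := ArtinB.exists_hom (n := n) (fun k => if k + 1 < n then crossing k else 1)
    (fun i hi => by simp only [if_pos (show i + 1 < n by omega), if_pos (show i + 1 + 1 < n by omega), crossing_braid])
    (fun i hi => by simp [if_neg (show ¬ i + 1 + 1 < n by omega)])
    (fun i j hij hj => by
      split_ifs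
      exacts [crossing_comm hij, Commute.one_right _, Commute.one_left _, Commute.one_left _])
  let K : Subgroup (ArtinB n) :=
    { carrier := {g | ∃ c : ℕ → ℕ → ℤ, (∀ i j z, Θ g ((i, j), z) = ((prm n g i, prm n g j), z + c i j)) ∧
        (∀ i j, c i j = c j i) ∧ ∀ i j, i ≠ j → (2 ∣ c i j ↔ (i < j ↔ prm n g i < prm n g j))}
      one_mem' := ⟨fun _ _ => 0, by simp⟩
      mul_mem' := by
        rintro g h ⟨c, h1, h2, h3⟩ ⟨d, h4, h5, h6⟩
        refine ⟨fun i j => d i j + c (prm n h i) (prm n h j), fun i j z => ?_, fun i j => ?_, fun i j hij => ?_⟩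
        · rw [map_mul, map_mul, Equiv.Perm.mul_apply, h4, h1, add_assoc]; rfl
        · exact congrArg₂ _ (h5 _ _) (h2 _ _)
        · have e1 := h6 i j hij
          have e2 := h3 _ _ ((prm n h).injective.ne hij)
          rw [map_mul, Equiv.Perm.mul_apply, Equiv.Perm.mul_apply]
          rw [← even_iff_two_dvd] at e1 e2 ⊢
          rw [Int.even_add]
          tauto
      inv_mem' := by
        rintro g ⟨c, h1, h2, h3⟩
        have e : ∀ i, prm n g (prm n g⁻¹ i) = i := fun i => by
          rw [← Equiv.Perm.mul_apply, ← map_mul, mul_inv_cancel, map_one, Equiv.Perm.one_apply]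
        refine ⟨fun i j => - c (prm n g⁻¹ i) (prm n g⁻¹ j), fun i j z => ?_, fun i j => ?_, fun i j hij => ?_⟩
        · rw [map_inv, Equiv.Perm.inv_eq_iff_eq, h1, e, e]
          simp
        · exact congrArg _ (h2 _ _)
        · have := h3 (prm n g⁻¹ i) (prm n g⁻¹ j) ((prm n g⁻¹).injective.ne hij)
          rw [e, e] at this
          rw [dvd_neg, this]
          exact iff_comm }
  have hK : ∀ g, g ∈ K := ArtinB.induction fun k hk => by
    rcases Nat.lt_or_ge (k + 1) n with h | h
    · refine ⟨fun i j => if i = k ∧ j = k + 1 ∨ i = k + 1 ∧ j = k then 1 else 0, fun i j z => ?_, fun i j => ?_,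
        fun i j hij => ?_⟩
      · rw [hΘ k hk, if_pos h, crossing_apply, prm_sg h]
      · simp only [and_comm, or_comm]
      · rw [prm_sg h]
        simp only [Equiv.swap_apply_def]
        split_ifs <;> omega
    · obtain rfl : k = n - 1 := by omega
      refine ⟨fun _ _ => 0, fun i j z => ?_, fun _ _ => rfl, fun i j hij => ?_⟩
      · rw [hΘ _ hk, if_neg (by omega), prm_last (by omega)]; simp
      · rw [prm_last (by omega)]; simp
  choose S h1 h2 h3 using hK
  refine ⟨S, fun g h i j => ?_, h2, h3⟩
  have := h1 (g * h) i j 0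
  rw [map_mul, Equiv.Perm.mul_apply, h1, h1] at this
  simpa using (congrArg Prod.snd this).symm

/-! ### Excluding the exotic permutations on six points -/

/-- The permutation of the first `n` positions underlying an element of `ArtinB n`. -/
noncomputable def prmF (n : ℕ) : ArtinB n →* Equiv.Perm (Fin n) where
  toFun g :=
    { toFun := fun i => ⟨prm n g i, prm_lt g i.2⟩
      invFun := fun i => ⟨(prm n g)⁻¹ i, by rw [← map_inv]; exact prm_lt _ i.2⟩
      left_inv := fun i => by simp
      right_inv := fun i => by simp }
  map_one' := by ext; simp
  map_mul' g h := by ext; simp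

theorem coe_prmF {n : ℕ} (g : ArtinB n) (x : Fin n) : (prmF n g x : ℕ) = prm n g x := rfl

theorem exists_cocycle_prmF (n : ℕ) : ∃ S : ArtinB n → Fin n → Fin n → ℤ,
    (∀ g h i j, S (g * h) i j = S h i j + S g (prmF n h i) (prmF n h j)) ∧ (∀ g i j, S g i j = S g j i) ∧
    ∀ g i j, i ≠ j → (2 ∣ S g i j ↔ (i < j ↔ prmF n g i < prmF n g j)) := by
  obtain ⟨S, h1, h2, h3⟩ := exists_cocycle n
  exact ⟨fun g i j => S g i j, fun g h i j => h1 g h i j, fun g i j => h2 g i j, fun g i j hij =>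
    h3 g i j (Fin.val_injective.ne hij)⟩

theorem exists_apply_eq_of_card_eq_six {X : Type*} [Fintype X] [DecidableEq X] (hX : Fintype.card X = 6)
    {f g h : Equiv.Perm X} (hf : ∀ x, f (f x) = x) (hg : ∀ x, g (g x) = x) (hh : ∀ x, h (h x) = x)
    (hf' : ∀ x, f x ≠ x) (hg' : ∀ x, g x ≠ x) (hh' : ∀ x, h x ≠ x) (hfg : ∀ x, f (g x) = g (f x))
    (hfh : ∀ x, f (h x) = h (f x)) (hgh : ∀ x, g (h x) = h (g x)) (h1 : f ≠ g) (h2 : f ≠ h) (h3 : g ≠ h) :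
    ∃ a, f a ≠ g a ∧ h a = f (g a) ∧ ∀ x, f x ≠ h x → x = a ∨ x = f a ∨ x = g a ∨ x = f (g a) := by
  obtain ⟨a, ha⟩ : ∃ a, f a ≠ g a := by
    by_contra! hc
    exact h1 (Equiv.ext hc)
  have e1 : f (g a) ≠ a := fun e => ha (by rw [← e, hf, e])
  have hT : ∃ T : Finset X, (∀ x, x ∈ T ↔ x = a ∨ x = f a ∨ x = g a ∨ x = f (g a)) ∧ T.card = 4 := by
    refine ⟨{a, f a, g a, f (g a)}, by simp, ?_⟩
    have e2 : f a ≠ f (g a) := f.injective.ne (hg' a).symm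
    simp [Finset.card_insert_of_notMem, (hf' a).symm, (hg' a).symm, e1.symm, ha, e2, (hf' (g a)).symm]
  obtain ⟨T, hT, hT4⟩ := hT
  obtain ⟨p, q, hpq, hc⟩ := Finset.card_eq_two.1 (show Tᶜ.card = 2 by rw [Finset.card_compl, hX, hT4])
  have hC : ∀ x, x ∉ T ↔ x = p ∨ x = q := fun x => by
    rw [← Finset.mem_compl, hc]; simp
  have hfT : ∀ x, f x ∈ T → x ∈ T := fun x hx => by
    rw [hT] at hx ⊢
    rcases hx with e | e | e | e
    · exact Or.inr (Or.inl (by rw [← e, hf]))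
    · exact Or.inl (f.injective e)
    · exact Or.inr (Or.inr (Or.inr (by rw [← e, hf])))
    · exact Or.inr (Or.inr (Or.inl (f.injective e)))
  have hgT : ∀ x, g x ∈ T → x ∈ T := fun x hx => by
    rw [hT] at hx ⊢
    rcases hx with e | e | e | e
    · exact Or.inr (Or.inr (Or.inl (by rw [← e, hg])))
    · exact Or.inr (Or.inr (Or.inr (by rw [hfg, ← e, hg])))
    · exact Or.inl (g.injective e)
    · exact Or.inr (Or.inl (g.injective (by rw [e, hfg])))
  have hne : ∀ x ∈ T, f x ≠ g x := fun x hx => by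
    rw [hT] at hx
    rcases hx with rfl | rfl | rfl | rfl
    · exact ha
    · rw [← hfg]; exact f.injective.ne ha
    · rw [hfg]; exact g.injective.ne ha
    · rw [← hfg]; exact f.injective.ne (by rw [hfg]; exact g.injective.ne ha)
  have key : ∀ k : Equiv.Perm X, (∀ x, k x ≠ x) → (∀ x, k x ∈ T → x ∈ T) → k p = q ∧ k q = p := fun k hk hkT => by
    have h5 := (hC (k p)).1 fun h => (hC p).2 (Or.inl rfl) (hkT p h)
    have h6 := (hC (k q)).1 fun h => (hC q).2 (Or.inr rfl) (hkT q h)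
    exact ⟨h5.resolve_left (hk p), h6.resolve_right (hk q)⟩
  have kf := key f hf' hfT
  have kg := key g hg' hgT
  have hhT : ∀ x, h x ∈ T → x ∈ T := fun x hx => by
    by_contra hxT
    refine hne _ hx ?_
    rw [hfh, hgh]
    rcases (hC x).1 hxT with rfl | rfl
    · rw [kf.1, kg.1]
    · rw [kf.2, kg.2]
  have kh := key h hh' hhT
  have hoff : ∀ k : Equiv.Perm X, k p = q ∧ k q = p → (∀ x, k (f x) = f (k x)) → (∀ x, k (g x) = g (k x)) →
      h a = k a → k = h := fun k hk k1 k2 k3 => by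
    refine Equiv.ext fun x => ?_
    by_cases hx : x ∈ T
    · rw [hT] at hx
      rcases hx with rfl | rfl | rfl | rfl
      · exact k3.symm
      · rw [k1, ← hfh, k3]
      · rw [k2, ← hgh, k3]
      · rw [k1, ← hfh, k2, ← hgh, k3]
    · rcases (hC x).1 hx with rfl | rfl
      · rw [hk.1, kh.1]
      · rw [hk.2, kh.2]
  refine ⟨a, ha, ?_, fun x hx => ?_⟩
  · rcases (hT (h a)).1 (hhT _ (by rw [hh, hT]; exact Or.inl rfl)) with e | e | e | e
    · exact absurd e (hh' a)
    · exact absurd (hoff f kf (fun _ => rfl) hfg e) h2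
    · exact absurd (hoff g kg (fun x => (hfg x).symm) (fun _ => rfl) e) h3
    · exact e
  · rw [← hT]
    by_contra hxT
    rcases (hC x).1 hxT with rfl | rfl
    · exact hx (by rw [kf.1, kh.1])
    · exact hx (by rw [kf.2, kh.2])

theorem BraidSeq.false_of_card_six {τ : ℕ → ArtinB 6} (h : BraidSeq τ 5) (h2 : prmF 6 (τ 0) ^ 2 = 1)
    (hfix : ∀ x, prmF 6 (τ 0) x ≠ x) (hne : prmF 6 (τ 0) ≠ prmF 6 (τ 1)) : False := by
  obtain ⟨S, S1, S2, S3⟩ := exists_cocycle_prmF 6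
  have hs : BraidSeq (fun i => prmF 6 (τ i)) 5 := h.map (prmF 6)
  have hdist : ∀ i j, i < j → j < 5 → prmF 6 (τ i) ≠ prmF 6 (τ j) := fun i j hij hj he =>
    hne (hs.eq_zero_of_eq hij hj (by omega) he (k := 1) (by omega)).symm
  have hsq : ∀ i < 5, prmF 6 (τ i) ^ 2 = 1 := fun i hi => hs.pow_eq_one h2 hi
  have hinv : ∀ i < 5, ∀ x, prmF 6 (τ i) (prmF 6 (τ i) x) = x := fun i hi x => by
    rw [← Equiv.Perm.mul_apply, ← pow_two, hsq i hi, Equiv.Perm.one_apply]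
  have hfpf : ∀ i < 5, ∀ x, prmF 6 (τ i) x ≠ x := fun i hi => by
    induction i with
    | zero => exact hfix
    | succ i ih =>
      intro x hx
      have e := hs.conj_succ (i := i) hi
      rw [← e, Equiv.Perm.mul_apply, Equiv.Perm.mul_apply, ← Equiv.Perm.eq_inv_iff_eq] at hx
      exact ih (by omega) _ hx
  have hcomm : ∀ i j, i + 2 ≤ j → j < 5 → ∀ x, prmF 6 (τ i) (prmF 6 (τ j) x) = prmF 6 (τ j) (prmF 6 (τ i) x) :=
    fun i j hij hj x => Equiv.congr_fun (hs.comm i j hij hj).eq x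
  obtain ⟨a, ha, had, hx⟩ := exists_apply_eq_of_card_eq_six (by simp) (hinv 0 (by omega)) (hinv 2 (by omega))
    (hinv 4 (by omega)) (hfpf 0 (by omega)) (hfpf 2 (by omega)) (hfpf 4 (by omega)) (hcomm 0 2 (by omega) (by omega))
    (hcomm 0 4 (by omega) (by omega)) (hcomm 2 4 (by omega) (by omega)) (hdist 0 2 (by omega) (by omega))
    (hdist 0 4 (by omega) (by omega)) (hdist 2 4 (by omega) (by omega))
  have f2 := hinv 0 (by omega)
  have g2 := hinv 2 (by omega)
  have k2 := hinv 4 (by omega)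
  have hfg := hcomm 0 2 (by omega) (by omega)
  have hfk := hcomm 0 4 (by omega) (by omega)
  have hgk := hcomm 2 4 (by omega) (by omega)
  have fa := hfpf 0 (by omega) a
  have psq : ∀ i < 5, prmF 6 (τ i * τ i) = 1 := fun i hi => by rw [map_mul, ← pow_two, hsq i hi]
  have kb : prmF 6 (τ 4) (prmF 6 (τ 0) a) = prmF 6 (τ 2) a := by rw [← hfk, had, f2]
  have kc : prmF 6 (τ 4) (prmF 6 (τ 2) a) = prmF 6 (τ 0) a := by rw [← hgk, had, hfg, g2]
  have kd : prmF 6 (τ 4) (prmF 6 (τ 0) (prmF 6 (τ 2) a)) = a := by rw [← had, k2]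
  set b := prmF 6 (τ 0) a with hb
  set c := prmF 6 (τ 2) a with hc
  set d := prmF 6 (τ 0) c with hd
  have gb : prmF 6 (τ 2) b = d := by rw [hb, ← hfg]
  have gd : prmF 6 (τ 2) d = b := by rw [← gb, g2]
  have fb : prmF 6 (τ 0) b = a := f2 a
  have gc : prmF 6 (τ 2) c = a := g2 a
  have fd : prmF 6 (τ 0) d = c := f2 c
  have cd : c ≠ d := (hfpf 0 (by omega) c).symm
  -- the product of the three commuting elements fixes `a` and `b`
  have c02 := h.comm 0 2 (by omega) (by omega)
  have c04 := h.comm 0 4 (by omega) (by omega)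
  have c24 := h.comm 2 4 (by omega) (by omega)
  have hW : (τ 0 * τ 2 * τ 4) * (τ 0 * τ 2 * τ 4) = (τ 0 * τ 0) * ((τ 2 * τ 2) * (τ 4 * τ 4)) := by
    have e1 : τ 4 * (τ 0 * τ 2) = τ 0 * τ 2 * τ 4 := (c04.mul_left c24).eq.symm
    calc _ = τ 0 * τ 2 * (τ 4 * (τ 0 * τ 2)) * τ 4 := by group
      _ = τ 0 * (τ 2 * τ 0) * τ 2 * (τ 4 * τ 4) := by rw [e1]; group
      _ = _ := by rw [← c02.eq]; group
  have hWa : prmF 6 (τ 0 * τ 2 * τ 4) a = a := by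
    rw [map_mul, map_mul, Equiv.Perm.mul_apply, Equiv.Perm.mul_apply, had, gd, fb]
  have hWb : prmF 6 (τ 0 * τ 2 * τ 4) b = b := by
    rw [map_mul, map_mul, Equiv.Perm.mul_apply, Equiv.Perm.mul_apply, kb, gc]
  have w1 := S1 (τ 0 * τ 2 * τ 4) (τ 0 * τ 2 * τ 4) a b
  rw [hWa, hWb, hW, S1, S1, map_mul (prmF 6) (τ 2 * τ 2), psq 2 (by omega), psq 4 (by omega), mul_one, Equiv.Perm.one_apply,
    Equiv.Perm.one_apply] at w1
  have w2 := (S3 (τ 0 * τ 2 * τ 4) a b fa.symm).2 (by rw [hWa, hWb])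
  have w3 := S1 (τ 0) (τ 0) a b
  rw [← hb, fb, S2 (τ 0) b a] at w3
  have w4 := S3 (τ 0) a b fa.symm
  rw [← hb, fb] at w4
  have w5 : ¬ (2 : ℤ) ∣ S (τ 0) a b := fun h => by
    have := w4.1 h
    rcases lt_or_gt_of_ne fa with h' | h'
    · exact lt_asymm h' (this.2 h')
    · exact lt_asymm h' (this.1 h')
  have w6 := S1 (τ 2) (τ 2) a b
  rw [← hc, gb] at w6
  have w7 := S3 (τ 2) a b fa.symm
  have w8 := S3 (τ 2) c d cd
  rw [← hc, gb] at w7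
  rw [gc, gd, iff_comm (a := c < d), ← w7] at w8
  -- conjugation carries `τ 2` to `τ 4` and fixes `τ 0`
  obtain ⟨G, hG, hG0⟩ : ∃ G, G * τ 2 * G⁻¹ = τ 4 ∧ Commute G (τ 0) := by
    refine ⟨τ 3 * τ 4 * (τ 2 * τ 3), ?_, ?_⟩
    · calc _ = (τ 3 * τ 4) * ((τ 2 * τ 3) * τ 2 * (τ 2 * τ 3)⁻¹) * (τ 3 * τ 4)⁻¹ := by group
        _ = _ := by rw [h.conj_succ (i := 2) (by omega)]; exact h.conj_succ (i := 3) (by omega)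
    · have c03 := h.comm 0 3 (by omega) (by omega)
      exact ((c03.symm.mul_left c04.symm).mul_left (c02.symm.mul_left c03.symm))
  have hG' : G * τ 2 = τ 4 * G := by rw [← hG]; group
  have gam0 : ∀ x, prmF 6 G (prmF 6 (τ 0) x) = prmF 6 (τ 0) (prmF 6 G x) := fun x => by
    rw [← Equiv.Perm.mul_apply, ← map_mul, hG0.eq, map_mul, Equiv.Perm.mul_apply]
  have gam2 : ∀ x, prmF 6 G (prmF 6 (τ 2) x) = prmF 6 (τ 4) (prmF 6 G x) := fun x => by
    rw [← Equiv.Perm.mul_apply, ← map_mul, hG', map_mul, Equiv.Perm.mul_apply]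
  have hG2 : (τ 4 * τ 4) * G = G * (τ 2 * τ 2) := by
    rw [mul_assoc, ← hG', ← mul_assoc, ← hG', mul_assoc]
  have w9 := S1 (τ 4 * τ 4) G a b
  rw [hG2, S1, psq 2 (by omega), Equiv.Perm.one_apply, Equiv.Perm.one_apply, add_comm, add_right_inj, hb, gam0,
    ← hb] at w9
  have w10 := S1 (τ 4) (τ 4) a b
  rw [had, kb] at w10
  have w11 := S1 (τ 4) (τ 4) c d
  rw [kc, kd, S2 (τ 4) c d, S2 (τ 4) b a, add_comm, S2 (τ 4) d c, S2 (τ 4) c d, ← w10] at w11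
  have w12 := hx (prmF 6 G a) fun e => ha ((prmF 6 G).injective (by rw [gam0, gam2, e]))
  have w13 : S (τ 2 * τ 2) a b = S (τ 4 * τ 4) a b := by
    rw [w9]
    rcases w12 with e | e | e | e <;> rw [e]
    · rw [fb, S2]
    · rw [← hd, w11]
    · rw [fd, S2, w11]
  omega

/-! ### Reduction to the standard permutation representation -/

theorem not_commute_swap {Ω : Type*} [DecidableEq Ω] {x y z : Ω} (h1 : x ≠ y) (h2 : x ≠ z) (h3 : y ≠ z) :
    ¬ Commute (Equiv.swap x y) (Equiv.swap x z) := fun h => by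
  have := Equiv.congr_fun h.eq x
  rw [Equiv.Perm.mul_apply, Equiv.Perm.mul_apply, Equiv.swap_apply_left, Equiv.swap_apply_left,
    Equiv.swap_apply_of_ne_of_ne h2.symm h3.symm, Equiv.swap_apply_of_ne_of_ne h1.symm h3] at this
  exact h3 this.symm

theorem BraidSeq.exists_points {Ω : Type*} [DecidableEq Ω] {s : ℕ → Equiv.Perm Ω} {m : ℕ} (h : BraidSeq s m)
    (hm : 4 ≤ m) (hne : s 0 ≠ s 1) {c : Equiv.Perm Ω} (hc : ∀ i, i + 1 < m → c * s i * c⁻¹ = s (i + 1))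
    (h0 : (s 0).IsSwap) : ∃ p : ℕ → Ω, (∀ i < m, s i = Equiv.swap (p i) (p (i + 1))) ∧
      ∀ i j, i < j → j ≤ m → p i ≠ p j := by
  have hdist : ∀ i j, i < j → j < m → s i ≠ s j := fun i j hij hj he =>
    hne (h.eq_zero_of_eq hij hj hm he (k := 1) (by omega)).symm
  have hpow : ∀ x y, s 0 = Equiv.swap x y → ∀ i < m, s i = Equiv.swap ((c ^ i) x) ((c ^ i) y) := fun x y hxy i hi => by
    induction i with
    | zero => simpa using hxy
    | succ i ih =>
      rw [← hc i hi, ih (by omega), pow_succ', Equiv.Perm.mul_apply, Equiv.Perm.mul_apply,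
        Equiv.swap_apply_apply c]
  have hfix : ∀ x y, x ≠ y → s 0 = Equiv.swap x y → c x ≠ x := fun x y hxy h1 hcx => by
    have e : (c ^ 2) x = x := by rw [pow_two, Equiv.Perm.mul_apply, hcx, hcx]
    have h2 := hpow x y h1 2 (by omega)
    rw [e] at h2
    have hy : y ≠ (c ^ 2) y := fun hy => hdist 0 2 (by omega) (by omega) (by rw [h1, h2, ← hy])
    have hcom := h.comm 0 2 (by omega) (by omega)
    rw [h1, h2] at hcom
    exact not_commute_swap hxy (fun hx => hxy ((c ^ 2).injective (by rw [e, ← hx]))) hy hcom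
  have main : ∀ x y, x ≠ y → s 0 = Equiv.swap x y → c x = y → ∃ p : ℕ → Ω,
      (∀ i < m, s i = Equiv.swap (p i) (p (i + 1))) ∧ ∀ i j, i < j → j ≤ m → p i ≠ p j := fun x y hxy h1 hcx => by
    have hp : ∀ i < m, s i = Equiv.swap ((c ^ i) x) ((c ^ (i + 1)) x) := fun i hi => by
      rw [hpow x y h1 i hi, pow_succ, Equiv.Perm.mul_apply, hcx]
    have hz : ∀ k, 0 < k → k ≤ m → (c ^ k) x ≠ x := fun k hk hkm he => by
      rcases Nat.lt_or_ge 1 k with hk1 | hk1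
      · have h2 := hp (k - 1) (by omega)
        rw [Nat.sub_add_cancel hk, he, Equiv.swap_comm] at h2
        have hne' : y ≠ (c ^ (k - 1)) x := fun hy =>
          hdist 0 (k - 1) (by omega) (by omega) (by rw [h1, h2, ← hy])
        rcases Nat.lt_or_ge 2 k with hk2 | hk2
        · have hcom := h.comm 0 (k - 1) (by omega) (by omega)
          rw [h1, h2] at hcom
          refine not_commute_swap hxy (fun hx => ?_) hne' hcom
          have h3 : (c ^ k) x = c x := by
            rw [show k = (k - 1) + 1 by omega, pow_succ', Equiv.Perm.mul_apply, ← hx]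
          exact hxy (by rw [← hcx, ← h3, he])
        · obtain rfl : k = 2 := by omega
          exact hne' (by simp [hcx])
      · obtain rfl : k = 1 := by omega
        rw [pow_one, hcx] at he
        exact hxy he.symm
    refine ⟨fun i => (c ^ i) x, hp, fun i j hij hj he => hz (j - i) (by omega) (by omega) ?_⟩
    refine (c ^ i).injective ?_
    rw [← Equiv.Perm.mul_apply, ← pow_add, show i + (j - i) = j by omega]
    exact he.symm
  obtain ⟨x, y, hxy, h1⟩ := h0
  by_cases h2 : c x = y
  · exact main x y hxy h1 h2
  by_cases h3 : c y = x
  · exact main y x hxy.symm (by rw [h1, Equiv.swap_comm]) h3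
  have h4 := hfix x y hxy h1
  have h5 := hfix y x hxy.symm (by rw [h1, Equiv.swap_comm])
  refine absurd (h.eq_of_commute (i := 0) (by omega) ?_) hne
  have h6 := hpow x y h1 1 (by omega)
  rw [pow_one] at h6
  rw [zero_add, h1, h6]
  refine Equiv.Perm.Disjoint.commute fun z => ?_
  by_cases hz : z = x
  · subst hz
    exact Or.inr (Equiv.swap_apply_of_ne_of_ne (Ne.symm h4) (Ne.symm h3))
  by_cases hz' : z = y
  · subst hz'
    exact Or.inr (Equiv.swap_apply_of_ne_of_ne (Ne.symm h2) (Ne.symm h5))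
  exact Or.inl (Equiv.swap_apply_of_ne_of_ne hz hz')

theorem apply_of_commute_swap {π : Equiv.Perm ℕ} {i : ℕ} (h : Commute π (Equiv.swap i (i + 1))) :
    (π i = i ∧ π (i + 1) = i + 1) ∨ (π i = i + 1 ∧ π (i + 1) = i) := by
  have e := Equiv.congr_fun h.eq i
  rw [Equiv.Perm.mul_apply, Equiv.Perm.mul_apply, Equiv.swap_apply_left] at e
  have hne : π i ≠ π (i + 1) := π.injective.ne (by omega)
  by_cases h1 : π i = i
  · exact Or.inl ⟨h1, by rw [e, h1, Equiv.swap_apply_left]⟩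
  by_cases h2 : π i = i + 1
  · exact Or.inr ⟨h2, by rw [e, h2, Equiv.swap_apply_right]⟩
  · rw [Equiv.swap_apply_of_ne_of_ne h1 h2] at e
    exact absurd e.symm hne

theorem eq_one_of_commute_swap {n : ℕ} (hn : 5 ≤ n) {π : Equiv.Perm ℕ} (hlt : ∀ j < n, π j < n)
    (hge : ∀ j, n ≤ j → π j = j) (h : ∀ i, i + 2 < n → Commute π (Equiv.swap i (i + 1))) : π = 1 := by
  have h1 : π 1 = 1 := by
    have h1 := apply_of_commute_swap (h 0 (by omega))
    have h2 := apply_of_commute_swap (h 1 (by omega))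
    rw [zero_add] at h1
    omega
  have h0 : ∀ i, i + 2 < n → π i = i ∧ π (i + 1) = i + 1 := fun i hi => by
    induction i with
    | zero =>
      have h2 := apply_of_commute_swap (h 0 hi)
      rw [zero_add] at h2 ⊢
      omega
    | succ i ih =>
      have := ih (by omega)
      rcases apply_of_commute_swap (h (i + 1) hi) with h2 | h2 <;> omega
  have hsmall : ∀ j, j + 1 < n → π j = j := fun j hj => by
    rcases j with _ | j
    · exact (h0 0 (by omega)).1
    · exact (h0 j (by omega)).2
  refine Equiv.ext fun j => ?_
  rw [Equiv.Perm.one_apply]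
  rcases Nat.lt_or_ge j n with hj | hj
  · by_contra hne
    have h3 := hlt j hj
    rcases Nat.lt_or_ge (j + 1) n with hj1 | hj1
    · exact hne (hsmall j hj1)
    · exact hne (π.injective (hsmall (π j) (by omega)))
  · exact hge j hj

theorem isSwap_prm_of_isSwap_prmF {n : ℕ} {g : ArtinB n} (h : (prmF n g).IsSwap) : (prm n g).IsSwap := by
  obtain ⟨x, y, hxy, h⟩ := h
  refine ⟨x, y, Fin.val_injective.ne hxy, Equiv.ext fun j => ?_⟩
  rcases Nat.lt_or_ge j n with hj | hj
  · rw [← coe_prmF g ⟨j, hj⟩, h, Equiv.swap_apply_def, Equiv.swap_apply_def]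
    simp only [Fin.ext_iff]
    split_ifs <;> rfl
  · rw [prm_of_ge g hj, Equiv.swap_apply_of_ne_of_ne] <;> omega

theorem isSwap_prm_map_sg {n : ℕ} (h : 5 ≤ n) {φ : ArtinB n →* ArtinB n} (hinj : Function.Injective φ) :
    (prm n (φ (sg n 0))).IsSwap := by
  refine isSwap_prm_of_isSwap_prmF ?_
  have hs := (sg_braidSeq n).map φ
  have hne : prmF n (φ (sg n 0)) ≠ prmF n (φ (sg n 1)) := fun he => prm_map_sg_ne h hinj (Equiv.ext fun j => by
    rcases Nat.lt_or_ge j n with hj | hj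
    · rw [← coe_prmF _ ⟨j, hj⟩, he, coe_prmF]
    · rw [prm_of_ge _ hj, prm_of_ge _ hj])
  rcases (BraidSeq.card_support h (hs.map (prmF n)) (by simp) hne).2 with h2 | ⟨rfl, h2, h3⟩
  · exact Equiv.Perm.card_support_eq_two.1 h2
  · exact (BraidSeq.false_of_card_six hs h2 h3 hne).elim

theorem exists_conj_prm_eq {n : ℕ} (h : 5 ≤ n) {φ : ArtinB n →* ArtinB n} (hinj : Function.Injective φ) :
    ∃ x, ∀ g, prm n (conjComp x φ g) = prm n g := by
  obtain ⟨p, hp, hpd⟩ := BraidSeq.exists_points (((sg_braidSeq n).map φ).map (prm n)) (by omega)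
    (prm_map_sg_ne h hinj) (c := prm n (φ (ρB n))) (fun i hi => by
      rw [← map_mul, ← map_mul, ρB_mul_sg (by omega), map_mul, map_mul, mul_inv_cancel_right])
    (isSwap_prm_map_sg h hinj)
  have hlt : ∀ i < n, p i < n := fun i hi => by
    by_contra hge
    rcases Nat.lt_or_ge i (n - 1) with hi1 | hi1
    · have e := prm_of_ge (φ (sg n i)) (not_lt.1 hge)
      rw [hp i hi1, Equiv.swap_apply_left] at e
      exact hpd i (i + 1) (by omega) (by omega) e.symm
    · obtain rfl : i = (n - 2) + 1 := by omega
      have e := prm_of_ge (φ (sg n (n - 2))) (not_lt.1 hge)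
      rw [hp (n - 2) (by omega), Equiv.swap_apply_right] at e
      exact hpd (n - 2) (n - 2 + 1) (by omega) (by omega) e
  have hinjp : Function.Injective fun i : Fin n => (⟨p i, hlt i i.2⟩ : Fin n) := fun i j hij => by
    have hij' : p i = p j := congrArg Fin.val hij
    by_contra hne
    rcases lt_or_gt_of_ne hne with hl | hl
    · exact hpd i j hl (by omega) hij'
    · exact hpd j i hl (by omega) hij'.symm
  let e : Equiv.Perm (Fin n) := Equiv.ofBijective _ (Finite.injective_iff_bijective.1 hinjp)
  obtain ⟨g, hg⟩ := exists_prm_eq (n := n) le_rfl (σ := e.extendDomain Fin.equivSubtype) fun i hi =>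
    Equiv.Perm.extendDomain_apply_not_subtype _ _ (by omega)
  have hgp : ∀ i < n, prm n g i = p i := fun i hi => by
    rw [hg]
    exact Equiv.Perm.extendDomain_apply_image e Fin.equivSubtype ⟨i, hi⟩
  have hsw : ∀ i, i + 1 < n → prm n (conjComp g⁻¹ φ (sg n i)) = Equiv.swap i (i + 1) := fun i hi => by
    have e1 : prm n (φ (sg n i)) = prm n g * Equiv.swap i (i + 1) * (prm n g)⁻¹ := by
      rw [hp i (by omega), ← hgp i (by omega), ← hgp (i + 1) hi, Equiv.swap_apply_apply]
    change prm n (g⁻¹ * φ (sg n i) * g⁻¹⁻¹) = _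
    rw [map_mul, map_mul, e1, inv_inv, map_inv]
    group
  refine ⟨g⁻¹, fun y => DFunLike.congr_fun (ArtinB.hom_ext (f := (prm n).comp (conjComp g⁻¹ φ)) (g := prm n)
    fun i hi => ?_) y⟩
  rw [MonoidHom.comp_apply]
  rcases Nat.lt_or_ge (i + 1) n with hi1 | hi1
  · rw [hsw i hi1, prm_sg hi1]
  · obtain rfl : i = n - 1 := by omega
    rw [prm_last (by omega)]
    refine eq_one_of_commute_swap h (fun j => prm_lt _) (fun j => prm_of_ge _) fun i hi => ?_
    rw [← hsw i (by omega)]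
    exact (((sg_comm (n := n) (i := i) (j := n - 1) (by omega)).symm.map (conjComp g⁻¹ φ)).map (prm n))

/-- an endomorphism of `A[Bₙ]`, `n ≥ 5`, is injective iff it is conjugate
to an endomorphism of type (2a) or (2b). -/
theorem endomorphism_injective_iff (n : ℕ) (hn : 5 ≤ n) (φ : ArtinB n →* ArtinB n) :
    Function.Injective φ ↔
      ∃ x : ArtinB n,
        (∃ ε p q : ℤ, IsType2a n ε p q (conjComp x φ)) ∨
        (∃ ε p q : ℤ, IsType2b n ε p q (conjComp x φ)) := by
  constructor
  · intro hinj
    obtain ⟨x, hx⟩ := exists_conj_prm_eq hn hinj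
    obtain ⟨y, hy⟩ := exists_type_of_prm hn hx ((MulAut.conj x).injective.comp hinj)
    have e : conjComp y (conjComp x φ) = conjComp (y * x) φ := MonoidHom.ext fun g => by
      simp [conjComp, mul_assoc]
    exact ⟨y * x, e ▸ hy⟩
  · rintro ⟨x, hx⟩
    have h : Function.Injective (MulAut.conj x ∘ φ) := injective_of_isType (by omega) hx
    exact h.of_comp
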